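/- For all positive integers d, l, l', r, s, s' there are positive integers f = f(d,l,l',r,s,s') and g = g(d,l,l',r,s,s') with the following property. Let G be a graph which has an induced minor isomorphic to K_{f,g}. Then one of the following holds: (a) G has an induced subgraph isomorphic to K_{r,r}, to a subdivision of the wall W_{r×r}, or to the line graph of a subdivision of W_{r×r}; (b) there is a d-ample interrupted (s,l)-constellation in G; or (c) there is a d-ample 2r²-zigzagged (s',l')-constellation in G. -/

import Mathlib

open SimpleGraph

/-- Two vertex sets `X` and `Y` are *anticomplete* in `G` if they are disjoint and
there is no edge of `G` with an end in each. -/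
def Anticomplete {V : Type} (G : SimpleGraph V) (X Y : Set V) : Prop :=
  Disjoint X Y ∧ ∀ x ∈ X, ∀ y ∈ Y, ¬ G.Adj x y

/-- `G` has an induced subgraph isomorphic to `H`. -/
def HasInducedSubgraphIso {V W : Type} (G : SimpleGraph V) (H : SimpleGraph W) : Prop :=
  ∃ X : Set V, Nonempty (H ≃g G.induce X)

/-- `G` has an induced minor isomorphic to `H`, witnessed by branch sets. -/
def HasInducedMinor {V W : Type} (G : SimpleGraph V) (H : SimpleGraph W) : Prop :=
  ∃ B : W → Set V,
    (∀ w, (G.induce (B w)).Connected) ∧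
    (Pairwise fun u v => Disjoint (B u) (B v)) ∧
    (∀ u v : W, u ≠ v → (H.Adj u v ↔ ¬ Anticomplete G (B u) (B v)))

/-- The set `P` induces a path in `G`. -/
def IsPathSet {V : Type} (G : SimpleGraph V) (P : Set V) : Prop :=
  ∃ n : ℕ, Nonempty (G.induce P ≃g pathGraph (n + 1))

/-- The vertex sets of the connected components of the subgraph of `G` induced on `X`. -/
def CompsOn {V : Type} (G : SimpleGraph V) (X : Set V) : Set (Set V) :=
  {L | ∃ C : (G.induce X).ConnectedComponent, L = Subtype.val '' C.supp}

/-- The induced subgraph of `G` on `W` together with the stable set `S ⊆ W` forms a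
constellation: every component of `W \ S` is a path and every vertex of `S` has a
neighbor in every such component. -/
structure IsConstellationOn {V : Type} (G : SimpleGraph V) (W S : Set V) : Prop where
  subset : S ⊆ W
  stable : ∀ x ∈ S, ∀ y ∈ S, ¬ G.Adj x y
  comp_paths : ∀ L ∈ CompsOn G (W \ S), IsPathSet G L
  dominates : ∀ x ∈ S, ∀ L ∈ CompsOn G (W \ S), ∃ y ∈ L, G.Adj x y

/-- `p` is a route of the constellation `(W, S)` in `G`: an induced path of the induced
subgraph of `G` on `W`, with its two (distinct) ends in `S` and its interior outside `S`. -/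
structure IsRoute {V : Type} (G : SimpleGraph V) (W S : Set V) {x y : V}
    (p : G.Walk x y) : Prop where
  ne : x ≠ y
  isPath : p.IsPath
  induced : ∀ u v, u ∈ p.support → v ∈ p.support → G.Adj u v → p.toSubgraph.Adj u v
  support_mem : ∀ v ∈ p.support, v ∈ W
  fst_mem : x ∈ S
  snd_mem : y ∈ S
  interior : ∀ v ∈ p.support, v ≠ x → v ≠ y → v ∉ S

/-- The constellation `(W, S)` in `G` is `d`-ample: no route has length at most `d+1`. -/
def DAmple {V : Type} (G : SimpleGraph V) (W S : Set V) (d : ℕ) : Prop :=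
  ∀ ⦃x y : V⦄ (p : G.Walk x y), IsRoute G W S p → d + 1 < p.length

/-- The constellation `(W, S)` in `G` is interrupted with respect to some linear order
(encoded by an injective-on-`S` function `f : V → ℕ`). -/
def Interrupted {V : Type} (G : SimpleGraph V) (W S : Set V) : Prop :=
  ∃ f : V → ℕ, Set.InjOn f S ∧
    ∀ x ∈ S, ∀ y ∈ S, ∀ z ∈ S, f x < f y → f y < f z →
      ∀ (p : G.Walk x y), IsRoute G W S p → ∃ v ∈ p.support, G.Adj z v

/-- The constellation `(W, S)` in `G` is `q`-zigzagged. -/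
def Zigzagged {V : Type} (G : SimpleGraph V) (W S : Set V) (q : ℕ) : Prop :=
  ∃ f : V → ℕ, Set.InjOn f S ∧
    ∀ x ∈ S, ∀ y ∈ S, f x < f y →
      ∀ (p : G.Walk x y), IsRoute G W S p →
        {z | z ∈ S ∧ f x < f z ∧ f z < f y ∧ ¬ ∃ v ∈ p.support, G.Adj z v}.ncard < q

/-- The constellation `(W, S)` in `G` is `(qm, q, qp)`-mixed. -/
def Mixed {V : Type} (G : SimpleGraph V) (W S : Set V) (qm q qp : ℕ) : Prop :=
  ∃ f : V → ℕ, Set.InjOn f S ∧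
    ∀ x ∈ S, ∀ y ∈ S, f x < f y →
      ∀ (p : G.Walk x y), IsRoute G W S p →
        ∀ Qm Q Qp : Set V, Qm ⊆ S → Q ⊆ S → Qp ⊆ S →
          Qm.ncard = qm → Q.ncard = q → Qp.ncard = qp →
          (∀ z ∈ Qm, f z < f x) → (∀ z ∈ Q, f x < f z ∧ f z < f y) →
          (∀ z ∈ Qp, f y < f z) →
          ∃ z ∈ Qm ∪ Q ∪ Qp, ∃ v ∈ p.support, G.Adj z v

/-- The constellation `(W', S')` sits in the constellation `(W, S)` (both within `G`). -/
def SitsIn {V : Type} (G : SimpleGraph V) (W' S' W S : Set V) : Prop :=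
  W' ⊆ W ∧ S' ⊆ S ∧
  (∀ L ∈ CompsOn G (W' \ S'), ∃ M ∈ CompsOn G (W \ S), L ⊆ M) ∧
  (∀ M ∈ CompsOn G (W \ S), ∀ L₁ ∈ CompsOn G (W' \ S'), ∀ L₂ ∈ CompsOn G (W' \ S'),
      L₁ ⊆ M → L₂ ⊆ M → L₁ = L₂)

/-- A witness that `S` is a subdivision of `H`, where each edge of `H` is replaced by a
path whose length satisfies `ok`. -/
structure SubdivModel {U W : Type} (S : SimpleGraph U) (H : SimpleGraph W)
    (ok : ℕ → Prop) where
  b : W → U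
  b_inj : Function.Injective b
  path : ∀ ⦃u v : W⦄, H.Adj u v → S.Walk (b u) (b v)
  path_isPath : ∀ ⦃u v : W⦄ (h : H.Adj u v), (path h).IsPath
  path_len : ∀ ⦃u v : W⦄ (h : H.Adj u v), ok (path h).length
  path_symm : ∀ ⦃u v : W⦄ (h : H.Adj u v), path h.symm = (path h).reverse
  branch_avoid : ∀ ⦃u v : W⦄ (h : H.Adj u v) (w : W), b w ∈ (path h).support → w = u ∨ w = v
  interiors_anticomplete :
    ∀ ⦃u v u' v' : W⦄ (h : H.Adj u v) (h' : H.Adj u' v'),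
      (s(u, v) : Sym2 W) ≠ s(u', v') →
      ∀ x ∈ (path h).support, x ≠ b u → x ≠ b v →
      ∀ y ∈ (path h').support, y ≠ b u' → y ≠ b v' →
        x ≠ y ∧ ¬ S.Adj x y
  cover : ∀ x : U, (∃ w, x = b w) ∨ ∃ (u v : W) (h : H.Adj u v), x ∈ (path h).support
  edges_eq : ∀ x y : U, S.Adj x y → ∃ (u v : W) (h : H.Adj u v), (path h).toSubgraph.Adj x y

/-- `S` is a subdivision of `H` with path lengths satisfying `ok`. -/
def IsSubdivisionWith {U W : Type} (S : SimpleGraph U) (H : SimpleGraph W)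
    (ok : ℕ → Prop) : Prop :=
  Nonempty (SubdivModel S H ok)

/-- The line graph of `G`. -/
def LineGraph {V : Type} (G : SimpleGraph V) : SimpleGraph G.edgeSet :=
  SimpleGraph.fromRel (fun e f => ∃ v : V, v ∈ (e : Sym2 V) ∧ v ∈ (f : Sym2 V))

/-- The `r`-by-`r` hexagonal wall (brick wall). -/
def Wall (r : ℕ) : SimpleGraph (Fin r × Fin (2 * r)) :=
  SimpleGraph.fromRel (fun a b =>
    (a.1 = b.1 ∧ a.2.val + 1 = b.2.val) ∨
    (a.2 = b.2 ∧ a.1.val + 1 = b.1.val ∧ (a.1.val + a.2.val) % 2 = 0))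

/-- The full binary tree of radius `r`, on `2^(r+1) - 1` vertices (heap indexing). -/
def BinTree (r : ℕ) : SimpleGraph (Fin (2 ^ (r + 1) - 1)) :=
  SimpleGraph.fromRel (fun a b =>
    b.val + 1 = 2 * (a.val + 1) ∨ b.val + 1 = 2 * (a.val + 1) + 1)

/-- The leaf-extension of `H` by leaves `L` attached via `f`. -/
def leafExt {W : Type} (H : SimpleGraph W) (L : Type) (f : L → W) :
    SimpleGraph (W ⊕ L) :=
  SimpleGraph.fromRel (fun a b =>
    match a, b with
    | Sum.inl a, Sum.inl b => H.Adj a b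
    | Sum.inl a, Sum.inr x => f x = a
    | _, _ => False)

/-- `G` has treewidth at most `k` (via tree decompositions). -/
def TreewidthLE {V : Type} (G : SimpleGraph V) (k : ℕ) : Prop :=
  ∃ (ι : Type) (T : SimpleGraph ι) (bag : ι → Set V),
    T.IsTree ∧
    (∀ v, ∃ i, v ∈ bag i) ∧
    (∀ u v, G.Adj u v → ∃ i, u ∈ bag i ∧ v ∈ bag i) ∧
    (∀ v, (T.induce {i | v ∈ bag i}).Connected) ∧
    (∀ i, (bag i).ncard ≤ k + 1)

/-- `G` has pathwidth at most `k` (via path decompositions). -/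
def PathwidthLE {V : Type} (G : SimpleGraph V) (k : ℕ) : Prop :=
  ∃ (n : ℕ) (bag : Fin n → Set V),
    (∀ v, ∃ i, v ∈ bag i) ∧
    (∀ u v, G.Adj u v → ∃ i, u ∈ bag i ∧ v ∈ bag i) ∧
    (∀ (v : V) (i j k' : Fin n), i ≤ j → j ≤ k' → v ∈ bag i → v ∈ bag k' → v ∈ bag j) ∧
    (∀ i, (bag i).ncard ≤ k + 1)

/-- An induced `(s,t)`-model in `G`. -/
def IsInducedModel {V : Type} (G : SimpleGraph V) {s t : ℕ}
    (A : Fin s → Set V) (B : Fin t → Set V) : Prop :=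
  (∀ i, (G.induce (A i)).Connected) ∧
  (∀ j, (G.induce (B j)).Connected) ∧
  (∀ i j : Fin s, i ≠ j → Anticomplete G (A i) (A j)) ∧
  (∀ i j : Fin t, i ≠ j → Anticomplete G (B i) (B j)) ∧
  (∀ (i : Fin s) (j : Fin t), Disjoint (A i) (B j) ∧ ¬ Anticomplete G (A i) (B j))

/-- The `A`-contraction of a model: each `A i` is contracted to the vertex `Sum.inl i`. -/
def AContraction {V : Type} (G : SimpleGraph V) {s t : ℕ}
    (A : Fin s → Set V) (B : Fin t → Set V) :
    SimpleGraph (Fin s ⊕ (⋃ j, B j : Set V)) :=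
  SimpleGraph.fromRel (fun x y =>
    match x, y with
    | Sum.inl i, Sum.inl i' => i ≠ i' ∧ ∃ a ∈ A i, ∃ a' ∈ A i', G.Adj a a'
    | Sum.inl i, Sum.inr b => ∃ a ∈ A i, G.Adj a ↑b
    | Sum.inr b, Sum.inr b' => G.Adj ↑b ↑b'
    | _, _ => False)

/-- A linear induced model is `d`-`A`-ample if its `A`-contraction is `d`-ample. -/
def ModelAAmple {V : Type} (G : SimpleGraph V) {s t : ℕ}
    (A : Fin s → Set V) (B : Fin t → Set V) (d : ℕ) : Prop :=
  DAmple (AContraction G A B) Set.univ (Set.range Sum.inl) d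

/-- A linear induced model is `d`-ample if it is `d`-`A`-ample and `d`-`B`-ample. -/
def ModelAmple {V : Type} (G : SimpleGraph V) {s t : ℕ}
    (A : Fin s → Set V) (B : Fin t → Set V) (d : ℕ) : Prop :=
  ModelAAmple G A B d ∧ ModelAAmple G B A d

/-- The zigzag sequences. -/
def Zseq : ℕ → List ℤ
  | 0 => []
  | 1 => [1]
  | 2 => [1, 2]
  | 3 => [1, 2, 3]
  | n + 4 =>
      (Zseq (n + 3)).dropLast ++ (((Zseq (n + 2)).map (· + 1)).reverse).dropLast
        ++ (Zseq (n + 3)).map (· + 1)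

/-- Collapse each maximal run of consecutive equal entries to a single entry. -/
def collapse (l : List ℤ) : List ℤ := l.destutter (· ≠ ·)

/-- `B` is an alignment in the sequence `A`. -/
def IsAlignment (A : List ℤ) (B : Finset ℤ) : Prop :=
  (∀ b ∈ B, b ∈ A) ∧
  ∃ i j : ℕ, i ≤ j ∧ j < A.length ∧
    ∀ b ∈ B,
      (collapse (((A.take (j + 1)).drop i).filter (fun a => decide (a ∈ B)))).count b = 1

theorem exists_end_homogeneous {C : Type} (k : ℕ)
    (ih : ∀ m : ℕ, ∃ N : ℕ, ∀ {α : Type} [DecidableEq α] (S : Finset α) (χ : Finset α → C),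
      N ≤ S.card → ∃ T ⊆ S, T.card = m ∧ ∃ c, ∀ K ⊆ T, K.card = k → χ K = c) (t : ℕ) :
    ∃ N : ℕ, ∀ {α : Type} [DecidableEq α] (S : Finset α) (χ : Finset α → C),
      N ≤ S.card → ∃ T ⊆ S, T.card = t ∧ ∃ (f : α → ℕ) (φ : α → C), Set.InjOn f T ∧
        ∀ a ∈ T, ∀ K ⊆ T, K.card = k → (∀ b ∈ K, f a < f b) → χ (insert a K) = φ a := by
  induction t with
  | zero =>
    refine ⟨1, fun {α} _ S χ hS => ?_⟩
    exact ⟨∅, by simp, rfl, fun _ => 0, fun _ => χ ∅, by simp, by simp⟩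
  | succ t iht =>
    obtain ⟨N₁, h₁⟩ := iht
    obtain ⟨N₂, h₂⟩ := ih N₁
    refine ⟨N₂ + 1, fun {α} _ S χ hS => ?_⟩
    obtain ⟨a, ha⟩ : S.Nonempty := Finset.card_pos.mp (by omega)
    obtain ⟨T', hT', hcard', c, hc⟩ := h₂ (S.erase a) (fun K => χ (insert a K))
      (by rw [Finset.card_erase_of_mem ha]; omega)
    obtain ⟨T, hT, hcard, f, φ, hf, hφ⟩ := h₁ T' χ hcard'.ge
    have haT : a ∉ T := fun h => by simpa using hT' (hT h)
    refine ⟨insert a T, ?_, ?_, fun x => if x = a then 0 else f x + 1,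
      fun x => if x = a then c else φ x, ?_, ?_⟩
    · intro x hx
      rcases Finset.mem_insert.mp hx with rfl | hx
      · exact ha
      · exact Finset.mem_of_mem_erase (hT' (hT hx))
    · rw [Finset.card_insert_of_notMem haT, hcard]
    · intro x hx y hy hxy
      simp only at hxy
      split_ifs at hxy with h1 h2 h2
      · exact h1.trans h2.symm
      · simp at hx hy
        exact hf (by simpa [h1] using hx) (by simpa [h2] using hy) (by omega)
    · intro x hx K hK hKc hlt
      have haK : a ∉ K := by
        intro h
        have := hlt a h
        simp at this
      have hKT : K ⊆ T := fun y hy => by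
        rcases Finset.mem_insert.mp (hK hy) with rfl | h
        · exact absurd hy haK
        · exact h
      by_cases hxa : x = a
      · subst hxa
        simp only [if_true]
        exact hc K (hKT.trans hT) hKc
      · simp only [hxa, if_false]
        refine hφ x (by simpa [hxa] using hx) K hKT hKc fun b hb => ?_
        have := hlt b hb
        have hba : b ≠ a := fun h => haK (h ▸ hb)
        simp [hxa, hba] at this
        exact this

/-- Ramsey's theorem for uniform hypergraphs. -/
theorem hypergraph_ramsey (C : Type) [Finite C] (k m : ℕ) :
    ∃ N : ℕ, ∀ {α : Type} [DecidableEq α] (S : Finset α) (χ : Finset α → C),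
      N ≤ S.card → ∃ T ⊆ S, T.card = m ∧ ∃ c, ∀ K ⊆ T, K.card = k → χ K = c := by
  induction k generalizing m with
  | zero =>
    refine ⟨m, fun {α} _ S χ hS => ?_⟩
    obtain ⟨T, hT, hc⟩ := Finset.exists_subset_card_eq hS
    exact ⟨T, hT, hc, χ ∅, fun K _ hK => by rw [Finset.card_eq_zero.mp hK]⟩
  | succ k ih =>
    have := Fintype.ofFinite C
    classical
    obtain ⟨N, hN⟩ := exists_end_homogeneous k ih (Fintype.card C * m)
    refine ⟨max N 1, fun {α} _ S χ hS => ?_⟩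
    obtain ⟨T, hT, hcard, f, φ, hf, hφ⟩ := hN S χ (le_trans (le_max_left _ _) hS)
    have : Nonempty C := ⟨χ ∅⟩
    obtain ⟨c, -, hc⟩ := Finset.exists_le_card_fiber_of_mul_le_card_of_maps_to
      (s := T) (t := Finset.univ) (f := φ) (n := m) (by simp) (by simp)
      (by rw [hcard, Finset.card_univ])
    obtain ⟨T', hT', hc'⟩ := Finset.exists_subset_card_eq hc
    have hTT : T' ⊆ T := hT'.trans (Finset.filter_subset _ _)
    refine ⟨T', hTT.trans hT, hc', c, fun K hK hKc => ?_⟩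
    obtain ⟨a, haK, hamin⟩ := Finset.exists_min_image K f (Finset.card_pos.mp (by omega))
    have := hφ a (hTT (hK haK)) (K.erase a)
      ((Finset.erase_subset _ _).trans (hK.trans hTT))
      (by rw [Finset.card_erase_of_mem haK]; omega) (fun b hb => by
        have hb' := Finset.mem_of_mem_erase hb
        refine lt_of_le_of_ne (hamin b hb') fun h => Finset.ne_of_mem_erase hb ?_
        exact (hf (hTT (hK haK)) (hTT (hK hb')) h).symm)
    rw [Finset.insert_erase haK] at this
    rw [this]
    exact (Finset.mem_filter.mp (hT' (hK haK))).2

/-- Ramsey's theorem on `Fin`, with the homogeneous set given by an order embedding. -/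
theorem fin_ramsey (C : Type) [Finite C] (k m : ℕ) :
    ∃ N : ℕ, ∀ n, N ≤ n → ∀ (χ : Finset (Fin n) → C), ∃ (e : Fin m ↪o Fin n) (c : C),
      ∀ K : Finset (Fin m), K.card = k → χ (K.map e.toEmbedding) = c := by
  obtain ⟨N, hN⟩ := hypergraph_ramsey C k m
  refine ⟨N, fun n hn χ => ?_⟩
  obtain ⟨T, -, hT, c, hc⟩ := hN (Finset.univ : Finset (Fin n)) χ (by simpa using hn)
  refine ⟨T.orderEmbOfFin hT, c, fun K hK => hc _ ?_ (by simpa using hK)⟩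
  intro x hx
  obtain ⟨y, -, rfl⟩ := Finset.mem_map.mp hx
  exact T.orderEmbOfFin_mem hT y

/-- Ramsey's theorem on `Fin` for subsets of several sizes at once. -/
theorem fin_ramsey_le (C : Type) [Finite C] (k m : ℕ) :
    ∃ N : ℕ, ∀ n, N ≤ n → ∀ (χ : Finset (Fin n) → C), ∃ (e : Fin m ↪o Fin n) (c : ℕ → C),
      ∀ K : Finset (Fin m), K.card ≤ k → χ (K.map e.toEmbedding) = c K.card := by
  induction k generalizing m with
  | zero =>
    obtain ⟨N, hN⟩ := fin_ramsey C 0 m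
    refine ⟨N, fun n hn χ => ?_⟩
    obtain ⟨e, c, h⟩ := hN n hn χ
    exact ⟨e, fun _ => c, fun K hK => h K (by omega)⟩
  | succ k ih =>
    obtain ⟨N₁, h₁⟩ := ih m
    obtain ⟨N, hN⟩ := fin_ramsey C (k + 1) N₁
    refine ⟨N, fun n hn χ => ?_⟩
    obtain ⟨e, c, h⟩ := hN n hn χ
    obtain ⟨e', c', h'⟩ := h₁ N₁ le_rfl (fun K => χ (K.map e.toEmbedding))
    refine ⟨e'.trans e, fun i => if i = k + 1 then c else c' i, fun K hK => ?_⟩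
    have hmap : K.map (e'.trans e).toEmbedding =
        (K.map e'.toEmbedding).map e.toEmbedding := by
      rw [Finset.map_map]; rfl
    rw [hmap]
    by_cases hk : K.card = k + 1
    · simp only [h _ ((Finset.card_map _).trans hk), hk, if_true]
    · simp only [hk, if_false]
      exact h' K (by omega)

/-- The pigeonhole principle with an order embedding of the large fibre. -/
theorem fin_pigeonhole (C : Type) [Finite C] (m : ℕ) :
    ∃ N : ℕ, ∀ n, N ≤ n → ∀ (χ : Fin n → C), ∃ (e : Fin m ↪o Fin n) (c : C),
      ∀ i, χ (e i) = c := by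
  obtain ⟨N, hN⟩ := fin_ramsey C 1 m
  rcases isEmpty_or_nonempty C with hC | hC
  · exact ⟨1, fun n hn χ => hC.elim (χ ⟨0, hn⟩)⟩
  classical
  refine ⟨N, fun n hn χ => ?_⟩
  obtain ⟨e, c, h⟩ := hN n hn
    (fun K => if hK : K.Nonempty then χ hK.choose else Classical.arbitrary C)
  refine ⟨e, c, fun i => ?_⟩
  have := h {i} (by simp)
  have hne : (Finset.map e.toEmbedding {i}).Nonempty := by simp
  rw [dif_pos hne] at this
  rw [← this]
  congr 1
  obtain ⟨j, hj, hj'⟩ := Finset.mem_map.mp hne.choose_spec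
  rw [← hj', Finset.mem_singleton.mp hj]
  rfl

/-- Some edge of `G` joins `X` to `Y`. -/
def Touch {V : Type} (G : SimpleGraph V) (X Y : Set V) : Prop :=
  ∃ x ∈ X, ∃ y ∈ Y, G.Adj x y

/-- The set `S` is nonempty and induces a connected subgraph, expressed through cuts. -/
def Conn {V : Type} (G : SimpleGraph V) (S : Set V) : Prop :=
  S.Nonempty ∧ ∀ T : Set V, (S ∩ T).Nonempty →
    (∀ x ∈ S, x ∈ T → ∀ y ∈ S, G.Adj x y → y ∈ T) → S ⊆ T

/-- The vertices `p 0, …, p n` form an induced path in this order. -/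
def IndPath {V : Type} (G : SimpleGraph V) (n : ℕ) (p : ℕ → V) : Prop :=
  (∀ i ≤ n, ∀ j ≤ n, p i = p j → i = j) ∧
  ∀ i ≤ n, ∀ j ≤ n, (G.Adj (p i) (p j) ↔ i + 1 = j ∨ j + 1 = i)

/-- The set of the values `p a, …, p b`. -/
def seg {V : Type} (p : ℕ → V) (a b : ℕ) : Set V := p '' Set.Icc a b

section Basics

variable {V : Type} {G : SimpleGraph V}

theorem Touch.symm {X Y : Set V} (h : Touch G X Y) : Touch G Y X := by
  obtain ⟨x, hx, y, hy, h⟩ := h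
  exact ⟨y, hy, x, hx, h.symm⟩

theorem Touch.mono {X Y X' Y' : Set V} (h : Touch G X Y) (hX : X ⊆ X') (hY : Y ⊆ Y') :
    Touch G X' Y' := by
  obtain ⟨x, hx, y, hy, h⟩ := h
  exact ⟨x, hX hx, y, hY hy, h⟩

theorem anticomplete_iff {X Y : Set V} :
    Anticomplete G X Y ↔ Disjoint X Y ∧ ¬ Touch G X Y := by
  simp [Anticomplete, Touch]

theorem Anticomplete.symm {X Y : Set V} (h : Anticomplete G X Y) : Anticomplete G Y X :=
  ⟨h.1.symm, fun x hx y hy hxy => h.2 y hy x hx hxy.symm⟩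

theorem Anticomplete.mono {X Y X' Y' : Set V} (h : Anticomplete G X Y) (hX : X' ⊆ X)
    (hY : Y' ⊆ Y) : Anticomplete G X' Y' :=
  ⟨h.1.mono hX hY, fun x hx y hy => h.2 x (hX hx) y (hY hy)⟩

theorem Anticomplete.ne {X Y : Set V} (h : Anticomplete G X Y) {x y : V} (hx : x ∈ X)
    (hy : y ∈ Y) : x ≠ y := fun e => Set.disjoint_left.mp h.1 hx (e ▸ hy)

theorem anticomplete_of {X Y : Set V} (h : ∀ x ∈ X, ∀ y ∈ Y, x ≠ y ∧ ¬ G.Adj x y) :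
    Anticomplete G X Y :=
  ⟨Set.disjoint_left.mpr fun x hx hy => (h x hx x hy).1 rfl, fun x hx y hy => (h x hx y hy).2⟩

theorem Anticomplete.union_left {X Y Z : Set V} (h : Anticomplete G X Z)
    (h' : Anticomplete G Y Z) : Anticomplete G (X ∪ Y) Z := by
  refine anticomplete_of ?_
  rintro x (hx | hx) z hz
  · exact ⟨h.ne hx hz, h.2 x hx z hz⟩
  · exact ⟨h'.ne hx hz, h'.2 x hx z hz⟩

theorem Anticomplete.union_right {X Y Z : Set V} (h : Anticomplete G Z X)
    (h' : Anticomplete G Z Y) : Anticomplete G Z (X ∪ Y) :=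
  (h.symm.union_left h'.symm).symm

theorem Anticomplete.iUnion_left {ι : Sort*} {X : ι → Set V} {Z : Set V}
    (h : ∀ i, Anticomplete G (X i) Z) : Anticomplete G (⋃ i, X i) Z := by
  refine anticomplete_of fun x hx z hz => ?_
  obtain ⟨i, hi⟩ := Set.mem_iUnion.mp hx
  exact ⟨(h i).ne hi hz, (h i).2 x hi z hz⟩

theorem Conn.nonempty {S : Set V} (h : Conn G S) : S.Nonempty := h.1

theorem conn_singleton (x : V) : Conn G {x} := by
  refine ⟨⟨x, rfl⟩, ?_⟩
  rintro T ⟨y, rfl, hy⟩ - z rfl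
  exact hy

theorem Conn.union {S T : Set V} (hS : Conn G S) (hT : Conn G T)
    (h : (S ∩ T).Nonempty ∨ Touch G S T) : Conn G (S ∪ T) := by
  refine ⟨hS.1.mono Set.subset_union_left, fun U ⟨x, hx, hxU⟩ hU => ?_⟩
  have cS : (S ∩ U).Nonempty → S ⊆ U := fun hne =>
    hS.2 U hne fun x hx hxU y hy => hU x (Or.inl hx) hxU y (Or.inl hy)
  have cT : (T ∩ U).Nonempty → T ⊆ U := fun hne =>
    hT.2 U hne fun x hx hxU y hy => hU x (Or.inr hx) hxU y (Or.inr hy)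
  have hST : S ⊆ U ↔ T ⊆ U := by
    rcases h with ⟨z, hzS, hzT⟩ | ⟨z, hz, w, hw, hzw⟩
    · exact ⟨fun hh => cT ⟨z, hzT, hh hzS⟩, fun hh => cS ⟨z, hzS, hh hzT⟩⟩
    · exact ⟨fun hh => cT ⟨w, hw, hU z (Or.inl hz) (hh hz) w (Or.inr hw) hzw⟩,
        fun hh => cS ⟨z, hz, hU w (Or.inr hw) (hh hw) z (Or.inl hz) hzw.symm⟩⟩
  rcases hx with hx | hx
  · have := cS ⟨x, hx, hxU⟩
    exact Set.union_subset this (hST.mp this)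
  · have := cT ⟨x, hx, hxU⟩
    exact Set.union_subset (hST.mpr this) this

theorem Conn.insert {S : Set V} (hS : Conn G S) {x y : V} (hy : y ∈ S) (h : G.Adj x y) :
    Conn G (insert x S) := by
  rw [Set.insert_eq]
  exact (conn_singleton x).union hS (Or.inr ⟨x, rfl, y, hy, h⟩)

theorem Conn.union_iUnion {ι : Sort*} {S : Set V} {F : ι → Set V} (hS : Conn G S)
    (hF : ∀ i, Conn G (F i)) (h : ∀ i, (S ∩ F i).Nonempty ∨ Touch G S (F i)) :
    Conn G (S ∪ ⋃ i, F i) := by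
  refine ⟨hS.1.mono Set.subset_union_left, fun U ⟨x, hx, hxU⟩ hU => ?_⟩
  have key : ∀ i, (((S ∪ F i) ∩ U).Nonempty) → S ∪ F i ⊆ U := fun i hne =>
    (hS.union (hF i) (h i)).2 U hne fun x hx hxU y hy => hU x
      (Set.union_subset_union_right S (Set.subset_iUnion F i) hx) hxU y
      (Set.union_subset_union_right S (Set.subset_iUnion F i) hy)
  have hSU : S ⊆ U := by
    rcases hx with hx | hx
    · exact hS.2 U ⟨x, hx, hxU⟩ fun x hx hxU y hy => hU x (Or.inl hx) hxU y (Or.inl hy)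
    · obtain ⟨i, hi⟩ := Set.mem_iUnion.mp hx
      exact Set.subset_union_left.trans (key i ⟨x, Or.inr hi, hxU⟩)
  obtain ⟨z, hz⟩ := hS.1
  refine Set.union_subset hSU (Set.iUnion_subset fun i => ?_)
  exact Set.subset_union_right.trans (key i ⟨z, Or.inl hz, hSU hz⟩)

/-- In a connected set, a proper nonempty part sends an edge to the rest. -/
theorem conn_iff_connected {S : Set V} : Conn G S ↔ (G.induce S).Connected := by
  constructor
  · rintro ⟨⟨x, hx⟩, h⟩
    have : Nonempty S := ⟨⟨x, hx⟩⟩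
    refine ⟨fun a b => ?_⟩
    have := h {y | ∃ hy : y ∈ S, (G.induce S).Reachable a ⟨y, hy⟩}
      ⟨a, a.2, a.2, Reachable.refl _⟩
      (fun y hy ⟨_, hr⟩ z hz hyz => ⟨hz, hr.trans (Adj.reachable (by simpa using hyz))⟩)
    exact (this b.2).2
  · intro h
    obtain ⟨x⟩ := h.nonempty
    refine ⟨⟨x, x.2⟩, fun T ⟨y, hy, hyT⟩ hT z hz => ?_⟩
    obtain ⟨w⟩ := h.preconnected ⟨y, hy⟩ ⟨z, hz⟩
    have : ∀ (a b : S) (w : (G.induce S).Walk a b), a.1 ∈ T → b.1 ∈ T := by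
      intro a b w
      induction w with
      | nil => exact id
      | cons h _ ih => exact fun ha => ih (hT _ (Subtype.prop _) ha _ (Subtype.prop _) h)
    exact this _ _ w hyT

theorem IndPath.inj {n : ℕ} {p : ℕ → V} (h : IndPath G n p) {i j : ℕ} (hi : i ≤ n)
    (hj : j ≤ n) (e : p i = p j) : i = j := h.1 i hi j hj e

theorem IndPath.adj_iff {n : ℕ} {p : ℕ → V} (h : IndPath G n p) {i j : ℕ} (hi : i ≤ n)
    (hj : j ≤ n) : G.Adj (p i) (p j) ↔ i + 1 = j ∨ j + 1 = i := h.2 i hi j hj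

theorem IndPath.adj_succ {n : ℕ} {p : ℕ → V} (h : IndPath G n p) {i : ℕ} (hi : i < n) :
    G.Adj (p i) (p (i + 1)) := (h.adj_iff hi.le hi).mpr (Or.inl rfl)

theorem IndPath.mono {n m : ℕ} {p : ℕ → V} (h : IndPath G n p) (hm : m ≤ n) :
    IndPath G m p :=
  ⟨fun i hi j hj => h.1 i (hi.trans hm) j (hj.trans hm),
    fun i hi j hj => h.2 i (hi.trans hm) j (hj.trans hm)⟩

theorem IndPath.shift {n m a : ℕ} {p : ℕ → V} (h : IndPath G n p) (hm : a + m ≤ n) :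
    IndPath G m (fun i => p (a + i)) :=
  ⟨fun i hi j hj e => by
      have := h.1 (a + i) (by omega) (a + j) (by omega) e
      omega,
    fun i hi j hj => by
      rw [h.2 (a + i) (by omega) (a + j) (by omega)]
      omega⟩

theorem IndPath.reverse {n : ℕ} {p : ℕ → V} (h : IndPath G n p) :
    IndPath G n (fun i => p (n - i)) :=
  ⟨fun i hi j hj e => by
      have := h.1 (n - i) (by omega) (n - j) (by omega) e
      omega,
    fun i hi j hj => by
      rw [h.2 (n - i) (by omega) (n - j) (by omega)]
      omega⟩

theorem mem_seg {p : ℕ → V} {a b : ℕ} {x : V} :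
    x ∈ seg p a b ↔ ∃ i, a ≤ i ∧ i ≤ b ∧ p i = x := by
  simp [seg, and_assoc]

theorem seg_mem {p : ℕ → V} {a b i : ℕ} (ha : a ≤ i) (hb : i ≤ b) : p i ∈ seg p a b :=
  mem_seg.mpr ⟨i, ha, hb, rfl⟩

theorem seg_mono {p : ℕ → V} {a b a' b' : ℕ} (ha : a' ≤ a) (hb : b ≤ b') :
    seg p a b ⊆ seg p a' b' := Set.image_mono (Set.Icc_subset_Icc ha hb)

theorem IndPath.mem_seg_iff {n : ℕ} {p : ℕ → V} (h : IndPath G n p) {a b i : ℕ}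
    (hi : i ≤ n) (hb : b ≤ n) : p i ∈ seg p a b ↔ a ≤ i ∧ i ≤ b := by
  rw [mem_seg]
  constructor
  · rintro ⟨j, h1, h2, h3⟩
    rw [← h.inj (by omega) hi h3]
    exact ⟨h1, h2⟩
  · rintro ⟨h1, h2⟩
    exact ⟨i, h1, h2, rfl⟩

theorem conn_seg_of_adj {p : ℕ → V} {a b : ℕ} (hab : a ≤ b)
    (h : ∀ i, a ≤ i → i < b → G.Adj (p i) (p (i + 1))) : Conn G (seg p a b) := by
  induction b, hab using Nat.le_induction with
  | base =>
    have : seg p a a = {p a} := by simp [seg]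
    rw [this]
    exact conn_singleton _
  | succ b hab ih =>
    have : seg p a (b + 1) = insert (p (b + 1)) (seg p a b) := by
      ext x
      simp only [mem_seg, Set.mem_insert_iff]
      constructor
      · rintro ⟨i, h1, h2, rfl⟩
        rcases Nat.lt_or_ge b i with h3 | h3
        · exact Or.inl (by rw [show i = b + 1 by omega])
        · exact Or.inr ⟨i, h1, h3, rfl⟩
      · rintro (rfl | ⟨i, h1, h2, rfl⟩)
        · exact ⟨b + 1, by omega, le_rfl, rfl⟩
        · exact ⟨i, h1, by omega, rfl⟩
    rw [this]
    exact (ih fun i h1 h2 => h i h1 (by omega)).insert (seg_mem hab le_rfl)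
      (h b hab (by omega)).symm

theorem IndPath.conn_seg {n : ℕ} {p : ℕ → V} (h : IndPath G n p) {a b : ℕ} (hab : a ≤ b)
    (hb : b ≤ n) : Conn G (seg p a b) :=
  conn_seg_of_adj hab fun i _ hi => h.adj_succ (by omega)

/-- A connected subset of an induced path is a segment of the path. -/
theorem IndPath.conn_subset {n : ℕ} {p : ℕ → V} (h : IndPath G n p) {S : Set V}
    (hS : Conn G S) (hSp : S ⊆ seg p 0 n) :
    ∃ a b, a ≤ b ∧ b ≤ n ∧ S = seg p a b := by
  classical
  obtain ⟨x, hx⟩ := hS.1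
  obtain ⟨i₀, -, hi₀, rfl⟩ := mem_seg.mp (hSp hx)
  have hex : ∃ i, i ≤ n ∧ p i ∈ S := ⟨i₀, hi₀, hx⟩
  let a := Nat.find hex
  obtain ⟨han, haS⟩ : a ≤ n ∧ p a ∈ S := Nat.find_spec hex
  have hamin : ∀ i, i ≤ n → p i ∈ S → a ≤ i := fun i h1 h2 => Nat.find_min' hex ⟨h1, h2⟩
  let b := Nat.findGreatest (fun i => p i ∈ S) n
  have hbS : p b ∈ S := Nat.findGreatest_spec (P := fun i => p i ∈ S) hi₀ hx
  have hbn : b ≤ n := Nat.findGreatest_le n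
  have hbmax : ∀ i, i ≤ n → p i ∈ S → i ≤ b := fun i h1 h2 => Nat.le_findGreatest h1 h2
  refine ⟨a, b, hamin b hbn hbS, hbn, Set.Subset.antisymm ?_ ?_⟩
  · intro y hy
    obtain ⟨i, -, hi, rfl⟩ := mem_seg.mp (hSp hy)
    exact seg_mem (hamin i hi hy) (hbmax i hi hy)
  · intro y hy
    obtain ⟨i, hai, hib, rfl⟩ := mem_seg.mp hy
    by_contra hyS
    have := hS.2 (seg p 0 i) ⟨p a, haS, seg_mem (Nat.zero_le _) hai⟩ (by
      intro z hz hzi w hw hzw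
      obtain ⟨j, -, hj, rfl⟩ := mem_seg.mp (hSp hz)
      obtain ⟨k, -, hk, rfl⟩ := mem_seg.mp (hSp hw)
      have hji := ((h.mem_seg_iff hj (by omega)).mp hzi).2
      have hjne : j ≠ i := fun e => hyS (e ▸ hz)
      have := (h.adj_iff hj hk).mp hzw
      exact seg_mem (Nat.zero_le _) (by omega))
    have hbi := ((h.mem_seg_iff hbn (by omega)).mp (this hbS)).2
    exact hyS ((show b = i by omega) ▸ hbS)

theorem isPathSet_iff {P : Set V} :
    IsPathSet G P ↔ ∃ n p, IndPath G n p ∧ P = seg p 0 n := by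
  constructor
  · rintro ⟨n, ⟨φ⟩⟩
    refine ⟨n, fun i => φ.symm (Fin.ofNat (n + 1) i), ⟨fun i hi j hj e => ?_,
      fun i hi j hj => ?_⟩, ?_⟩
    · have := φ.symm.injective (Subtype.ext e)
      simp only [Fin.ofNat, Fin.mk.injEq] at this
      rwa [Nat.mod_eq_of_lt (by omega), Nat.mod_eq_of_lt (by omega)] at this
    · have := φ.symm.map_rel_iff (a := Fin.ofNat (n + 1) i) (b := Fin.ofNat (n + 1) j)
      simp only [comap_adj, Function.Embedding.subtype_apply, pathGraph_adj] at this
      simp only [Fin.ofNat, Nat.mod_eq_of_lt (show i < n + 1 by omega),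
        Nat.mod_eq_of_lt (show j < n + 1 by omega)] at this ⊢
      exact this
    · ext x
      rw [mem_seg]
      constructor
      · intro hx
        refine ⟨φ ⟨x, hx⟩, Nat.zero_le _, by omega, ?_⟩
        have : Fin.ofNat (n + 1) (φ ⟨x, hx⟩ : ℕ) = φ ⟨x, hx⟩ :=
          Fin.ext (Nat.mod_eq_of_lt (Fin.is_lt _))
        rw [this, RelIso.symm_apply_apply]
      · rintro ⟨i, -, -, rfl⟩
        exact Subtype.prop _
  · rintro ⟨n, p, hp, rfl⟩
    have hmem : ∀ i : Fin (n + 1), p i ∈ seg p 0 n :=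
      fun i => seg_mem (Nat.zero_le _) (by omega)
    let f : Fin (n + 1) → seg p 0 n := fun i => ⟨p i, hmem i⟩
    have hf : Function.Bijective f := by
      constructor
      · intro i j hij
        exact Fin.ext (hp.inj (by omega) (by omega) (Subtype.ext_iff.mp hij))
      · rintro ⟨x, hx⟩
        obtain ⟨i, -, hi, rfl⟩ := mem_seg.mp hx
        exact ⟨⟨i, by omega⟩, rfl⟩
    refine ⟨n, ⟨RelIso.symm ⟨Equiv.ofBijective f hf, ?_⟩⟩⟩
    intro i j
    simp only [Equiv.ofBijective_apply, comap_adj, Function.Embedding.subtype_apply,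
      pathGraph_adj, f]
    exact hp.adj_iff (by omega) (by omega)

theorem IsPathSet.conn {P : Set V} (h : IsPathSet G P) : Conn G P := by
  obtain ⟨n, p, hp, rfl⟩ := isPathSet_iff.mp h
  exact hp.conn_seg (Nat.zero_le _) le_rfl

theorem IndPath.isPathSet_seg {n : ℕ} {p : ℕ → V} (h : IndPath G n p) {a b : ℕ}
    (hab : a ≤ b) (hb : b ≤ n) : IsPathSet G (seg p a b) := by
  refine isPathSet_iff.mpr ⟨b - a, fun i => p (a + i), h.shift (by omega), ?_⟩
  ext x
  simp only [mem_seg]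
  constructor
  · rintro ⟨i, h1, h2, rfl⟩
    exact ⟨i - a, by omega, by omega, by rw [show a + (i - a) = i by omega]⟩
  · rintro ⟨i, h1, h2, rfl⟩
    exact ⟨a + i, by omega, by omega, rfl⟩

theorem IsPathSet.of_conn {P S : Set V} (h : IsPathSet G P) (hS : Conn G S) (hSP : S ⊆ P) :
    IsPathSet G S := by
  obtain ⟨n, p, hp, rfl⟩ := isPathSet_iff.mp h
  obtain ⟨a, b, hab, hb, rfl⟩ := hp.conn_subset hS hSP
  exact hp.isPathSet_seg hab hb

theorem conn_exists_chain {S : Set V} (hS : Conn G S) {x y : V} (hx : x ∈ S) (hy : y ∈ S) :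
    ∃ (n : ℕ) (p : ℕ → V), p 0 = x ∧ p n = y ∧ (∀ i ≤ n, p i ∈ S) ∧
      ∀ i < n, G.Adj (p i) (p (i + 1)) := by
  refine hS.2 {y | ∃ (n : ℕ) (p : ℕ → V), p 0 = x ∧ p n = y ∧ (∀ i ≤ n, p i ∈ S) ∧
      ∀ i < n, G.Adj (p i) (p (i + 1))} ⟨x, hx, 0, fun _ => x, rfl, rfl, fun _ _ => hx,
      fun _ h => absurd h (Nat.not_lt_zero _)⟩ ?_ hy
  rintro y hy ⟨n, p, h0, hn, hpS, hadj⟩ z hz hyz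
  refine ⟨n + 1, fun i => if i ≤ n then p i else z, ?_, ?_, ?_, ?_⟩
  · simp [h0]
  · simp
  · intro i hi
    by_cases h : i ≤ n
    · simp [h, hpS i h]
    · simp [h, hz]
  · intro i hi
    rcases Nat.lt_or_ge i n with h | h
    · simp [h.le, Nat.succ_le_iff.mpr h, hadj i h]
    · obtain rfl : i = n := by omega
      simp [hn, hyz]

/-- A shortest path inside a connected set from one set to another. -/
theorem Conn.exists_indPath {S X Y : Set V} (hS : Conn G S) (hX : (S ∩ X).Nonempty)
    (hY : (S ∩ Y).Nonempty) :
    ∃ (n : ℕ) (p : ℕ → V), IndPath G n p ∧ (∀ i ≤ n, p i ∈ S) ∧ p 0 ∈ X ∧ p n ∈ Y ∧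
      (∀ i ≤ n, p i ∈ X → i = 0) ∧ (∀ i ≤ n, p i ∈ Y → i = n) := by
  classical
  let Q : ℕ → Prop := fun n => ∃ p : ℕ → V, p 0 ∈ X ∧ p n ∈ Y ∧ (∀ i ≤ n, p i ∈ S) ∧
      ∀ i < n, G.Adj (p i) (p (i + 1))
  have hex : ∃ n, Q n := by
    obtain ⟨x, hxS, hxX⟩ := hX
    obtain ⟨y, hyS, hyY⟩ := hY
    obtain ⟨n, p, h0, hn, h⟩ := conn_exists_chain hS hxS hyS
    exact ⟨n, p, h0 ▸ hxX, hn ▸ hyY, h⟩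
  obtain ⟨p, h0, hn, hpS, hadj⟩ := Nat.find_spec hex
  set n := Nat.find hex with hndef
  have hmin : ∀ m < n, ¬ Q m := fun m hm => Nat.find_min hex hm
  have shortcut : ∀ i d, 1 ≤ d → i + d ≤ n → (i + d = n → p i ∈ Y) →
      (i + d < n → G.Adj (p i) (p (i + d + 1))) → False := by
    intro i d hd hn' hY' hadj'
    refine hmin (n - d) (by omega) ⟨fun k => if k ≤ i then p k else p (k + d), by simp [h0],
      ?_, ?_, ?_⟩
    · beta_reduce
      by_cases h : n - d ≤ i
      · rw [if_pos h, show n - d = i by omega]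
        exact hY' (by omega)
      · rw [if_neg h, show n - d + d = n by omega]
        exact hn
    · intro k hk
      beta_reduce
      split_ifs
      · exact hpS k (by omega)
      · exact hpS _ (by omega)
    · intro k hk
      beta_reduce
      rcases Nat.lt_trichotomy k i with h | h | h
      · rw [if_pos h.le, if_pos (by omega)]
        exact hadj k (by omega)
      · subst h
        rw [if_pos le_rfl, if_neg (by omega), show k + 1 + d = k + d + 1 by omega]
        exact hadj' (by omega)
      · rw [if_neg (by omega), if_neg (by omega), show k + 1 + d = k + d + 1 by omega]
        exact hadj _ (by omega)
  have hinj : ∀ i j, i < j → j ≤ n → p i ≠ p j := by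
    intro i j hij hj e
    refine shortcut i (j - i) (by omega) (by omega) (fun h => ?_) (fun h => ?_)
    · rw [e, show j = n by omega]
      exact hn
    · rw [e, show i + (j - i) = j by omega]
      exact hadj j (by omega)
  have hchord : ∀ i j, i + 1 < j → j ≤ n → ¬ G.Adj (p i) (p j) := by
    intro i j hij hj e
    refine shortcut i (j - i - 1) (by omega) (by omega) (fun h => by omega) (fun h => ?_)
    rw [show i + (j - i - 1) + 1 = j by omega]
    exact e
  refine ⟨n, p, ⟨?_, ?_⟩, hpS, h0, hn, ?_, ?_⟩
  · intro i hi j hj e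
    rcases Nat.lt_trichotomy i j with h | h | h
    · exact absurd e (hinj i j h hj)
    · exact h
    · exact absurd e.symm (hinj j i h hi)
  · intro i hi j hj
    constructor
    · intro e
      have hne : i ≠ j := fun h => G.loopless.irrefl _ (h ▸ e)
      by_contra hc
      rcases Nat.lt_or_ge i j with h | h
      · exact hchord i j (by omega) hj e
      · exact hchord j i (by omega) hi e.symm
    · rintro (rfl | rfl)
      · exact hadj i (by omega)
      · exact (hadj j (by omega)).symm
  · intro i hi hiX
    by_contra hne
    refine hmin (n - i) (by omega) ⟨fun k => p (i + k), hiX, ?_, fun k hk => hpS _ (by omega),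
      fun k hk => hadj _ (by omega)⟩
    beta_reduce
    rw [show i + (n - i) = n by omega]
    exact hn
  · intro i hi hiY
    by_contra hne
    exact hmin i (by omega) ⟨p, h0, hiY, fun k hk => hpS _ (by omega),
      fun k hk => hadj _ (by omega)⟩

end Basics

theorem exists_walk_of_seq {U : Type} {S : SimpleGraph U} {x y : U} (p : ℕ → U) (n : ℕ)
    (h0 : p 0 = x) (hn : p n = y) (h : ∀ i < n, S.Adj (p i) (p (i + 1))) :
    ∃ w : S.Walk x y, w.length = n ∧ w.support = (List.range (n + 1)).map p ∧
      w.edges = (List.range n).map fun i => s(p i, p (i + 1)) := by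
  induction n generalizing y with
  | zero =>
    subst h0 hn
    exact ⟨Walk.nil, by simp⟩
  | succ n ih =>
    obtain ⟨w, h1, h2, h3⟩ := ih rfl fun i hi => h i (by omega)
    subst hn
    refine ⟨w.concat (h n (by omega)), by simp [h1], ?_, ?_⟩
    · rw [Walk.support_concat, h2, List.range_succ (n := n + 1)]
      simp
    · rw [Walk.edges_concat, h3, List.range_succ (n := n)]
      simp

theorem Walk.toSubgraph_adj_iff_edges {U : Type} {S : SimpleGraph U} {x y a b : U}
    (w : S.Walk x y) : w.toSubgraph.Adj a b ↔ s(a, b) ∈ w.edges := by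
  rw [← Walk.mem_edges_toSubgraph, Subgraph.mem_edgeSet]

/-- Assembling a subdivision from vertex sequences, one for each edge. -/
theorem isSubdivisionWith_of_seq {U W : Type} {S : SimpleGraph U} {H : SimpleGraph W}
    (o : W → ℕ) (ho : Function.Injective o) (b : W → U) (hb : Function.Injective b)
    (len : W → W → ℕ) (q : W → W → ℕ → U)
    (hlen : ∀ u v, H.Adj u v → o u < o v → 1 ≤ len u v)
    (hq0 : ∀ u v, H.Adj u v → o u < o v → q u v 0 = b u)
    (hqn : ∀ u v, H.Adj u v → o u < o v → q u v (len u v) = b v)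
    (hinj : ∀ u v, H.Adj u v → o u < o v → ∀ i ≤ len u v, ∀ j ≤ len u v,
      q u v i = q u v j → i = j)
    (hadj : ∀ u v, H.Adj u v → o u < o v → ∀ i < len u v,
      S.Adj (q u v i) (q u v (i + 1)))
    (hbr : ∀ u v, H.Adj u v → o u < o v → ∀ i ≤ len u v, ∀ w, b w = q u v i →
      w = u ∨ w = v)
    (hinter : ∀ u v u' v', H.Adj u v → o u < o v → H.Adj u' v' → o u' < o v' →
      ¬ (u = u' ∧ v = v') → ∀ i ≤ len u v, q u v i ≠ b u → q u v i ≠ b v →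
      ∀ j ≤ len u' v', q u' v' j ≠ b u' → q u' v' j ≠ b v' →
      q u v i ≠ q u' v' j ∧ ¬ S.Adj (q u v i) (q u' v' j))
    (hcov : ∀ x, (∃ w, x = b w) ∨ ∃ u v, H.Adj u v ∧ o u < o v ∧ ∃ i ≤ len u v, x = q u v i)
    (hedge : ∀ x y, S.Adj x y → ∃ u v, H.Adj u v ∧ o u < o v ∧ ∃ i < len u v,
      (x = q u v i ∧ y = q u v (i + 1)) ∨ (y = q u v i ∧ x = q u v (i + 1))) :
    IsSubdivisionWith S H (fun n => 1 ≤ n) := by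
  have hw : ∀ u v, ∀ h : H.Adj u v, ∃ w : S.Walk (b u) (b v), o u < o v →
      w.length = len u v ∧ w.support = (List.range (len u v + 1)).map (q u v) ∧
      w.edges = (List.range (len u v)).map fun i => s(q u v i, q u v (i + 1)) := by
    intro u v h
    rcases Nat.lt_or_ge (o u) (o v) with hlt | hlt
    · obtain ⟨w, hw⟩ := exists_walk_of_seq (q u v) (len u v) (hq0 u v h hlt) (hqn u v h hlt)
        (hadj u v h hlt)
      exact ⟨w, fun _ => hw⟩
    · have hlt' : o v < o u := lt_of_le_of_ne hlt fun e => h.ne (ho e.symm)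
      obtain ⟨w, -⟩ := exists_walk_of_seq (q v u) (len v u) (hq0 v u h.symm hlt')
        (hqn v u h.symm hlt') (hadj v u h.symm hlt')
      exact ⟨w.reverse, fun h => absurd h (by omega)⟩
  choose P hP using hw
  have hside : ∀ {u v}, H.Adj u v → ¬ o u < o v → o v < o u := fun {u v} h hlt =>
    lt_of_le_of_ne (not_lt.mp hlt) fun e => h.ne (ho e.symm)
  have key : ∀ {u v} (h : H.Adj u v), ∃ u' v', ∃ h' : H.Adj u' v', o u' < o v' ∧
      ((u = u' ∧ v = v') ∨ (u = v' ∧ v = u')) ∧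
      (∀ x, x ∈ (if o u < o v then P u v h else (P v u h.symm).reverse).support ↔
        ∃ i ≤ len u' v', x = q u' v' i) := by
    intro u v h
    by_cases hlt : o u < o v
    · refine ⟨u, v, h, hlt, Or.inl ⟨rfl, rfl⟩, fun x => ?_⟩
      rw [if_pos hlt, (hP u v h hlt).2.1]
      simp only [List.mem_map, List.mem_range, Nat.lt_succ_iff]
      exact ⟨fun ⟨i, hi, e⟩ => ⟨i, hi, e.symm⟩, fun ⟨i, hi, e⟩ => ⟨i, hi, e.symm⟩⟩
    · have hlt' := hside h hlt
      refine ⟨v, u, h.symm, hlt', Or.inr ⟨rfl, rfl⟩, fun x => ?_⟩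
      rw [if_neg hlt, Walk.support_reverse, List.mem_reverse, (hP v u h.symm hlt').2.1]
      simp only [List.mem_map, List.mem_range, Nat.lt_succ_iff]
      exact ⟨fun ⟨i, hi, e⟩ => ⟨i, hi, e.symm⟩, fun ⟨i, hi, e⟩ => ⟨i, hi, e.symm⟩⟩
  have hlenP : ∀ u v (h : H.Adj u v), o u < o v → (P u v h).IsPath ∧ 1 ≤ (P u v h).length := by
    intro u v h hlt
    obtain ⟨h1, h2, -⟩ := hP u v h hlt
    refine ⟨(Walk.isPath_def _).mpr ?_, by rw [h1]; exact hlen u v h hlt⟩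
    rw [h2]
    refine List.Nodup.map_on ?_ List.nodup_range
    intro i hi j hj e
    exact hinj u v h hlt i (by simpa [Nat.lt_succ_iff] using hi) j
      (by simpa [Nat.lt_succ_iff] using hj) e
  refine ⟨⟨b, hb, fun u v h => if o u < o v then P u v h else (P v u h.symm).reverse,
    ?_, ?_, ?_, ?_, ?_, ?_, ?_⟩⟩
  · intro u v h
    split_ifs with hlt
    · exact (hlenP u v h hlt).1
    · exact (hlenP v u h.symm (hside h hlt)).1.reverse
  · intro u v h
    split_ifs with hlt
    · exact (hlenP u v h hlt).2
    · rw [Walk.length_reverse]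
      exact (hlenP v u h.symm (hside h hlt)).2
  · intro u v h
    by_cases hlt : o u < o v
    · rw [if_pos hlt, if_neg (by omega)]
    · rw [if_neg hlt, if_pos (hside h hlt), Walk.reverse_reverse]
  · intro u v h w hwm
    obtain ⟨u', v', h', hlt, huv, hs⟩ := key h
    obtain ⟨i, hi, e⟩ := (hs _).mp hwm
    have := hbr u' v' h' hlt i hi w e
    rcases huv with ⟨rfl, rfl⟩ | ⟨rfl, rfl⟩
    · exact this
    · exact this.symm
  · intro u v u' v' h h' hne x hx hxu hxv y hy hyu hyv
    obtain ⟨a, c, hac, hlt, huv, hs⟩ := key h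
    obtain ⟨a', c', hac', hlt', huv', hs'⟩ := key h'
    obtain ⟨i, hi, rfl⟩ := (hs _).mp hx
    obtain ⟨j, hj, rfl⟩ := (hs' _).mp hy
    refine hinter a c a' c' hac hlt hac' hlt' ?_ i hi ?_ ?_ j hj ?_ ?_
    · rintro ⟨rfl, rfl⟩
      refine hne ?_
      rcases huv with ⟨rfl, rfl⟩ | ⟨rfl, rfl⟩ <;> rcases huv' with ⟨rfl, rfl⟩ | ⟨rfl, rfl⟩ <;>
        simp [Sym2.eq_swap]
    all_goals
      rcases huv with ⟨rfl, rfl⟩ | ⟨rfl, rfl⟩ <;> rcases huv' with ⟨rfl, rfl⟩ | ⟨rfl, rfl⟩ <;>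
        assumption
  · intro x
    rcases hcov x with h | ⟨u, v, h, hlt, i, hi, rfl⟩
    · exact Or.inl h
    · refine Or.inr ⟨u, v, h, ?_⟩
      rw [if_pos hlt, (hP u v h hlt).2.1]
      exact List.mem_map_of_mem (by simpa [Nat.lt_succ_iff] using hi)
  · intro x y hxy
    obtain ⟨u, v, h, hlt, i, hi, hc⟩ := hedge x y hxy
    refine ⟨u, v, h, ?_⟩
    rw [if_pos hlt, Walk.toSubgraph_adj_iff_edges, (hP u v h hlt).2.2, List.mem_map]
    refine ⟨i, by simpa using hi, ?_⟩
    rcases hc with ⟨rfl, rfl⟩ | ⟨rfl, rfl⟩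
    · rfl
    · exact Sym2.eq_swap

/-- One of the basic obstructions: `K_{r,r}`, a subdivided wall or the line graph of one. -/
def Good {V : Type} (G : SimpleGraph V) (r : ℕ) : Prop :=
  HasInducedSubgraphIso G (completeBipartiteGraph (Fin r) (Fin r)) ∨
  (∃ X : Set V, IsSubdivisionWith (G.induce X) (Wall r) (fun n => 1 ≤ n)) ∨
  (∃ (m : ℕ) (S' : SimpleGraph (Fin m)),
    IsSubdivisionWith S' (Wall r) (fun n => 1 ≤ n) ∧ HasInducedSubgraphIso G (LineGraph S'))

/-- The terminals `y a` can be linked inside `D` by legs meeting in one vertex only. -/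
def TypeC {V ι : Type} (G : SimpleGraph V) (D : Set V) (y : ι → V) : Prop :=
  ∃ c ∈ D, ∃ leg : ι → Set V,
    (∀ a, Conn G (leg a) ∧ leg a ⊆ D ∧ c ∈ leg a ∧ y a ∈ leg a) ∧
    ∀ a b, a ≠ b → Anticomplete G (leg a \ {c}) (leg b \ {c})

/-- The terminals `y a` can be linked inside `D` by disjoint legs attached to a clique. -/
def TypeT {V ι : Type} (G : SimpleGraph V) (D : Set V) (y : ι → V) : Prop :=
  ∃ (z : ι → V) (leg : ι → Set V),
    (∀ a, Conn G (leg a) ∧ leg a ⊆ D ∧ z a ∈ leg a ∧ y a ∈ leg a) ∧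
    ∀ a b, a ≠ b → Disjoint (leg a) (leg b) ∧
      ∀ x ∈ leg a, ∀ x' ∈ leg b, G.Adj x x' ↔ x = z a ∧ x' = z b

/-- Vertex regions `D v` and edge regions `C v w` modelled on the graph `H`. -/
structure Assembly {V W : Type} (G : SimpleGraph V) (H : SimpleGraph W) (D : W → Set V)
    (y : W → W → V) (C : W → W → Set V) : Prop where
  D_anti : ∀ v w, v ≠ w → Anticomplete G (D v) (D w)
  C_symm : ∀ v w, H.Adj v w → C v w = C w v
  C_conn : ∀ v w, H.Adj v w → Conn G (C v w)
  C_disj : ∀ v w, H.Adj v w → ∀ u, Disjoint (D u) (C v w)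
  C_anti : ∀ v w, H.Adj v w → ∀ u, u ≠ v → u ≠ w → Anticomplete G (D u) (C v w)
  C_touch : ∀ v w, H.Adj v w → ∃ x ∈ C v w, G.Adj (y v w) x
  C_only : ∀ v w, H.Adj v w → ∀ u ∈ D v, ∀ x ∈ C v w, G.Adj u x → u = y v w
  C_C : ∀ v w v' w', H.Adj v w → H.Adj v' w' → s(v, w) ≠ s(v', w') →
    Anticomplete G (C v w) (C v' w')

section Assembly

variable {V W : Type} {G : SimpleGraph V} {H : SimpleGraph W}

theorem TypeC.comp {ι κ : Type} {D : Set V} {y : ι → V} (h : TypeC G D y) (f : κ → ι)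
    (hf : Function.Injective f) : TypeC G D (fun a => y (f a)) := by
  obtain ⟨c, hc, leg, h1, h2⟩ := h
  exact ⟨c, hc, fun a => leg (f a), fun a => h1 (f a), fun a b hab => h2 _ _ (hf.ne hab)⟩

theorem TypeT.comp {ι κ : Type} {D : Set V} {y : ι → V} (h : TypeT G D y) (f : κ → ι)
    (hf : Function.Injective f) : TypeT G D (fun a => y (f a)) := by
  obtain ⟨z, leg, h1, h2⟩ := h
  exact ⟨fun a => z (f a), fun a => leg (f a), fun a => h1 (f a),
    fun a b hab => h2 _ _ (hf.ne hab)⟩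

/-- A subdivision from connected sets meeting only at the branch vertices. -/
theorem exists_subdivision_of_regions (o : W → ℕ) (ho : Function.Injective o) (c : W → V)
    (hc : Function.Injective c) (hcc : ∀ v w, ¬ G.Adj (c v) (c w)) (M : W → W → Set V)
    (hM : ∀ v w, H.Adj v w → o v < o w → Conn G (M v w) ∧ c v ∈ M v w ∧ c w ∈ M v w)
    (hcM : ∀ v w, H.Adj v w → o v < o w → ∀ u, u ≠ v → u ≠ w →
      Anticomplete G {c u} (M v w))
    (hMM : ∀ v w v' w', H.Adj v w → o v < o w → H.Adj v' w' → o v' < o w' →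
      ¬ (v = v' ∧ w = w') →
      Anticomplete G (M v w \ {c v, c w}) (M v' w' \ {c v', c w'})) :
    ∃ X : Set V, IsSubdivisionWith (G.induce X) H (fun n => 1 ≤ n) := by
  have hp : ∀ v w, ∃ (n : ℕ) (p : ℕ → V), H.Adj v w → o v < o w →
      IndPath G n p ∧ (∀ i ≤ n, p i ∈ M v w) ∧ p 0 = c v ∧ p n = c w := by
    intro v w
    by_cases h : H.Adj v w ∧ o v < o w
    · obtain ⟨h1, h2, h3⟩ := hM v w h.1 h.2
      obtain ⟨n, p, hp, hpS, h0, hn, -⟩ := h1.exists_indPath (X := {c v}) (Y := {c w})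
        ⟨_, h2, rfl⟩ ⟨_, h3, rfl⟩
      exact ⟨n, p, fun _ _ => ⟨hp, hpS, h0, hn⟩⟩
    · exact ⟨0, fun _ => c v, fun h1 h2 => absurd ⟨h1, h2⟩ h⟩
  choose n p hp using hp
  let X : Set V := {x | (∃ v, x = c v) ∨
    ∃ v w, H.Adj v w ∧ o v < o w ∧ ∃ i ≤ n v w, x = p v w i}
  have hcX : ∀ v, c v ∈ X := fun v => Or.inl ⟨v, rfl⟩
  have hq : ∀ v w, ∃ q : ℕ → X, H.Adj v w → o v < o w →
      ∀ i ≤ n v w, (q i : V) = p v w i := by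
    intro v w
    by_cases h : H.Adj v w ∧ o v < o w
    · classical
      refine ⟨fun i => if hi : i ≤ n v w then
        ⟨p v w i, Or.inr ⟨v, w, h.1, h.2, i, hi, rfl⟩⟩ else ⟨c v, hcX v⟩, fun _ _ i hi => ?_⟩
      simp [hi]
    · exact ⟨fun _ => ⟨c v, hcX v⟩, fun h1 h2 => absurd ⟨h1, h2⟩ h⟩
  choose q hq using hq
  have hlen : ∀ v w, H.Adj v w → o v < o w → 1 ≤ n v w := by
    intro v w h hlt
    obtain ⟨h1, h2, h3, h4⟩ := hp v w h hlt
    rcases Nat.eq_zero_or_pos (n v w) with h0 | h0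
    · rw [h0, h3] at h4
      exact absurd (hc h4) h.ne
    · exact h0
  have hcp : ∀ v w, H.Adj v w → o v < o w → ∀ i ≤ n v w, ∀ u, c u = p v w i →
      u = v ∨ u = w := by
    intro v w h hlt i hi u e
    by_contra hu
    rw [not_or] at hu
    exact (hcM v w h hlt u hu.1 hu.2).ne rfl ((hp v w h hlt).2.1 i hi) e
  have hnonend : ∀ v w, H.Adj v w → o v < o w → ∀ i ≤ n v w, p v w i ≠ c v →
      p v w i ≠ c w → p v w i ∈ M v w \ {c v, c w} := by
    intro v w h hlt i hi h1 h2
    exact ⟨(hp v w h hlt).2.1 i hi, by simp [h1, h2]⟩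
  refine ⟨X, isSubdivisionWith_of_seq o ho (fun v => ⟨c v, hcX v⟩)
    (fun v w e => hc (Subtype.ext_iff.mp e)) n q hlen ?_ ?_ ?_ ?_ ?_ ?_ ?_ ?_⟩
  · intro v w h hlt
    exact Subtype.ext ((hq v w h hlt 0 (Nat.zero_le _)).trans (hp v w h hlt).2.2.1)
  · intro v w h hlt
    exact Subtype.ext ((hq v w h hlt _ le_rfl).trans (hp v w h hlt).2.2.2)
  · intro v w h hlt i hi j hj e
    have := Subtype.ext_iff.mp e
    rw [hq v w h hlt i hi, hq v w h hlt j hj] at this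
    exact (hp v w h hlt).1.inj hi hj this
  · intro v w h hlt i hi
    simp only [comap_adj, Function.Embedding.subtype_apply]
    rw [hq v w h hlt i hi.le, hq v w h hlt _ hi]
    exact (hp v w h hlt).1.adj_succ hi
  · intro v w h hlt i hi u e
    refine hcp v w h hlt i hi u ?_
    rw [← hq v w h hlt i hi, ← e]
  · intro v w v' w' h hlt h' hlt' hne i hi h1 h2 j hj h3 h4
    rw [Ne, Subtype.ext_iff, hq v w h hlt i hi] at h1 h2
    rw [Ne, Subtype.ext_iff, hq v' w' h' hlt' j hj] at h3 h4
    have ha := hMM v w v' w' h hlt h' hlt' hne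
    have hx := hnonend v w h hlt i hi h1 h2
    have hy := hnonend v' w' h' hlt' j hj h3 h4
    rw [Ne, Subtype.ext_iff, hq v w h hlt i hi, hq v' w' h' hlt' j hj]
    simp only [comap_adj, Function.Embedding.subtype_apply]
    rw [hq v w h hlt i hi, hq v' w' h' hlt' j hj]
    exact ⟨ha.ne hx hy, ha.2 _ hx _ hy⟩
  · rintro ⟨x, ⟨v, rfl⟩ | ⟨v, w, h, hlt, i, hi, rfl⟩⟩
    · exact Or.inl ⟨v, rfl⟩
    · exact Or.inr ⟨v, w, h, hlt, i, hi, Subtype.ext (hq v w h hlt i hi).symm⟩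
  · have same : ∀ v w, H.Adj v w → o v < o w → ∀ x y : X, ∀ i ≤ n v w, ∀ j ≤ n v w,
        (x : V) = p v w i → (y : V) = p v w j → G.Adj x y →
        ∃ u v, H.Adj u v ∧ o u < o v ∧ ∃ i < n u v,
          (x = q u v i ∧ y = q u v (i + 1)) ∨ (y = q u v i ∧ x = q u v (i + 1)) := by
      intro v w h hlt x y i hi j hj hx hy hxy
      rw [hx, hy, (hp v w h hlt).1.adj_iff hi hj] at hxy
      have hx' : x = q v w i := Subtype.ext (hx.trans (hq v w h hlt i hi).symm)
      have hy' : y = q v w j := Subtype.ext (hy.trans (hq v w h hlt j hj).symm)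
      rcases hxy with e | e
      · exact ⟨v, w, h, hlt, i, by omega, Or.inl ⟨hx', by rw [e, hy']⟩⟩
      · exact ⟨v, w, h, hlt, j, by omega, Or.inr ⟨hy', by rw [e, hx']⟩⟩
    have endpt : ∀ x y : X, ∀ u, (x : V) = c u → G.Adj x y →
        ∃ u v, H.Adj u v ∧ o u < o v ∧ ∃ i < n u v,
          (x = q u v i ∧ y = q u v (i + 1)) ∨ (y = q u v i ∧ x = q u v (i + 1)) := by
      intro x y u hx hxy
      rcases y.2 with ⟨v, hv⟩ | ⟨v, w, h, hlt, j, hj, hy⟩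
      · rw [hx, hv] at hxy
        exact absurd hxy (hcc u v)
      · by_cases hu : u = v ∨ u = w
        · rcases hu with rfl | rfl
          · exact same u w h hlt x y 0 (Nat.zero_le _) j hj
              (hx.trans (hp u w h hlt).2.2.1.symm) hy hxy
          · exact same v u h hlt x y _ le_rfl j hj
              (hx.trans (hp v u h hlt).2.2.2.symm) hy hxy
        · rw [not_or] at hu
          rw [hx, hy] at hxy
          exact absurd hxy ((hcM v w h hlt u hu.1 hu.2).2 _ rfl _
            ((hp v w h hlt).2.1 j hj))
    intro x y hxy
    replace hxy : G.Adj x y := hxy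
    have flip : ∀ x y : X, (∃ u v, H.Adj u v ∧ o u < o v ∧ ∃ i < n u v,
          (y = q u v i ∧ x = q u v (i + 1)) ∨ (x = q u v i ∧ y = q u v (i + 1))) →
        (∃ u v, H.Adj u v ∧ o u < o v ∧ ∃ i < n u v,
          (x = q u v i ∧ y = q u v (i + 1)) ∨ (y = q u v i ∧ x = q u v (i + 1))) :=
      fun x y ⟨u, v, h, hlt, i, hi, h'⟩ => ⟨u, v, h, hlt, i, hi, h'.symm⟩
    by_cases hx : ∃ u, (x : V) = c u
    · obtain ⟨u, hu⟩ := hx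
      exact endpt x y u hu hxy
    by_cases hy : ∃ u, (y : V) = c u
    · obtain ⟨u, hu⟩ := hy
      exact flip x y (endpt y x u hu hxy.symm)
    rcases x.2 with hx' | ⟨v, w, h, hlt, i, hi, ex⟩
    · exact absurd hx' hx
    rcases y.2 with hy' | ⟨v', w', h', hlt', j, hj, ey⟩
    · exact absurd hy' hy
    by_cases hvw : v = v' ∧ w = w'
    · obtain ⟨rfl, rfl⟩ := hvw
      exact same v w h hlt x y i hi j hj ex ey hxy
    · exfalso
      refine (hMM v w v' w' h hlt h' hlt' hvw).2 _ (hnonend v w h hlt i hi ?_ ?_) _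
        (hnonend v' w' h' hlt' j hj ?_ ?_) (ex ▸ ey ▸ hxy)
      · exact fun e => hx ⟨v, ex.trans e⟩
      · exact fun e => hx ⟨w, ex.trans e⟩
      · exact fun e => hy ⟨v', ey.trans e⟩
      · exact fun e => hy ⟨w', ey.trans e⟩

end Assembly

section LineAssembly

variable {V W : Type} {G : SimpleGraph V} {H : SimpleGraph W}

/-- The `k`-th vertex of the subdivided edge `v w` with `n v w` inner vertices. -/
noncomputable def subdivSeq (n : W → W → ℕ) (v w : W) (k : ℕ) :
    W ⊕ (Σ e : W × W, Fin (n e.1 e.2)) :=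
  if k = 0 then Sum.inl v
  else if h : k - 1 < n v w then Sum.inr ⟨(v, w), ⟨k - 1, h⟩⟩ else Sum.inl w

theorem subdivSeq_zero (n : W → W → ℕ) (v w : W) : subdivSeq n v w 0 = Sum.inl v := by
  simp [subdivSeq]

theorem subdivSeq_last (n : W → W → ℕ) (v w : W) :
    subdivSeq n v w (n v w + 1) = Sum.inl w := by
  simp [subdivSeq]

theorem subdivSeq_mid (n : W → W → ℕ) {v w : W} {k : ℕ} (h0 : k ≠ 0) (hk : k - 1 < n v w) :
    subdivSeq n v w k = Sum.inr ⟨(v, w), ⟨k - 1, hk⟩⟩ := by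
  simp [subdivSeq, h0, hk]

theorem subdivSeq_eq_inl {n : W → W → ℕ} {v w u : W} {k : ℕ} (hk : k ≤ n v w + 1)
    (h : subdivSeq n v w k = Sum.inl u) : (k = 0 ∧ u = v) ∨ (k = n v w + 1 ∧ u = w) := by
  unfold subdivSeq at h
  split_ifs at h with h0 h1
  · exact Or.inl ⟨h0, (Sum.inl.inj h).symm⟩
  · exact Or.inr ⟨by omega, (Sum.inl.inj h).symm⟩

theorem subdivSeq_cases {n : W → W → ℕ} (v w : W) {k : ℕ} (hk : k ≤ n v w + 1) :
    k = 0 ∨ k = n v w + 1 ∨ ∃ h : k - 1 < n v w,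
      k ≠ 0 ∧ subdivSeq n v w k = Sum.inr ⟨(v, w), ⟨k - 1, h⟩⟩ := by
  by_cases h0 : k = 0
  · exact Or.inl h0
  by_cases h1 : k - 1 < n v w
  · exact Or.inr (Or.inr ⟨h1, h0, subdivSeq_mid n h0 h1⟩)
  · exact Or.inr (Or.inl (by omega))

theorem subdivSeq_inj {n : W → W → ℕ} {v w : W} (hvw : v ≠ w) {i j : ℕ}
    (hi : i ≤ n v w + 1) (hj : j ≤ n v w + 1)
    (h : subdivSeq n v w i = subdivSeq n v w j) : i = j := by
  rcases subdivSeq_cases v w hi with rfl | rfl | ⟨h1, h0, e⟩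
  · rw [subdivSeq_zero] at h
    rcases subdivSeq_eq_inl hj h.symm with h | h
    · exact h.1.symm
    · exact absurd h.2 hvw
  · rw [subdivSeq_last] at h
    rcases subdivSeq_eq_inl hj h.symm with h | h
    · exact absurd h.2.symm hvw
    · exact h.1.symm
  · rcases subdivSeq_cases v w hj with rfl | rfl | ⟨h1', h0', e'⟩
    · rw [subdivSeq_zero, e] at h
      cases h
    · rw [subdivSeq_last, e] at h
      cases h
    · rw [e, e'] at h
      simp only [Sum.inr.injEq, Sigma.mk.injEq, heq_eq_eq, true_and, Fin.mk.injEq] at h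
      omega

theorem subdivSeq_cross {n : W → W → ℕ} {v w v' w' : W} (hne : ¬ (v = v' ∧ w = w'))
    {i j : ℕ} (hi : i ≤ n v w + 1)
    (h : subdivSeq n v w i = subdivSeq n v' w' j) (hj : j ≤ n v' w' + 1) :
    ∃ u, subdivSeq n v w i = Sum.inl u := by
  rcases subdivSeq_cases v w hi with rfl | rfl | ⟨h1, h0, e⟩
  · exact ⟨v, subdivSeq_zero n v w⟩
  · exact ⟨w, subdivSeq_last n v w⟩
  · rcases subdivSeq_cases v' w' hj with rfl | rfl | ⟨h1', h0', e'⟩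
    · exact ⟨v', h.trans (subdivSeq_zero n v' w')⟩
    · exact ⟨w', h.trans (subdivSeq_last n v' w')⟩
    · rw [e, e'] at h
      have h2 := congrArg (fun s => Sum.elim (fun _ => none) (fun x => some x.1) s) h
      simp only [Sum.elim_inr, Option.some.injEq, Prod.mk.injEq] at h2
      exact absurd h2 hne

/-- The line graph of a subdivision from disjoint connected sets attached at cliques. -/
theorem exists_lineGraph_of_regions [Finite W] (o : W → ℕ) (ho : Function.Injective o)
    (z : W → W → V) (M : W → W → Set V)
    (hM : ∀ v w, H.Adj v w → o v < o w → Conn G (M v w) ∧ z v w ∈ M v w ∧ z w v ∈ M v w ∧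
      z v w ≠ z w v)
    (hMM : ∀ v w v' w', H.Adj v w → o v < o w → H.Adj v' w' → o v' < o w' →
      ¬ (v = v' ∧ w = w') → Disjoint (M v w) (M v' w') ∧
      ∀ x ∈ M v w, ∀ x' ∈ M v' w', (G.Adj x x' ↔
        (v = v' ∧ x = z v w ∧ x' = z v' w') ∨ (v = w' ∧ x = z v w ∧ x' = z w' v') ∨
        (w = v' ∧ x = z w v ∧ x' = z v' w') ∨ (w = w' ∧ x = z w v ∧ x' = z w' v'))) :
    ∃ (m : ℕ) (S' : SimpleGraph (Fin m)),
      IsSubdivisionWith S' H (fun n => 1 ≤ n) ∧ HasInducedSubgraphIso G (LineGraph S') := by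
  classical
  have hp : ∀ v w, ∃ (n : ℕ) (p : ℕ → V), (H.Adj v w ∧ o v < o w →
      IndPath G n p ∧ (∀ i ≤ n, p i ∈ M v w) ∧ p 0 = z v w ∧ p n = z w v ∧ 1 ≤ n) ∧
      (¬ (H.Adj v w ∧ o v < o w) → n = 0) := by
    intro v w
    by_cases h : H.Adj v w ∧ o v < o w
    · obtain ⟨h1, h2, h3, h4⟩ := hM v w h.1 h.2
      obtain ⟨n, p, hp, hpS, h0, hn, -⟩ := h1.exists_indPath (X := {z v w}) (Y := {z w v})
        ⟨_, h2, rfl⟩ ⟨_, h3, rfl⟩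
      refine ⟨n, p, fun _ => ⟨hp, hpS, h0, hn, ?_⟩, fun h' => absurd h h'⟩
      rcases Nat.eq_zero_or_pos n with e | e
      · subst e
        exact absurd (h0.symm.trans hn) h4
      · exact e
    · exact ⟨0, fun _ => z v w, fun h1 => absurd h1 h, fun _ => rfl⟩
  choose n p hp hn0 using hp
  have : Fintype W := Fintype.ofFinite W
  let U := W ⊕ (Σ e : W × W, Fin (n e.1 e.2))
  let ε : U ≃ Fin (Fintype.card U) := Fintype.equivFin U
  let σ : W → W → ℕ → Fin (Fintype.card U) := fun v w k => ε (subdivSeq n v w k)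
  let R : Fin (Fintype.card U) → Fin (Fintype.card U) → Prop := fun x y =>
    ∃ v w, H.Adj v w ∧ o v < o w ∧ ∃ k < n v w + 1,
      (x = σ v w k ∧ y = σ v w (k + 1)) ∨ (y = σ v w k ∧ x = σ v w (k + 1))
  have hσ : ∀ {v w}, H.Adj v w → ∀ {i j}, i ≤ n v w + 1 → j ≤ n v w + 1 →
      σ v w i = σ v w j → i = j := fun h i j hi hj e =>
    subdivSeq_inj h.ne hi hj (ε.injective e)
  let S' : SimpleGraph (Fin (Fintype.card U)) :=
    { Adj := R
      symm := ⟨fun x y ⟨v, w, h, hlt, k, hk, h'⟩ => ⟨v, w, h, hlt, k, hk, h'.symm⟩⟩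
      loopless := ⟨by
        rintro x ⟨v, w, h, hlt, k, hk, ⟨h1, h2⟩ | ⟨h1, h2⟩⟩ <;>
        · have := hσ h (by omega) (by omega) (h1.symm.trans h2)
          omega⟩ }
  have hσadj : ∀ v w, H.Adj v w → o v < o w → ∀ k < n v w + 1,
      S'.Adj (σ v w k) (σ v w (k + 1)) :=
    fun v w h hlt k hk => ⟨v, w, h, hlt, k, hk, Or.inl ⟨rfl, rfl⟩⟩
  have hσ0 : ∀ v w, σ v w 0 = ε (Sum.inl v) := fun v w => by
    simp only [σ, subdivSeq_zero]
  have hσn : ∀ v w, σ v w (n v w + 1) = ε (Sum.inl w) := fun v w => by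
    simp only [σ, subdivSeq_last]
  have hσb : ∀ v w k u, k ≤ n v w + 1 → σ v w k = ε (Sum.inl u) →
      (k = 0 ∧ u = v) ∨ (k = n v w + 1 ∧ u = w) := fun v w k u hk e =>
    subdivSeq_eq_inl hk (ε.injective e)
  have hσc : ∀ {v w v' w' i j}, ¬ (v = v' ∧ w = w') → i ≤ n v w + 1 → j ≤ n v' w' + 1 →
      σ v w i = σ v' w' j → ∃ u, σ v w i = ε (Sum.inl u) := by
    intro v w v' w' i j hne hi hj e
    obtain ⟨u, hu⟩ := subdivSeq_cross hne hi (ε.injective e) hj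
    exact ⟨u, congrArg ε hu⟩
  refine ⟨_, S', isSubdivisionWith_of_seq o ho (fun v => ε (Sum.inl v))
    (fun v w e => Sum.inl.inj (ε.injective e)) (fun v w => n v w + 1) σ
    (fun _ _ _ _ => by omega) (fun v w _ _ => hσ0 v w) (fun v w _ _ => hσn v w)
    (fun v w h _ i hi j hj e => hσ h hi hj e) hσadj ?_ ?_ ?_ (fun x y h => h), ?_⟩
  · intro v w h hlt k hk u e
    rcases hσb v w k u hk e.symm with h | h
    · exact Or.inl h.2
    · exact Or.inr h.2
  · intro v w v' w' h hlt h' hlt' hne i hi hi0 hin j hj hj0 hjn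
    have hnb : ∀ u, σ v w i ≠ ε (Sum.inl u) := by
      intro u e
      rcases hσb v w i u hi e with ⟨-, rfl⟩ | ⟨-, rfl⟩
      · exact hi0 e
      · exact hin e
    have hnb' : ∀ u, σ v' w' j ≠ ε (Sum.inl u) := by
      intro u e
      rcases hσb v' w' j u hj e with ⟨-, rfl⟩ | ⟨-, rfl⟩
      · exact hj0 e
      · exact hjn e
    constructor
    · intro e
      obtain ⟨u, hu⟩ := hσc hne hi hj e
      exact hnb u hu
    · rintro ⟨a, b, hab, hlt2, k, hk, hc⟩
      have aux : ∀ {s t}, s ≤ n a b + 1 → t ≤ n a b + 1 → σ v w i = σ a b s →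
          σ v' w' j = σ a b t → False := by
        intro s t hs ht e1 e2
        by_cases h1 : v = a ∧ w = b
        · by_cases h2 : v' = a ∧ w' = b
          · exact hne ⟨h1.1.trans h2.1.symm, h1.2.trans h2.2.symm⟩
          · obtain ⟨u, hu⟩ := hσc h2 hj ht e2
            exact hnb' u hu
        · obtain ⟨u, hu⟩ := hσc h1 hi hs e1
          exact hnb u hu
      rcases hc with ⟨e1, e2⟩ | ⟨e1, e2⟩
      · exact aux (by omega) (by omega) e1 e2
      · exact aux (by omega) (by omega) e2 e1
  · intro x
    obtain ⟨u, rfl⟩ := ε.surjective x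
    rcases u with v | ⟨⟨v, w⟩, k⟩
    · exact Or.inl ⟨v, rfl⟩
    · have hvw : H.Adj v w ∧ o v < o w := by
        by_contra h
        have h0 := hn0 v w h
        have := k.2
        simp only [h0] at this
        omega
      refine Or.inr ⟨v, w, hvw.1, hvw.2, k + 1, by have := k.2; simp only at this; omega, ?_⟩
      simp only [σ, EmbeddingLike.apply_eq_iff_eq]
      rw [subdivSeq_mid n (by omega) (by simp)]
      simp
  · have hch : ∀ e : S'.edgeSet, ∃ (v w : W) (k : ℕ), H.Adj v w ∧ o v < o w ∧ k < n v w + 1 ∧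
        (e : Sym2 _) = s(σ v w k, σ v w (k + 1)) := by
      rintro ⟨e, he⟩
      induction e with
      | _ x y =>
        obtain ⟨v, w, h, hlt, k, hk, ⟨rfl, rfl⟩ | ⟨rfl, rfl⟩⟩ := (mem_edgeSet _).mp he
        · exact ⟨v, w, k, h, hlt, hk, rfl⟩
        · exact ⟨v, w, k, h, hlt, hk, Sym2.eq_swap⟩
    choose a b k hab hlt hk he using hch
    let f : S'.edgeSet → V := fun e => p (a e) (b e) (k e)
    have hfM : ∀ e, f e ∈ M (a e) (b e) := fun e =>
      (hp _ _ ⟨hab e, hlt e⟩).2.1 _ (Nat.lt_succ_iff.mp (hk e))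
    have hfinj : Function.Injective f := by
      intro e e' h
      by_cases hne : a e = a e' ∧ b e = b e'
      · have h' : p (a e) (b e) (k e) = p (a e') (b e') (k e') := h
        rw [hne.1, hne.2] at h'
        have hke := hk e
        rw [hne.1, hne.2] at hke
        have := (hp _ _ ⟨hab e', hlt e'⟩).1.inj (Nat.lt_succ_iff.mp hke)
          (Nat.lt_succ_iff.mp (hk e')) h'
        refine Subtype.ext ?_
        rw [he e, he e', hne.1, hne.2, this]
      · exact absurd (h ▸ hfM e') (Set.disjoint_left.mp
          (hMM _ _ _ _ (hab e) (hlt e) (hab e') (hlt e') hne).1 (hfM e))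
    have hmem : ∀ e : S'.edgeSet, ∀ x, x ∈ (e : Sym2 _) ↔
        x = σ (a e) (b e) (k e) ∨ x = σ (a e) (b e) (k e + 1) := by
      intro e x
      rw [he e, Sym2.mem_iff]
    have hends : ∀ e : S'.edgeSet, ∀ u, ε (Sum.inl u) ∈ (e : Sym2 _) ↔
        (u = a e ∧ f e = z (a e) (b e)) ∨ (u = b e ∧ f e = z (b e) (a e)) := by
      intro e u
      obtain ⟨hP, -, h0, hn, hpos⟩ := hp _ _ ⟨hab e, hlt e⟩
      have hke := hk e
      rw [hmem, ← h0, ← hn]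
      constructor
      · rintro (h | h)
        · rcases hσb _ _ _ _ hke.le h.symm with ⟨h1, h2⟩ | ⟨h1, h2⟩
          · exact Or.inl ⟨h2, by simp only [f, h1]⟩
          · omega
        · rcases hσb _ _ _ _ hke h.symm with ⟨h1, h2⟩ | ⟨h1, h2⟩
          · omega
          · refine Or.inr ⟨h2, ?_⟩
            simp only [f, show k e = n (a e) (b e) by omega]
      · rintro (⟨h1, h2⟩ | ⟨h1, h2⟩)
        · have := hP.inj (Nat.lt_succ_iff.mp hke) (Nat.zero_le _) h2
          exact Or.inl (by rw [this, hσ0, h1])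
        · have := hP.inj (Nat.lt_succ_iff.mp hke) le_rfl h2
          exact Or.inr (by rw [this, hσn, h1])
    have hadj : ∀ e e', G.Adj (f e) (f e') ↔ (LineGraph S').Adj e e' := by
      intro e e'
      simp only [LineGraph, fromRel_adj]
      have hsymm : ((∃ v, v ∈ (e : Sym2 (Fin (Fintype.card U))) ∧
          v ∈ (e' : Sym2 (Fin (Fintype.card U)))) ∨
          ∃ v, v ∈ (e' : Sym2 (Fin (Fintype.card U))) ∧
            v ∈ (e : Sym2 (Fin (Fintype.card U)))) ↔
          ∃ v, v ∈ (e : Sym2 (Fin (Fintype.card U))) ∧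
            v ∈ (e' : Sym2 (Fin (Fintype.card U))) :=
        ⟨fun h => h.elim id fun ⟨v, h1, h2⟩ => ⟨v, h2, h1⟩, Or.inl⟩
      rw [hsymm]
      by_cases hne : a e = a e' ∧ b e = b e'
      · have hke := hk e
        have hke' := hk e'
        rw [hne.1, hne.2] at hke
        obtain ⟨hP, -, -⟩ := hp _ _ ⟨hab e', hlt e'⟩
        have h1 : G.Adj (f e) (f e') ↔ k e + 1 = k e' ∨ k e' + 1 = k e := by
          simp only [f]
          rw [hne.1, hne.2]
          exact hP.adj_iff (Nat.lt_succ_iff.mp hke) (Nat.lt_succ_iff.mp hke')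
        rw [h1]
        constructor
        · intro h
          refine ⟨fun h' => ?_, ?_⟩
          · rw [h'] at h
            omega
          · simp only [hmem]
            rw [hne.1, hne.2]
            rcases h with h | h
            · exact ⟨_, Or.inr rfl, Or.inl (by rw [h])⟩
            · exact ⟨_, Or.inl rfl, Or.inr (by rw [h])⟩
        · rintro ⟨hne', x, hx, hx'⟩
          have hkk : k e ≠ k e' := by
            intro h
            exact hne' (Subtype.ext (by rw [he e, he e', hne.1, hne.2, h]))
          rw [hmem] at hx hx'
          rw [hne.1, hne.2] at hx
          rcases hx with rfl | rfl <;> rcases hx' with h | h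
          all_goals
            have := hσ (hab e') (by omega) (by omega) h
            omega
      · rw [(hMM _ _ _ _ (hab e) (hlt e) (hab e') (hlt e') hne).2 _ (hfM e) _ (hfM e')]
        constructor
        · intro h
          refine ⟨fun h' => hne (by rw [h']; exact ⟨rfl, rfl⟩), ?_⟩
          rcases h with ⟨h1, h2, h3⟩ | ⟨h1, h2, h3⟩ | ⟨h1, h2, h3⟩ | ⟨h1, h2, h3⟩
          · exact ⟨ε (Sum.inl (a e)), (hends e _).mpr (Or.inl ⟨rfl, h2⟩),
              (hends e' _).mpr (Or.inl ⟨h1, h3⟩)⟩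
          · exact ⟨ε (Sum.inl (a e)), (hends e _).mpr (Or.inl ⟨rfl, h2⟩),
              (hends e' _).mpr (Or.inr ⟨h1, h3⟩)⟩
          · exact ⟨ε (Sum.inl (b e)), (hends e _).mpr (Or.inr ⟨rfl, h2⟩),
              (hends e' _).mpr (Or.inl ⟨h1, h3⟩)⟩
          · exact ⟨ε (Sum.inl (b e)), (hends e _).mpr (Or.inr ⟨rfl, h2⟩),
              (hends e' _).mpr (Or.inr ⟨h1, h3⟩)⟩
        · rintro ⟨-, x, hx, hx'⟩
          have hu : ∃ u, x = ε (Sum.inl u) := by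
            have hke := hk e
            have hke' := hk e'
            rcases (hmem e x).mp hx with rfl | rfl <;> rcases (hmem e' _).mp hx' with h | h <;>
              exact hσc hne (by omega) (by omega) h
          obtain ⟨u, rfl⟩ := hu
          rcases (hends e u).mp hx with ⟨h1, h2⟩ | ⟨h1, h2⟩ <;>
            rcases (hends e' u).mp hx' with ⟨h3, h4⟩ | ⟨h3, h4⟩
          · exact Or.inl ⟨h1.symm.trans h3, h2, h4⟩
          · exact Or.inr (Or.inl ⟨h1.symm.trans h3, h2, h4⟩)
          · exact Or.inr (Or.inr (Or.inl ⟨h1.symm.trans h3, h2, h4⟩))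
          · exact Or.inr (Or.inr (Or.inr ⟨h1.symm.trans h3, h2, h4⟩))
    refine ⟨Set.range f, ⟨⟨Equiv.ofInjective f hfinj, ?_⟩⟩⟩
    intro e e'
    simp only [comap_adj, Function.Embedding.subtype_apply, Equiv.ofInjective_apply]
    exact hadj e e'

end LineAssembly

section Assembly2

variable {V W : Type} {G : SimpleGraph V} {H : SimpleGraph W}

theorem Assembly.C_only' {D : W → Set V} {y : W → W → V} {C : W → W → Set V}
    (h : Assembly G H D y C) {v w a : W} (hab : H.Adj v w) (ha : a = v ∨ a = w) :
    ∃ b, H.Adj a b ∧ s(a, b) = s(v, w) ∧ C v w = C a b := by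
  rcases ha with rfl | rfl
  · exact ⟨w, hab, rfl, rfl⟩
  · exact ⟨v, hab.symm, Sym2.eq_swap, h.C_symm _ _ hab⟩

theorem Assembly.exists_subdivision [Finite W] {D : W → Set V} {y : W → W → V}
    {C : W → W → Set V} (h : Assembly G H D y C)
    (hD : ∀ v, TypeC G (D v) (fun w : {w // H.Adj v w} => y v w)) :
    ∃ X : Set V, IsSubdivisionWith (G.induce X) H (fun n => 1 ≤ n) := by
  classical
  choose c hcD leg hleg hlegs using hD
  obtain ⟨m, ⟨e⟩⟩ := Finite.exists_equiv_fin W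
  let L : W → W → Set V := fun v w => if hvw : H.Adj v w then leg v ⟨w, hvw⟩ else ∅
  have hL : ∀ v w, H.Adj v w → Conn G (L v w) ∧ L v w ⊆ D v ∧ c v ∈ L v w ∧ y v w ∈ L v w := by
    intro v w hvw
    simp only [L, hvw, dif_pos]
    exact hleg v ⟨w, hvw⟩
  have hLL : ∀ v w v' w', H.Adj v w → H.Adj v' w' → ¬ (v = v' ∧ w = w') →
      Anticomplete G (L v w \ {c v}) (L v' w' \ {c v'}) := by
    intro v w v' w' h1 h2 hne
    by_cases hv : v = v'
    · subst hv
      simp only [L, h1, h2, dif_pos]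
      exact hlegs v _ _ fun e => hne ⟨rfl, Subtype.ext_iff.mp e⟩
    · exact (h.D_anti v v' hv).mono (Set.sdiff_subset.trans (hL v w h1).2.1)
        (Set.sdiff_subset.trans (hL v' w' h2).2.1)
  have hLC : ∀ v w a b, H.Adj v w → H.Adj a b → s(v, w) ≠ s(a, b) →
      Anticomplete G (L v w \ {c v}) (C a b) := by
    intro v w a b h1 h2 hne
    by_cases hv : v = a ∨ v = b
    · obtain ⟨b', hb, hs, hC⟩ := h.C_only' h2 hv
      rw [hC]
      refine ⟨(h.C_disj v b' hb v).mono_left (Set.sdiff_subset.trans (hL v w h1).2.1), ?_⟩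
      intro x hx t ht hxt
      have hxy := h.C_only v b' hb x ((hL v w h1).2.1 hx.1) t ht hxt
      refine (hLL v w v b' h1 hb fun e => hne ?_).ne hx ⟨(hL v b' hb).2.2.2, ?_⟩ hxy
      · rw [e.2, hs]
      · rw [← hxy]
        exact hx.2
    · rw [not_or] at hv
      exact (h.C_anti a b h2 v hv.1 hv.2).mono (Set.sdiff_subset.trans (hL v w h1).2.1) le_rfl
  refine exists_subdivision_of_regions (fun v => (e v : ℕ))
    (fun v w hvw => e.injective (Fin.ext hvw)) c ?_ ?_ (fun v w => L v w ∪ C v w ∪ L w v)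
    ?_ ?_ ?_
  · intro v w hvw
    by_contra hne
    exact (h.D_anti v w hne).ne (hcD v) (hcD w) hvw
  · intro v w hvw
    by_cases hne : v = w
    · subst hne
      exact G.loopless.irrefl _ hvw
    · exact (h.D_anti v w hne).2 _ (hcD v) _ (hcD w) hvw
  · intro v w hvw _
    refine ⟨?_, Or.inl (Or.inl (hL v w hvw).2.2.1), Or.inr (hL w v hvw.symm).2.2.1⟩
    obtain ⟨x, hx, hx'⟩ := h.C_touch v w hvw
    obtain ⟨x2, hx2, hx2'⟩ := h.C_touch w v hvw.symm
    refine ((hL v w hvw).1.union (h.C_conn v w hvw) (Or.inr ?_)).union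
      (hL w v hvw.symm).1 (Or.inr ?_)
    · exact ⟨_, (hL v w hvw).2.2.2, x, hx, hx'⟩
    · exact ⟨x2, Or.inr (h.C_symm v w hvw ▸ hx2), _, (hL w v hvw.symm).2.2.2, hx2'.symm⟩
  · intro v w hvw _ u hu hu'
    have hcu : ({c u} : Set V) ⊆ D u := Set.singleton_subset_iff.mpr (hcD u)
    refine (Anticomplete.union_right ?_ ?_).union_right ?_
    · exact (h.D_anti u v hu).mono hcu (hL v w hvw).2.1
    · exact (h.C_anti v w hvw u hu hu').mono hcu le_rfl
    · exact (h.D_anti u w hu').mono hcu (hL w v hvw.symm).2.1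
  · intro v w v' w' hvw hlt hvw' hlt' hne
    have hs : s(v, w) ≠ s(v', w') := by
      intro hs
      rcases Sym2.eq_iff.mp hs with ⟨rfl, rfl⟩ | ⟨rfl, rfl⟩
      · exact hne ⟨rfl, rfl⟩
      · exact absurd hlt (by omega)
    have hsub : ∀ v w, (L v w ∪ C v w ∪ L w v) \ {c v, c w} ⊆
        L v w \ {c v} ∪ C v w ∪ L w v \ {c w} := by
      rintro v w x ⟨(hx | hx) | hx, hx'⟩
      · exact Or.inl (Or.inl ⟨hx, fun e => hx' (Or.inl e)⟩)
      · exact Or.inl (Or.inr hx)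
      · exact Or.inr ⟨hx, fun e => hx' (Or.inr e)⟩
    refine Anticomplete.mono ?_ (hsub v w) (hsub v' w')
    have hswap : ∀ a b a' b' : W, s(a, b) ≠ s(a', b') → ¬ (a = a' ∧ b = b') :=
      fun a b a' b' h e => h (by rw [e.1, e.2])
    have hs1 : s(v, w) ≠ s(w', v') := fun e => hs (e.trans Sym2.eq_swap)
    have hs2 : s(w, v) ≠ s(v', w') := fun e => hs (Sym2.eq_swap.trans e)
    have hs3 : s(w, v) ≠ s(w', v') := fun e => hs (Sym2.eq_swap.trans (e.trans Sym2.eq_swap))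
    refine (Anticomplete.union_left ?_ ?_).union_left ?_
    · exact ((hLL v w v' w' hvw hvw' hne).union_right (hLC v w v' w' hvw hvw' hs)).union_right
        (hLL v w w' v' hvw hvw'.symm (hswap _ _ _ _ hs1))
    · exact ((hLC v' w' v w hvw' hvw hs.symm).symm.union_right
        (h.C_C v w v' w' hvw hvw' hs)).union_right
        (hLC w' v' v w hvw'.symm hvw hs1.symm).symm
    · exact ((hLL w v v' w' hvw.symm hvw' (hswap _ _ _ _ hs2)).union_right
        (hLC w v v' w' hvw.symm hvw' hs2)).union_right
        (hLL w v w' v' hvw.symm hvw'.symm (hswap _ _ _ _ hs3))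

theorem Assembly.exists_lineGraph [Finite W] {D : W → Set V} {y : W → W → V}
    {C : W → W → Set V} (h : Assembly G H D y C)
    (hD : ∀ v, TypeT G (D v) (fun w : {w // H.Adj v w} => y v w)) :
    ∃ (m : ℕ) (S' : SimpleGraph (Fin m)),
      IsSubdivisionWith S' H (fun n => 1 ≤ n) ∧ HasInducedSubgraphIso G (LineGraph S') := by
  classical
  choose z' leg hleg hlegs using hD
  obtain ⟨m, ⟨e⟩⟩ := Finite.exists_equiv_fin W
  let L : W → W → Set V := fun v w => if hvw : H.Adj v w then leg v ⟨w, hvw⟩ else ∅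
  let z : W → W → V := fun v w => if hvw : H.Adj v w then z' v ⟨w, hvw⟩ else y v w
  have hL : ∀ v w, H.Adj v w → Conn G (L v w) ∧ L v w ⊆ D v ∧ z v w ∈ L v w ∧ y v w ∈ L v w := by
    intro v w hvw
    simp only [L, z, hvw, dif_pos]
    exact hleg v ⟨w, hvw⟩
  have hLL : ∀ v w w', H.Adj v w → H.Adj v w' → w ≠ w' → Disjoint (L v w) (L v w') ∧
      ∀ x ∈ L v w, ∀ x' ∈ L v w', (G.Adj x x' ↔ x = z v w ∧ x' = z v w') := by
    intro v w w' h1 h2 hne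
    simp only [L, z, h1, h2, dif_pos]
    exact hlegs v _ _ fun e => hne (Subtype.ext_iff.mp e)
  have hLC : ∀ v w a b, H.Adj v w → H.Adj a b → s(v, w) ≠ s(a, b) →
      Anticomplete G (L v w) (C a b) := by
    intro v w a b h1 h2 hne
    by_cases hv : v = a ∨ v = b
    · obtain ⟨b', hb, hs, hC⟩ := h.C_only' h2 hv
      rw [hC]
      refine ⟨(h.C_disj v b' hb v).mono_left (hL v w h1).2.1, ?_⟩
      intro x hx t ht hxt
      have hxy := h.C_only v b' hb x ((hL v w h1).2.1 hx) t ht hxt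
      refine Set.disjoint_left.mp (hLL v w b' h1 hb fun e => hne ?_).1 hx
        (hxy ▸ (hL v b' hb).2.2.2)
      rw [e, hs]
    · rw [not_or] at hv
      exact (h.C_anti a b h2 v hv.1 hv.2).mono (hL v w h1).2.1 le_rfl
  have hLD : ∀ v w v' w', H.Adj v w → H.Adj v' w' → v ≠ v' →
      Anticomplete G (L v w) (L v' w') := fun v w v' w' h1 h2 hne =>
    (h.D_anti v v' hne).mono (hL v w h1).2.1 (hL v' w' h2).2.1
  have hLdisj : ∀ v w v' w', H.Adj v w → H.Adj v' w' → s(v, w) ≠ s(v', w') →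
      Disjoint (L v w) (L v' w') := by
    intro v w v' w' h1 h2 hne
    by_cases hv : v = v'
    · subst hv
      exact (hLL v w w' h1 h2 fun e => hne (by rw [e])).1
    · exact (hLD v w v' w' h1 h2 hv).1
  refine exists_lineGraph_of_regions (fun v => (e v : ℕ))
    (fun v w hvw => e.injective (Fin.ext hvw)) z (fun v w => L v w ∪ C v w ∪ L w v) ?_ ?_
  · intro v w hvw _
    refine ⟨?_, Or.inl (Or.inl (hL v w hvw).2.2.1), Or.inr (hL w v hvw.symm).2.2.1,
      (h.D_anti v w hvw.ne).ne ((hL v w hvw).2.1 (hL v w hvw).2.2.1)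
        ((hL w v hvw.symm).2.1 (hL w v hvw.symm).2.2.1)⟩
    obtain ⟨x, hx, hx'⟩ := h.C_touch v w hvw
    obtain ⟨x2, hx2, hx2'⟩ := h.C_touch w v hvw.symm
    refine ((hL v w hvw).1.union (h.C_conn v w hvw) (Or.inr ?_)).union
      (hL w v hvw.symm).1 (Or.inr ?_)
    · exact ⟨_, (hL v w hvw).2.2.2, x, hx, hx'⟩
    · exact ⟨x2, Or.inr (h.C_symm v w hvw ▸ hx2), _, (hL w v hvw.symm).2.2.2, hx2'.symm⟩
  · intro v w v' w' hvw hlt hvw' hlt' hne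
    have hs : s(v, w) ≠ s(v', w') := by
      intro hs
      rcases Sym2.eq_iff.mp hs with ⟨rfl, rfl⟩ | ⟨rfl, rfl⟩
      · exact hne ⟨rfl, rfl⟩
      · exact absurd hlt (by omega)
    have hs1 : s(v, w) ≠ s(w', v') := fun e => hs (e.trans Sym2.eq_swap)
    have hs2 : s(w, v) ≠ s(v', w') := fun e => hs (Sym2.eq_swap.trans e)
    have hs3 : s(w, v) ≠ s(w', v') := fun e => hs (Sym2.eq_swap.trans (e.trans Sym2.eq_swap))
    have hadj : ∀ a b a' b', H.Adj a b → H.Adj a' b' → s(a, b) ≠ s(a', b') →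
        ∀ x ∈ L a b, ∀ x' ∈ L a' b', G.Adj x x' → a = a' ∧ x = z a b ∧ x' = z a' b' := by
      intro a b a' b' h1 h2 hne x hx x' hx' hxx
      by_cases ha : a = a'
      · subst ha
        exact ⟨rfl, ((hLL a b b' h1 h2 fun e => hne (by rw [e])).2 x hx x' hx').mp hxx⟩
      · exact absurd hxx ((hLD a b a' b' h1 h2 ha).2 x hx x' hx')
    have hz : ∀ a b b', H.Adj a b → H.Adj a b' → s(a, b) ≠ s(a, b') →
        G.Adj (z a b) (z a b') := by
      intro a b b' h1 h2 hne
      exact ((hLL a b b' h1 h2 fun e => hne (by rw [e])).2 _ (hL a b h1).2.2.1 _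
        (hL a b' h2).2.2.1).mpr ⟨rfl, rfl⟩
    have hvs := hvw.symm
    have hvs' := hvw'.symm
    constructor
    · simp only [Set.disjoint_union_left, Set.disjoint_union_right]
      exact ⟨⟨⟨⟨hLdisj _ _ _ _ hvw hvw' hs, (hLC _ _ _ _ hvw' hvw hs.symm).1.symm⟩,
          hLdisj _ _ _ _ hvs hvw' hs2⟩,
        ⟨(hLC _ _ _ _ hvw hvw' hs).1, (h.C_C _ _ _ _ hvw hvw' hs).1⟩,
          (hLC _ _ _ _ hvs hvw' hs2).1⟩,
        ⟨hLdisj _ _ _ _ hvw hvs' hs1, (hLC _ _ _ _ hvs' hvw hs1.symm).1.symm⟩,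
          hLdisj _ _ _ _ hvs hvs' hs3⟩
    · intro x hx x' hx'
      constructor
      · intro hxx
        rcases hx with (hx | hx) | hx <;> rcases hx' with (hx' | hx') | hx'
        · exact Or.inl (hadj _ _ _ _ hvw hvw' hs x hx x' hx' hxx)
        · exact absurd hxx ((hLC _ _ _ _ hvw hvw' hs).2 x hx x' hx')
        · exact Or.inr (Or.inl (hadj _ _ _ _ hvw hvs' hs1 x hx x' hx' hxx))
        · exact absurd hxx.symm ((hLC _ _ _ _ hvw' hvw hs.symm).2 x' hx' x hx)
        · exact absurd hxx ((h.C_C _ _ _ _ hvw hvw' hs).2 x hx x' hx')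
        · exact absurd hxx.symm ((hLC _ _ _ _ hvs' hvw hs1.symm).2 x' hx' x hx)
        · exact Or.inr (Or.inr (Or.inl (hadj _ _ _ _ hvs hvw' hs2 x hx x' hx' hxx)))
        · exact absurd hxx ((hLC _ _ _ _ hvs hvw' hs2).2 x hx x' hx')
        · exact Or.inr (Or.inr (Or.inr (hadj _ _ _ _ hvs hvs' hs3 x hx x' hx' hxx)))
      · rintro (⟨rfl, rfl, rfl⟩ | ⟨rfl, rfl, rfl⟩ | ⟨rfl, rfl, rfl⟩ | ⟨rfl, rfl, rfl⟩)
        · exact hz _ _ _ hvw hvw' hs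
        · exact hz _ _ _ hvw hvs' hs1
        · exact hz _ _ _ hvs hvw' hs2
        · exact hz _ _ _ hvs hvs' hs3

end Assembly2

section ThreeTerminals

variable {V : Type} {G : SimpleGraph V}

theorem typeC_of_three {D : Set V} {y : Fin 3 → V} {c : V} {L₀ L₁ L₂ : Set V}
    (h₀ : Conn G L₀ ∧ L₀ ⊆ D ∧ c ∈ L₀ ∧ y 0 ∈ L₀)
    (h₁ : Conn G L₁ ∧ L₁ ⊆ D ∧ c ∈ L₁ ∧ y 1 ∈ L₁)
    (h₂ : Conn G L₂ ∧ L₂ ⊆ D ∧ c ∈ L₂ ∧ y 2 ∈ L₂)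
    (h₀₁ : Anticomplete G (L₀ \ {c}) (L₁ \ {c})) (h₀₂ : Anticomplete G (L₀ \ {c}) (L₂ \ {c}))
    (h₁₂ : Anticomplete G (L₁ \ {c}) (L₂ \ {c})) : TypeC G D y := by
  refine ⟨c, h₀.2.1 h₀.2.2.1, ![L₀, L₁, L₂], fun a => ?_, fun a b hab => ?_⟩
  · fin_cases a
    exacts [h₀, h₁, h₂]
  · fin_cases a <;> fin_cases b
    exacts [absurd rfl hab, h₀₁, h₀₂, h₀₁.symm, absurd rfl hab, h₁₂, h₀₂.symm, h₁₂.symm,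
      absurd rfl hab]

theorem typeT_of_three {D : Set V} {y : Fin 3 → V} {z₀ z₁ z₂ : V} {L₀ L₁ L₂ : Set V}
    (h₀ : Conn G L₀ ∧ L₀ ⊆ D ∧ z₀ ∈ L₀ ∧ y 0 ∈ L₀)
    (h₁ : Conn G L₁ ∧ L₁ ⊆ D ∧ z₁ ∈ L₁ ∧ y 1 ∈ L₁)
    (h₂ : Conn G L₂ ∧ L₂ ⊆ D ∧ z₂ ∈ L₂ ∧ y 2 ∈ L₂)
    (h₀₁ : Disjoint L₀ L₁ ∧ ∀ x ∈ L₀, ∀ x' ∈ L₁, G.Adj x x' ↔ x = z₀ ∧ x' = z₁)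
    (h₀₂ : Disjoint L₀ L₂ ∧ ∀ x ∈ L₀, ∀ x' ∈ L₂, G.Adj x x' ↔ x = z₀ ∧ x' = z₂)
    (h₁₂ : Disjoint L₁ L₂ ∧ ∀ x ∈ L₁, ∀ x' ∈ L₂, G.Adj x x' ↔ x = z₁ ∧ x' = z₂) :
    TypeT G D y := by
  have sw : ∀ {A B : Set V} {a b : V},
      (Disjoint A B ∧ ∀ x ∈ A, ∀ x' ∈ B, (G.Adj x x' ↔ x = a ∧ x' = b)) →
      (Disjoint B A ∧ ∀ x ∈ B, ∀ x' ∈ A, (G.Adj x x' ↔ x = b ∧ x' = a)) := by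
    rintro A B a b ⟨h1, h2⟩
    exact ⟨h1.symm, fun x hx x' hx' => by rw [G.adj_comm, h2 x' hx' x hx, and_comm]⟩
  refine ⟨![z₀, z₁, z₂], ![L₀, L₁, L₂], fun a => ?_, fun a b hab => ?_⟩
  · fin_cases a
    exacts [h₀, h₁, h₂]
  · fin_cases a <;> fin_cases b
    exacts [absurd rfl hab, h₀₁, h₀₂, sw h₀₁, absurd rfl hab, h₁₂, sw h₀₂, sw h₁₂,
      absurd rfl hab]

theorem IndPath.anticomplete_seg {n : ℕ} {p : ℕ → V} (h : IndPath G n p) {a b c d : ℕ}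
    (hbc : b + 1 < c) (hd : d ≤ n) : Anticomplete G (seg p a b) (seg p c d) := by
  refine anticomplete_of ?_
  intro x hx y hy
  obtain ⟨i, h1, h2, rfl⟩ := mem_seg.mp hx
  obtain ⟨j, h3, h4, rfl⟩ := mem_seg.mp hy
  constructor
  · intro e
    have := h.inj (by omega) (by omega) e
    omega
  · rw [h.adj_iff (by omega) (by omega)]
    omega

theorem IndPath.anticomplete_seg_diff {n : ℕ} {p : ℕ → V} (h : IndPath G n p) {m : ℕ}
    (hm : m ≤ n) : Anticomplete G (seg p 0 m \ {p m}) (seg p m n \ {p m}) := by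
  refine anticomplete_of ?_
  rintro x ⟨hx, hxm⟩ y ⟨hy, hym⟩
  obtain ⟨i, h1, h2, rfl⟩ := mem_seg.mp hx
  obtain ⟨j, h3, h4, rfl⟩ := mem_seg.mp hy
  have hi : i ≠ m := fun e => hxm (by rw [e]; rfl)
  have hj : j ≠ m := fun e => hym (by rw [e]; rfl)
  constructor
  · intro e
    have := h.inj (by omega) (by omega) e
    omega
  · rw [h.adj_iff (by omega) (by omega)]
    omega

theorem seg_subset_iff {p : ℕ → V} {a b : ℕ} {S : Set V} :
    seg p a b ⊆ S ↔ ∀ i, a ≤ i → i ≤ b → p i ∈ S := by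
  constructor
  · exact fun h i h1 h2 => h (seg_mem h1 h2)
  · intro h x hx
    obtain ⟨i, h1, h2, rfl⟩ := mem_seg.mp hx
    exact h i h1 h2

/-- Three vertices of a connected set are linked through a vertex or through a triangle. -/
theorem typeC_or_typeT {D : Set V} (hD : Conn G D) (y : Fin 3 → V)
    (hy : Function.Injective y) (hyD : ∀ a, y a ∈ D) : TypeC G D y ∨ TypeT G D y := by
  classical
  obtain ⟨n, p, hp, hpD, hp0, hpn, -, -⟩ := hD.exists_indPath (X := {y 0}) (Y := {y 1})
    ⟨_, hyD 0, rfl⟩ ⟨_, hyD 1, rfl⟩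
  replace hp0 : p 0 = y 0 := hp0
  replace hpn : p n = y 1 := hpn
  have hn : 1 ≤ n := by
    rcases Nat.eq_zero_or_pos n with e | e
    · subst e
      exact absurd (hy (hp0.symm.trans hpn)) (by decide)
    · exact e
  have sub : ∀ {a b}, b ≤ n → seg p a b ⊆ D := fun hb =>
    seg_subset_iff.mpr fun i _ h => hpD i (h.trans hb)
  by_cases h2 : y 2 ∈ seg p 0 n
  · obtain ⟨m, -, hm, e⟩ := mem_seg.mp h2
    refine Or.inl (typeC_of_three (c := p m) (L₀ := seg p 0 m) (L₁ := seg p m n)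
      (L₂ := {p m}) ⟨hp.conn_seg (Nat.zero_le _) hm, sub hm, seg_mem (Nat.zero_le _) le_rfl,
        hp0 ▸ seg_mem le_rfl (Nat.zero_le _)⟩
      ⟨hp.conn_seg hm le_rfl, sub le_rfl, seg_mem le_rfl hm, hpn ▸ seg_mem hm le_rfl⟩
      ⟨conn_singleton _, by simpa using hpD m hm, rfl, e.symm⟩
      (hp.anticomplete_seg_diff hm) ?_ ?_)
    · exact ⟨by simp, by simp⟩
    · exact ⟨by simp, by simp⟩
  obtain ⟨k, q, hq, hqD, hq0, ⟨i₀, hi₀, hadj₀⟩, -, hqY⟩ :=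
    hD.exists_indPath (X := {y 2}) (Y := {v | ∃ i ≤ n, G.Adj v (p i)})
      ⟨_, hyD 2, rfl⟩ ⟨p 0, hpD 0 (Nat.zero_le _), 1, hn, hp.adj_succ hn⟩
  replace hq0 : q 0 = y 2 := hq0
  have hqP : ∀ i ≤ k, ∀ j ≤ n, q i ≠ p j := by
    intro i hi j hj e
    have hqiY : ∃ i' ≤ n, G.Adj (q i) (p i') := by
      rw [e]
      rcases Nat.lt_or_ge j n with h | h
      · exact ⟨j + 1, h, hp.adj_succ h⟩
      · exact ⟨j - 1, by omega, (hp.adj_iff hj (by omega)).mpr (by omega)⟩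
    have hik := hqY i hi hqiY
    rcases Nat.eq_zero_or_pos i with h0 | h0
    · rw [h0, hq0] at e
      exact h2 (e ▸ seg_mem (Nat.zero_le _) hj)
    · have := hqY (i - 1) (by omega) ⟨j, hj, by
        rw [← e]
        exact (hq.adj_iff (by omega) hi).mpr (by omega)⟩
      omega
  have hQD : seg q 0 k ⊆ D := seg_subset_iff.mpr fun i _ h => hqD i h
  have hQc : Conn G (seg q 0 k) := hq.conn_seg (Nat.zero_le _) le_rfl
  have hQ2 : y 2 ∈ seg q 0 k := hq0 ▸ seg_mem le_rfl (Nat.zero_le _)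
  have hQk : q k ∈ seg q 0 k := seg_mem (Nat.zero_le _) le_rfl
  have hQadj : ∀ x ∈ seg q 0 k, ∀ j ≤ n, x ≠ p j ∧ (G.Adj x (p j) → x = q k) := by
    intro x hx j hj
    obtain ⟨i, -, hi, rfl⟩ := mem_seg.mp hx
    exact ⟨hqP i hi j hj, fun h => by rw [hqY i hi ⟨j, hj, h⟩]⟩
  have hex : ∃ i, i ≤ n ∧ G.Adj (q k) (p i) := ⟨i₀, hi₀, hadj₀⟩
  let a := Nat.find hex
  obtain ⟨han, haA⟩ : a ≤ n ∧ G.Adj (q k) (p a) := Nat.find_spec hex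
  have hamin : ∀ i, i ≤ n → G.Adj (q k) (p i) → a ≤ i := fun i h1 h2 =>
    Nat.find_min' hex ⟨h1, h2⟩
  let b := Nat.findGreatest (fun i => G.Adj (q k) (p i)) n
  have hbA : G.Adj (q k) (p b) :=
    Nat.findGreatest_spec (P := fun i => G.Adj (q k) (p i)) hi₀ hadj₀
  have hbn : b ≤ n := Nat.findGreatest_le n
  have hbmax : ∀ i, i ≤ n → G.Adj (q k) (p i) → i ≤ b := fun i h1 h2 =>
    Nat.le_findGreatest h1 h2
  have hab : a ≤ b := hamin b hbn hbA
  rcases Nat.lt_trichotomy b (a + 1) with hlt | heq | hgt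
  · have hba : b = a := by omega
    have hleg : ∀ {c d}, d ≤ n →
        Anticomplete G (seg p c d \ {p a}) ((seg q 0 k ∪ {p a}) \ {p a}) := by
      intro c d hd
      refine anticomplete_of ?_
      rintro x ⟨hx, hxa⟩ w ⟨hw | hw, hwa⟩
      · obtain ⟨i, h1, h3, rfl⟩ := mem_seg.mp hx
        obtain ⟨h4, h5⟩ := hQadj w hw i (by omega)
        refine ⟨h4.symm, fun h => hxa ?_⟩
        have hwk := h5 h.symm
        rw [hwk] at h
        have h6 := hamin i (by omega) h.symm
        have h7 := hbmax i (by omega) h.symm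
        rw [show i = a by omega]
        rfl
      · exact absurd hw hwa
    refine Or.inl (typeC_of_three (c := p a) (L₀ := seg p 0 a) (L₁ := seg p a n)
      (L₂ := seg q 0 k ∪ {p a}) ⟨hp.conn_seg (Nat.zero_le _) han, sub han,
        seg_mem (Nat.zero_le _) le_rfl, hp0 ▸ seg_mem le_rfl (Nat.zero_le _)⟩
      ⟨hp.conn_seg han le_rfl, sub le_rfl, seg_mem le_rfl han, hpn ▸ seg_mem han le_rfl⟩
      ⟨hQc.union (conn_singleton _) (Or.inr ⟨_, hQk, _, rfl, haA⟩),
        Set.union_subset hQD (by simpa using hpD a han), Or.inr rfl, Or.inl hQ2⟩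
      (hp.anticomplete_seg_diff han) (hleg han) (hleg le_rfl))
  · have hleg : ∀ {c d e}, d ≤ n → (e = a ∨ e = b) →
        (∀ i, c ≤ i → i ≤ d → (i = a ∨ i = b) → i = e) → 
        Disjoint (seg p c d) (seg q 0 k) ∧
        ∀ x ∈ seg p c d, ∀ x' ∈ seg q 0 k, (G.Adj x x' ↔ x = p e ∧ x' = q k) := by
      intro c d e hd he hi
      constructor
      · refine Set.disjoint_left.mpr fun x hx hx' => ?_
        obtain ⟨i, h1, h3, rfl⟩ := mem_seg.mp hx
        exact (hQadj _ hx' i (by omega)).1 rfl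
      · intro x hx x' hx'
        obtain ⟨i, h1, h3, rfl⟩ := mem_seg.mp hx
        constructor
        · intro h
          have h4 := (hQadj x' hx' i (by omega)).2 h.symm
          rw [h4] at h
          have h6 := hamin i (by omega) h.symm
          have h7 := hbmax i (by omega) h.symm
          exact ⟨by rw [hi i h1 h3 (by omega)], h4⟩
        · rintro ⟨h4, h5⟩
          rw [h4, h5]
          rcases he with rfl | rfl
          · exact haA.symm
          · exact hbA.symm
    refine Or.inr (typeT_of_three (z₀ := p a) (z₁ := p b) (z₂ := q k) (L₀ := seg p 0 a)
      (L₁ := seg p b n) (L₂ := seg q 0 k) ⟨hp.conn_seg (Nat.zero_le _) han, sub han,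
        seg_mem (Nat.zero_le _) le_rfl, hp0 ▸ seg_mem le_rfl (Nat.zero_le _)⟩
      ⟨hp.conn_seg hbn le_rfl, sub le_rfl, seg_mem le_rfl hbn, hpn ▸ seg_mem hbn le_rfl⟩
      ⟨hQc, hQD, hQk, hQ2⟩ ⟨?_, ?_⟩
      (hleg han (Or.inl rfl) fun i h1 h3 h4 => by omega)
      (hleg le_rfl (Or.inr rfl) fun i h1 h3 h4 => by omega))
    · refine Set.disjoint_left.mpr fun x hx hx' => ?_
      obtain ⟨i, h1, h3, rfl⟩ := mem_seg.mp hx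
      have := (hp.mem_seg_iff (by omega) le_rfl).mp hx'
      omega
    · intro x hx x' hx'
      obtain ⟨i, h1, h3, rfl⟩ := mem_seg.mp hx
      obtain ⟨j, h4, h5, rfl⟩ := mem_seg.mp hx'
      rw [hp.adj_iff (by omega) h5]
      constructor
      · intro h
        exact ⟨by rw [show i = a by omega], by rw [show j = b by omega]⟩
      · rintro ⟨h6, h7⟩
        have := hp.inj (by omega) han h6
        have := hp.inj h5 hbn h7
        omega
  · have hleg : ∀ {c d}, d ≤ n → (∀ i, c ≤ i → i ≤ d → i ≤ a ∨ b ≤ i) →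
        Anticomplete G ((seg p c d ∪ {q k}) \ {q k}) (seg q 0 k \ {q k}) := by
      intro c d hd hi
      refine anticomplete_of ?_
      rintro x ⟨hx | hx, hxa⟩ w ⟨hw, hwa⟩
      · obtain ⟨i, h1, h3, rfl⟩ := mem_seg.mp hx
        obtain ⟨h4, h5⟩ := hQadj w hw i (by omega)
        exact ⟨h4.symm, fun h => hwa (h5 h.symm)⟩
      · exact absurd hx hxa
    have hkD : ({q k} : Set V) ⊆ D := by simpa using hqD k le_rfl
    refine Or.inl (typeC_of_three (c := q k) (L₀ := seg p 0 a ∪ {q k})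
      (L₁ := seg p b n ∪ {q k}) (L₂ := seg q 0 k)
      ⟨(hp.conn_seg (Nat.zero_le _) han).union (conn_singleton _)
        (Or.inr ⟨_, seg_mem (Nat.zero_le _) le_rfl, _, rfl, haA.symm⟩),
        Set.union_subset (sub han) hkD, Or.inr rfl,
        Or.inl (hp0 ▸ seg_mem le_rfl (Nat.zero_le _))⟩
      ⟨(hp.conn_seg hbn le_rfl).union (conn_singleton _)
        (Or.inr ⟨_, seg_mem le_rfl hbn, _, rfl, hbA.symm⟩),
        Set.union_subset (sub le_rfl) hkD, Or.inr rfl, Or.inl (hpn ▸ seg_mem hbn le_rfl)⟩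
      ⟨hQc, hQD, hQk, hQ2⟩ ?_
      (hleg han fun i h1 h3 => Or.inl h3) (hleg le_rfl fun i h1 h3 => Or.inr h1))
    refine (hp.anticomplete_seg (a := 0) hgt (le_refl n)).mono ?_ ?_ <;>
      rintro x ⟨hx | hx, hx'⟩
    exacts [hx, absurd hx hx', hx, absurd hx hx']

end ThreeTerminals

section Ports

variable {r : ℕ}

/-- The port of the brick `v` used by the edge to `w`: down `0`, up `1` or sideways `2`. -/
def port (v w : Fin r × Fin (2 * r)) : Fin 3 :=
  if v.1 = w.1 ∧ v.2.val + 1 = w.2.val then 2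
  else if (v.1.val + v.2.val) % 2 = 0 then (if v.1 = w.1 then 0 else 1)
  else if v.1 = w.1 then 1 else 0

theorem wall_adj_iff {v w : Fin r × Fin (2 * r)} : (Wall r).Adj v w ↔
    (v.1.val = w.1.val ∧ (v.2.val + 1 = w.2.val ∨ w.2.val + 1 = v.2.val)) ∨
    (v.2.val = w.2.val ∧ ((v.1.val + 1 = w.1.val ∧ (v.1.val + v.2.val) % 2 = 0) ∨
      (w.1.val + 1 = v.1.val ∧ (w.1.val + w.2.val) % 2 = 0))) := by
  obtain ⟨a, b⟩ := v
  obtain ⟨a', b'⟩ := w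
  simp only [Wall, SimpleGraph.fromRel_adj, ne_eq, Prod.mk.injEq, Fin.ext_iff]
  omega

theorem port_inj {v w w' : Fin r × Fin (2 * r)} (h : (Wall r).Adj v w)
    (h' : (Wall r).Adj v w') (hp : port v w = port v w') : w = w' := by
  rw [wall_adj_iff] at h h'
  obtain ⟨a, b⟩ := v
  obtain ⟨a', b'⟩ := w
  obtain ⟨a'', b''⟩ := w'
  simp only [port, Fin.ext_iff] at h h' hp
  simp only [Prod.mk.injEq, Fin.ext_iff]
  split_ifs at hp <;> omega

/-- An assembly modelled on the wall gives one of the basic obstructions. -/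
theorem good_of_assembly {V : Type} {G : SimpleGraph V}
    {D : Fin r × Fin (2 * r) → Set V} {y : Fin r × Fin (2 * r) → Fin 3 → V}
    {C : Fin r × Fin (2 * r) → Fin r × Fin (2 * r) → Set V}
    (h : Assembly G (Wall r) D (fun v w => y v (port v w)) C)
    (hD : (∀ v, TypeC G (D v) (y v)) ∨ ∀ v, TypeT G (D v) (y v)) : Good G r := by
  have hinj : ∀ v, Function.Injective
      (fun w : {w // (Wall r).Adj v w} => port v w) := fun v w w' hw =>
    Subtype.ext (port_inj w.2 w'.2 hw)
  rcases hD with hD | hD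
  · exact Or.inr (Or.inl (h.exists_subdivision fun v => (hD v).comp _ (hinj v)))
  · exact Or.inr (Or.inr (h.exists_lineGraph fun v => (hD v).comp _ (hinj v)))

end Ports

/-- The once subdivided complete graph on `n` vertices is an induced minor of `G`. -/
def SubK {V : Type} (G : SimpleGraph V) (n : ℕ) : Prop :=
  ∃ (A : Fin n → Set V) (C : Fin n → Fin n → Set V),
    (∀ v, Conn G (A v)) ∧ (∀ v w, v ≠ w → Anticomplete G (A v) (A w)) ∧
    (∀ v w, v < w → Conn G (C v w) ∧ Disjoint (A v) (C v w) ∧ Disjoint (A w) (C v w) ∧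
      Touch G (A v) (C v w) ∧ Touch G (A w) (C v w) ∧
      ∀ u, u ≠ v → u ≠ w → Anticomplete G (A u) (C v w)) ∧
    ∀ v w v' w', v < w → v' < w' → (v, w) ≠ (v', w') → Anticomplete G (C v w) (C v' w')

section LK

variable {V : Type} {G : SimpleGraph V}

theorem typeC_or_typeT' {ι : Type} {D : Set V} (hD : Conn G D) (e : ι ≃ Fin 3) (y : ι → V)
    (hy : Function.Injective y) (hyD : ∀ a, y a ∈ D) : TypeC G D y ∨ TypeT G D y := by
  rcases typeC_or_typeT hD (fun a => y (e.symm a)) (hy.comp e.symm.injective)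
    (fun a => hyD _) with h | h
  · left
    simpa using h.comp e e.injective
  · right
    simpa using h.comp e e.injective

theorem exists_good_of_subK (r : ℕ) : ∃ n, ∀ {V : Type} (G : SimpleGraph V),
    SubK G n → Good G r := by
  classical
  let W := Fin r × Fin (2 * r)
  let I := Sym2 W ⊕ (W × Fin 3)
  obtain ⟨kI, ⟨eI⟩⟩ := Finite.exists_equiv_fin I
  obtain ⟨kW, ⟨eW⟩⟩ := Finite.exists_equiv_fin W
  obtain ⟨N, hN⟩ := fin_ramsey Prop 4 (kW + kI)
  refine ⟨N, fun {V} G ⟨A, C, hA, hAA, hC, hCC⟩ => ?_⟩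
  have hpath : ∀ v w : Fin N, ∃ (n : ℕ) (p : ℕ → V), v < w → IndPath G n p ∧
      (∀ i ≤ n, p i ∈ C v w) ∧ (∃ x ∈ A v, G.Adj x (p 0)) ∧ (∃ x ∈ A w, G.Adj x (p n)) ∧
      (∀ i ≤ n, (∃ x ∈ A v, G.Adj x (p i)) → i = 0) := by
    intro v w
    by_cases hvw : v < w
    · obtain ⟨h1, h2, h3, ⟨x, hx, x', hx', hxx⟩, ⟨z, hz, z', hz', hzz⟩, -⟩ := hC v w hvw
      obtain ⟨n, p, hp, hpC, hp0, hpn, hpx, -⟩ := h1.exists_indPath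
        (X := {y | ∃ x ∈ A v, G.Adj x y}) (Y := {y | ∃ x ∈ A w, G.Adj x y})
        ⟨x', hx', x, hx, hxx⟩ ⟨z', hz', z, hz, hzz⟩
      exact ⟨n, p, fun _ => ⟨hp, hpC, hp0, hpn, hpx⟩⟩
    · exact ⟨0, fun _ => (hA v).1.some, fun h => absurd h hvw⟩
  choose len p hp using hpath
  let y : Fin N → Fin N → V := fun v w => p v w 0
  let rest : Fin N → Fin N → Set V := fun v w => {x | ∃ i, 1 ≤ i ∧ i ≤ len v w ∧ x = p v w i}
  have hyC : ∀ v w, v < w → y v w ∈ C v w := fun v w h => (hp v w h).2.1 0 (Nat.zero_le _)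
  have hrC : ∀ v w, v < w → rest v w ⊆ C v w := by
    rintro v w h _ ⟨i, -, hi, rfl⟩
    exact (hp v w h).2.1 i hi
  let DD : Fin N → (Fin N → Prop) → Set V := fun a P => A a ∪ {x | ∃ b, P b ∧ x = y a b}
  let χ : Finset (Fin N) → Prop := fun K => ∀ hK : K.Nonempty,
    TypeC G (DD (K.min' hK) (fun b => b ∈ K.erase (K.min' hK)))
      (fun b : {b // b ∈ K.erase (K.min' hK)} => y (K.min' hK) b)
  obtain ⟨e, c, hc⟩ := hN N le_rfl χ
  -- indices of vertices and of edges
  let a : W → Fin N := fun v => e (Fin.castAdd kI (eW v))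
  let β : I → Fin N := fun i => e (Fin.natAdd kW (eI i))
  have ha : Function.Injective a := fun v w h => by
    have := e.injective h
    simpa using this
  have hβ : Function.Injective β := fun v w h => by
    have := e.injective h
    simpa using this
  have haβ : ∀ v i, a v < β i := fun v i => by
    simp only [a, β, OrderEmbedding.lt_iff_lt, Fin.lt_def, Fin.val_castAdd, Fin.val_natAdd]
    have := (eW v).2
    omega
  have hne : ∀ v i, a v ≠ β i := fun v i => (haβ v i).ne
  let code : W → Fin 3 → I := fun v t =>
    if h : ∃ w, (Wall r).Adj v w ∧ port v w = t then Sum.inl s(v, h.choose) else Sum.inr (v, t)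
  have hcode : ∀ v w, (Wall r).Adj v w → code v (port v w) = Sum.inl s(v, w) := by
    intro v w h
    have h' : ∃ w', (Wall r).Adj v w' ∧ port v w' = port v w := ⟨w, h, rfl⟩
    have := h'.choose_spec
    simp only [code, h', dif_pos, port_inj this.1 h this.2]
    rfl
  have hcodei : ∀ v, Function.Injective (code v) := by
    intro v t t' h
    simp only [code] at h
    split_ifs at h with h1 h2 h2
    · have := h1.choose_spec
      have h3 := h2.choose_spec
      rw [Sum.inl.injEq, Sym2.congr_right] at h
      rw [← this.2, ← h3.2, h]
    · exact (Prod.mk.inj (Sum.inr.inj h)).2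
  have hβc : ∀ v t t', t ≠ t' → β (code v t) ≠ β (code v t') := fun v t t' h =>
    hβ.ne ((hcodei v).ne h)
  let D : W → Set V := fun v => DD (a v) (fun b => ∃ t, b = β (code v t))
  let Cr : W → W → Set V := fun v w =>
    (rest (a v) (β (Sum.inl s(v, w))) ∪ A (β (Sum.inl s(v, w)))) ∪
      rest (a w) (β (Sum.inl s(v, w)))
  let yy : W → Fin 3 → V := fun v t => y (a v) (β (code v t))
  have hyA : ∀ v i j, Anticomplete G {y (a v) (β i)} (A (β j)) ∨ i = j := by
    intro v i j
    by_cases hij : i = j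
    · exact Or.inr hij
    · exact Or.inl (((hC _ _ (haβ v i)).2.2.2.2.2 _ (hne v j).symm
        (hβ.ne (Ne.symm hij))).symm.mono (by simpa using hyC _ _ (haβ v i)) le_rfl)
  have hCne : ∀ v i w j, (v ≠ w ∨ i ≠ j) →
      Anticomplete G (C (a v) (β i)) (C (a w) (β j)) := by
    intro v i w j h
    refine hCC _ _ _ _ (haβ v i) (haβ w j) ?_
    rw [Ne, Prod.mk.injEq, not_and_or]
    exact h.imp ha.ne hβ.ne
  have hACne : ∀ v w i, v ≠ w → Anticomplete G (A (a v)) (C (a w) (β i)) := fun v w i h =>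
    (hC _ _ (haβ w i)).2.2.2.2.2 _ (ha.ne h) (hne v i)
  have hBCne : ∀ w i j, i ≠ j → Anticomplete G (A (β i)) (C (a w) (β j)) := fun w i j h =>
    (hC _ _ (haβ w j)).2.2.2.2.2 _ (hne w i).symm (hβ.ne h)
  have hDsub : ∀ v x, x ∈ D v → x ∈ A (a v) ∨ ∃ t, x = yy v t := by
    rintro v x (hx | ⟨_, ⟨t, rfl⟩, rfl⟩)
    · exact Or.inl hx
    · exact Or.inr ⟨t, rfl⟩
  have hyyC : ∀ v t, yy v t ∈ C (a v) (β (code v t)) := fun v t => hyC _ _ (haβ _ _)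
  have hrest : ∀ v i x, x ∈ rest (a v) (β i) → ∀ u ∈ A (a v), ¬ G.Adj u x := by
    rintro v i _ ⟨j, hj, hj', rfl⟩ u hu huj
    have := (hp _ _ (haβ v i)).2.2.2.2 j hj' ⟨u, hu, huj⟩
    omega
  have hDr : ∀ u i v, Disjoint (D u) (rest (a v) (β i)) := by
    refine fun u i v => Set.disjoint_left.mpr fun x hx hxr => ?_
    by_cases huv : u = v
    · subst huv
      rcases hDsub _ _ hx with hx | ⟨t, rfl⟩
      · exact Set.disjoint_left.mp (hC _ _ (haβ u i)).2.1 hx (hrC _ _ (haβ u i) hxr)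
      · by_cases hi : code u t = i
        · subst hi
          obtain ⟨j, hj, hj', hxj⟩ := hxr
          have := (hp _ _ (haβ u (code u t))).1.1 0 (Nat.zero_le _) j hj' hxj
          omega
        · exact (hCne u _ u i (Or.inr hi)).ne (hyyC u t) (hrC _ _ (haβ u i) hxr) rfl
    · rcases hDsub _ _ hx with hx | ⟨t, rfl⟩
      · exact (hACne u v i huv).ne hx (hrC _ _ (haβ v i) hxr) rfl
      · exact (hCne u _ v i (Or.inl huv)).ne (hyyC u t) (hrC _ _ (haβ v i) hxr) rfl
  have hDB : ∀ u i, Disjoint (D u) (A (β i)) := by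
    refine fun u i => Set.disjoint_left.mpr fun x hx hxr => ?_
    rcases hDsub _ _ hx with hx | ⟨t, rfl⟩
    · exact (hAA _ _ (hne u i)).ne hx hxr rfl
    · rcases hyA u (code u t) i with h | h
      · exact h.ne rfl hxr rfl
      · refine Set.disjoint_left.mp (hC _ _ (haβ u (code u t))).2.2.1 ?_ (hyyC u t)
        rwa [h]
  -- edges from a vertex region to an edge region
  have hadj : ∀ v w, (Wall r).Adj v w → ∀ u z x, z ∈ D u → x ∈ Cr v w → G.Adj z x →
      (u = v ∨ u = w) ∧ z = y (a u) (β (Sum.inl s(v, w))) := by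
    intro v w hvw
    have main : ∀ u t, code u t = Sum.inl s(v, w) → (u = v ∨ u = w) := by
      intro u t h
      simp only [code] at h
      split_ifs at h with h'
      have h2 := Sum.inl.inj h
      rw [Sym2.eq_iff] at h2
      exact h2.imp (fun h => h.1) (fun h => h.1)
    have h1 : ∀ v', (v' = v ∨ v' = w) → ∀ u z x, z ∈ D u →
        x ∈ rest (a v') (β (Sum.inl s(v, w))) → G.Adj z x →
        (u = v ∨ u = w) ∧ z = y (a u) (β (Sum.inl s(v, w))) := by
      intro v' hv' u z x hz hx hzx
      have hxC := hrC _ _ (haβ v' _) hx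
      by_cases huv : u = v'
      · subst huv
        refine ⟨hv', ?_⟩
        rcases hDsub _ _ hz with hz | ⟨t, rfl⟩
        · exact absurd hzx (hrest _ _ _ hx _ hz)
        · by_cases hi : code u t = Sum.inl s(v, w)
          · change y (a u) (β (code u t)) = _
            rw [hi]
          · exact absurd hzx ((hCne u _ u _ (Or.inr hi)).2 _ (hyyC u t) _ hxC)
      · rcases hDsub _ _ hz with hz | ⟨t, rfl⟩
        · exact absurd hzx ((hACne u v' _ huv).2 _ hz _ hxC)
        · exact absurd hzx ((hCne u _ v' _ (Or.inl huv)).2 _ (hyyC u t) _ hxC)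
    rintro u z x hz ((hx | hx) | hx) hzx
    · exact h1 v (Or.inl rfl) u z x hz hx hzx
    · rcases hDsub _ _ hz with hz | ⟨t, rfl⟩
      · exact absurd hzx ((hAA _ _ (hne u _)).2 _ hz _ hx)
      · rcases hyA u (code u t) (Sum.inl s(v, w)) with h | h
        · exact absurd hzx (h.2 _ rfl _ hx)
        · exact ⟨main u t h, by simp only [yy, h]⟩
    · exact h1 w (Or.inr rfl) u z x hz hx hzx
  have hyadj : ∀ v i, (∃ x ∈ rest (a v) (β i), G.Adj (y (a v) (β i)) x) ∨
      ∃ x ∈ A (β i), G.Adj (y (a v) (β i)) x := by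
    intro v i
    obtain ⟨h1, h2, h3, ⟨z, hz, hzn⟩, h5⟩ := hp _ _ (haβ v i)
    rcases Nat.eq_zero_or_pos (len (a v) (β i)) with h0 | h0
    · rw [h0] at hzn
      exact Or.inr ⟨z, hz, hzn.symm⟩
    · exact Or.inl ⟨_, ⟨1, le_rfl, h0, rfl⟩, h1.adj_succ h0⟩
  have hrconn : ∀ v i, rest (a v) (β i) = ∅ ∨ Conn G (rest (a v) (β i)) ∧
      Touch G (A (β i)) (rest (a v) (β i)) := by
    intro v i
    obtain ⟨h1, h2, h3, ⟨z, hz, hzn⟩, h5⟩ := hp _ _ (haβ v i)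
    rcases Nat.eq_zero_or_pos (len (a v) (β i)) with h0 | h0
    · left
      refine Set.eq_empty_of_forall_notMem ?_
      rintro _ ⟨j, hj, hj', -⟩
      omega
    · right
      have : rest (a v) (β i) = seg (p (a v) (β i)) 1 (len (a v) (β i)) := by
        ext x
        simp only [rest, seg, Set.mem_ofPred_eq, Set.mem_image, Set.mem_Icc, and_assoc, eq_comm]
      refine ⟨?_, z, hz, _, ⟨_, h0, le_rfl, rfl⟩, hzn⟩
      rw [this]
      exact h1.conn_seg h0 le_rfl
  have hCsub : ∀ v w v' w', s(v, w) ≠ s(v', w') → Anticomplete G (Cr v w) (Cr v' w') := by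
    intro v w v' w' h
    have h0 : (Sum.inl s(v, w) : I) ≠ Sum.inl s(v', w') := fun h' => h (Sum.inl.inj h')
    have hrr : ∀ x x', Anticomplete G (rest (a x) (β (Sum.inl s(v, w))))
        (rest (a x') (β (Sum.inl s(v', w')))) := fun x x' =>
      (hCne x _ x' _ (Or.inr h0)).mono (hrC _ _ (haβ _ _)) (hrC _ _ (haβ _ _))
    have hrA : ∀ x, Anticomplete G (rest (a x) (β (Sum.inl s(v, w))))
        (A (β (Sum.inl s(v', w')))) := fun x =>
      (hBCne x _ _ h0.symm).symm.mono (hrC _ _ (haβ _ _)) le_rfl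
    have hAr : ∀ x, Anticomplete G (A (β (Sum.inl s(v, w))))
        (rest (a x) (β (Sum.inl s(v', w')))) := fun x =>
      (hBCne x _ _ h0).mono le_rfl (hrC _ _ (haβ _ _))
    have hAA' := hAA _ _ (hβ.ne h0)
    exact (((hrr _ _).union_left (hAr _)).union_left (hrr _ _)).union_right
      (((hrA _).union_left hAA').union_left (hrA _)) |>.union_right
      (((hrr _ _).union_left (hAr _)).union_left (hrr _ _))
  have hassembly : Assembly G (Wall r) D (fun v w => yy v (port v w)) Cr := by
    constructor
    · intro v w hvw
      refine anticomplete_of fun x hx z hz => ?_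
      suffices h : ∃ X Z, Anticomplete G X Z ∧ x ∈ X ∧ z ∈ Z by
        obtain ⟨X, Z, h, hx, hz⟩ := h
        exact ⟨h.ne hx hz, h.2 x hx z hz⟩
      rcases hDsub _ _ hx with hx | ⟨t, rfl⟩ <;> rcases hDsub _ _ hz with hz | ⟨t', rfl⟩
      · exact ⟨_, _, hAA _ _ (ha.ne hvw), hx, hz⟩
      · exact ⟨_, _, hACne v w _ hvw, hx, hyyC _ _⟩
      · exact ⟨_, _, (hACne w v _ hvw.symm).symm, hyyC _ _, hz⟩
      · exact ⟨_, _, hCne v _ w _ (Or.inl hvw), hyyC _ _, hyyC _ _⟩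
    · intro v w _
      have hs : (Sum.inl s(v, w) : I) = Sum.inl s(w, v) := congrArg Sum.inl Sym2.eq_swap
      simp only [Cr]
      rw [hs, Set.union_right_comm, Set.union_comm (rest (a v) _), Set.union_right_comm]
    · intro v w _
      have h1 : Conn G (rest (a v) (β (Sum.inl s(v, w))) ∪ A (β (Sum.inl s(v, w)))) := by
        rcases hrconn v (Sum.inl s(v, w)) with h | h
        · rw [h, Set.empty_union]
          exact hA _
        · exact h.1.union (hA _) (Or.inr h.2.symm)
      rcases hrconn w (Sum.inl s(v, w)) with h | h
      · simp only [Cr]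
        rw [h, Set.union_empty]
        exact h1
      · exact h1.union h.1 (Or.inr (h.2.mono Set.subset_union_right le_rfl))
    · intro v w _ u
      exact ((hDr u _ v).union_right (hDB u _)).union_right (hDr u _ w)
    · intro v w hvw u huv huw
      refine ⟨((hDr u _ v).union_right (hDB u _)).union_right (hDr u _ w), ?_⟩
      intro x hx z hz hxz
      exact (hadj v w hvw u x z hx hz hxz).1.elim huv huw
    · intro v w hvw
      have := hyadj v (Sum.inl s(v, w))
      simp only [yy, hcode v w hvw]
      rcases this with ⟨x, hx, hxx⟩ | ⟨x, hx, hxx⟩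
      · exact ⟨x, Or.inl (Or.inl hx), hxx⟩
      · exact ⟨x, Or.inl (Or.inr hx), hxx⟩
    · intro v w hvw u hu x hx hux
      simp only [yy, hcode v w hvw]
      exact (hadj v w hvw v u x hu hx hux).2
    · intro v w v' w' _ _ h
      exact hCsub v w v' w' h
  refine good_of_assembly hassembly ?_
  have htype : ∀ v, (c → TypeC G (D v) (yy v)) ∧ (¬ c → TypeT G (D v) (yy v)) := by
    intro v
    let g : Fin 3 → Fin (kW + kI) := fun t => Fin.natAdd kW (eI (code v t))
    have hg : Function.Injective g := fun t t' h => hcodei v (by simpa [g] using h)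
    let a0 : Fin (kW + kI) := Fin.castAdd kI (eW v)
    have ha0 : ∀ t, a0 < g t := fun t => by
      have := (eW v).2
      simp only [a0, g, Fin.lt_def, Fin.val_castAdd, Fin.val_natAdd]
      omega
    let K : Finset (Fin (kW + kI)) := insert a0 (Finset.univ.image g)
    have hK : K.card = 4 := by
      rw [Finset.card_insert_of_notMem, Finset.card_image_of_injective _ hg]
      · simp
      · simp only [Finset.mem_image, Finset.mem_univ, true_and, not_exists]
        exact fun t h => (ha0 t).ne h.symm
    have hχ := hc K hK
    have hKn : (K.map e.toEmbedding).Nonempty := ⟨e a0, by simp [K]⟩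
    have hmin : (K.map e.toEmbedding).min' hKn = a v := by
      refine le_antisymm (Finset.min'_le _ _ (by simp [K, a, a0])) (Finset.le_min' _ _ _ ?_)
      intro z hz
      simp only [K, Finset.mem_map, Finset.mem_insert, Finset.mem_image, Finset.mem_univ,
        true_and] at hz
      obtain ⟨z, (rfl | ⟨t, rfl⟩), rfl⟩ := hz
      · exact le_rfl
      · exact (haβ v _).le
    have hmem : ∀ b, b ∈ (K.map e.toEmbedding).erase ((K.map e.toEmbedding).min' hKn) ↔
        ∃ t, b = β (code v t) := by
      intro b
      rw [hmin, Finset.mem_erase]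
      simp only [K, Finset.mem_map, Finset.mem_insert, Finset.mem_image, Finset.mem_univ,
        true_and]
      constructor
      · rintro ⟨h1, z, (rfl | ⟨t, rfl⟩), rfl⟩
        · exact absurd rfl h1
        · exact ⟨t, rfl⟩
      · rintro ⟨t, rfl⟩
        exact ⟨(hne v _).symm, _, Or.inr ⟨t, rfl⟩, rfl⟩
    let Y := {b // b ∈ (K.map e.toEmbedding).erase ((K.map e.toEmbedding).min' hKn)}
    let f : Fin 3 → Y := fun t => ⟨β (code v t), (hmem _).2 ⟨t, rfl⟩⟩
    have hf : Function.Bijective f := by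
      constructor
      · intro t t' h
        exact hcodei v (hβ (congrArg Subtype.val h))
      · rintro ⟨b, hb⟩
        obtain ⟨t, rfl⟩ := (hmem b).1 hb
        exact ⟨t, rfl⟩
    have hDeq : DD ((K.map e.toEmbedding).min' hKn)
        (fun b => b ∈ (K.map e.toEmbedding).erase ((K.map e.toEmbedding).min' hKn)) = D v := by
      have : (fun b => b ∈ (K.map e.toEmbedding).erase ((K.map e.toEmbedding).min' hKn)) =
          fun b => ∃ t, b = β (code v t) := funext fun b => propext (hmem b)
      rw [this, hmin]
    have hDconn : Conn G (D v) := by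
      have : D v = A (a v) ∪ ⋃ t, {yy v t} := by
        ext x
        constructor
        · intro hx
          exact (hDsub _ _ hx).imp_right fun ⟨t, h⟩ => Set.mem_iUnion.mpr ⟨t, h⟩
        · rintro (hx | hx)
          · exact Or.inl hx
          · obtain ⟨t, h⟩ := Set.mem_iUnion.mp hx
            exact Or.inr ⟨_, ⟨t, rfl⟩, h⟩
      rw [this]
      refine (hA _).union_iUnion (fun t => conn_singleton _) fun t => Or.inr ?_
      obtain ⟨z, hz, hzz⟩ := (hp _ _ (haβ v (code v t))).2.2.1
      exact ⟨z, hz, _, rfl, hzz⟩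
    constructor
    · intro hcc
      have h : χ (K.map e.toEmbedding) := by rw [hχ]; exact hcc
      have h := h hKn
      rw [hDeq] at h
      have := h.comp f hf.1
      simpa only [f, yy, hmin] using this
    · intro hcc
      have h : ¬ χ (K.map e.toEmbedding) := by rw [hχ]; exact hcc
      have h' : ¬ TypeC G (D v) (fun b : Y => y ((K.map e.toEmbedding).min' hKn) b) := by
        intro h'
        refine h fun _ => ?_
        rw [hDeq]
        exact h'
      have := (typeC_or_typeT' hDconn (Equiv.ofBijective f hf).symm _ ?_ ?_).resolve_left h'
      · have := this.comp f hf.1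
        simpa only [f, yy, hmin] using this
      · intro b b' hbb
        obtain ⟨t, rfl⟩ := hf.2 b
        obtain ⟨t', rfl⟩ := hf.2 b'
        simp only [hmin, f] at hbb
        by_contra hn
        have : t ≠ t' := fun h => hn (by rw [h])
        exact (hCne v _ v _ (Or.inr ((hcodei v).ne this))).ne (hyyC v t) (hyyC v t') hbb
      · intro b
        obtain ⟨t, rfl⟩ := hf.2 b
        simp only [hmin, f]
        exact Or.inr ⟨_, ⟨t, rfl⟩, rfl⟩
  by_cases hcc : c
  · exact Or.inl fun v => (htype v).1 hcc
  · exact Or.inr fun v => (htype v).2 hcc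

end LK

/-- Connected rows `A` and connected columns `B` forming a complete bipartite induced minor. -/
structure BiModel {V ι κ : Type} (G : SimpleGraph V) (A : ι → Set V) (B : κ → Set V) : Prop where
  connA : ∀ i, Conn G (A i)
  connB : ∀ j, Conn G (B j)
  antiA : ∀ i i', i ≠ i' → Anticomplete G (A i) (A i')
  antiB : ∀ j j', j ≠ j' → Anticomplete G (B j) (B j')
  disj : ∀ i j, Disjoint (A i) (B j)
  touch : ∀ i j, Touch G (A i) (B j)

section BiModel

variable {V ι κ : Type} {G : SimpleGraph V} {A : ι → Set V} {B : κ → Set V}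

theorem BiModel.swap (h : BiModel G A B) : BiModel G B A :=
  ⟨h.connB, h.connA, h.antiB, h.antiA, fun i j => (h.disj j i).symm, fun i j => (h.touch j i).symm⟩

/-- Pass to subsets of the rows and columns, reindexed. -/
theorem BiModel.shrink {ι' κ' : Type} (h : BiModel G A B) {f : ι' → ι} (hf : Function.Injective f)
    {g : κ' → κ} (hg : Function.Injective g) {A' : ι' → Set V} {B' : κ' → Set V}
    (hA : ∀ i, A' i ⊆ A (f i)) (hB : ∀ j, B' j ⊆ B (g j)) (hcA : ∀ i, Conn G (A' i))
    (hcB : ∀ j, Conn G (B' j)) (ht : ∀ i j, Touch G (A' i) (B' j)) : BiModel G A' B' :=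
  ⟨hcA, hcB, fun i i' hi => (h.antiA _ _ (hf.ne hi)).mono (hA i) (hA i'),
    fun j j' hj => (h.antiB _ _ (hg.ne hj)).mono (hB j) (hB j'),
    fun i j => (h.disj (f i) (g j)).mono (hA i) (hB j), ht⟩

theorem BiModel.comp {ι' κ' : Type} (h : BiModel G A B) {f : ι' → ι} (hf : Function.Injective f)
    {g : κ' → κ} (hg : Function.Injective g) : BiModel G (fun i => A (f i)) (fun j => B (g j)) :=
  h.shrink hf hg (fun _ => le_rfl) (fun _ => le_rfl) (fun _ => h.connA _) (fun _ => h.connB _)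
    fun _ _ => h.touch _ _

theorem IndPath.isPathSet {n : ℕ} {p : ℕ → V} (h : IndPath G n p) :
    IsPathSet G (seg p 0 n) :=
  isPathSet_iff.mpr ⟨n, p, h, rfl⟩

/-- A connected set contains a path touching many columns, or touches any given columns by a
connected subset touching few further columns. -/
theorem exists_path_or_sparse [Fintype κ] {S : Set V} (hS : Conn G S) (B : κ → Set V)
    (ht : ∀ j, Touch G S (B j)) (m : ℕ) :
    (∃ P ⊆ S, IsPathSet G P ∧ m ≤ {j | Touch G P (B j)}.ncard) ∨
    ∀ M : Finset κ, ∃ X ⊆ S, Conn G X ∧ (∀ j ∈ M, Touch G X (B j)) ∧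
      {j | Touch G X (B j)}.ncard ≤ (M.card + 1) * m := by
  classical
  obtain ⟨x, hx⟩ := hS.1
  have hp : ∀ j, ∃ (n : ℕ) (p : ℕ → V), IndPath G n p ∧ (∀ i ≤ n, p i ∈ S) ∧ p 0 = x ∧
      ∃ y ∈ B j, G.Adj (p n) y := by
    intro j
    obtain ⟨y, hy, z, hz, hyz⟩ := ht j
    obtain ⟨n, p, h1, h2, h3, h4, -⟩ := hS.exists_indPath (X := {x})
      (Y := {y | ∃ z ∈ B j, G.Adj y z}) ⟨x, hx, rfl⟩ ⟨y, hy, z, hz, hyz⟩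
    exact ⟨n, p, h1, h2, h3, h4⟩
  choose n p hp hpS hp0 hpB using hp
  have hsub : ∀ j, seg (p j) 0 (n j) ⊆ S := by
    rintro j _ ⟨i, hi, rfl⟩
    exact hpS j i hi.2
  rw [or_iff_not_imp_left]
  intro hno
  push Not at hno
  have hlt : ∀ j, {j' | Touch G (seg (p j) 0 (n j)) (B j')}.ncard ≤ m := fun j =>
    (hno _ (hsub j) (hp j).isPathSet).le
  have hlt0 : {j' | Touch G {x} (B j')}.ncard ≤ m := by
    refine (hno {x} (by simpa using hx) (isPathSet_iff.mpr ⟨0, fun _ => x, ?_, ?_⟩)).le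
    · refine ⟨fun i hi j hj _ => by omega, fun i hi j hj => ?_⟩
      have h0 : ¬ G.Adj x x := G.loopless.irrefl x
      simp only [h0, false_iff]
      omega
    · simp [seg]
  intro M
  induction M using Finset.induction_on with
  | empty =>
    exact ⟨{x}, by simpa using hx, conn_singleton x, by simp, by simpa using hlt0⟩
  | insert j M hj ih =>
    clear ih
    refine ⟨{x} ∪ ⋃ j' : {j' // j' ∈ insert j M}, seg (p j') 0 (n j'), ?_, ?_, ?_, ?_⟩
    · refine Set.union_subset (by simpa using hx) (Set.iUnion_subset fun j' => hsub _)
    · refine (conn_singleton x).union_iUnion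
        (fun j' => (hp _).conn_seg (Nat.zero_le _) le_rfl) fun j' => Or.inl ⟨x, rfl, ?_⟩
      exact ⟨0, ⟨le_rfl, Nat.zero_le _⟩, hp0 _⟩
    · intro j' hj'
      obtain ⟨y, hy, hyy⟩ := hpB j'
      refine ⟨_, Or.inr (Set.mem_iUnion.mpr ⟨⟨j', hj'⟩, n j', ⟨Nat.zero_le _, le_rfl⟩, rfl⟩),
        y, hy, hyy⟩
    · have hcov : {j' | Touch G ({x} ∪ ⋃ j' : {j' // j' ∈ insert j M},
          seg (p j') 0 (n j')) (B j')} ⊆ {j' | Touch G {x} (B j')} ∪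
          ⋃ j₁ ∈ insert j M, {j' | Touch G (seg (p j₁) 0 (n j₁)) (B j')} := by
        rintro j' ⟨y, (hy | hy), z, hz, hyz⟩
        · exact Or.inl ⟨y, hy, z, hz, hyz⟩
        · obtain ⟨j₁, hy⟩ := Set.mem_iUnion.mp hy
          exact Or.inr (Set.mem_biUnion j₁.2 ⟨y, hy, z, hz, hyz⟩)
      refine (Set.ncard_le_ncard hcov (Set.toFinite _)).trans ((Set.ncard_union_le _ _).trans ?_)
      have h2 : (⋃ j₁ ∈ insert j M, {j' | Touch G (seg (p j₁) 0 (n j₁)) (B j')}).ncard ≤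
          ∑ j₁ ∈ insert j M, {j' | Touch G (seg (p j₁) 0 (n j₁)) (B j')}.ncard :=
        Finset.set_ncard_biUnion_le _ _
      have h3 := Finset.sum_le_card_nsmul (insert j M) _ m (fun j₁ _ => hlt j₁)
      rw [smul_eq_mul] at h3
      calc _ ≤ m + (insert j M).card * m := by omega
        _ = _ := by ring

end BiModel

/-- A large set contains a large subset that is free for a bounded set mapping. -/
theorem exists_free_set (a b m : ℕ) : ∃ N, ∀ n, N ≤ n → ∀ T : Finset (Fin n) → Set (Fin n),
    (∀ M, M.card = a → (T M).ncard ≤ b) → ∃ e : Fin m ↪o Fin n,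
      ∀ M : Finset (Fin m), M.card = a → ∀ z, e z ∈ T (M.map e.toEmbedding) → z ∈ M := by
  classical
  obtain ⟨N, hN⟩ := fin_ramsey (Fin (a + 1) → Prop) (a + 1) (m + (a + b + 1))
  refine ⟨N, fun n hn T hT => ?_⟩
  let χ : Finset (Fin n) → Fin (a + 1) → Prop := fun K t =>
    ∃ z ∈ K, (K.filter (· < z)).card = t ∧ z ∈ T (K.erase z)
  obtain ⟨e, c, hc⟩ := hN n hn χ
  have hχ : ∀ (M : Finset (Fin (m + (a + b + 1)))) z, M.card = a → z ∉ M →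
      ∀ t : Fin (a + 1), (M.filter (· < z)).card = t →
        (e z ∈ T (M.map e.toEmbedding) ↔ c t) := by
    intro M z hM hz t ht
    have hK : (insert z M).card = a + 1 := by rw [Finset.card_insert_of_notMem hz, hM]
    have herase : ((insert z M).map e.toEmbedding).erase (e z) = M.map e.toEmbedding := by
      rw [Finset.map_insert]
      exact Finset.erase_insert (by simpa using hz)
    have hrank : ∀ w, (((insert z M).map e.toEmbedding).filter (· < e w)).card =
        ((insert z M).filter (· < w)).card := by
      intro w
      rw [Finset.filter_map, Finset.card_map]
      congr 1
      ext x
      simp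
    have hrz : ((insert z M).filter (· < z)).card = t := by
      rw [← ht]
      congr 1
      ext x
      simp only [Finset.mem_filter, Finset.mem_insert]
      constructor
      · rintro ⟨rfl | h, h'⟩
        · exact absurd h' (lt_irrefl _)
        · exact ⟨h, h'⟩
      · rintro ⟨h, h'⟩
        exact ⟨Or.inr h, h'⟩
    rw [← hc _ hK]
    constructor
    · intro h
      exact ⟨e z, by simp, by rw [hrank, hrz], by rwa [herase]⟩
    · rintro ⟨w, hw, hwt, hwT⟩
      obtain ⟨w, hw', rfl⟩ := Finset.mem_map.mp hw
      change (((insert z M).map e.toEmbedding).filter (· < e w)).card = t at hwt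
      have : w = z := by
        rw [hrank, ← hrz] at hwt
        by_contra hne
        rcases lt_or_gt_of_ne hne with h | h
        · refine hwt.not_lt (Finset.card_lt_card ((Finset.ssubset_iff_of_subset ?_).mpr
            ⟨w, ?_, ?_⟩))
          · intro x hx
            simp only [Finset.mem_filter] at hx ⊢
            exact ⟨hx.1, hx.2.trans h⟩
          · simpa using ⟨Finset.mem_insert.mp hw', h⟩
          · simp
        · refine hwt.not_gt (Finset.card_lt_card ((Finset.ssubset_iff_of_subset ?_).mpr
            ⟨z, ?_, ?_⟩))
          · intro x hx
            simp only [Finset.mem_filter] at hx ⊢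
            exact ⟨hx.1, hx.2.trans h⟩
          · simpa using h
          · simp
      subst this
      change e w ∈ T (((insert w M).map e.toEmbedding).erase (e w)) at hwT
      rwa [herase] at hwT
  have hcF : ∀ t, ¬ c t := by
    intro t ht
    have ht2 := t.2
    let u : ℕ → Fin (m + (a + b + 1)) := fun i =>
      if h : i < m + (a + b + 1) then ⟨i, h⟩ else ⟨0, by omega⟩
    have hu : ∀ i, i < m + (a + b + 1) → (u i).val = i := fun i h => by simp [u, h]
    let M : Finset (Fin (m + (a + b + 1))) :=
      Finset.univ.filter fun i => i.val < t ∨ (t + b + 1 ≤ i.val ∧ i.val < a + b + 1)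
    have hMim : M = ((Finset.range t ∪ Finset.Ico (t + b + 1) (a + b + 1)).image u) := by
      ext i
      simp only [M, Finset.mem_filter, Finset.mem_univ, true_and, Finset.mem_image,
        Finset.mem_union, Finset.mem_range, Finset.mem_Ico]
      constructor
      · intro h
        exact ⟨i.val, h, Fin.ext (hu _ i.2)⟩
      · rintro ⟨j, hj, rfl⟩
        rw [hu j (by omega)]
        exact hj
    have hMc : M.card = a := by
      rw [hMim, Finset.card_image_of_injOn, Finset.card_union_of_disjoint]
      · simp
        omega
      · rw [Finset.disjoint_left]
        intro i hi hi'
        simp only [Finset.mem_range, Finset.mem_Ico] at hi hi'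
        omega
      · intro i hi j hj hij
        simp only [Finset.coe_union, Finset.coe_range, Finset.coe_Ico, Set.mem_union,
          Set.mem_Iio, Set.mem_Ico] at hi hj
        have := congrArg Fin.val hij
        rwa [hu i (by omega), hu j (by omega)] at this
    have hmem : ∀ i, t.val ≤ i → i < t + b + 1 → e (u i) ∈ T (M.map e.toEmbedding) := by
      intro i h1 h2
      refine (hχ M (u i) hMc ?_ t ?_).mpr ht
      · simp only [M, Finset.mem_filter, Finset.mem_univ, true_and]
        rw [hu i (by omega)]
        omega
      · have : M.filter (· < u i) = (Finset.range t).image u := by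
          ext j
          simp only [M, Finset.mem_filter, Finset.mem_univ, true_and, Finset.mem_image,
            Finset.mem_range, Fin.lt_def]
          rw [hu i (by omega)]
          constructor
          · intro h
            exact ⟨j.val, by omega, Fin.ext (hu _ j.2)⟩
          · rintro ⟨k, hk, rfl⟩
            rw [hu k (by omega)]
            omega
        rw [this, Finset.card_image_of_injOn, Finset.card_range]
        intro i hi j hj hij
        simp only [Finset.coe_range, Set.mem_Iio] at hi hj
        have := congrArg Fin.val hij
        rwa [hu i (by omega), hu j (by omega)] at this
    have hle := hT (M.map e.toEmbedding) (by simpa using hMc)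
    have hsub : (((Finset.Ico t.val (t + b + 1)).image (fun i => e (u i)) : Finset (Fin n)) :
        Set (Fin n)) ⊆ T (M.map e.toEmbedding) := by
      intro z hz
      simp only [Finset.coe_image, Set.mem_image, Finset.coe_Ico, Set.mem_Ico] at hz
      obtain ⟨i, hi, rfl⟩ := hz
      exact hmem i hi.1 hi.2
    have := Set.ncard_le_ncard hsub (Set.toFinite _)
    rw [Set.ncard_coe_finset, Finset.card_image_of_injOn, Nat.card_Ico] at this
    · omega
    · intro i hi j hj hij
      simp only [Finset.coe_Ico, Set.mem_Ico] at hi hj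
      have := congrArg Fin.val (e.injective hij)
      rwa [hu i (by omega), hu j (by omega)] at this
  refine ⟨(Fin.castAddOrderEmb (a + b + 1)).trans e, fun M hM z hz => ?_⟩
  by_contra hzM
  have hz' : e (Fin.castAddOrderEmb (a + b + 1) z) ∈
      T ((M.map (Fin.castAddOrderEmb (a + b + 1)).toEmbedding).map e.toEmbedding) := by
    rw [Finset.map_map]
    exact hz
  have hlt : (((M.map (Fin.castAddOrderEmb (a + b + 1)).toEmbedding).filter
      (· < Fin.castAddOrderEmb (a + b + 1) z)).card) < a + 1 :=
    Nat.lt_succ_of_le ((Finset.card_filter_le _ _).trans (by simp [hM]))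
  exact hcF ⟨_, hlt⟩ ((hχ _ _ (by simpa using hM) 
    (fun h => hzM ((Finset.mem_map' _).mp h)) ⟨_, hlt⟩ rfl).mp hz')

section Linearise

/-- Rows touching prescribed pairs of columns only give a subdivided clique minor. -/
theorem subK_of_rows {V κ : Type} {G : SimpleGraph V} {n : ℕ} {A : Fin n → Set V}
    {B : κ → Set V} (hA : ∀ i, Conn G (A i)) (hB : ∀ j, Conn G (B j))
    (hAA : ∀ i i', i ≠ i' → Anticomplete G (A i) (A i'))
    (hBB : ∀ j j', j ≠ j' → Anticomplete G (B j) (B j'))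
    (hAB : ∀ i j, Disjoint (A i) (B j)) (code : Fin n → Fin n → κ)
    (hcode : ∀ v w v' w', v < w → v' < w' → (v, w) ≠ (v', w') → code v w ≠ code v' w')
    (ht : ∀ v w, v < w → ∀ u, Touch G (A u) (B (code v w)) ↔ u = v ∨ u = w) : SubK G n := by
  refine ⟨A, fun v w => B (code v w), hA, hAA, fun v w hvw => ⟨hB _, hAB _ _, hAB _ _,
    (ht v w hvw v).mpr (Or.inl rfl), (ht v w hvw w).mpr (Or.inr rfl), fun u h1 h2 => ?_⟩,
    fun v w v' w' h h' hne => hBB _ _ (hcode v w v' w' h h' hne)⟩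
  exact anticomplete_iff.mpr ⟨hAB _ _, fun h => ((ht v w hvw u).mp h).elim h1 h2⟩

theorem exists_path_rows (n p q : ℕ) : ∃ P Q : ℕ, ∀ P' Q', P ≤ P' → Q ≤ Q' →
    ∀ {V : Type} {G : SimpleGraph V}
    {A : Fin P' → Set V} {B : Fin Q' → Set V}, BiModel G A B → SubK G n ∨
    ∃ (A' : Fin p → Set V) (g : Fin q → Fin Q'), BiModel G A' (fun j => B (g j)) ∧
      ∀ i, IsPathSet G (A' i) := by
  classical
  obtain ⟨m, ⟨enc⟩⟩ := Finite.exists_equiv_fin (Sym2 (Fin n))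
  obtain ⟨Q, hQ⟩ := exists_free_set (n - 1) ((n - 1 + 1) * q) m
  obtain ⟨P, hP⟩ := fin_pigeonhole ((Fin q ↪o Fin Q) ⊕ (Fin m ↪o Fin Q)) (n + p)
  refine ⟨P, Q, fun P' Q' hP' hQ' {V G A B₀} h₀ => ?_⟩
  let B : Fin Q → Set V := fun j => B₀ (Fin.castLE hQ' j)
  have h : BiModel G A B := h₀.comp Function.injective_id (Fin.castLE_injective hQ')
  have hχ : ∀ i, ∃ c : (Fin q ↪o Fin Q) ⊕ (Fin m ↪o Fin Q),
      (∀ e, c = Sum.inl e → ∃ P ⊆ A i, IsPathSet G P ∧ ∀ j, Touch G P (B (e j))) ∧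
      (∀ e, c = Sum.inr e → ∀ M : Finset (Fin m), M.card = n - 1 →
        ∃ X ⊆ A i, Conn G X ∧ ∀ j, Touch G X (B (e j)) ↔ j ∈ M) := by
    intro i
    rcases exists_path_or_sparse (h.connA i) B (h.touch i) q with ⟨P, hPA, hPp, hc⟩ | hX
    · have : ∃ T : Finset (Fin Q), T.card = q ∧ ∀ j ∈ T, Touch G P (B j) := by
        rw [Set.ncard_eq_toFinset_card'] at hc
        obtain ⟨T, hT, hTc⟩ := Finset.exists_subset_card_eq hc
        exact ⟨T, hTc, fun j hj => by simpa using hT hj⟩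
      obtain ⟨T, hTc, hT⟩ := this
      refine ⟨Sum.inl (T.orderEmbOfFin hTc), ?_, by simp⟩
      rintro e ⟨⟩
      exact ⟨P, hPA, hPp, fun j => hT _ (Finset.orderEmbOfFin_mem T hTc j)⟩
    · choose X hXA hXc hXt hXn using hX
      obtain ⟨e, he⟩ := hQ Q le_rfl (fun M => {j | Touch G (X M) (B j)}) fun M hM => by
        rw [← hM]
        exact hXn M
      refine ⟨Sum.inr e, by simp, ?_⟩
      rintro e' ⟨⟩ M hM
      refine ⟨X _, hXA _, hXc (M.map e.toEmbedding), fun j => ⟨fun hj => he M hM j hj, fun hj =>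
        hXt _ _ (Finset.mem_map_of_mem _ hj)⟩⟩
  choose χ hχ1 hχ2 using hχ
  obtain ⟨ι, c, hc⟩ := hP P' hP' χ
  rcases c with e | e
  · right
    choose X hXA hXp hXt using fun i => hχ1 _ e (hc i)
    refine ⟨fun i => X (Fin.natAdd n i), fun j => Fin.castLE hQ' (e j), ?_, fun i => hXp _⟩
    exact h₀.shrink (ι.injective.comp (Fin.natAdd_injective p n))
      ((Fin.castLE_injective hQ').comp e.injective)
      (fun i => hXA _) (fun j => le_rfl) (fun i => (hXp _).conn) (fun j => h₀.connB _)
      fun i j => hXt _ j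
  · left
    let M : Fin n → Finset (Fin m) := fun v => (Finset.univ.erase v).image fun w => enc s(v, w)
    have hM : ∀ v, (M v).card = n - 1 := by
      intro v
      rw [Finset.card_image_of_injective, Finset.card_erase_of_mem (Finset.mem_univ _)]
      · simp
      · intro w w' h
        exact Sym2.congr_right.mp (enc.injective h)
    choose X hXA hXc hXt using fun v => hχ2 _ e (hc (Fin.castAdd p v)) (M v) (hM v)
    refine subK_of_rows (A := X) (B := B) hXc h.connB
      (fun i i' hi => (h.antiA _ _ (ι.injective.ne ((Fin.castAdd_injective n p).ne hi))).mono
        (hXA i) (hXA i')) h.antiB (fun i j => (h.disj _ j).mono (hXA i) le_rfl)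
      (fun v w => e (enc s(v, w))) ?_ ?_
    · intro v w v' w' h h' hne heq
      have := enc.injective (e.injective heq)
      rw [Sym2.eq_iff] at this
      rcases this with ⟨rfl, rfl⟩ | ⟨rfl, rfl⟩
      · exact hne rfl
      · exact absurd h (lt_asymm h')
    · intro v w hvw u
      rw [hXt]
      simp only [M, Finset.mem_image, Finset.mem_erase, Finset.mem_univ, and_true,
        enc.injective.eq_iff]
      constructor
      · rintro ⟨w', hw', h⟩
        rw [Sym2.eq_iff] at h
        exact h.imp (fun h => h.1) (fun h => h.1)
      · rintro (rfl | rfl)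
        · exact ⟨w, hvw.ne', rfl⟩
        · exact ⟨v, hvw.ne, Sym2.eq_swap⟩

/-- A large complete bipartite induced minor gives one with all branch sets paths, or a
subdivided clique. -/
theorem exists_linear_model (n p q : ℕ) : ∃ f g : ℕ, 0 < f ∧ 0 < g ∧
    ∀ {V : Type} (G : SimpleGraph V),
    HasInducedMinor G (completeBipartiteGraph (Fin f) (Fin g)) → SubK G n ∨
    ∃ (A : Fin p → Set V) (B : Fin q → Set V), BiModel G A B ∧ (∀ i, IsPathSet G (A i)) ∧
      ∀ j, IsPathSet G (B j) := by
  obtain ⟨P₁, Q₁, h1⟩ := exists_path_rows n q p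
  obtain ⟨P₂, Q₂, h2⟩ := exists_path_rows n Q₁ P₁
  refine ⟨P₂ + 1, Q₂ + 1, by omega, by omega, fun {V} G ⟨B, hB1, hB2, hB3⟩ => ?_⟩
  have hmod : BiModel G (fun i : Fin (P₂ + 1) => B (Sum.inl i))
      (fun j : Fin (Q₂ + 1) => B (Sum.inr j)) := by
    refine ⟨fun i => conn_iff_connected.mpr (hB1 _), fun i => conn_iff_connected.mpr (hB1 _),
      fun i i' h => ?_, fun i i' h => ?_, fun i j => hB2 (by simp), fun i j => ?_⟩
    · have := hB3 (Sum.inl i) (Sum.inl i') (by simpa using h)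
      simpa using this
    · have := hB3 (Sum.inr i) (Sum.inr i') (by simpa using h)
      simpa using this
    · have := hB3 (Sum.inl i) (Sum.inr j) (by simp)
      rw [anticomplete_iff] at this
      have h2 := hB2 (show Sum.inl i ≠ Sum.inr j by simp)
      simp only [completeBipartiteGraph_adj, Sum.isLeft_inl, Sum.isRight_inr, and_self,
        true_or, true_iff] at this
      by_contra h
      exact this ⟨h2, h⟩
  rcases h2 _ _ (Nat.le_succ _) (Nat.le_succ _) hmod with h | ⟨A', g, hA', hp⟩
  · exact Or.inl h
  rcases h1 _ _ le_rfl le_rfl hA'.swap with h | ⟨B', g', hB', hp'⟩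
  · exact Or.inl h
  exact Or.inr ⟨_, B', hB'.swap, fun i => hp _, hp'⟩

end Linearise

section Ample

theorem exists_many_rows_of_small {V ι : Type} [Finite V] [Fintype ι] {G : SimpleGraph V}
    {A : ι → Set V} {d m : ℕ} {I : Set V} (hI : I.ncard ≤ d)
    (h : d * m < {i | Touch G I (A i)}.ncard) :
    ∃ b ∈ I, m < {i | ∃ x ∈ A i, G.Adj b x}.ncard := by
  classical
  by_contra! hc
  have hfin : I.Finite := Set.toFinite I
  have hsub : {i | Touch G I (A i)} ⊆ ⋃ b ∈ hfin.toFinset, {i | ∃ x ∈ A i, G.Adj b x} := by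
    rintro i ⟨b, hb, x, hx, hbx⟩
    exact Set.mem_biUnion (by simpa using hb) ⟨x, hx, hbx⟩
  have h1 := (Set.ncard_le_ncard hsub (Set.toFinite _)).trans (Finset.set_ncard_biUnion_le _ _)
  have h2 := Finset.sum_le_card_nsmul hfin.toFinset (fun b => {i | ∃ x ∈ A i, G.Adj b x}.ncard) m
    (fun b hb => hc b (by simpa using hb))
  rw [smul_eq_mul, ← Set.ncard_eq_toFinset_card I hfin] at h2
  have := Nat.mul_le_mul_right m hI
  omega

theorem exists_orderEmb_of_ncard {n m : ℕ} {S : Set (Fin n)} (h : m ≤ S.ncard) :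
    ∃ e : Fin m ↪o Fin n, ∀ i, e i ∈ S := by
  classical
  rw [Set.ncard_eq_toFinset_card'] at h
  obtain ⟨T, hT, hTc⟩ := Finset.exists_subset_card_eq h
  exact ⟨T.orderEmbOfFin hTc, fun i => by simpa using hT (Finset.orderEmbOfFin_mem T hTc i)⟩

/-- With respect to many rows, a column is ample, has a vertex of large degree, or can reach
any two of many rows while avoiding the others. -/
theorem exists_ample_rows (d n m p : ℕ) : ∃ P : ℕ, ∀ {V : Type} [Finite V] {G : SimpleGraph V}
    (A : Fin P → Set V) (B : Set V),
    (∃ e : Fin p ↪o Fin P, ∀ I ⊆ B, Conn G I → I.ncard ≤ d → ∀ i i', i ≠ i' →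
      Touch G I (A (e i)) → ¬ Touch G I (A (e i'))) ∨
    (∃ e : Fin m ↪o Fin P, ∃ b ∈ B, ∀ i, ∃ x ∈ A (e i), G.Adj b x) ∨
    ∃ e : Fin n ↪o Fin P, ∀ M : Finset (Fin n), M.card = 2 →
      ∃ I ⊆ B, Conn G I ∧ ∀ i, Touch G I (A (e i)) ↔ i ∈ M := by
  classical
  obtain ⟨N, hN⟩ := exists_free_set 2 (d * m) n
  obtain ⟨P, hP⟩ := fin_ramsey Prop 2 (N + p)
  refine ⟨P, fun {V _ G} A B => ?_⟩
  obtain ⟨e, c, hc⟩ := hP P le_rfl fun K => ∃ I ⊆ B, Conn G I ∧ I.ncard ≤ d ∧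
    ∀ i ∈ K, Touch G I (A i)
  by_cases hcc : c
  · by_cases hm : ∃ b ∈ B, m ≤ {i : Fin P | ∃ x ∈ A i, G.Adj b x}.ncard
    · obtain ⟨b, hb, h⟩ := hm
      obtain ⟨e, he⟩ := exists_orderEmb_of_ncard h
      exact Or.inr (Or.inl ⟨e, b, hb, he⟩)
    push Not at hm
    let e' : Fin N ↪o Fin P := (Fin.castAddOrderEmb p).trans e
    have hI : ∀ M : Finset (Fin N), ∃ I : Set V, M.card = 2 → I ⊆ B ∧ Conn G I ∧ I.ncard ≤ d ∧
        ∀ i ∈ M, Touch G I (A (e' i)) := by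
      intro M
      by_cases hM : M.card = 2
      · have := hc (M.map (Fin.castAddOrderEmb p).toEmbedding) (by simpa using hM)
        obtain ⟨I, h1, h2, h3, h4⟩ := this.mpr hcc
        refine ⟨I, fun _ => ⟨h1, h2, h3, fun i hi => h4 _ ?_⟩⟩
        exact Finset.mem_map_of_mem _ (Finset.mem_map_of_mem _ hi)
      · exact ⟨∅, fun h => absurd h hM⟩
    choose I hI using hI
    obtain ⟨f, hf⟩ := hN N le_rfl (fun M => {i | Touch G (I M) (A (e' i))}) fun M hM => by
      by_contra! hlt
      obtain ⟨b, hb, hbm⟩ := exists_many_rows_of_small (hI M hM).2.2.1 hlt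
      have h1 := hm b ((hI M hM).1 hb)
      have h2 : {i | ∃ x ∈ A (e' i), G.Adj b x}.ncard ≤ {i | ∃ x ∈ A i, G.Adj b x}.ncard := by
        rw [← Set.ncard_image_of_injective _ e'.injective]
        refine Set.ncard_le_ncard ?_ (Set.toFinite _)
        rintro _ ⟨i, hi, rfl⟩
        exact hi
      omega
    refine Or.inr (Or.inr ⟨f.trans e', fun M hM => ?_⟩)
    have h := hI (M.map f.toEmbedding) (by simpa using hM)
    exact ⟨_, h.1, h.2.1, fun i => ⟨fun hi => hf M hM i hi, fun hi =>
      h.2.2.2 _ (Finset.mem_map_of_mem _ hi)⟩⟩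
  · left
    refine ⟨(Fin.natAddOrderEmb N).trans e, fun I hIB hIc hId i i' hne h h' => hcc ?_⟩
    rw [← hc {Fin.natAdd N i, Fin.natAdd N i'} (Finset.card_pair (by simpa using hne))]
    refine ⟨I, hIB, hIc, hId, fun j hj => ?_⟩
    simp only [Finset.map_insert, Finset.map_singleton, Finset.mem_insert,
      Finset.mem_singleton] at hj
    rcases hj with rfl | rfl
    · exact h
    · exact h'

/-- The columns `B` are `d`-ample for the rows `A`. -/
def AmpleCols {V ι κ : Type} (G : SimpleGraph V) (A : ι → Set V) (B : κ → Set V) (d : ℕ) : Prop :=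
  ∀ j, ∀ I ⊆ B j, Conn G I → I.ncard ≤ d → ∀ i i', i ≠ i' → Touch G I (A i) → ¬ Touch G I (A i')

theorem exists_ample_cols (d n m k p q : ℕ) : ∃ P Q : ℕ, ∀ P' Q', P ≤ P' → Q ≤ Q' →
    ∀ {V : Type} [Finite V] {G : SimpleGraph V} {A : Fin P' → Set V} {B : Fin Q' → Set V},
    BiModel G A B → SubK G n ∨
    (∃ (f : Fin m ↪o Fin P') (g : Fin k ↪o Fin Q') (b : Fin k → V), (∀ j, b j ∈ B (g j)) ∧
      ∀ i j, ∃ x ∈ A (f i), G.Adj (b j) x) ∨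
    ∃ (f : Fin p ↪o Fin P') (g : Fin q ↪o Fin Q'),
      AmpleCols G (fun i => A (f i)) (fun j => B (g j)) d := by
  classical
  obtain ⟨P, hP⟩ := exists_ample_rows d n m p
  obtain ⟨K, ⟨enc⟩⟩ := Finite.exists_equiv_fin (Fin n × Fin n)
  obtain ⟨Q, hQ⟩ := fin_pigeonhole
    ((Fin p ↪o Fin P) ⊕ ((Fin m ↪o Fin P) ⊕ (Fin n ↪o Fin P))) (q + (k + K))
  refine ⟨P, Q, fun P' Q' hP' hQ' {V _ G A B} h => ?_⟩
  let cP : Fin P ↪o Fin P' := Fin.castLEOrderEmb hP'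
  have hχ : ∀ j, ∃ c : (Fin p ↪o Fin P) ⊕ ((Fin m ↪o Fin P) ⊕ (Fin n ↪o Fin P)),
      (∀ e, c = Sum.inl e → ∀ I ⊆ B j, Conn G I → I.ncard ≤ d → ∀ i i', i ≠ i' →
        Touch G I (A (cP (e i))) → ¬ Touch G I (A (cP (e i')))) ∧
      (∀ e, c = Sum.inr (Sum.inl e) → ∃ b ∈ B j, ∀ i, ∃ x ∈ A (cP (e i)), G.Adj b x) ∧
      (∀ e, c = Sum.inr (Sum.inr e) → ∀ M : Finset (Fin n), M.card = 2 →
        ∃ I ⊆ B j, Conn G I ∧ ∀ i, Touch G I (A (cP (e i))) ↔ i ∈ M) := by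
    intro j
    rcases hP (fun i => A (cP i)) (B j) with ⟨e, he⟩ | ⟨e, he⟩ | ⟨e, he⟩
    · exact ⟨Sum.inl e, by rintro _ ⟨⟩; exact he, by simp, by simp⟩
    · exact ⟨Sum.inr (Sum.inl e), by simp, by rintro _ ⟨⟩; exact he, by simp⟩
    · exact ⟨Sum.inr (Sum.inr e), by simp, by simp, by rintro _ ⟨⟩; exact he⟩
  choose χ hχ1 hχ2 hχ3 using hχ
  obtain ⟨ι, c, hc⟩ := hQ Q' hQ' χ
  rcases c with e | e | e
  · refine Or.inr (Or.inr ⟨e.trans cP, (Fin.castAddOrderEmb (k + K)).trans ι, ?_⟩)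
    intro j
    exact hχ1 _ e (hc _)
  · choose b hb hbb using fun j => hχ2 _ e (hc j)
    exact Or.inr (Or.inl ⟨e.trans cP,
      ((Fin.castAddOrderEmb K).trans (Fin.natAddOrderEmb q)).trans ι, fun j => b _,
      fun j => hb _, fun i j => hbb _ i⟩)
  · left
    let code : Fin n → Fin n → Fin (q + (k + K)) := fun v w =>
      Fin.natAdd q (Fin.natAdd k (enc (v, w)))
    have hcode : ∀ v w v' w', code v w = code v' w' → (v, w) = (v', w') := by
      intro v w v' w' h
      simpa [code] using h
    have hI : ∀ v w, ∃ I, v < w → I ⊆ B (ι (code v w)) ∧ Conn G I ∧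
        ∀ i, Touch G I (A (cP (e i))) ↔ i = v ∨ i = w := by
      intro v w
      by_cases hvw : v < w
      · obtain ⟨I, h1, h2, h3⟩ := hχ3 _ e (hc (code v w)) {v, w} (Finset.card_pair hvw.ne)
        exact ⟨I, fun _ => ⟨h1, h2, fun i => by simpa using h3 i⟩⟩
      · exact ⟨∅, fun h => absurd h hvw⟩
    choose I hI using hI
    refine ⟨fun v => A (cP (e v)), I, fun v => h.connA _, fun v w hvw => h.antiA _ _ ?_,
      fun v w hvw => ?_, fun v w v' w' hvw hvw' hne => ?_⟩
    · exact cP.injective.ne (e.injective.ne hvw)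
    · obtain ⟨h1, h2, h3⟩ := hI v w hvw
      have hd : ∀ i, Disjoint (A i) (I v w) := fun i => (h.disj i _).mono le_rfl h1
      refine ⟨h2, hd _, hd _, ((h3 v).mpr (Or.inl rfl)).symm, ((h3 w).mpr (Or.inr rfl)).symm,
        fun u hu hu' => anticomplete_iff.mpr ⟨hd _, fun ht => ?_⟩⟩
      exact ((h3 u).mp ht.symm).elim hu hu'
    · exact (h.antiB _ _ (ι.injective.ne fun h => hne (hcode _ _ _ _ h))).mono (hI v w hvw).1
        (hI v' w' hvw').1

end Ample

/-- The vertices `x i` and the paths `B j` form a constellation. -/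
def IsCon {V ι κ : Type} (G : SimpleGraph V) (x : ι → V) (B : κ → Set V) : Prop :=
  BiModel G (fun i => {x i}) B ∧ ∀ j, IsPathSet G (B j)

section Con

variable {V ι κ : Type} {G : SimpleGraph V} {A : ι → Set V} {x : ι → V} {B : κ → Set V}

theorem AmpleCols.shrink {ι' κ' : Type} {d : ℕ} (h : AmpleCols G A B d) {f : ι' → ι}
    (hf : Function.Injective f) (g : κ' → κ) {B' : κ' → Set V} (hB : ∀ j, B' j ⊆ B (g j)) :
    AmpleCols G (fun i => A (f i)) B' d := fun j I hI hIc hId i i' hne =>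
  h (g j) I (hI.trans (hB j)) hIc hId _ _ (hf.ne hne)

theorem IsCon.shrink {ι' κ' : Type} (h : IsCon G x B) {f : ι' → ι}
    (hf : Function.Injective f) {g : κ' → κ} (hg : Function.Injective g) {B' : κ' → Set V}
    (hB : ∀ j, B' j ⊆ B (g j)) (hc : ∀ j, Conn G (B' j))
    (ht : ∀ i j, Touch G {x (f i)} (B' j)) : IsCon G (fun i => x (f i)) B' :=
  ⟨h.1.shrink hf hg (fun _ => le_rfl) hB (fun _ => conn_singleton _) hc ht,
    fun j => (h.2 (g j)).of_conn (hc j) (hB j)⟩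

theorem IsCon.injective (h : IsCon G x B) : Function.Injective x := by
  intro i i' hi
  by_contra hne
  exact (h.1.antiA i i' hne).ne rfl rfl hi

theorem Conn.subset_of_iUnion {S : Set V} (hS : Conn G S) (hB : ∀ j j', j ≠ j' →
    Anticomplete G (B j) (B j')) (h : S ⊆ ⋃ j, B j) : ∃ j, S ⊆ B j := by
  obtain ⟨v, hv⟩ := hS.1
  obtain ⟨j, hj⟩ := Set.mem_iUnion.mp (h hv)
  refine ⟨j, hS.2 _ ⟨v, hv, hj⟩ fun a _ haj b hb hab => ?_⟩
  obtain ⟨j', hj'⟩ := Set.mem_iUnion.mp (h hb)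
  by_cases hjj : j = j'
  · rwa [hjj]
  · exact absurd hab ((hB j j' hjj).2 a haj b hj')

theorem compsOn_iUnion (hc : ∀ j, Conn G (B j)) (hB : ∀ j j', j ≠ j' →
    Anticomplete G (B j) (B j')) : CompsOn G (⋃ j, B j) = Set.range B := by
  have key : ∀ j (v : (⋃ j, B j : Set V)), v.1 ∈ B j →
      Subtype.val '' ((G.induce (⋃ j, B j)).connectedComponentMk v).supp = B j := by
    intro j v hv
    apply le_antisymm
    · rintro _ ⟨w, hw, rfl⟩
      have hr : (G.induce (⋃ j, B j)).Reachable v w :=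
        (SimpleGraph.ConnectedComponent.exact hw).symm
      obtain ⟨p⟩ := hr
      clear hw
      induction p with
      | nil => exact hv
      | @cons a b c hab p ih =>
        refine ih ?_
        obtain ⟨j', hj'⟩ := Set.mem_iUnion.mp b.2
        by_cases hjj : j = j'
        · rwa [hjj]
        · exact absurd hab ((hB j j' hjj).2 _ hv _ hj')
    · refine (hc j).2 _ ⟨v, hv, v, rfl, rfl⟩ ?_
      rintro _ ha ⟨a, ha', rfl⟩ b hb hab
      refine ⟨⟨b, Set.mem_iUnion.mpr ⟨j, hb⟩⟩, ?_, rfl⟩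
      have h1 : (G.induce (⋃ j, B j)).Adj a ⟨b, Set.mem_iUnion.mpr ⟨j, hb⟩⟩ := hab
      rw [SimpleGraph.ConnectedComponent.mem_supp_iff] at ha' ⊢
      rw [← ha']
      exact SimpleGraph.ConnectedComponent.sound h1.symm.reachable
  ext L
  constructor
  · rintro ⟨C, rfl⟩
    induction C using SimpleGraph.ConnectedComponent.ind with
    | h v =>
      obtain ⟨j, hj⟩ := Set.mem_iUnion.mp v.2
      exact ⟨j, (key j v hj).symm⟩
  · rintro ⟨j, rfl⟩
    obtain ⟨v, hv⟩ := (hc j).1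
    exact ⟨_, (key j ⟨v, Set.mem_iUnion.mpr ⟨j, hv⟩⟩ hv).symm⟩

theorem IsCon.diff_eq (h : IsCon G x B) :
    (Set.range x ∪ ⋃ j, B j) \ Set.range x = ⋃ j, B j := by
  rw [Set.union_sdiff_left, sdiff_eq_left, Set.disjoint_left]
  rintro v hv ⟨i, rfl⟩
  obtain ⟨j, hj⟩ := Set.mem_iUnion.mp hv
  exact Set.disjoint_left.mp (h.1.disj i j) rfl hj

theorem IsCon.isConstellationOn (h : IsCon G x B) :
    IsConstellationOn G (Set.range x ∪ ⋃ j, B j) (Set.range x) := by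
  refine ⟨Set.subset_union_left, ?_, ?_, ?_⟩
  · rintro _ ⟨i, rfl⟩ _ ⟨i', rfl⟩ hadj
    by_cases hne : i = i'
    · subst hne
      exact G.loopless.irrefl _ hadj
    · exact (h.1.antiA i i' hne).2 _ rfl _ rfl hadj
  · rw [h.diff_eq, compsOn_iUnion h.1.connB h.1.antiB]
    rintro _ ⟨j, rfl⟩
    exact h.2 j
  · rw [h.diff_eq, compsOn_iUnion h.1.connB h.1.antiB]
    rintro _ ⟨i, rfl⟩ _ ⟨j, rfl⟩
    obtain ⟨_, rfl, y, hy, hxy⟩ := h.1.touch i j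
    exact ⟨y, hy, hxy⟩

theorem IsCon.ncard_range {s : ℕ} {x : Fin s → V} (h : IsCon G x B) :
    (Set.range x).ncard = s := by
  rw [← Set.image_univ, Set.ncard_image_of_injective _ h.injective, Set.ncard_univ]
  simp

theorem IsCon.ncard_compsOn {l : ℕ} {B : Fin l → Set V} (h : IsCon G x B) :
    (CompsOn G ((Set.range x ∪ ⋃ j, B j) \ Set.range x)).ncard = l := by
  have hinj : Function.Injective B := by
    intro j j' hj
    by_contra hne
    obtain ⟨v, hv⟩ := (h.1.connB j).1
    exact (h.1.antiB j j' hne).ne hv (hj ▸ hv) rfl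
  rw [h.diff_eq, compsOn_iUnion h.1.connB h.1.antiB, ← Set.image_univ,
    Set.ncard_image_of_injective _ hinj, Set.ncard_univ]
  simp

theorem IsCon.route (h : IsCon G x B) {u v : V} {p : G.Walk u v}
    (hp : IsRoute G (Set.range x ∪ ⋃ j, B j) (Set.range x) p) :
    ∃ j, ∃ I ⊆ B j, Conn G I ∧ (∀ w ∈ I, w ∈ p.support) ∧ Touch G I {u} ∧ Touch G I {v} ∧
      I.ncard + 1 ≤ p.length := by
  have h2 : 2 ≤ p.length := by
    by_contra! hlt
    interval_cases hl : p.length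
    · exact hp.ne (p.eq_of_length_eq_zero hl)
    · exact h.isConstellationOn.stable u hp.fst_mem v hp.snd_mem
        (SimpleGraph.Walk.adj_of_length_eq_one hl)
  have hsub : seg p.getVert 1 (p.length - 1) ⊆ ⋃ j, B j := by
    rintro _ ⟨i, ⟨hi, hi'⟩, rfl⟩
    have hm : p.getVert i ∈ p.support := p.getVert_mem_support i
    have hu : p.getVert i ≠ u := fun he => by
      have := hp.isPath.getVert_injOn (x₁ := i) (x₂ := 0) (by simp; omega) (by simp)
        (by simpa using he)
      omega
    have hv : p.getVert i ≠ v := fun he => by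
      have := hp.isPath.getVert_injOn (x₁ := i) (x₂ := p.length) (by simp; omega) (by simp)
        (by simpa using he)
      omega
    exact (hp.support_mem _ hm).resolve_left (hp.interior _ hm hu hv)
  have hc : Conn G (seg p.getVert 1 (p.length - 1)) :=
    conn_seg_of_adj (by omega) fun i hi hi' => p.adj_getVert_succ (by omega)
  obtain ⟨j, hj⟩ := hc.subset_of_iUnion h.1.antiB hsub
  refine ⟨j, _, hj, hc, ?_, ?_, ?_, ?_⟩
  · rintro _ ⟨i, -, rfl⟩
    exact p.getVert_mem_support i
  · refine ⟨_, ⟨1, ⟨le_rfl, by omega⟩, rfl⟩, u, rfl, ?_⟩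
    have := p.adj_getVert_succ (i := 0) (by omega)
    simpa using this.symm
  · refine ⟨_, ⟨p.length - 1, ⟨by omega, le_rfl⟩, rfl⟩, v, rfl, ?_⟩
    have := p.adj_getVert_succ (i := p.length - 1) (by omega)
    rw [Nat.sub_add_cancel (by omega), p.getVert_length] at this
    exact this
  · have : (seg p.getVert 1 (p.length - 1)).ncard ≤ (Set.Icc 1 (p.length - 1)).ncard :=
      Set.ncard_image_le (Set.toFinite _)
    have h3 : (Set.Icc 1 (p.length - 1)).ncard = p.length - 1 := by
      rw [Set.ncard_eq_toFinset_card']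
      simp
    omega

theorem IsCon.dAmple {d : ℕ} (h : IsCon G x B) (hd : AmpleCols G (fun i => {x i}) B d) :
    DAmple G (Set.range x ∪ ⋃ j, B j) (Set.range x) d := by
  intro u v p hp
  by_contra! hlt
  obtain ⟨j, I, hIB, hI, -, hu, hv, hn⟩ := h.route hp
  obtain ⟨i, rfl⟩ := hp.fst_mem
  obtain ⟨i', rfl⟩ := hp.snd_mem
  exact hd j I hIB hI (by omega) i i' (fun h => hp.ne (by rw [h])) hu hv

theorem touch_singleton_iff {I : Set V} {z : V} : Touch G I {z} ↔ ∃ v ∈ I, G.Adj z v := by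
  constructor
  · rintro ⟨v, hv, _, rfl, h⟩
    exact ⟨v, hv, h.symm⟩
  · rintro ⟨v, hv, h⟩
    exact ⟨v, hv, z, rfl, h.symm⟩

/-- The conclusion that `G` has an ample interrupted constellation. -/
def HasInterrupted {V : Type} (G : SimpleGraph V) (d s l : ℕ) : Prop :=
  ∃ W' S' : Set V, IsConstellationOn G W' S' ∧ DAmple G W' S' d ∧ Interrupted G W' S' ∧
    S'.ncard = s ∧ (CompsOn G (W' \ S')).ncard = l

/-- The conclusion that `G` has an ample zigzagged constellation. -/
def HasZigzagged {V : Type} (G : SimpleGraph V) (d s l q : ℕ) : Prop :=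
  ∃ W' S' : Set V, IsConstellationOn G W' S' ∧ DAmple G W' S' d ∧ Zigzagged G W' S' q ∧
    S'.ncard = s ∧ (CompsOn G (W' \ S')).ncard = l

theorem IsCon.hasInterrupted {d s l : ℕ} {x : Fin s → V} {B : Fin l → Set V}
    (h : IsCon G x B) (hd : AmpleCols G (fun i => {x i}) B d)
    (hi : ∀ i i' k, i < i' → i' < k → ∀ j, ∀ I ⊆ B j, Conn G I → Touch G I {x i} →
      Touch G I {x i'} → Touch G I {x k}) : HasInterrupted G d s l := by
  refine ⟨_, _, h.isConstellationOn, h.dAmple hd, ⟨Function.extend x Fin.val 0, ?_, ?_⟩,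
    h.ncard_range, h.ncard_compsOn⟩
  · rintro _ ⟨i, rfl⟩ _ ⟨i', rfl⟩ he
    rw [h.injective.extend_apply, h.injective.extend_apply] at he
    rw [Fin.ext he]
  · rintro _ ⟨i, rfl⟩ _ ⟨i', rfl⟩ _ ⟨k, rfl⟩ h1 h2 p hp
    simp only [h.injective.extend_apply] at h1 h2
    obtain ⟨j, I, hIB, hI, hIp, hu, hv, -⟩ := h.route hp
    obtain ⟨v, hv, hadj⟩ := touch_singleton_iff.mp (hi i i' k h1 h2 j I hIB hI hu hv)
    exact ⟨v, hIp v hv, hadj⟩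

theorem IsCon.hasZigzagged {d s l q : ℕ} {x : Fin s → V} {B : Fin l → Set V}
    (h : IsCon G x B) (hd : AmpleCols G (fun i => {x i}) B d)
    (hi : ∀ i i', i < i' → ∀ j, ∀ I ⊆ B j, Conn G I → Touch G I {x i} →
      Touch G I {x i'} → {k | i < k ∧ k < i' ∧ ¬ Touch G I {x k}}.ncard < q) :
    HasZigzagged G d s l q := by
  refine ⟨_, _, h.isConstellationOn, h.dAmple hd, ⟨Function.extend x Fin.val 0, ?_, ?_⟩,
    h.ncard_range, h.ncard_compsOn⟩
  · rintro _ ⟨i, rfl⟩ _ ⟨i', rfl⟩ he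
    rw [h.injective.extend_apply, h.injective.extend_apply] at he
    rw [Fin.ext he]
  · rintro _ ⟨i, rfl⟩ _ ⟨i', rfl⟩ h1 p hp
    simp only [h.injective.extend_apply] at h1
    obtain ⟨j, I, hIB, hI, hIp, hu, hv, -⟩ := h.route hp
    refine lt_of_le_of_lt ?_ (hi i i' h1 j I hIB hI hu hv)
    refine le_trans (Set.ncard_le_ncard ?_ (Set.toFinite _))
      (Set.ncard_image_le (f := x) (Set.toFinite _))
    rintro _ ⟨⟨k, rfl⟩, h2, h3, h4⟩
    simp only [h.injective.extend_apply] at h2 h3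
    refine ⟨k, ⟨h2, h3, fun ht => h4 ?_⟩, rfl⟩
    obtain ⟨v, hv, hadj⟩ := touch_singleton_iff.mp ht
    exact ⟨v, hIp v hv, hadj⟩

theorem exists_ample_con (d n r s l : ℕ) : ∃ S L : ℕ, ∀ S' L', S ≤ S' → L ≤ L' →
    ∀ {V : Type} [Finite V] {G : SimpleGraph V}
    {x : Fin S' → V} {B : Fin L' → Set V}, IsCon G x B → SubK G n ∨ Good G r ∨
    ∃ (f : Fin s ↪o Fin S') (g : Fin l ↪o Fin L'),
      AmpleCols G (fun i => {x (f i)}) (fun j => B (g j)) d := by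
  obtain ⟨S, L, h⟩ := exists_ample_cols d n r r s l
  refine ⟨S, L, fun S' L' hS hL {V _ G x B} hx => ?_⟩
  rcases h S' L' hS hL hx.1 with h | ⟨f, g, b, hb, hadj⟩ | h
  · exact Or.inl h
  · refine Or.inr (Or.inl (Or.inl ?_))
    let φ : Fin r ⊕ Fin r → V := Sum.elim (fun i => x (f i)) b
    have hbx : ∀ i j, x (f i) ≠ b j := fun i j he =>
      Set.disjoint_left.mp (hx.1.disj (f i) (g j)) rfl (he ▸ hb j)
    have hbb : ∀ j j', j ≠ j' → Anticomplete G (B (g j)) (B (g j')) := fun j j' hne =>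
      hx.1.antiB _ _ (g.injective.ne hne)
    have hφ : Function.Injective φ := by
      rintro (i | i) (j | j) hij
      · exact congrArg Sum.inl (f.injective (hx.injective hij))
      · exact absurd hij (hbx i j)
      · exact absurd hij.symm (hbx j i)
      · by_contra hne
        exact (hbb i j fun h => hne (by rw [h])).ne (hb i) (hb j) hij
    refine ⟨Set.range φ, ⟨⟨Equiv.ofInjective φ hφ, ?_⟩⟩⟩
    have h1 : ∀ i j, G.Adj (x (f i)) (b j) := fun i j => by
      obtain ⟨_, rfl, h⟩ := hadj i j
      exact h.symm
    have h2 : ∀ i i', ¬ G.Adj (x (f i)) (x (f i')) := fun i i' h =>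
      hx.isConstellationOn.stable _ ⟨_, rfl⟩ _ ⟨_, rfl⟩ h
    have h3 : ∀ j j', ¬ G.Adj (b j) (b j') := fun j j' h => by
      by_cases hj : j = j'
      · subst hj
        exact G.loopless.irrefl _ h
      · exact (hbb j j' hj).2 _ (hb j) _ (hb j') h
    rintro (i | i) (j | j)
    · simp [φ, h2]
    · simp [φ, h1]
    · simp [φ, (h1 j i).symm]
    · simp [φ, h3]
  · exact Or.inr (Or.inr h)

end Con

/-- Inside `B`, the vertices `x (e p)` and `x (e q)` can be joined by a path with no other
neighbour among `x (e 0), …, x (e (n - 1))`. -/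
def Joins {V : Type} (G : SimpleGraph V) (x : ℕ → V) (B : Set V) (e : ℕ → ℕ) (n p q : ℕ) :
    Prop :=
  ∃ I ⊆ B, Conn G I ∧ ∀ t < n, (Touch G I {x (e t)} ↔ t = p ∨ t = q)

section Pattern

variable {V : Type} {G : SimpleGraph V}

theorem exists_uniform_joins (k N M : ℕ) (hN : 0 < N) : ∃ R L : ℕ,
    ∀ {V : Type} {G : SimpleGraph V} (x : Fin R → V) (B : Fin L → Set V),
    ∃ (f : Fin N ↪o Fin R) (g : Fin M ↪o Fin L) (X : ℕ → V) (F : ℕ → ℕ → ℕ → Prop),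
      (∀ i : Fin N, X i = x (f i)) ∧
      ∀ n p q, n ≤ k → p < n → q < n → ∀ e : ℕ → ℕ, (∀ t < n, e t < N) →
        (∀ t t', t < t' → t' < n → e t < e t') → ∀ j,
        (Joins G X (B (g j)) e n p q ↔ F n p q) := by
  obtain ⟨R, hR⟩ := fin_ramsey_le (Fin k → Fin k → Prop) k N
  obtain ⟨L, hL⟩ := fin_pigeonhole (Finset (Fin R) → Fin k → Fin k → Prop) M
  refine ⟨R, L, fun {V G} x B => ?_⟩
  obtain ⟨g, χ, hχ⟩ := hL L le_rfl fun j K p q => ∃ I ⊆ B j, Conn G I ∧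
    ∀ t : Fin K.card, (Touch G I {x (K.orderEmbOfFin rfl t)} ↔ t.1 = p ∨ t.1 = q)
  obtain ⟨f, c, hc⟩ := hR R le_rfl χ
  obtain ⟨X, hX⟩ : ∃ X : ℕ → V, ∀ i : Fin N, X i = x (f i) :=
    ⟨fun i => if h : i < N then x (f ⟨i, h⟩) else x (f ⟨0, hN⟩), fun i => by simp [i.2]⟩
  refine ⟨f, g, X, fun n p q => ∃ (hp : p < k) (hq : q < k), c n ⟨p, hp⟩ ⟨q, hq⟩, hX, ?_⟩
  intro n p q hn hp hq e heN he j
  let e' : Fin n ↪o Fin N := OrderEmbedding.ofStrictMono (fun t => ⟨e t, heN t t.2⟩)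
    fun t t' h => he t t' h t'.2
  let K : Finset (Fin N) := Finset.univ.map e'.toEmbedding
  have hK : K.card = n := by simp [K]
  have hK' : (K.map f.toEmbedding).card = n := by simp [hK]
  have h1 := hc K (hK.le.trans hn)
  rw [hK, ← hχ j] at h1
  have h2 := congrFun (congrFun h1 ⟨p, by omega⟩) ⟨q, by omega⟩
  have h3 : ∀ t : Fin n, (K.map f.toEmbedding).orderEmbOfFin hK' t = f (e' t) := by
    have := Finset.orderEmbOfFin_unique' hK' (f := e'.trans f) (by
      intro t
      simp [K])
    intro t
    rw [← this]
    rfl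
  have h4 : ∀ t : Fin (K.map f.toEmbedding).card, (K.map f.toEmbedding).orderEmbOfFin rfl t =
      f (e' (Fin.cast hK' t)) := by
    intro t
    rw [← h3]
    simp
  constructor
  · rintro ⟨I, hI, hIc, hIt⟩
    refine ⟨by omega, by omega, ?_⟩
    rw [← h2]
    refine ⟨I, hI, hIc, fun t => ?_⟩
    rw [h4]
    have := hIt t (by omega)
    rw [hX ⟨e t, heN t (by omega)⟩] at this
    exact this
  · rintro ⟨_, _, hF⟩
    rw [← h2] at hF
    obtain ⟨I, hI, hIc, hIt⟩ := hF
    refine ⟨I, hI, hIc, fun t ht => ?_⟩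
    have := hIt ⟨t, by omega⟩
    rw [h4] at this
    rw [hX ⟨e t, heN t ht⟩]
    exact this

/-- If all pairs of the vertices `x` can be joined, there is a subdivided wall. -/
theorem good_of_joins {r M : ℕ} (hr : 0 < r) {X : ℕ → V} {B : Fin M → Set V}
    (hM : Fintype.card (Sym2 (Fin r × Fin (2 * r))) ≤ M)
    (hX : ∀ i < r * (2 * r), ∀ i' < r * (2 * r), i ≠ i' → Anticomplete G {X i} {X i'})
    (hXB : ∀ i < r * (2 * r), ∀ j, X i ∉ B j)
    (hB : ∀ j j', j ≠ j' → Anticomplete G (B j) (B j'))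
    (h : ∀ p q, p < q → q < r * (2 * r) → ∀ j, Joins G X (B j) id (r * (2 * r)) p q) :
    Good G r := by
  let idx : Fin r × Fin (2 * r) ≃ Fin (r * (2 * r)) := finProdFinEquiv
  let col : Sym2 (Fin r × Fin (2 * r)) → Fin M := fun e =>
    Fin.castLE hM (Fintype.equivFin _ e)
  have hcol : Function.Injective col := fun e e' he =>
    (Fintype.equivFin _).injective (Fin.castLE_injective hM he)
  have key : ∀ e : Sym2 (Fin r × Fin (2 * r)), ∃ I ⊆ B (col e), ¬ e.IsDiag → Conn G I ∧
      ∀ u, Touch G I {X (idx u)} ↔ u ∈ e := by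
    intro e
    induction e using Sym2.ind with
    | _ v w =>
    by_cases hvw : v = w
    · exact ⟨∅, Set.empty_subset _, fun h => absurd hvw (by simpa using h)⟩
    have hne : (idx v).1 ≠ (idx w).1 := fun h => hvw (idx.injective (Fin.ext h))
    rcases lt_or_gt_of_ne hne with hlt | hlt
    · obtain ⟨I, hI, hIc, hIt⟩ := h _ _ hlt (idx w).2 (col s(v, w))
      refine ⟨I, hI, fun _ => ⟨hIc, fun u => ?_⟩⟩
      rw [show (idx u).1 = id (idx u).1 from rfl, hIt _ (idx u).2, Sym2.mem_iff]
      simp [← Fin.ext_iff]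
    · obtain ⟨I, hI, hIc, hIt⟩ := h _ _ hlt (idx v).2 (col s(v, w))
      refine ⟨I, hI, fun _ => ⟨hIc, fun u => ?_⟩⟩
      rw [show (idx u).1 = id (idx u).1 from rfl, hIt _ (idx u).2, Sym2.mem_iff]
      simp [← Fin.ext_iff, or_comm]
  choose I hI hI' using key
  have hdiag : ∀ v w, (Wall r).Adj v w → ¬ (s(v, w)).IsDiag := fun v w hvw => by
    simpa using hvw.ne
  refine good_of_assembly (D := fun v => {X (idx v)}) (y := fun v _ => X (idx v))
    (C := fun v w => I s(v, w)) ⟨?_, ?_, ?_, ?_, ?_, ?_, ?_, ?_⟩ (Or.inl fun v => ?_)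
  · exact fun v w hvw => hX _ (idx v).2 _ (idx w).2 fun he => hvw (idx.injective (Fin.ext he))
  · intro v w _
    rw [Sym2.eq_swap]
  · exact fun v w hvw => (hI' _ (hdiag v w hvw)).1
  · intro v w hvw u
    rw [Set.disjoint_singleton_left]
    exact fun hu => hXB _ (idx u).2 _ (hI _ hu)
  · intro v w hvw u huv huw
    rw [anticomplete_iff]
    refine ⟨Set.disjoint_singleton_left.mpr fun hu => hXB _ (idx u).2 _ (hI _ hu), fun ht => ?_⟩
    have := ((hI' _ (hdiag v w hvw)).2 u).mp ht.symm
    rw [Sym2.mem_iff] at this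
    exact this.elim huv huw
  · intro v w hvw
    exact touch_singleton_iff.mp (((hI' _ (hdiag v w hvw)).2 v).mpr (Sym2.mem_mk_left v w))
  · rintro v w hvw u rfl x hx hadj
    rfl
  · intro v w v' w' _ _ hne
    exact (hB _ _ (hcol.ne hne)).mono (hI _) (hI _)
  · exact ⟨X (idx v), rfl, fun _ => {X (idx v)},
      fun _ => ⟨conn_singleton _, le_rfl, rfl, rfl⟩, fun _ _ _ => by
        simp [Anticomplete]⟩

/-- A large ample constellation contains an interrupted one or a zigzagged one, unless the graph
contains a subdivided wall. -/
theorem exists_interrupted_or_zigzagged (d r s l s' l' : ℕ) (hr : 0 < r) : ∃ R L : ℕ,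
    ∀ {V : Type} {G : SimpleGraph V} {x : Fin R → V} {B : Fin L → Set V},
    IsCon G x B → AmpleCols G (fun i => {x i}) B d →
    Good G r ∨ HasInterrupted G d s l ∨ HasZigzagged G d s' l' (2 * r ^ 2) := by
  let k := r * (2 * r)
  have hk : 2 * r ^ 2 = k := by simp only [k]; ring
  have hk0 : 0 < k := by positivity
  let M₀ := Fintype.card (Sym2 (Fin r × Fin (2 * r)))
  obtain ⟨R, L, h⟩ := exists_uniform_joins k (k + s + s') (M₀ + l + l' + 1) (by omega)
  refine ⟨R, L, fun {V G x B} hx hd => ?_⟩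
  obtain ⟨f, g, X, F, hX, hF⟩ := h (G := G) x B
  have hxX : ∀ (i : ℕ) (hi : i < k + s + s'), X i = x (f ⟨i, hi⟩) := fun i hi => hX ⟨i, hi⟩
  -- restricting the constellation to an interval of vertices and a subpath of each column
  have sub : ∀ a m c (ham : a + m ≤ k + s + s') (hc : c ≤ M₀ + l + l' + 1) (I : Fin c → Set V),
      (∀ j, I j ⊆ B (g (Fin.castLE hc j))) → (∀ j, Conn G (I j)) →
      (∀ i < m, ∀ j, Touch G {X (a + i)} (I j)) → ∀ σ : Fin m → Fin m, Function.Injective σ →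
      IsCon G (fun i : Fin m => X (a + σ i)) I ∧
      AmpleCols G (fun i : Fin m => {X (a + σ i)}) I d := by
    intro a m c ham hc I hI hIc hIt σ hσ
    have hinj : Function.Injective fun i : Fin m => f ⟨a + σ i, by omega⟩ := by
      intro i i' hii
      have := f.injective hii
      simp only [Fin.mk.injEq] at this
      exact hσ (Fin.ext (by omega))
    have hg : Function.Injective fun j => g (Fin.castLE hc j) := fun j j' hj =>
      Fin.castLE_injective hc (g.injective hj)
    have he : (fun i : Fin m => X (a + σ i)) = fun i => x (f ⟨a + σ i, by omega⟩) :=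
      funext fun i => hxX _ _
    have he' : (fun i : Fin m => ({X (a + σ i)} : Set V)) =
        fun i => {x (f ⟨a + σ i, by omega⟩)} := funext fun i => by rw [hxX]
    rw [he, he']
    refine ⟨hx.shrink hinj hg hI hIc fun i j => ?_, hd.shrink hinj _ hI⟩
    rw [← hxX]
    exact hIt _ (σ i).2 j
  by_cases hall : ∀ p q, p < q → q < k → F k p q
  · left
    refine good_of_joins (X := X) (B := fun j => B (g j)) hr (by omega) ?_ ?_ ?_ ?_
    · intro i hi i' hi' hne
      rw [hxX i (by omega), hxX i' (by omega)]
      refine hx.1.antiA _ _ fun h => hne ?_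
      have := f.injective h
      simpa using this
    · intro i hi j hij
      rw [hxX i (by omega)] at hij
      exact Set.disjoint_left.mp (hx.1.disj _ _) rfl hij
    · exact fun j j' hne => hx.1.antiB _ _ (g.injective.ne hne)
    · intro p q hpq hq j
      exact (hF k p q le_rfl (by omega) hq id (fun t ht => by simp; omega)
        (fun t t' h _ => h) j).mpr (hall p q hpq hq)
  right
  have hbad : ∃ b n p q, n ≤ k ∧ p < q ∧ q < n ∧ ¬ F n p q ∧ q - p = b := by
    push Not at hall
    obtain ⟨p, q, hpq, hq, hnF⟩ := hall
    exact ⟨_, k, p, q, le_rfl, hpq, hq, hnF, rfl⟩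
  classical
  have hbad' : ∃ n p q, n ≤ k ∧ p < q ∧ q < n ∧ ¬ F n p q ∧ q - p = Nat.find hbad :=
    Nat.find_spec hbad
  obtain ⟨p, q, hn, hpq, hq, hnF, hb⟩ := Nat.find_spec hbad'
  have hmin : ∀ n' p' q', p' < q' → q' < n' → q' - p' ≤ q - p → n' < Nat.find hbad' →
      F n' p' q' := by
    intro n' p' q' h1 h2 h3 h4
    by_contra hF'
    rcases eq_or_lt_of_le h3 with h5 | h5
    · exact Nat.find_min hbad' h4 ⟨p', q', by omega, h1, h2, hF', h5.trans hb⟩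
    · exact Nat.find_min hbad (hb ▸ h5) ⟨n', p', q', by omega, h1, h2, hF', rfl⟩
  generalize Nat.find hbad' = n at hn hq hnF hmin
  clear hbad' hb hall
  have hno : ∀ e : ℕ → ℕ, (∀ t < n, e t < k + s + s') → (∀ t t', t < t' → t' < n → e t < e t') →
      ∀ j, ∀ I ⊆ B (g j), Conn G I → ¬ ∀ t < n, (Touch G I {X (e t)} ↔ t = p ∨ t = q) :=
    fun e h1 h2 j I hI hIc hIt =>
      hnF ((hF n p q hn (by omega) hq e h1 h2 j).mp ⟨I, hI, hIc, hIt⟩)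
  by_cases hb : p + 1 < q
  · right
    have hF' := hmin (n - 1) p (q - 1) (by omega) (by omega) (by omega) (by omega)
    have hl : l' ≤ M₀ + l + l' + 1 := by omega
    choose I hI hIc hIt using fun j : Fin l' => (hF (n - 1) p (q - 1) (by omega) (by omega)
      (by omega) (fun t => if t ≤ p then t else t + s') (fun t ht => by split_ifs <;> omega)
      (fun t t' h h' => by split_ifs <;> omega) (Fin.castLE hl j)).mpr hF'
    beta_reduce at hIt
    have hlow : ∀ j, ∀ t < p, ¬ Touch G (I j) {X t} := fun j t ht h => by
      have := hIt j t (by omega)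
      rw [if_pos (by omega)] at this
      have := this.mp h
      omega
    have hhigh : ∀ j t, q < t → t < n → ¬ Touch G (I j) {X (t - 1 + s')} := fun j t ht ht' h => by
      have := hIt j (t - 1) (by omega)
      rw [if_neg (by omega)] at this
      have := this.mp h
      omega
    have hall : ∀ i < s', ∀ j, Touch G {X (p + 1 + i)} (I j) := by
      intro i hi j
      by_contra hnt
      refine hno (fun t => if t ≤ p then t else if t = p + 1 then p + 1 + i else t - 1 + s')
        (fun t ht => by split_ifs <;> omega) (fun t t' h h' => by split_ifs <;> omega) _ (I j)
        (hI j) (hIc j) fun t ht => ?_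
      split_ifs with h1 h2
      · have := hIt j t (by omega)
        rw [if_pos h1] at this
        rw [this]
        omega
      · exact ⟨fun h => absurd h.symm hnt, fun h => by omega⟩
      · have := hIt j (t - 1) (by omega)
        rw [if_neg (by omega)] at this
        rw [this]
        omega
    obtain ⟨hcon, hamp⟩ := sub (p + 1) s' l' (by omega) hl I hI hIc hall id
      Function.injective_id
    refine hcon.hasZigzagged hamp fun i i' hii j J hJ hJc hJi hJi' => ?_
    by_contra! hcard
    obtain ⟨m, hm⟩ := exists_orderEmb_of_ncard (m := q - p - 1) (le_trans (by omega) hcard)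
    let m' : ℕ → ℕ := fun t => if h : t < q - p - 1 then m ⟨t, h⟩ else 0
    have hm' : ∀ t < q - p - 1, i.1 < m' t ∧ m' t < i'.1 ∧ ¬ Touch G J {X (p + 1 + m' t)} := by
      intro t ht
      simp only [m', dif_pos ht]
      exact hm ⟨t, ht⟩
    have hmm : ∀ t t', t < t' → t' < q - p - 1 → m' t < m' t' := by
      intro t t' h h'
      simp only [m', dif_pos h', dif_pos (h.trans h')]
      exact m.strictMono h
    refine hno (fun t => if t < p then t else if t = p then p + 1 + i else if t < q then
        p + 1 + m' (t - p - 1) else if t = q then p + 1 + i' else t - 1 + s')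
      (fun t ht => ?_) (fun t t' h h' => ?_) _ J (hJ.trans (hI j)) hJc fun t ht => ?_
    · have := hm' (t - p - 1)
      split_ifs <;> omega
    · have h1 := hm' (t - p - 1)
      have h2 := hm' (t' - p - 1)
      have h3 := hmm (t - p - 1) (t' - p - 1)
      dsimp only [id] at *
      split_ifs <;> omega
    · split_ifs with h1 h2 h3 h4
      · exact ⟨fun h => absurd (h.mono hJ le_rfl) (hlow j t h1), fun h => by omega⟩
      · exact ⟨fun _ => Or.inl h2, fun _ => hJi⟩
      · exact ⟨fun h => absurd h (hm' (t - p - 1) (by omega)).2.2, fun h => by omega⟩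
      · exact ⟨fun _ => Or.inr h4, fun _ => hJi'⟩
      · exact ⟨fun h => absurd (h.mono hJ le_rfl) (hhigh j t (by omega) ht), fun h => by omega⟩
  left
  have hl : l ≤ M₀ + l + l' + 1 := by omega
  by_cases hc : q + 1 < n
  · have hF' := hmin (n - 1) p q (by omega) (by omega) (by omega) (by omega)
    choose I hI hIc hIt using fun j : Fin l => (hF (n - 1) p q (by omega) (by omega)
      (by omega) (fun t => if t ≤ q then t else t + s) (fun t ht => by split_ifs <;> omega)
      (fun t t' h h' => by split_ifs <;> omega) (Fin.castLE hl j)).mpr hF'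
    beta_reduce at hIt
    have hlow : ∀ j, ∀ t < p, ¬ Touch G (I j) {X t} := fun j t ht h => by
      have := hIt j t (by omega)
      rw [if_pos (by omega)] at this
      have := this.mp h
      omega
    have hhigh : ∀ j t, q + 1 < t → t < n → ¬ Touch G (I j) {X (t - 1 + s)} :=
      fun j t ht ht' h => by
        have := hIt j (t - 1) (by omega)
        rw [if_neg (by omega)] at this
        have := this.mp h
        omega
    have hall : ∀ i < s, ∀ j, Touch G {X (q + 1 + i)} (I j) := by
      intro i hi j
      by_contra hnt
      refine hno (fun t => if t ≤ q then t else if t = q + 1 then q + 1 + i else t - 1 + s)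
        (fun t ht => by split_ifs <;> omega) (fun t t' h h' => by split_ifs <;> omega) _ (I j)
        (hI j) (hIc j) fun t ht => ?_
      split_ifs with h1 h2
      · have := hIt j t (by omega)
        rw [if_pos h1] at this
        rw [this]
      · exact ⟨fun h => absurd h.symm hnt, fun h => by omega⟩
      · exact ⟨fun h => absurd h (hhigh j t (by omega) ht), fun h => by omega⟩
    obtain ⟨hcon, hamp⟩ := sub (q + 1) s l (by omega) hl I hI hIc hall id
      Function.injective_id
    refine hcon.hasInterrupted hamp fun i i' i'' hii hii' j J hJ hJc hJi hJi' => ?_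
    by_contra hJi''
    dsimp only [id] at *
    refine hno (fun t => if t < p then t else if t = p then q + 1 + i else if t = q then
        q + 1 + i' else if t = q + 1 then q + 1 + i'' else t - 1 + s)
      (fun t ht => by split_ifs <;> omega) (fun t t' h h' => by split_ifs <;> omega) _ J
      (hJ.trans (hI j)) hJc fun t ht => ?_
    split_ifs with h1 h2 h3 h4
    · exact ⟨fun h => absurd (h.mono hJ le_rfl) (hlow j t h1), fun h => by omega⟩
    · exact ⟨fun _ => Or.inl h2, fun _ => hJi⟩
    · exact ⟨fun _ => Or.inr h3, fun _ => hJi'⟩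
    · exact ⟨fun h => absurd h hJi'', fun h => by omega⟩
    · exact ⟨fun h => absurd (h.mono hJ le_rfl) (hhigh j t (by omega) ht), fun h => by omega⟩
  by_cases ha : 0 < p
  · have hF' := hmin (n - 1) (p - 1) (q - 1) (by omega) (by omega) (by omega) (by omega)
    choose I hI hIc hIt using fun j : Fin l => (hF (n - 1) (p - 1) (q - 1) (by omega) (by omega)
      (by omega) (fun t => if t + 1 < p then t else t + s) (fun t ht => by split_ifs <;> omega)
      (fun t t' h h' => by split_ifs <;> omega) (Fin.castLE hl j)).mpr hF'
    beta_reduce at hIt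
    have hlow : ∀ j t, t + 1 < p → ¬ Touch G (I j) {X t} := fun j t ht h => by
      have := hIt j t (by omega)
      rw [if_pos ht] at this
      have := this.mp h
      omega
    have hall : ∀ i < s, ∀ j, Touch G {X (p - 1 + i)} (I j) := by
      intro i hi j
      by_contra hnt
      refine hno (fun t => if t + 1 < p then t else if t + 1 = p then p - 1 + i else t - 1 + s)
        (fun t ht => by split_ifs <;> omega) (fun t t' h h' => by split_ifs <;> omega) _ (I j)
        (hI j) (hIc j) fun t ht => ?_
      split_ifs with h1 h2
      · exact ⟨fun h => absurd h (hlow j t h1), fun h => by omega⟩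
      · exact ⟨fun h => absurd h.symm hnt, fun h => by omega⟩
      · have := hIt j (t - 1) (by omega)
        rw [if_neg (by omega)] at this
        rw [this]
        omega
    obtain ⟨hcon, hamp⟩ := sub (p - 1) s l (by omega) hl I hI hIc hall Fin.rev
      Fin.rev_injective
    refine hcon.hasInterrupted hamp fun i i' i'' hii hii' j J hJ hJc hJi hJi' => ?_
    by_contra hJi''
    have h1 := Fin.rev_lt_rev.mpr hii
    have h2 := Fin.rev_lt_rev.mpr hii'
    refine hno (fun t => if t + 1 < p then t else if t + 1 = p then p - 1 + i''.rev else
        if t = p then p - 1 + i'.rev else p - 1 + i.rev)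
      (fun t ht => by split_ifs <;> omega) (fun t t' h h' => by split_ifs <;> omega) _ J
      (hJ.trans (hI j)) hJc fun t ht => ?_
    split_ifs with h1 h2 h3
    · exact ⟨fun h => absurd (h.mono hJ le_rfl) (hlow j t h1), fun h => by omega⟩
    · exact ⟨fun h => absurd h hJi'', fun h => by omega⟩
    · exact ⟨fun _ => Or.inl h3, fun _ => hJi'⟩
    · exact ⟨fun _ => by omega, fun _ => hJi⟩
  · exfalso
    refine hno id (fun t ht => by simp; omega) (fun t t' h _ => h) ⟨0, by omega⟩ _ le_rfl
      (hx.1.connB _) fun t ht => ?_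
    have ht' : t < k + s + s' := by omega
    rw [id, hxX t ht']
    exact ⟨fun _ => by omega, fun _ => (hx.1.touch _ _).symm⟩

end Pattern

/-- The conclusion that `G` has an `(s, l)`-constellation. -/
def HasCon {V : Type} (G : SimpleGraph V) (s l : ℕ) : Prop :=
  ∃ (x : Fin s → V) (B : Fin l → Set V), IsCon G x B

/-- A bipartite model whose branch sets are paths, in which every vertex and every edge of a path
touches at most one path of the other side. -/
structure PathModel {V ι κ : Type} (G : SimpleGraph V) (A : ι → Set V) (B : κ → Set V) :
    Prop where
  model : BiModel G A B
  pathA : ∀ i, IsPathSet G (A i)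
  pathB : ∀ j, IsPathSet G (B j)
  ampleB : AmpleCols G A B 2
  ampleA : AmpleCols G B A 2

section PathModel

variable {V ι κ : Type} {G : SimpleGraph V} {A : ι → Set V} {B : κ → Set V}

theorem PathModel.shrink {ι' κ' : Type} (h : PathModel G A B) {f : ι' → ι}
    (hf : Function.Injective f) {g : κ' → κ} (hg : Function.Injective g) {B' : κ' → Set V}
    (hB : ∀ j, B' j ⊆ B (g j)) (hc : ∀ j, Conn G (B' j))
    (ht : ∀ i j, Touch G (A (f i)) (B' j)) : PathModel G (fun i => A (f i)) B' where
  model := h.model.shrink hf hg (fun _ => le_rfl) hB (fun _ => h.model.connA _) hc ht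
  pathA i := h.pathA _
  pathB j := (h.pathB (g j)).of_conn (hc j) (hB j)
  ampleB := h.ampleB.shrink hf g hB
  ampleA i I hI hIc hId j j' hne h1 h2 := h.ampleA (f i) I hI hIc hId _ _ (hg.ne hne)
    (h1.mono le_rfl (hB j)) (h2.mono le_rfl (hB j'))

theorem isCon_of_touch {m k : ℕ} {A : Fin m → Set V} {B : Fin k → Set V} {b : Fin k → V}
    (hA : ∀ i, IsPathSet G (A i)) (hAA : ∀ i i', i ≠ i' → Anticomplete G (A i) (A i'))
    (hBB : ∀ j j', j ≠ j' → Anticomplete G (B j) (B j')) (hb : ∀ j, b j ∈ B j)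
    (hdisj : ∀ i j, Disjoint (A i) (B j)) (ht : ∀ i j, ∃ x ∈ A i, G.Adj (b j) x) :
    IsCon G b A := by
  refine ⟨⟨fun _ => conn_singleton _, fun i => (hA i).conn, ?_, hAA, ?_, ?_⟩, hA⟩
  · exact fun i i' hne => (hBB i i' hne).mono (by simpa using hb i) (by simpa using hb i')
  · exact fun i j => (hdisj j i).symm.mono_left (by simpa using hb i)
  · intro i j
    obtain ⟨x, hx, hadj⟩ := ht j i
    exact ⟨_, rfl, x, hx, hadj⟩

theorem exists_pathModel (n s l p q : ℕ) : ∃ P Q : ℕ, ∀ {V : Type} [Finite V]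
    {G : SimpleGraph V} {A : Fin P → Set V} {B : Fin Q → Set V}, BiModel G A B →
    (∀ i, IsPathSet G (A i)) → (∀ j, IsPathSet G (B j)) →
    SubK G n ∨ HasCon G s l ∨
      ∃ (A' : Fin p → Set V) (B' : Fin q → Set V), PathModel G A' B' := by
  obtain ⟨Q₁, P₁, h₁⟩ := exists_ample_cols 2 n l s q p
  obtain ⟨P, Q, h₂⟩ := exists_ample_cols 2 n l s P₁ Q₁
  refine ⟨P, Q, fun {V _ G A B} h hA hB => ?_⟩
  have conv : ∀ {a b : ℕ} {A : Fin a → Set V} {B : Fin b → Set V}, BiModel G A B →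
      (∀ i, IsPathSet G (A i)) → (∃ (f : Fin l ↪o Fin a) (g : Fin s ↪o Fin b) (x : Fin s → V),
      (∀ j, x j ∈ B (g j)) ∧ ∀ i j, ∃ y ∈ A (f i), G.Adj (x j) y) → HasCon G s l := by
    rintro a b A B h hA ⟨f, g, x, hx, hadj⟩
    exact ⟨x, fun i => A (f i), isCon_of_touch (B := fun j => B (g j)) (fun i => hA _)
      (fun i i' hne => h.antiA _ _ (f.injective.ne hne))
      (fun j j' hne => h.antiB _ _ (g.injective.ne hne)) hx (fun i j => h.disj _ _) hadj⟩
  rcases h₂ P Q le_rfl le_rfl h with h2 | h2 | ⟨f, g, h2⟩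
  · exact Or.inl h2
  · exact Or.inr (Or.inl (conv h hA h2))
  have h' := h.comp f.injective g.injective
  rcases h₁ Q₁ P₁ le_rfl le_rfl h'.swap with h1 | h1 | ⟨g', f', h1⟩
  · exact Or.inl h1
  · exact Or.inr (Or.inl (conv h'.swap (fun _ => hB _) h1))
  · exact Or.inr (Or.inr ⟨_, _, h'.comp f'.injective g'.injective, fun _ => hA _, fun _ => hB _,
      h2.shrink f'.injective g' fun _ => le_rfl, h1⟩)

end PathModel

/-- A path model in which the columns are grouped, with the end `s c j` of each column of group `c`
touching a connected set `T c`, which touches nothing else of the model. -/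
structure Anchored {V : Type} (G : SimpleGraph V) {m h N : ℕ} (T : Fin m → Set V)
    (A : Fin h → Set V) (B : Fin m → Fin N → Set V) (s : Fin m → Fin N → V) : Prop where
  model : PathModel G A (fun cj : Fin m × Fin N => B cj.1 cj.2)
  connT : ∀ c, Conn G (T c)
  antiT : ∀ c c', c ≠ c' → Anticomplete G (T c) (T c')
  antiTA : ∀ c i, Anticomplete G (T c) (A i)
  disjTB : ∀ c c' j, Disjoint (T c) (B c' j)
  s_mem : ∀ c j, s c j ∈ B c j
  touchT : ∀ c j, Touch G {s c j} (T c)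
  eq_of_touch : ∀ c c' j, ∀ v ∈ B c' j, Touch G {v} (T c) → v = s c' j ∧ c' = c
  s_not_touch : ∀ c j i, ¬ Touch G {s c j} (A i)
  s_end : ∀ c j, ∀ u ∈ B c j, ∀ u' ∈ B c j, G.Adj (s c j) u → G.Adj (s c j) u' → u = u'

section Anchored

variable {V ι κ : Type} {G : SimpleGraph V} {A : ι → Set V} {B : κ → Set V}

theorem AmpleCols.eq_of_touch (h : AmpleCols G A B 2) {j : κ} {v : V} (hv : v ∈ B j) {i i' : ι}
    (h1 : Touch G {v} (A i)) (h2 : Touch G {v} (A i')) : i = i' := by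
  by_contra hne
  exact h j {v} (by simpa using hv) (conn_singleton v) (by simp) i i' hne h1 h2

theorem AmpleCols.eq_of_touch_pair (h : AmpleCols G A B 2) {j : κ} {v w : V} (hv : v ∈ B j)
    (hw : w ∈ B j) (hvw : G.Adj v w) {i i' : ι} (h1 : Touch G {v} (A i))
    (h2 : Touch G {w} (A i')) : i = i' := by
  by_contra hne
  have hc : Conn G {v, w} := (conn_singleton w).insert rfl hvw
  refine h j {v, w} ?_ hc (Set.ncard_pair hvw.ne).le i i' hne (h1.mono (by simp) le_rfl)
    (h2.mono (by simp) le_rfl)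
  rintro _ (rfl | rfl)
  exacts [hv, hw]

/-- Shorten a column so that only one end touches some row. -/
theorem PathModel.exists_trim [Nontrivial ι] (h : PathModel G A B) (j : κ) :
    ∃ (i : ι) (S : Set V) (v : V), S ⊆ B j ∧ Conn G S ∧ (∀ i', Touch G (A i') S) ∧ v ∈ S ∧
      (∀ w ∈ S, Touch G {w} (A i) → w = v) ∧ Touch G {v} (A i) ∧
      ∀ u ∈ S, ∀ u' ∈ S, G.Adj v u → G.Adj v u' → u = u' := by
  classical
  obtain ⟨n, q, hq, hB⟩ := isPathSet_iff.mp (h.pathB j)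
  have hex : ∃ k a b, a + k = b ∧ b ≤ n ∧ ∀ i, Touch G (A i) (seg q a b) :=
    ⟨n, 0, n, by omega, le_rfl, fun i => hB ▸ h.model.touch i j⟩
  obtain ⟨a, b, hab, hb, ht⟩ := Nat.find_spec hex
  have hmin := fun k => Nat.find_min hex (m := k)
  generalize Nat.find hex = k at hab hmin
  have hS : seg q a b ⊆ B j := hB ▸ seg_mono (Nat.zero_le a) hb
  have hk : 0 < k := by
    by_contra! hk
    have hba : b = a := by omega
    subst hba
    obtain ⟨i, i', hne⟩ := exists_pair_ne ι
    have hs : seg q b b = {q b} := by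
      ext x
      rw [mem_seg]
      constructor
      · rintro ⟨t, h1, h2, rfl⟩
        rw [show t = b by omega]
        rfl
      · rintro rfl
        exact ⟨b, le_rfl, le_rfl, rfl⟩
    rw [hs] at ht hS
    exact hne (h.ampleB.eq_of_touch (hS rfl) (ht i).symm (ht i').symm)
  have hno : ∃ i, ¬ Touch G (A i) (seg q (a + 1) b) := by
    by_contra! hall
    exact hmin (k - 1) (by omega) ⟨a + 1, b, by omega, hb, hall⟩
  obtain ⟨i, hi⟩ := hno
  have huniq : ∀ w ∈ seg q a b, Touch G {w} (A i) → w = q a := by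
    intro w hw htw
    obtain ⟨t, h1, h2, rfl⟩ := mem_seg.mp hw
    by_contra hne
    have hta : t ≠ a := fun h => hne (by rw [h])
    refine hi (htw.symm.mono le_rfl ?_)
    rw [Set.singleton_subset_iff]
    exact seg_mem (by omega) h2
  refine ⟨i, seg q a b, q a, hS, hq.conn_seg (by omega) hb, ht, seg_mem le_rfl (by omega), huniq,
    ?_, ?_⟩
  · obtain ⟨x, hx, w, hw, hadj⟩ := ht i
    have := huniq w hw ⟨w, rfl, x, hx, hadj.symm⟩
    exact ⟨w, this, x, hx, hadj.symm⟩
  · intro u hu u' hu' h1 h2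
    obtain ⟨t, h3, h4, rfl⟩ := mem_seg.mp hu
    obtain ⟨t', h5, h6, rfl⟩ := mem_seg.mp hu'
    rw [hq.adj_iff (by omega) (by omega)] at h1 h2
    congr 1
    omega

theorem exists_sorted_groups {L k : ℕ} (x : Fin (L * k) → ℕ) (hx : Function.Injective x) :
    ∃ u : Fin L → Fin k → Fin (L * k), (∀ c c' t t', u c t = u c' t' → c = c' ∧ t = t') ∧
      (∀ c c' t t', c < c' → x (u c t) < x (u c' t')) ∧
      ∀ c t t', t ≤ t' → x (u c t) ≤ x (u c t') := by
  have hs : StrictMono (x ∘ Tuple.sort x) :=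
    (Tuple.monotone_sort x).strictMono_of_injective (hx.comp (Tuple.sort x).injective)
  refine ⟨fun c t => Tuple.sort x (finProdFinEquiv (c, t)), ?_, ?_, ?_⟩
  · intro c c' t t' h
    have := finProdFinEquiv.injective ((Tuple.sort x).injective h)
    simpa using this
  · intro c c' t t' h
    refine hs ?_
    rw [Fin.lt_def]
    simp only [finProdFinEquiv_apply_val]
    have : k * (c.1 + 1) ≤ k * c'.1 := Nat.mul_le_mul_left _ h
    have := t.2
    rw [Nat.mul_add] at *
    omega
  · intro c t t' h
    refine hs.monotone ?_
    rw [Fin.le_def]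
    simp only [finProdFinEquiv_apply_val]
    have : t.1 ≤ t'.1 := h
    omega

theorem exists_anchored (s l m h N : ℕ) (hh : 0 < h) : ∃ q : ℕ, ∀ {V : Type}
    {G : SimpleGraph V} {A : Fin (h + 1) → Set V} {B : Fin q → Set V}, PathModel G A B →
    HasCon G s l ∨ ∃ (T : Fin m → Set V) (A' : Fin h → Set V) (B' : Fin m → Fin N → Set V)
      (x : Fin m → Fin N → V), Anchored G T A' B' x := by
  obtain ⟨L, hL⟩ := exists_free_set 1 l m
  obtain ⟨k, hk⟩ := fin_pigeonhole (Set (Fin L)) (N + s + 1)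
  obtain ⟨q, hq⟩ := fin_pigeonhole (Fin (h + 1)) (L * (k + 1))
  refine ⟨q, fun {V G A B} hAB => ?_⟩
  haveI : Nontrivial (Fin (h + 1)) := Fin.nontrivial_iff_two_le.mpr (by omega)
  choose a S v hSB hSc hSt hvS huniq hvt hvend using hAB.exists_trim
  obtain ⟨e, a₀, ha⟩ := hq q le_rfl a
  obtain ⟨n, p, hp, hA₀⟩ := isPathSet_iff.mp (hAB.pathA a₀)
  have hx : ∀ j, ∃ t ≤ n, G.Adj (v (e j)) (p t) := by
    intro j
    obtain ⟨_, rfl, y, hy, hadj⟩ := hvt (e j)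
    rw [ha, hA₀] at hy
    obtain ⟨t, -, ht, rfl⟩ := mem_seg.mp hy
    exact ⟨t, ht, hadj⟩
  choose x hxn hxadj using hx
  have hpA : ∀ t ≤ n, p t ∈ A a₀ := fun t ht => hA₀ ▸ seg_mem (Nat.zero_le t) ht
  have htouch : ∀ j, Touch G {p (x j)} (B (e j)) := fun j =>
    ⟨_, rfl, _, hSB _ (hvS _), (hxadj j).symm⟩
  have hxne : ∀ j j', j ≠ j' → x j ≠ x j' := fun j j' hne he =>
    hne (e.injective (hAB.ampleA.eq_of_touch (hpA _ (hxn j)) (htouch j)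
      (by rw [he]; exact htouch j')))
  have hxne' : ∀ j j', j ≠ j' → x j + 1 ≠ x j' := fun j j' hne he =>
    hne (e.injective (hAB.ampleA.eq_of_touch_pair (hpA _ (hxn j)) (hpA _ (hxn j'))
      ((hp.adj_iff (hxn j) (hxn j')).mpr (Or.inl he)) (htouch j) (htouch j')))
  obtain ⟨u, hu, hult, hule⟩ := exists_sorted_groups x
    (fun j j' he => by by_contra hne; exact hxne j j' hne he)
  let D : Fin L → Set V := fun c => seg p (x (u c 0)) (x (u c (Fin.last k)))
  have hDA : ∀ c, D c ⊆ A a₀ := fun c => hA₀ ▸ seg_mono (Nat.zero_le _) (hxn _)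
  have hDc : ∀ c, IsPathSet G (D c) := fun c =>
    hp.isPathSet_seg (hule _ _ _ (Fin.zero_le _)) (hxn _)
  have hDlt : ∀ c c', c < c' → Anticomplete G (D c) (D c') := by
    intro c c' hcc
    have hne : u c (Fin.last k) ≠ u c' 0 := fun h => hcc.ne (hu _ _ _ _ h).1
    have h1 := hult c c' (Fin.last k) 0 hcc
    have h2 := hxne' _ _ hne
    exact hp.anticomplete_seg (by omega) (hxn _)
  have hDD : ∀ c c', c ≠ c' → Anticomplete G (D c) (D c') := by
    intro c c' hne
    rcases lt_or_gt_of_ne hne with h | h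
    · exact hDlt c c' h
    · exact (hDlt c' c h).symm
  have hDt : ∀ c t, Touch G {v (e (u c t))} (D c) := fun c t =>
    ⟨_, rfl, _, seg_mem (hule _ _ _ (Fin.zero_le t)) (hule _ _ _ (Fin.le_last t)), hxadj _⟩
  choose f E hE using fun c => hk (k + 1) (by omega)
    fun t => {c' | Touch G {v (e (u c t))} (D c')}
  have hinj : ∀ c c' t t', e (u c (f c t)) = e (u c' (f c' t')) → c = c' ∧ t = t' := by
    intro c c' t t' he
    obtain ⟨rfl, h⟩ := hu _ _ _ _ (e.injective he)
    exact ⟨rfl, (f c).injective h⟩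
  by_cases hbig : ∃ c, l ≤ (E c).ncard
  · left
    obtain ⟨c, hc⟩ := hbig
    obtain ⟨w, hw⟩ := exists_orderEmb_of_ncard hc
    let g : Fin s → Fin (N + s + 1) := Fin.castLE (by omega)
    refine ⟨fun j => v (e (u c (f c (g j)))), fun i => D (w i),
      isCon_of_touch (B := fun j => B (e (u c (f c (g j))))) (fun i => hDc _)
      (fun i i' hne => hDD _ _ (w.injective.ne hne)) (fun j j' hne => ?_)
      (fun j => hSB _ (hvS _)) (fun i j => (hAB.model.disj a₀ _).mono_left (hDA _)) ?_⟩
    · exact hAB.model.antiB _ _ fun h => hne (Fin.castLE_injective _ (hinj _ _ _ _ h).2)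
    · intro i j
      have h1 := hw i
      rw [← hE c (g j)] at h1
      obtain ⟨_, rfl, y, hy, hadj⟩ := h1
      exact ⟨y, hy, hadj⟩
  right
  push Not at hbig
  obtain ⟨w, hw⟩ := hL L le_rfl (fun M => ⋃ c ∈ M, E c) fun M hM => by
    obtain ⟨c, rfl⟩ := Finset.card_eq_one.mp hM
    simpa using (hbig c).le
  let g : Fin N → Fin (N + s + 1) := Fin.castLE (by omega)
  have hfree : ∀ c c' j, Touch G {v (e (u (w c') (f (w c') (g j))))} (D (w c)) → c' = c := by
    intro c c' j ht
    have h1 : w c ∈ E (w c') := by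
      rw [← hE (w c') (g j)]
      exact ht
    have := hw {c'} (by simp) c (by simpa using h1)
    exact (Finset.mem_singleton.mp this).symm
  have hpm := hAB.shrink (f := a₀.succAbove) Fin.succAbove_right_injective
    (g := fun cj : Fin m × Fin N => e (u (w cj.1) (f (w cj.1) (g cj.2))))
    (fun cj cj' h => by
      obtain ⟨h1, h2⟩ := hinj _ _ _ _ h
      exact Prod.ext (w.injective h1) (Fin.castLE_injective _ h2))
    (B' := fun cj => S (e (u (w cj.1) (f (w cj.1) (g cj.2))))) (fun _ => hSB _) (fun _ => hSc _)
    (fun _ _ => hSt _ _)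
  refine ⟨fun c => D (w c), fun i => A (a₀.succAbove i),
    fun c j => S (e (u (w c) (f (w c) (g j)))), fun c j => v (e (u (w c) (f (w c) (g j)))),
    hpm, fun c => (hDc _).conn, fun c c' hne => hDD _ _ (w.injective.ne hne), ?_, ?_, ?_, ?_, ?_,
    ?_, ?_⟩
  · exact fun c i => (hAB.model.antiA _ _ (Fin.succAbove_ne a₀ i).symm).mono (hDA _) le_rfl
  · exact fun c c' j => (hAB.model.disj a₀ _).mono (hDA _) (hSB _)
  · exact fun c j => hvS _
  · exact fun c j => hDt _ _
  · intro c c' j y hy ht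
    have hy' := huniq _ y hy (by rw [ha]; exact ht.mono le_rfl (hDA _))
    subst hy'
    exact ⟨rfl, hfree _ _ _ ht⟩
  · intro c j i ht
    have h1 := hvt (e (u (w c) (f (w c) (g j))))
    rw [ha] at h1
    exact Fin.succAbove_ne a₀ i (hAB.ampleB.eq_of_touch (hSB _ (hvS _)) ht h1)
  · exact fun c j => hvend _

end Anchored

/-- There are `k` pairwise disjoint connected sets in `Ω`, each meeting `X` and `Y`. -/
def Linked {W : Type} (H : SimpleGraph W) (Ω X Y : Set W) (k : ℕ) : Prop :=
  ∃ P : Fin k → Set W, (∀ i, Conn H (P i) ∧ P i ⊆ Ω ∧ (P i ∩ X).Nonempty ∧ (P i ∩ Y).Nonempty) ∧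
    ∀ i j, i ≠ j → Disjoint (P i) (P j)

/-- No set of fewer than `k` vertices separates `X` from `Y` inside `Ω`. -/
def Unseparated {W : Type} (H : SimpleGraph W) (Ω X Y : Set W) (k : ℕ) : Prop :=
  ∀ S : Set W, S.ncard < k → ∃ Z, Conn H Z ∧ Z ⊆ Ω \ S ∧ (Z ∩ X).Nonempty ∧ (Z ∩ Y).Nonempty

section Menger

variable {W : Type} {H H' : SimpleGraph W}

theorem Conn.of_adj {S : Set W} (h : Conn H S) (hH : ∀ u ∈ S, ∀ v ∈ S, H.Adj u v → H'.Adj u v) :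
    Conn H' S :=
  ⟨h.1, fun T hT hST => h.2 T hT fun x hx hxT y hy hxy => hST x hx hxT y hy (hH x hx y hy hxy)⟩

theorem deleteEdge_adj {x y u v : W} (h : H.Adj u v) (hne : ¬ (u = x ∧ v = y))
    (hne' : ¬ (u = y ∧ v = x)) : (H.deleteEdges {s(x, y)}).Adj u v := by
  rw [deleteEdges_adj]
  refine ⟨h, ?_⟩
  simp only [Set.mem_singleton_iff, Sym2.eq_iff]
  tauto

theorem Conn.deleteEdge {S : Set W} {x y : W} (h : Conn H S) (hxy : ¬ (x ∈ S ∧ y ∈ S)) :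
    Conn (H.deleteEdges {s(x, y)}) S := by
  refine h.of_adj fun u hu v hv huv => deleteEdge_adj huv ?_ ?_
  · rintro ⟨rfl, rfl⟩
    exact hxy ⟨hu, hv⟩
  · rintro ⟨rfl, rfl⟩
    exact hxy ⟨hv, hu⟩

/-- If `S` separates `X` from `Y` after the removal of the edge `xy`, with `y` on the side of `Y`,
then linking `X` to `S ∪ {x}` is as hard as linking `X` to `Y`. -/
theorem exists_half_linkage [Finite W] {Ω X Y S : Set W} {x y : W} {k : ℕ} (hxy : H.Adj x y)
    (hS : S.ncard < k)
    (hsep : ∀ Z, Conn (H.deleteEdges {s(x, y)}) Z → Z ⊆ Ω \ S → (Z ∩ X).Nonempty →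
      ¬ (Z ∩ Y).Nonempty)
    (hy : ∃ Z, Conn (H.deleteEdges {s(x, y)}) Z ∧ Z ⊆ Ω \ S ∧ y ∈ Z ∧ (Z ∩ Y).Nonempty)
    (hun : Unseparated H Ω X Y k)
    (ih : Unseparated (H.deleteEdges {s(x, y)}) Ω X (insert x S) k →
      Linked (H.deleteEdges {s(x, y)}) Ω X (insert x S) k) :
    ∃ (s : Fin k → W) (A : Fin k → Set W), (∀ i, Conn (H.deleteEdges {s(x, y)}) (A i)) ∧
      (∀ i, A i ⊆ Ω) ∧ (∀ i, (A i ∩ X).Nonempty) ∧ (∀ i, s i ∈ A i) ∧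
      (∀ i, ∀ v ∈ A i, v ≠ s i → v ∉ insert x S ∧
        ∃ Z, Conn (H.deleteEdges {s(x, y)}) Z ∧ Z ⊆ Ω \ S ∧ v ∈ Z ∧ (Z ∩ X).Nonempty) ∧
      (∀ i j, i ≠ j → Disjoint (A i) (A j)) ∧ (∀ i, s i ∈ insert x S) ∧
      ∀ t ∈ insert x S, ∃ i, s i = t := by
  classical
  set H' := H.deleteEdges {s(x, y)} with hH'
  have hhit : ∀ Z, Conn H Z → Z ⊆ Ω → (Z ∩ X).Nonempty → (Z ∩ Y).Nonempty →
      (Z ∩ insert x S).Nonempty := by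
    intro Z hZ hZΩ hZX hZY
    by_contra hne
    rw [Set.not_nonempty_iff_eq_empty] at hne
    have hnot : ∀ v ∈ Z, v ∉ insert x S := fun v hv hv' =>
      Set.notMem_empty v (hne ▸ ⟨hv, hv'⟩)
    exact hsep Z (hZ.deleteEdge fun h => hnot x h.1 (Set.mem_insert _ _))
      (fun v hv => ⟨hZΩ hv, fun h => hnot v hv (Set.mem_insert_of_mem _ h)⟩) hZX hZY
  have hcard : (insert x S).ncard = k := by
    refine le_antisymm ((Set.ncard_insert_le x S).trans hS) ?_
    by_contra hlt
    obtain ⟨Z, hZ, hZs, hZX, hZY⟩ := hun (insert x S) (by omega)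
    obtain ⟨v, hv, hv'⟩ := hhit Z hZ (fun v hv => (hZs hv).1) hZX hZY
    exact (hZs hv).2 hv'
  obtain ⟨Zy, hZy, hZyΩ, hyZ, hZyY⟩ := hy
  obtain ⟨P, hP, hPd⟩ := ih fun T hT => by
    obtain ⟨Z, hZ, hZT, hZX, hZY⟩ := hun T hT
    obtain ⟨n, p, hp, hpZ, hp0, hpn, -, hpl⟩ :=
      hZ.exists_indPath hZX (hhit Z hZ (fun v hv => (hZT hv).1) hZX hZY)
    refine ⟨seg p 0 n, (hp.conn_seg (Nat.zero_le _) le_rfl).deleteEdge ?_, ?_,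
      ⟨p 0, seg_mem le_rfl (Nat.zero_le _), hp0⟩, ⟨p n, seg_mem (Nat.zero_le _) le_rfl, hpn⟩⟩
    · rintro ⟨hx, hy⟩
      obtain ⟨i, hi, hix⟩ := hx
      obtain ⟨j, hj, hjy⟩ := hy
      have hin : i = n := hpl i hi.2 (hix ▸ Set.mem_insert _ _)
      have hjn : j ≠ n := fun h => hxy.ne (by rw [← hix, ← hjy, hin, h])
      have hc : Conn H' (seg p 0 j) := (hp.conn_seg (Nat.zero_le _) hj.2).deleteEdge fun h => by
        have := (hp.mem_seg_iff hi.2 hj.2).mp (hix ▸ h.1)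
        have := hj.2
        omega
      refine hsep (seg p 0 j ∪ Zy)
        (hc.union hZy (Or.inl ⟨p j, seg_mem (Nat.zero_le _) le_rfl, hjy ▸ hyZ⟩))
        (Set.union_subset ?_ hZyΩ) ⟨p 0, Or.inl (seg_mem le_rfl (Nat.zero_le _)), hp0⟩
        (hZyY.mono (Set.inter_subset_inter_left _ Set.subset_union_right))
      rintro _ ⟨a, ha, rfl⟩
      refine ⟨(hZT (hpZ a (ha.2.trans hj.2))).1, fun h => ?_⟩
      have := hpl a (ha.2.trans hj.2) (Set.mem_insert_of_mem _ h)
      have := ha.2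
      have := hj.2
      omega
    · rintro _ ⟨a, ha, rfl⟩
      exact hZT (hpZ a ha.2)
  choose hPc hPΩ hPX hPS using hP
  choose n p hp hpP hp0 hpn _ hpl using fun i => (hPc i).exists_indPath (hPX i) (hPS i)
  have hsub : ∀ i, seg (p i) 0 (n i) ⊆ P i := by
    rintro i _ ⟨a, ha, rfl⟩
    exact hpP i a ha.2
  have hsinj : Function.Injective fun i => p i (n i) := by
    intro i j hij
    by_contra hne
    refine Set.disjoint_left.mp (hPd i j hne) (hpP i _ le_rfl) ?_
    beta_reduce at hij
    rw [hij]
    exact hpP j _ le_rfl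
  refine ⟨fun i => p i (n i), fun i => seg (p i) 0 (n i), fun i => (hp i).conn_seg (Nat.zero_le _) le_rfl,
    fun i => (hsub i).trans (hPΩ i), fun i => ⟨p i 0, seg_mem le_rfl (Nat.zero_le _), hp0 i⟩,
    fun i => seg_mem (Nat.zero_le _) le_rfl, ?_, fun i j hij => (hPd i j hij).mono (hsub i) (hsub j),
    hpn, ?_⟩
  · rintro i _ ⟨a, ha, rfl⟩ hne
    have hlt : a < n i := lt_of_le_of_ne ha.2 fun h => hne (by rw [h])
    have hout : ∀ b ≤ a, p i b ∉ insert x S := fun b hb hbS => by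
      have := hpl i b (hb.trans ha.2) hbS
      omega
    refine ⟨hout a le_rfl, seg (p i) 0 a, (hp i).conn_seg (Nat.zero_le _) ha.2, ?_,
      seg_mem (Nat.zero_le _) le_rfl, ⟨p i 0, seg_mem le_rfl (Nat.zero_le _), hp0 i⟩⟩
    rintro _ ⟨b, hb, rfl⟩
    exact ⟨hPΩ i (hpP i b (hb.2.trans ha.2)), fun h => hout b hb.2 (Set.mem_insert_of_mem _ h)⟩
  · intro t ht
    have hr : Set.range (fun i => p i (n i)) = insert x S := by
      refine Set.eq_of_subset_of_ncard_le ?_ ?_ (Set.toFinite _)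
      · rintro _ ⟨i, rfl⟩
        exact hpn i
      · rw [hcard, ← Set.image_univ, Set.ncard_image_of_injective _ hsinj, Set.ncard_univ,
          Nat.card_fin]
    rw [← hr] at ht
    exact ht

/-- Menger's theorem for two sets of vertices. -/
theorem linked_of_unseparated [Finite W] (Ω : Set W) (k : ℕ) (H : SimpleGraph W) (X Y : Set W)
    (h : Unseparated H Ω X Y k) : Linked H Ω X Y k := by
  classical
  induction hm : H.edgeSet.ncard using Nat.strong_induction_on generalizing H X Y with
  | _ m ih =>
  by_cases hE : ∃ a b, H.Adj a b
  swap
  · have hle : k ≤ (Ω ∩ X ∩ Y).ncard := by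
      by_contra hlt
      obtain ⟨Z, hZ, hZs, ⟨x, hxZ, hxX⟩, y, hyZ, hyY⟩ := h (Ω ∩ X ∩ Y) (by omega)
      have hZx : Z ⊆ {x} := hZ.2 {x} ⟨x, hxZ, rfl⟩ fun u _ _ v _ huv => (hE ⟨u, v, huv⟩).elim
      obtain rfl : y = x := hZx hyZ
      exact (hZs hxZ).2 ⟨⟨(hZs hxZ).1, hxX⟩, hyY⟩
    obtain ⟨T, hT, hTk⟩ := Set.exists_subset_card_eq hle
    have : Finite T := Set.toFinite T
    obtain ⟨e⟩ : Nonempty (Fin k ≃ T) := by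
      refine ⟨(Finite.equivFinOfCardEq ?_).symm⟩
      rw [Nat.card_coe_set_eq, hTk]
    refine ⟨fun i => {(e i : W)}, fun i => ⟨conn_singleton _, ?_, ?_, ?_⟩, fun i j hij => ?_⟩
    · exact Set.singleton_subset_iff.mpr (hT (e i).2).1.1
    · exact ⟨_, rfl, (hT (e i).2).1.2⟩
    · exact ⟨_, rfl, (hT (e i).2).2⟩
    · rw [Set.disjoint_singleton]
      exact fun he => hij (e.injective (Subtype.ext he))
  obtain ⟨a, b, hab⟩ := hE
  have hlt : ∀ {a b}, H.Adj a b → (H.deleteEdges {s(a, b)}).edgeSet.ncard < m := by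
    intro a b hab
    rw [← hm]
    refine Set.ncard_lt_ncard ?_ (Set.toFinite _)
    rw [edgeSet_deleteEdges]
    exact ⟨Set.sdiff_subset, fun hs => (hs ((mem_edgeSet H).mpr hab)).2 rfl⟩
  have hup : ∀ {a b} {Z : Set W}, Conn (H.deleteEdges {s(a, b)}) Z → Conn H Z := fun hZ =>
    hZ.of_adj fun u _ v _ huv => (deleteEdges_adj.mp huv).1
  by_cases hun : Unseparated (H.deleteEdges {s(a, b)}) Ω X Y k
  · obtain ⟨P, hP, hPd⟩ := ih _ (hlt hab) _ _ _ hun rfl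
    exact ⟨P, fun i => ⟨hup (hP i).1, (hP i).2⟩, hPd⟩
  obtain ⟨S, hS, hsep⟩ : ∃ S : Set W, S.ncard < k ∧ ∀ Z, Conn (H.deleteEdges {s(a, b)}) Z →
      Z ⊆ Ω \ S → (Z ∩ X).Nonempty → ¬ (Z ∩ Y).Nonempty := by
    unfold Unseparated at hun
    push Not at hun
    obtain ⟨S, hS, hs⟩ := hun
    refine ⟨S, hS, fun Z hZ hZS hZX => ?_⟩
    rw [Set.not_nonempty_iff_eq_empty]
    exact hs Z hZ hZS hZX
  obtain ⟨x, y, hxy, he, ⟨Zx, hZx, hZxS, hxZ, hZxX⟩, ⟨Zy, hZy, hZyS, hyZ, hZyY⟩⟩ : ∃ x y,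
      H.Adj x y ∧ s(a, b) = s(x, y) ∧
      (∃ Z, Conn (H.deleteEdges {s(x, y)}) Z ∧ Z ⊆ Ω \ S ∧ x ∈ Z ∧ (Z ∩ X).Nonempty) ∧
      ∃ Z, Conn (H.deleteEdges {s(x, y)}) Z ∧ Z ⊆ Ω \ S ∧ y ∈ Z ∧ (Z ∩ Y).Nonempty := by
    obtain ⟨Z, hZ, hZS, hZX, hZY⟩ := h S hS
    obtain ⟨n, p, hp, hpZ, hp0, hpn, -, -⟩ := hZ.exists_indPath hZX hZY
    have hpS : ∀ i j, j ≤ n → seg p i j ⊆ Ω \ S := by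
      rintro i j hj _ ⟨c, hc, rfl⟩
      exact hZS (hpZ c (hc.2.trans hj))
    obtain ⟨i, hi, hei⟩ : ∃ i, i < n ∧ s(a, b) = s(p i, p (i + 1)) := by
      by_contra! hno
      refine hsep (seg p 0 n) ((hp.conn_seg (Nat.zero_le _) le_rfl).of_adj ?_) (hpS 0 n le_rfl)
        ⟨p 0, seg_mem le_rfl (Nat.zero_le _), hp0⟩ ⟨p n, seg_mem (Nat.zero_le _) le_rfl, hpn⟩
      rintro _ ⟨i, hi, rfl⟩ _ ⟨j, hj, rfl⟩ hij
      rw [deleteEdges_adj]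
      refine ⟨hij, fun h => ?_⟩
      rw [Set.mem_singleton_iff] at h
      rcases (hp.adj_iff hi.2 hj.2).mp hij with rfl | rfl
      · exact hno i hj.2 h.symm
      · exact hno j hi.2 (h.symm.trans Sym2.eq_swap)
    have hnx : ∀ {u v}, u ≤ v → v ≤ n → (v ≤ i ∨ i + 1 ≤ u) →
        Conn (H.deleteEdges {s(p i, p (i + 1))}) (seg p u v) := fun {u v} huv hv h' =>
      (hp.conn_seg huv hv).deleteEdge fun hh => by
        have h1 := (hp.mem_seg_iff (by omega) hv).mp hh.1
        have h2 := (hp.mem_seg_iff (by omega) hv).mp hh.2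
        omega
    refine ⟨p i, p (i + 1), hp.adj_succ hi, hei, ?_, ?_⟩
    · exact ⟨seg p 0 i, hnx (Nat.zero_le _) hi.le (Or.inl le_rfl), hpS _ _ hi.le,
        seg_mem (Nat.zero_le _) le_rfl, ⟨p 0, seg_mem le_rfl (Nat.zero_le _), hp0⟩⟩
    · exact ⟨seg p (i + 1) n, hnx hi le_rfl (Or.inr le_rfl), hpS _ _ le_rfl,
        seg_mem le_rfl hi, ⟨p n, seg_mem hi le_rfl, hpn⟩⟩
  rw [he] at hsep
  have hunsym : Unseparated H Ω Y X k := fun T hT => by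
    obtain ⟨Z, hZ, hZT, hZX, hZY⟩ := h T hT
    exact ⟨Z, hZ, hZT, hZY, hZX⟩
  obtain ⟨s, A, hA, hAΩ, hAX, hsA, hAS, hAd, hs, hsurj⟩ := exists_half_linkage hxy hS hsep
    ⟨Zy, hZy, hZyS, hyZ, hZyY⟩ h fun hu => ih _ (hlt hxy) _ _ _ hu rfl
  have hswap : H.deleteEdges {s(y, x)} = H.deleteEdges {s(x, y)} := by rw [Sym2.eq_swap]
  obtain ⟨t, B, hB, hBΩ, hBX, htB, hBS, hBd, ht, htsurj⟩ := exists_half_linkage (Ω := Ω) (X := Y)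
    (Y := X) (S := S) hxy.symm hS (fun Z hZ hZS hZX hZY => hsep Z (hswap ▸ hZ) hZS hZY hZX)
    ⟨Zx, hswap ▸ hZx, hZxS, hxZ, hZxX⟩ hunsym fun hu => ih _ (hlt hxy.symm) _ _ _ hu rfl
  rw [hswap] at hB hBS
  have hyS : y ∉ S := (hZyS hyZ).2
  have hxS : x ∉ S := (hZxS hxZ).2
  have hsepU : ∀ Z Z', Conn (H.deleteEdges {s(x, y)}) Z → Conn (H.deleteEdges {s(x, y)}) Z' →
      Z ⊆ Ω \ S → Z' ⊆ Ω \ S → (Z ∩ X).Nonempty → (Z' ∩ Y).Nonempty → ∀ v ∈ Z, v ∉ Z' :=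
    fun Z Z' hZ hZ' hZS hZS' hZX hZY v hv hv' =>
      hsep (Z ∪ Z') (hZ.union hZ' (Or.inl ⟨v, hv, hv'⟩)) (Set.union_subset hZS hZS')
        (hZX.mono (Set.inter_subset_inter_left _ Set.subset_union_left))
        (hZY.mono (Set.inter_subset_inter_left _ Set.subset_union_right))
  have hmeet : ∀ i j, ∀ v ∈ A i, v ∈ B j → v ∈ S ∧ v = s i ∧ v = t j := by
    intro i j v hv hv'
    by_cases h1 : v = s i
    · by_cases h2 : v = t j
      · have h3 := hs i
        have h4 := ht j
        rw [← h1] at h3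
        rw [← h2] at h4
        rcases h3 with rfl | h3
        · rcases h4 with h4 | h4
          · exact (hxy.ne h4).elim
          · exact ⟨h4, h1, h2⟩
        · exact ⟨h3, h1, h2⟩
      · obtain ⟨h3, Z, hZ, hZS, hvZ, hZY⟩ := hBS j v hv' h2
        have h4 := hs i
        rw [← h1] at h4
        rcases h4 with rfl | h4
        · exact (hsepU Zx Z hZx hZ hZxS hZS hZxX hZY _ hxZ hvZ).elim
        · exact (h3 (Set.mem_insert_of_mem _ h4)).elim
    · obtain ⟨h3, Z, hZ, hZS, hvZ, hZX⟩ := hAS i v hv h1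
      by_cases h2 : v = t j
      · have h4 := ht j
        rw [← h2] at h4
        rcases h4 with rfl | h4
        · exact (hsepU Z Zy hZ hZy hZS hZyS hZX hZyY _ hvZ hyZ).elim
        · exact (h3 (Set.mem_insert_of_mem _ h4)).elim
      · obtain ⟨_, Z', hZ', hZS', hvZ', hZY⟩ := hBS j v hv' h2
        exact (hsepU Z Z' hZ hZ' hZS hZS' hZX hZY _ hvZ hvZ').elim
  have hmatch : ∀ i, ∃ j, (s i = t j ∧ s i ∈ S) ∨ (s i = x ∧ t j = y) := by
    intro i
    rcases hs i with h1 | h1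
    · obtain ⟨j, hj⟩ := htsurj y (Set.mem_insert _ _)
      exact ⟨j, Or.inr ⟨h1, hj⟩⟩
    · obtain ⟨j, hj⟩ := htsurj (s i) (Set.mem_insert_of_mem _ h1)
      exact ⟨j, Or.inl ⟨hj.symm, h1⟩⟩
  choose φ hφ using hmatch
  have hsinj : ∀ i i', s i = s i' → i = i' := by
    intro i i' hii
    by_contra hne
    exact Set.disjoint_left.mp (hAd i i' hne) (hsA i) (hii ▸ hsA i')
  have htinj : ∀ j j', t j = t j' → j = j' := by
    intro i i' hii
    by_contra hne
    exact Set.disjoint_left.mp (hBd i i' hne) (htB i) (hii ▸ htB i')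
  have hφinj : ∀ i i', φ i = φ i' → i = i' := by
    intro i i' hii
    have h1 := hφ i'
    rw [← hii] at h1
    rcases hφ i with ⟨h2, h3⟩ | ⟨h2, h3⟩ <;> rcases h1 with ⟨h4, h5⟩ | ⟨h4, h5⟩
    · exact hsinj _ _ (h2.trans h4.symm)
    · exact (hyS (h5 ▸ h2 ▸ h3)).elim
    · exact (hyS (h3 ▸ h4 ▸ h5)).elim
    · exact hsinj _ _ (h2.trans h4.symm)
  have hcross : ∀ i i', i ≠ i' → Disjoint (A i) (B (φ i')) := by
    refine fun i i' hne => Set.disjoint_left.mpr fun v hv hv' => ?_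
    obtain ⟨h1, h2, h3⟩ := hmeet i _ v hv hv'
    rcases hφ i' with ⟨h4, h5⟩ | ⟨h4, h5⟩
    · exact hne (hsinj _ _ (by rw [← h2, h3, h4]))
    · exact hyS (h5 ▸ h3 ▸ h1)
  refine ⟨fun i => A i ∪ B (φ i), fun i => ⟨(hup (hA i)).union (hup (hB _)) ?_,
    Set.union_subset (hAΩ i) (hBΩ _),
    (hAX i).mono (Set.inter_subset_inter_left _ Set.subset_union_left),
    (hBX _).mono (Set.inter_subset_inter_left _ Set.subset_union_right)⟩, fun i i' hne => ?_⟩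
  · rcases hφ i with ⟨h2, h3⟩ | ⟨h2, h3⟩
    · exact Or.inl ⟨s i, hsA i, h2 ▸ htB _⟩
    · exact Or.inr ⟨s i, hsA i, t (φ i), htB _, by rw [h2, h3]; exact hxy⟩
  · rw [Set.disjoint_union_left, Set.disjoint_union_right, Set.disjoint_union_right]
    exact ⟨⟨hAd i i' hne, hcross i i' hne⟩, (hcross i' i hne.symm).symm,
      hBd _ _ fun h => hne (hφinj _ _ h)⟩

end Menger

/-- Outside the independent set `K`, all degrees are at most two. -/
structure ThinOff {W : Type} (H : SimpleGraph W) (K : Set W) : Prop where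
  indep : ∀ u ∈ K, ∀ v ∈ K, ¬ H.Adj u v
  deg : ∀ v ∉ K, {u | H.Adj v u}.ncard ≤ 2

/-- All neighbors of the vertices of `S` outside `K` are in `S`. -/
def ClosedOff {W : Type} (H : SimpleGraph W) (K S : Set W) : Prop :=
  ∀ v ∈ S, v ∉ K → ∀ u, H.Adj v u → u ∈ S

/-- The vertices of `X` are outside `K` and have degree at most one. -/
def Terminal {W : Type} (H : SimpleGraph W) (K X : Set W) : Prop :=
  ∀ x ∈ X, x ∉ K ∧ {u | H.Adj x u}.ncard ≤ 1

/-- Disjoint paths from `X` to `Y` in `Ω`. -/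
structure Linkage {W : Type} (H : SimpleGraph W) (Ω X Y : Set W) {n : ℕ} (len : Fin n → ℕ)
    (q : Fin n → ℕ → W) : Prop where
  path : ∀ c, IndPath H (len c) (q c)
  mem : ∀ c, ∀ i ≤ len c, q c i ∈ Ω
  fst_mem : ∀ c, q c 0 ∈ X
  last_mem : ∀ c, q c (len c) ∈ Y
  ne : ∀ c c', c ≠ c' → ∀ i ≤ len c, ∀ i' ≤ len c', q c i ≠ q c' i'

/-- Columns and rows in which the rows visit all the columns in the same order. -/
structure Slab {W : Type} (H : SimpleGraph W) (K : Set W) {h R : ℕ} (len : Fin h → ℕ)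
    (q : Fin h → ℕ → W) (ρ : Fin R → Set W) : Prop where
  path : ∀ c, IndPath H (len c) (q c)
  closedCol : ∀ c, ClosedOff H K (seg (q c) 0 (len c))
  ne : ∀ c c', c ≠ c' → ∀ i ≤ len c, ∀ i' ≤ len c', q c i ≠ q c' i'
  conn : ∀ t, Conn H (ρ t)
  closedRow : ∀ t, ClosedOff H K (ρ t)
  disj : ∀ t t', t ≠ t' → Disjoint (ρ t) (ρ t')
  meets : ∀ t c, ∃ i ≤ len c, q c i ∈ ρ t
  aligned : ∀ t t', t < t' → ∀ c, ∀ i ≤ len c, ∀ i' ≤ len c, q c i ∈ ρ t → q c i' ∈ ρ t' → i < i'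

section Cut

variable {W : Type} {H : SimpleGraph W} {K Ω X Y : Set W}

theorem ClosedOff.anticomplete {S T : Set W} (hS : ClosedOff H K S) (hT : ClosedOff H K T)
    (hH : ThinOff H K) (hd : Disjoint S T) : Anticomplete H S T := by
  refine ⟨hd, fun u hu v hv huv => ?_⟩
  by_cases hK : u ∈ K
  · have hv' : v ∉ K := fun h => hH.indep u hK v h huv
    exact Set.disjoint_left.mp hd hu (hT v hv hv' u huv.symm)
  · exact Set.disjoint_left.mp hd (hS u hu hK v huv) hv

theorem IndPath.closedOff [Finite W] {n : ℕ} {p : ℕ → W} (hp : IndPath H n p) (hn : 0 < n)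
    (hH : ThinOff H K) (h0 : p 0 ∈ K ∨ {u | H.Adj (p 0) u}.ncard ≤ 1)
    (h1 : p n ∈ K ∨ {u | H.Adj (p n) u}.ncard ≤ 1) : ClosedOff H K (seg p 0 n) := by
  rintro _ ⟨i, ⟨-, hi⟩, rfl⟩ hiK u hu
  by_contra hus
  have key : ∀ j ≤ n, H.Adj (p i) (p j) → ¬ {u | H.Adj (p i) u}.ncard ≤ 1 := fun j hj hij h => by
    have := (Set.ncard_le_one (Set.toFinite _)).mp h u hu (p j) hij
    exact hus (this ▸ seg_mem (Nat.zero_le _) hj)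
  rcases Nat.eq_zero_or_pos i with rfl | hi0
  · exact key 1 hn (hp.adj_succ hn) (h0.resolve_left hiK)
  rcases eq_or_lt_of_le hi with rfl | hin
  · refine key (i - 1) (by omega) ?_ (h1.resolve_left hiK)
    rw [hp.adj_iff le_rfl (by omega)]
    omega
  · have h2 : ({u, p (i - 1), p (i + 1)} : Set W).ncard = 3 := by
      rw [Set.ncard_eq_three]
      refine ⟨_, _, _, ?_, ?_, ?_, rfl⟩
      · rintro rfl
        exact hus (seg_mem (Nat.zero_le _) (by omega))
      · rintro rfl
        exact hus (seg_mem (Nat.zero_le _) (by omega))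
      · intro h
        have := hp.inj (by omega) (by omega) h
        omega
    have h3 : ({u, p (i - 1), p (i + 1)} : Set W) ⊆ {u | H.Adj (p i) u} := by
      rintro v (rfl | rfl | rfl)
      · exact hu
      · rw [Set.mem_ofPred_eq, hp.adj_iff hi (by omega)]
        omega
      · exact hp.adj_succ hin
    have := Set.ncard_le_ncard h3 (Set.toFinite _)
    have := hH.deg _ hiK
    omega

theorem Linkage.closedOff [Finite W] {n : ℕ} {len : Fin n → ℕ} {q : Fin n → ℕ → W}
    (h : Linkage H Ω X Y len q) (hH : ThinOff H K) (hX : Terminal H K X) (hY : Terminal H K Y)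
    (hXY : Disjoint X Y) (c : Fin n) : ClosedOff H K (seg (q c) 0 (len c)) := by
  refine (h.path c).closedOff ?_ hH (Or.inr (hX _ (h.fst_mem c)).2) (Or.inr (hY _ (h.last_mem c)).2)
  by_contra h0
  have h1 := h.last_mem c
  rw [show len c = 0 by omega] at h1
  exact Set.disjoint_left.mp hXY (h.fst_mem c) h1

theorem Linked.exists_linkage {n : ℕ} (h : Linked H Ω X Y n) :
    ∃ (len : Fin n → ℕ) (q : Fin n → ℕ → W), Linkage H Ω X Y len q := by
  obtain ⟨P, hP, hPd⟩ := h
  choose len q hq hqP hq0 hq1 _ _ using fun i => (hP i).1.exists_indPath (hP i).2.2.1 (hP i).2.2.2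
  refine ⟨len, q, hq, fun c i hi => (hP c).2.1 (hqP c i hi), hq0, hq1, fun c c' hc i hi i' hi' h => ?_⟩
  exact Set.disjoint_left.mp (hPd c c' hc) (hqP c i hi) (h ▸ hqP c' i' hi')

theorem Linkage.linked {n : ℕ} {len : Fin n → ℕ} {q : Fin n → ℕ → W}
    (h : Linkage H Ω X Y len q) : Linked H Ω X Y n := by
  refine ⟨fun c => seg (q c) 0 (len c), fun c => ⟨(h.path c).conn_seg (Nat.zero_le _) le_rfl, ?_,
    ⟨_, seg_mem le_rfl (Nat.zero_le _), h.fst_mem c⟩,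
    ⟨_, seg_mem (Nat.zero_le _) le_rfl, h.last_mem c⟩⟩, fun c c' hc => ?_⟩
  · rintro _ ⟨i, hi, rfl⟩
    exact h.mem c i hi.2
  · rw [Set.disjoint_left]
    rintro _ ⟨i, hi, rfl⟩ ⟨i', hi', he⟩
    exact h.ne c c' hc i hi.2 i' hi'.2 he.symm

theorem Linked.mono {n m : ℕ} (h : Linked H Ω X Y n) (hm : m ≤ n) : Linked H Ω X Y m := by
  obtain ⟨P, hP, hPd⟩ := h
  exact ⟨fun i => P (Fin.castLE hm i), fun i => hP _, fun i j hij =>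
    hPd _ _ fun h => hij (Fin.castLE_injective hm h)⟩

/-- The vertices on the paths of a linkage. -/
def colUnion {n : ℕ} (len : Fin n → ℕ) (q : Fin n → ℕ → W) : Set W :=
  ⋃ c, seg (q c) 0 (len c)

/-- A linkage that minimizes the number of its vertices outside `U`. -/
theorem Linked.exists_minimal {n : ℕ} (h : Linked H Ω X Y n) (U : Set W) :
    ∃ (len : Fin n → ℕ) (q : Fin n → ℕ → W), Linkage H Ω X Y len q ∧
      ∀ (len' : Fin n → ℕ) (q' : Fin n → ℕ → W), Linkage H Ω X Y len' q' →
        (colUnion len q \ U).ncard ≤ (colUnion len' q' \ U).ncard := by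
  classical
  have hex : ∃ m, ∃ (len : Fin n → ℕ) (q : Fin n → ℕ → W), Linkage H Ω X Y len q ∧
      (colUnion len q \ U).ncard = m := by
    obtain ⟨len, q, hq⟩ := h.exists_linkage
    exact ⟨_, len, q, hq, rfl⟩
  obtain ⟨len, q, hq, hm⟩ := Nat.find_spec hex
  refine ⟨len, q, hq, fun len' q' hq' => ?_⟩
  rw [hm]
  exact Nat.find_le ⟨len', q', hq', rfl⟩

/-- A vertex of a minimal linkage outside `U` extends to a transversal of the linkage that
connected parts of `U` cannot get around. -/
theorem Linkage.exists_cut [Finite W] {n : ℕ} {len : Fin n → ℕ} {q : Fin n → ℕ → W}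
    (h : Linkage H Ω X Y len q) {U : Set W} (hU : U ⊆ Ω)
    (hmin : ∀ (len' : Fin n → ℕ) (q' : Fin n → ℕ → W), Linkage H Ω X Y len' q' →
        (colUnion len q \ U).ncard ≤ (colUnion len' q' \ U).ncard)
    {c₁ : Fin n} {k : ℕ} (hk : k ≤ len c₁) (hkU : q c₁ k ∉ U) :
    ∃ σ : Fin n → ℕ, (∀ c, σ c ≤ len c) ∧ σ c₁ = k ∧ ∀ Z, Conn H Z → Z ⊆ U →
      (∀ c, q c (σ c) ∉ Z) → ∀ c, ∀ i ≤ len c, ∀ c', ∀ i' ≤ len c',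
        q c i ∈ Z → i < σ c → q c' i' ∈ Z → i' < σ c' := by
  classical
  set Ω' := (U ∪ colUnion len q) \ {q c₁ k} with hΩ'
  have hcolΩ : colUnion len q ⊆ Ω := by
    intro v hv
    obtain ⟨c, i, hi, rfl⟩ := Set.mem_iUnion.mp hv
    exact h.mem c i hi.2
  have hnot : ¬ Linked H Ω' X Y n := by
    intro hl
    obtain ⟨len', q', hq'⟩ := hl.exists_linkage
    have hsub : Ω' ⊆ Ω := fun v hv => (Set.union_subset hU hcolΩ) hv.1
    have := hmin len' q' ⟨hq'.path, fun c i hi => hsub (hq'.mem c i hi), hq'.fst_mem, hq'.last_mem,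
      hq'.ne⟩
    refine absurd this (not_le.mpr (Set.ncard_lt_ncard ?_ (Set.toFinite _)))
    have hin : ∀ v ∈ colUnion len' q', v ∈ Ω' := by
      intro v hv
      obtain ⟨c, i, hi, rfl⟩ := Set.mem_iUnion.mp hv
      exact hq'.mem c i hi.2
    refine ⟨fun v hv => ⟨(hin v hv.1).1.resolve_left hv.2, hv.2⟩, fun hs => ?_⟩
    have hv : q c₁ k ∈ colUnion len q := Set.mem_iUnion.mpr ⟨c₁, seg_mem (Nat.zero_le _) hk⟩
    exact (hin _ (hs ⟨hv, hkU⟩).1).2 rfl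
  have hns : ¬ Unseparated H Ω' X Y n := fun hu => hnot (linked_of_unseparated _ _ _ _ _ hu)
  unfold Unseparated at hns
  push Not at hns
  obtain ⟨S, hS, hsep⟩ := hns
  replace hsep : ∀ Z, Conn H Z → Z ⊆ Ω' → Disjoint Z S → (Z ∩ X).Nonempty → (Z ∩ Y).Nonempty →
      False := fun Z hZ hZΩ hZS hZX hZY => by
    have := hsep Z hZ (fun v hv => ⟨hZΩ hv, Set.disjoint_left.mp hZS hv⟩) hZX
    exact hZY.ne_empty this
  have hcol' : ∀ c i, i ≤ len c → q c i ≠ q c₁ k → q c i ∈ Ω' := fun c i hi hne =>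
    ⟨Or.inr (Set.mem_iUnion.mpr ⟨c, seg_mem (Nat.zero_le _) hi⟩), hne⟩
  have hhit : ∀ c, ∃ i ≤ len c, (c = c₁ → i = k) ∧ (c ≠ c₁ → q c i ∈ S) := by
    intro c
    by_cases hc : c = c₁
    · subst hc
      exact ⟨k, hk, fun _ => rfl, fun h => (h rfl).elim⟩
    by_contra! hno
    refine hsep (seg (q c) 0 (len c)) ((h.path c).conn_seg (Nat.zero_le _) le_rfl) ?_ ?_
      ⟨_, seg_mem le_rfl (Nat.zero_le _), h.fst_mem c⟩
      ⟨_, seg_mem (Nat.zero_le _) le_rfl, h.last_mem c⟩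
    · rintro _ ⟨i, hi, rfl⟩
      exact hcol' c i hi.2 (h.ne c c₁ hc i hi.2 k hk)
    · rw [Set.disjoint_left]
      rintro _ ⟨i, hi, rfl⟩ hiS
      exact (hno i hi.2 fun h => (hc h).elim).2 hiS
  choose σ hσ hσ₁ hσS using hhit
  have hSσ : ∀ v ∈ S, ∃ c, c ≠ c₁ ∧ v = q c (σ c) := by
    have hsub : (fun c => q c (σ c)) '' {c | c ≠ c₁} ⊆ S := by
      rintro _ ⟨c, hc, rfl⟩
      exact hσS c hc
    have hinj : Function.Injective fun c => q c (σ c) := fun c c' hcc => by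
      by_contra hne
      exact h.ne c c' hne _ (hσ c) _ (hσ c') hcc
    have hcard : {c : Fin n | c ≠ c₁}.ncard = n - 1 := by
      rw [show {c : Fin n | c ≠ c₁} = {c₁}ᶜ from rfl, Set.ncard_compl, Set.ncard_singleton,
        Nat.card_fin]
    have heq := Set.eq_of_subset_of_ncard_le hsub
      (by rw [Set.ncard_image_of_injective _ hinj, hcard]; omega) (Set.toFinite _)
    intro v hv
    rw [← heq] at hv
    obtain ⟨c, hc, rfl⟩ := hv
    exact ⟨c, hc, rfl⟩
  refine ⟨σ, hσ, hσ₁ c₁ rfl, fun Z hZ hZU hZσ c i hi c' i' hi' hiZ hlt hiZ' => ?_⟩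
  by_contra hge
  have hgt : σ c' < i' := lt_of_le_of_ne (not_lt.mp hge) fun he => hZσ c' (he ▸ hiZ')
  have hk₁ : q c₁ k = q c₁ (σ c₁) := by rw [hσ₁ c₁ rfl]
  have havoid : ∀ d, ∀ j ≤ len d, j ≠ σ d → q d j ≠ q c₁ k ∧ q d j ∉ S := by
    intro d j hj hne
    have hne' : ∀ e, q d j ≠ q e (σ e) := fun e he => by
      by_cases hde : d = e
      · subst hde
        exact hne ((h.path d).inj hj (hσ d) he)
      · exact h.ne d e hde j hj _ (hσ e) he
    refine ⟨hk₁ ▸ hne' c₁, fun hS' => ?_⟩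
    obtain ⟨e, -, he⟩ := hSσ _ hS'
    exact hne' e he
  have hc1 := (h.path c).conn_seg (Nat.zero_le i) hi
  have hc2 := (h.path c').conn_seg hi' le_rfl
  have hc3 := hc1.union hZ (Or.inl ⟨q c i, seg_mem (Nat.zero_le _) le_rfl, hiZ⟩)
  have hall : ∀ v ∈ seg (q c) 0 i ∪ Z ∪ seg (q c') i' (len c'), v ∈ Ω' ∧ v ∉ S := by
    rintro v ((⟨j, hj, rfl⟩ | hv) | ⟨j, hj, rfl⟩)
    · have h1 := hj.2
      obtain ⟨h2, h3⟩ := havoid c j (by omega) (by omega)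
      exact ⟨hcol' c j (by omega) h2, h3⟩
    · refine ⟨⟨Or.inl (hZU hv), ?_⟩, fun hvS => ?_⟩
      · rintro rfl
        exact hZσ c₁ (hk₁ ▸ hv)
      · obtain ⟨e, -, rfl⟩ := hSσ v hvS
        exact hZσ e hv
    · have h1 := hj.1
      obtain ⟨h2, h3⟩ := havoid c' j hj.2 (by omega)
      exact ⟨hcol' c' j hj.2 h2, h3⟩
  refine hsep _ (hc3.union hc2 (Or.inl ⟨q c' i', Or.inr hiZ', seg_mem le_rfl hi'⟩))
    (fun v hv => (hall v hv).1) (Set.disjoint_left.mpr fun v hv => (hall v hv).2)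
    ⟨q c 0, Or.inl (Or.inl (seg_mem le_rfl (Nat.zero_le _))), h.fst_mem c⟩
    ⟨q c' (len c'), Or.inr (seg_mem hi' le_rfl), h.last_mem c'⟩

end Cut

section Stage

variable {W : Type} {H : SimpleGraph W} {K Ω X Y : Set W}

/-- Between the visits of two anticomplete rows, a path leaves the union of the rows. -/
theorem IndPath.exists_between {ι : Type} {P : ι → Set W} {n : ℕ} {p : ℕ → W} (hp : IndPath H n p)
    (hP : ∀ t t', t ≠ t' → Anticomplete H (P t) (P t')) {t t' : ι} (ht : t ≠ t') {a b : ℕ}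
    (hab : a < b) (hb : b ≤ n) (ha : p a ∈ P t) (hb' : p b ∈ P t') :
    ∃ k, a < k ∧ k < b ∧ p k ∉ ⋃ t, P t := by
  by_contra! hno
  obtain ⟨j, hj⟩ := (hp.conn_seg hab.le hb).subset_of_iUnion hP (by
    rintro _ ⟨i, ⟨h1, h2⟩, rfl⟩
    rcases eq_or_lt_of_le h1 with rfl | h1
    · exact Set.mem_iUnion.mpr ⟨t, ha⟩
    rcases eq_or_lt_of_le h2 with rfl | h2
    · exact Set.mem_iUnion.mpr ⟨t', hb'⟩
    exact hno i h1 h2)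
  have h1 : j = t := by
    by_contra hne
    exact (hP j t hne).ne (hj (seg_mem le_rfl hab.le)) ha rfl
  have h2 : j = t' := by
    by_contra hne
    exact (hP j t' hne).ne (hj (seg_mem hab.le le_rfl)) hb' rfl
  exact ht (h1.symm.trans h2)

theorem Linkage.mem_of_degree_le_one [Finite W] {n : ℕ} {len : Fin n → ℕ} {q : Fin n → ℕ → W}
    (h : Linkage H Ω X Y len q) (c : Fin n) :
    ∀ x ∈ seg (q c) 0 (len c), {u | H.Adj x u}.ncard ≤ 1 → x ∈ X ∪ Y := by
  rintro _ ⟨i, ⟨-, hi⟩, rfl⟩ hd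
  rcases Nat.eq_zero_or_pos i with rfl | hi0
  · exact Or.inl (h.fst_mem c)
  rcases eq_or_lt_of_le hi with rfl | hin
  · exact Or.inr (h.last_mem c)
  have h1 := (Set.ncard_le_one (Set.toFinite _)).mp hd (q c (i - 1))
    (((h.path c).adj_iff hi (by omega)).mpr (by omega)) (q c (i + 1)) ((h.path c).adj_succ hin)
  have := (h.path c).inj (by omega) (by omega) h1
  omega

/-- Many rows visiting the same columns of a minimal linkage contain an aligned family. -/
theorem Linkage.exists_slab [Finite W] (hH : ThinOff H K) {n h R p : ℕ} {len : Fin n → ℕ}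
    {q : Fin n → ℕ → W} (hq : Linkage H Ω X Y len q)
    (hqc : ∀ c, ClosedOff H K (seg (q c) 0 (len c))) {P : Fin p → Set W}
    (hPc : ∀ t, Conn H (P t)) (hPK : ∀ t, ClosedOff H K (P t)) (hPΩ : ∀ t, P t ⊆ Ω)
    (hPd : ∀ t t', t ≠ t' → Disjoint (P t) (P t'))
    (hmin : ∀ (len' : Fin n → ℕ) (q' : Fin n → ℕ → W), Linkage H Ω X Y len' q' →
        (colUnion len q \ ⋃ t, P t).ncard ≤ (colUnion len' q' \ ⋃ t, P t).ncard)
    (hh : 0 < h) (J : Fin h ↪o Fin n) (e : Fin ((R + 1) * (R * n + 1)) ↪o Fin p)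
    (hmeet : ∀ k c, ∃ i ≤ len (J c), q (J c) i ∈ P (e k)) :
    ∃ ρ : Fin R → Set W, Slab H K (fun c => len (J c)) (fun c => q (J c)) ρ := by
  classical
  have hanti : ∀ t t', t ≠ t' → Anticomplete H (P t) (P t') := fun t t' ht =>
    (hPK t).anticomplete (hPK t') hH (hPd t t' ht)
  set c₁ := J ⟨0, hh⟩ with hc₁
  choose α hα hαP using fun k => hmeet k ⟨0, hh⟩
  have hαinj : Function.Injective α := fun k k' hkk => by
    by_contra hne
    refine (hanti _ _ fun h => hne (e.injective h)).ne (hαP k) (hαP k') ?_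
    rw [hkk]
  obtain ⟨u, hu, hus, hum⟩ := exists_sorted_groups α hαinj
  have hbetween : ∀ k : Fin R, ∃ v, v ≤ len c₁ ∧ q c₁ v ∉ ⋃ t, P t ∧
      (∀ j, α (u k.castSucc j) < v) ∧ ∀ j, v < α (u k.succ j) := by
    intro k
    have hlt := hus k.castSucc k.succ (Fin.last _) 0 Fin.castSucc_lt_succ
    obtain ⟨v, h1, h2, h3⟩ := (hq.path c₁).exists_between hanti
      (fun h => by
        have := (hu _ _ _ _ (e.injective h)).1
        exact (Fin.castSucc_lt_succ (i := k)).ne this) hlt (hα _) (hαP _) (hαP _)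
    exact ⟨v, h2.le.trans (hα _), h3, fun j => (hum _ _ _ (Fin.le_last j)).trans_lt h1,
      fun j => h2.trans_le (hum _ _ _ (Fin.zero_le j))⟩
  choose v hv hvP hvlt hvgt using hbetween
  choose σ hσ hσ₁ hσZ using fun k => hq.exists_cut (Set.iUnion_subset hPΩ) hmin (hv k) (hvP k)
  have hgood : ∀ k : Fin R, ∃ j, ∀ k' c, q c (σ k' c) ∉ P (e (u k.succ j)) := by
    intro k
    by_contra! hno
    choose k' c hkc using hno
    obtain ⟨j, j', hne, hj⟩ := Fintype.exists_ne_map_eq_of_card_lt (fun j => (k' j, c j))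
      (by simp)
    rw [Prod.mk.injEq] at hj
    refine (hanti _ _ fun h => hne (hu _ _ _ _ (e.injective h)).2).ne (hkc j) (hkc j') ?_
    rw [hj.1, hj.2]
  choose j hj using hgood
  have hρ : ∀ t t' : Fin R, t < t' → e (u t.succ (j t)) ≠ e (u t'.succ (j t')) := fun t t' ht h =>
    ht.ne (Fin.succ_injective _ (hu _ _ _ _ (e.injective h)).1)
  refine ⟨fun t => P (e (u t.succ (j t))), fun c => hq.path _, fun c => hqc _,
    fun c c' hc => hq.ne _ _ fun h => hc (J.injective h), fun t => hPc _, fun t => hPK _,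
    fun t t' ht => hPd _ _ ?_, fun t c => hmeet _ c, ?_⟩
  · rcases lt_or_gt_of_ne ht with h | h
    · exact hρ t t' h
    · exact (hρ t' t h).symm
  · intro t t' ht c i hi i' hi' hiP hiP'
    have hle : α (u t.succ (j t)) < v t' := by
      rcases eq_or_lt_of_le (Fin.succ_le_castSucc_iff.mpr ht) with heq | hlt
      · rw [heq]
        exact hvlt t' _
      · exact (hus _ _ _ 0 hlt).trans (hvlt t' 0)
    have h1 := hσZ t' _ (hPc _) (Set.subset_iUnion P _) (fun c => hj t t' c) c₁ _ (hα _) (J c) i hi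
      (hαP _) (by rw [hσ₁]; exact hle) hiP
    have h2 : σ t' (J c) < i' := by
      by_contra hle'
      have hne : i' ≠ σ t' (J c) := fun h => hj t' t' (J c) (h ▸ hiP')
      have h3 := hσZ t' _ (hPc _) (Set.subset_iUnion P _) (fun c => hj t' t' c) (J c) i' hi' c₁ _
        (hα _) hiP' (by omega) (hαP _)
      rw [hσ₁] at h3
      exact absurd (hvgt t' (j t')) (by omega)
    exact h1.trans h2

/-- Many paths between each of several pairs of terminal sets yield disjoint connecting paths or
a slab. -/
theorem exists_links_or_slab (h R : ℕ) (hh : 0 < h) : ∀ M : ℕ, ∃ N : ℕ, ∀ {W : Type} [Finite W]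
    {H : SimpleGraph W} {K : Set W}, ThinOff H K → ∀ (Ω : Set W) (X Y : Fin M → Set W),
    (∀ e, Terminal H K (X e) ∧ Terminal H K (Y e) ∧ Disjoint (X e) (Y e)) →
    (∀ e, Linked H Ω (X e) (Y e) N) →
    (∃ P : Fin M → Set W, (∀ e, Conn H (P e) ∧ ClosedOff H K (P e) ∧ P e ⊆ Ω ∧
        (P e ∩ X e).Nonempty ∧ (P e ∩ Y e).Nonempty ∧
        ∀ x ∈ P e, {u | H.Adj x u}.ncard ≤ 1 → x ∈ X e ∪ Y e) ∧ ∀ e e', e ≠ e' → Disjoint (P e) (P e')) ∨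
      ∃ (len : Fin h → ℕ) (q : Fin h → ℕ → W) (ρ : Fin R → Set W), Slab H K len q ρ := by
  intro M
  induction M with
  | zero =>
    refine ⟨0, fun _ Ω X Y _ _ => Or.inl ⟨fun _ => ∅, fun e => e.elim0, fun e => e.elim0⟩⟩
  | succ M ih =>
  classical
  obtain ⟨N, hN⟩ := ih
  obtain ⟨p, hp⟩ := fin_pigeonhole (Fin M × (Fin h ↪o Fin (N + h))) ((R + 1) * (R * (N + h) + 1))
  refine ⟨max (N + h) (max p 1), fun {W} _ {H} {K} hH Ω X Y hXY hlink => ?_⟩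
  obtain ⟨plen, P, hP⟩ := ((hlink 0).mono (le_trans (le_refl (max p 1)) (le_max_right _ _))).exists_linkage
  have hPK := hP.closedOff hH (hXY 0).1 (hXY 0).2.1 (hXY 0).2.2
  have hPc : ∀ t, Conn H (seg (P t) 0 (plen t)) := fun t =>
    (hP.path t).conn_seg (Nat.zero_le _) le_rfl
  have hPΩ : ∀ t, seg (P t) 0 (plen t) ⊆ Ω := by
    rintro t _ ⟨i, hi, rfl⟩
    exact hP.mem t i hi.2
  have hPd : ∀ t t', t ≠ t' → Disjoint (seg (P t) 0 (plen t)) (seg (P t') 0 (plen t')) := by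
    intro t t' ht
    rw [Set.disjoint_left]
    rintro _ ⟨i, hi, rfl⟩ ⟨i', hi', he⟩
    exact hP.ne t t' ht i hi.2 i' hi'.2 he.symm
  choose len q hq hmin using fun e : Fin M => ((hlink e.succ).mono (le_max_left (N + h) _)).exists_minimal
    (⋃ t, seg (P t) 0 (plen t))
  by_cases hmiss : ∃ t, ∀ e, N ≤ {c | ∀ i ≤ len e c, q e c i ∉ seg (P t) 0 (plen t)}.ncard
  · obtain ⟨t, ht⟩ := hmiss
    have hl : ∀ e : Fin M, Linked H (Ω \ seg (P t) 0 (plen t)) (X e.succ) (Y e.succ) N := by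
      intro e
      obtain ⟨f, hf⟩ := exists_orderEmb_of_ncard (ht e)
      refine Linkage.linked (len := fun c => len e (f c)) (q := fun c => q e (f c))
        ⟨fun c => (hq e).path _, fun c i hi => ⟨(hq e).mem _ i hi, hf c i hi⟩,
          fun c => (hq e).fst_mem _, fun c => (hq e).last_mem _,
          fun c c' hc => (hq e).ne _ _ fun h => hc (f.injective h)⟩
    rcases hN hH _ _ _ (fun e : Fin M => hXY e.succ) hl with ⟨P', hP', hPd'⟩ | hs
    · refine Or.inl ⟨Fin.cons (seg (P t) 0 (plen t)) P', ?_, ?_⟩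
      · refine Fin.cases ?_ fun e => ?_
        · exact ⟨hPc t, hPK t, hPΩ t, ⟨_, seg_mem le_rfl (Nat.zero_le _), hP.fst_mem t⟩,
            ⟨_, seg_mem (Nat.zero_le _) le_rfl, hP.last_mem t⟩, hP.mem_of_degree_le_one t⟩
        · simp only [Fin.cons_succ]
          obtain ⟨h1, h2, h3, h4⟩ := hP' e
          exact ⟨h1, h2, h3.trans Set.sdiff_subset, h4⟩
      · have key : ∀ e, Disjoint (seg (P t) 0 (plen t)) (P' e) := fun e =>
          Set.disjoint_left.mpr fun v hv hv' => ((hP' e).2.2.1 hv').2 hv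
        refine Fin.cases ?_ fun e => ?_ <;> refine Fin.cases ?_ fun e' => ?_
        · exact fun h => (h rfl).elim
        · exact fun _ => key e'
        · exact fun _ => (key e).symm
        · exact fun hne => hPd' e e' fun h => hne (h ▸ rfl)
    · exact Or.inr hs
  · push Not at hmiss
    choose e he using hmiss
    have hJ : ∀ t, ∃ J : Fin h ↪o Fin (N + h), ∀ c,
        ∃ i ≤ len (e t) (J c), q (e t) (J c) i ∈ seg (P t) 0 (plen t) := by
      intro t
      obtain ⟨J, hJ⟩ := exists_orderEmb_of_ncard (m := h)
        (S := {c | ∀ i ≤ len (e t) c, q (e t) c i ∉ seg (P t) 0 (plen t)}ᶜ) (by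
          have := he t
          rw [Set.ncard_compl, Nat.card_fin]
          omega)
      refine ⟨J, fun c => ?_⟩
      have := hJ c
      rw [Set.mem_compl_iff, Set.mem_ofPred_eq] at this
      push Not at this
      exact this
    choose J hJ using hJ
    obtain ⟨f, ⟨e₀, J₀⟩, hf⟩ := hp _ (le_max_left p 1) fun t => (e t, J t)
    obtain ⟨ρ, hρ⟩ := (hq e₀).exists_slab hH
      ((hq e₀).closedOff hH (hXY _).1 (hXY _).2.1 (hXY _).2.2) hPc hPK hPΩ hPd (hmin e₀) hh J₀ f
      (fun k c => by
        have := hf k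
        rw [Prod.mk.injEq] at this
        have hj := hJ (f k) c
        rw [this.1, this.2] at hj
        exact hj)
    exact Or.inr ⟨_, _, ρ, hρ⟩

end Stage

/-- Pairwise disjoint connected sets `F w` whose adjacencies are those of `H`; outside `K` they are
singletons. -/
structure Fibration {V W : Type} (G : SimpleGraph V) (H : SimpleGraph W) (K : Set W)
    (F : W → Set V) : Prop where
  conn : ∀ w, Conn G (F w)
  disj : ∀ u w, u ≠ w → Disjoint (F u) (F w)
  adj : ∀ u w, H.Adj u w ↔ u ≠ w ∧ Touch G (F u) (F w)
  single : ∀ w ∉ K, ∃ v, F w = {v}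

/-- The union of the fibers over `S`. -/
def lift {V W : Type} (F : W → Set V) (S : Set W) : Set V := ⋃ w ∈ S, F w

/-- The component of `v` in `C`, or `{v}` when `v` is not in `C`. -/
def cell {V : Type} (G : SimpleGraph V) (C : Set V) (v : V) : Set V :=
  {u | u = v ∨ ∃ D, Conn G D ∧ D ⊆ C ∧ v ∈ D ∧ u ∈ D}

/-- The cells of the vertices of `U`. -/
def CellType {V : Type} (G : SimpleGraph V) (U C : Set V) : Type :=
  {S : Set V // ∃ v ∈ U, S = cell G C v}

/-- The graph obtained from `U` by contracting the components of `C`. -/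
def cellGraph {V : Type} (G : SimpleGraph V) (U C : Set V) : SimpleGraph (CellType G U C) where
  Adj S T := S ≠ T ∧ Touch G S.1 T.1
  symm := ⟨fun _ _ h => ⟨h.1.symm, h.2.symm⟩⟩
  loopless := ⟨fun _ h => h.1 rfl⟩

section Lift

variable {V W : Type} {G : SimpleGraph V} {H : SimpleGraph W} {K : Set W} {F : W → Set V}

theorem mem_lift {S : Set W} {v : V} : v ∈ lift F S ↔ ∃ w ∈ S, v ∈ F w := by
  simp [lift]

theorem subset_lift {S : Set W} {w : W} (hw : w ∈ S) : F w ⊆ lift F S := fun _ hv =>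
  mem_lift.mpr ⟨w, hw, hv⟩

theorem Fibration.eq_of_mem (h : Fibration G H K F) {u w : W} {v : V} (hu : v ∈ F u)
    (hw : v ∈ F w) : u = w := by
  by_contra hne
  exact Set.disjoint_left.mp (h.disj u w hne) hu hw

theorem Fibration.conn_lift (h : Fibration G H K F) {S : Set W} (hS : Conn H S) :
    Conn G (lift F S) := by
  obtain ⟨w, hw⟩ := hS.1
  refine ⟨(h.conn w).1.mono (subset_lift hw), fun T hT hTs => ?_⟩
  have hfull : ∀ w ∈ S, (F w ∩ T).Nonempty → F w ⊆ T := fun w hw hne =>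
    (h.conn w).2 T hne fun x hx hxT y hy hxy =>
      hTs x (subset_lift hw hx) hxT y (subset_lift hw hy) hxy
  have hall : S ⊆ {w | (F w ∩ T).Nonempty} := by
    refine hS.2 _ ?_ ?_
    · obtain ⟨v, hv, hvT⟩ := hT
      obtain ⟨w, hw, hvw⟩ := mem_lift.mp hv
      exact ⟨w, hw, v, hvw, hvT⟩
    · intro x hx hxT y hy hxy
      obtain ⟨-, a, ha, b, hb, hab⟩ := (h.adj x y).mp hxy
      exact ⟨b, hb, hTs a (subset_lift hx ha) (hfull x hx hxT ha) b (subset_lift hy hb) hab⟩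
  intro v hv
  obtain ⟨w, hw, hvw⟩ := mem_lift.mp hv
  exact hfull w hw (hall hw) hvw

theorem Fibration.anticomplete_lift (h : Fibration G H K F) {S T : Set W}
    (hST : Anticomplete H S T) : Anticomplete G (lift F S) (lift F T) := by
  refine anticomplete_of fun x hx y hy => ?_
  obtain ⟨u, hu, hxu⟩ := mem_lift.mp hx
  obtain ⟨w, hw, hyw⟩ := mem_lift.mp hy
  have hne := hST.ne hu hw
  refine ⟨?_, fun hxy => hST.2 u hu w hw ((h.adj u w).mpr ⟨hne, x, hxu, y, hyw, hxy⟩)⟩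
  rintro rfl
  exact hne (h.eq_of_mem hxu hyw)

theorem Fibration.disjoint_lift (h : Fibration G H K F) {S T : Set W}
    (hST : Disjoint S T) : Disjoint (lift F S) (lift F T) := by
  refine Set.disjoint_left.mpr fun x hx hy => ?_
  obtain ⟨u, hu, hxu⟩ := mem_lift.mp hx
  obtain ⟨w, hw, hyw⟩ := mem_lift.mp hy
  exact Set.disjoint_left.mp hST hu (h.eq_of_mem hxu hyw ▸ hw)

end Lift

section Cell

variable {V : Type} {G : SimpleGraph V} {U C : Set V} {u v : V}

theorem mem_cell_self : v ∈ cell G C v := Or.inl rfl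

theorem conn_cell : Conn G (cell G C v) := by
  refine ⟨⟨v, mem_cell_self⟩, fun T ⟨u, hu, huT⟩ hT => ?_⟩
  have key : ∀ D, Conn G D → D ⊆ C → v ∈ D → (D ∩ T).Nonempty → D ⊆ T := fun D hD hDC hvD hne =>
    hD.2 T hne fun x hx hxT y hy hxy =>
      hT x (Or.inr ⟨D, hD, hDC, hvD, hx⟩) hxT y (Or.inr ⟨D, hD, hDC, hvD, hy⟩) hxy
  have hv : v ∈ T := by
    rcases hu with rfl | ⟨D, hD, hDC, hvD, huD⟩
    · exact huT
    · exact key D hD hDC hvD ⟨u, huD, huT⟩ hvD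
  rintro w (rfl | ⟨D, hD, hDC, hvD, hwD⟩)
  · exact hv
  · exact key D hD hDC hvD ⟨v, hvD, hv⟩ hwD

theorem cell_eq (h : u ∈ cell G C v) : cell G C u = cell G C v := by
  rcases h with rfl | ⟨D, hD, hDC, hvD, huD⟩
  · rfl
  ext w
  constructor
  · rintro (rfl | ⟨E, hE, hEC, huE, hwE⟩)
    · exact Or.inr ⟨D, hD, hDC, hvD, huD⟩
    · exact Or.inr ⟨D ∪ E, hD.union hE (Or.inl ⟨u, huD, huE⟩), Set.union_subset hDC hEC,
        Or.inl hvD, Or.inr hwE⟩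
  · rintro (rfl | ⟨E, hE, hEC, hvE, hwE⟩)
    · exact Or.inr ⟨D, hD, hDC, huD, hvD⟩
    · exact Or.inr ⟨D ∪ E, hD.union hE (Or.inl ⟨v, hvD, hvE⟩), Set.union_subset hDC hEC,
        Or.inl huD, Or.inr hwE⟩

theorem cell_of_notMem (h : v ∉ C) : cell G C v = {v} := by
  ext u
  refine ⟨?_, fun h => Or.inl h⟩
  rintro (rfl | ⟨D, -, hDC, hvD, -⟩)
  · rfl
  · exact (h (hDC hvD)).elim

theorem cell_subset (h : v ∈ C) : cell G C v ⊆ C := by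
  rintro u (rfl | ⟨D, -, hDC, -, huD⟩)
  · exact h
  · exact hDC huD

theorem cell_adj (hu : u ∈ C) (hv : v ∈ C) (h : G.Adj u v) : u ∈ cell G C v :=
  Or.inr ⟨{u, v}, (conn_singleton v).insert rfl h, by
    rintro _ (rfl | rfl)
    exacts [hu, hv], by simp, by simp⟩

/-- The cell of a vertex of `U`. -/
def cellOf (v : U) : CellType G U C := ⟨cell G C v, v, v.2, rfl⟩

instance [Finite V] : Finite (CellType G U C) := inferInstanceAs (Finite (Subtype _))

theorem fibration_cell : Fibration G (cellGraph G U C) {S | S.1 ⊆ C} Subtype.val where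
  conn := by
    rintro ⟨_, v, -, rfl⟩
    exact conn_cell
  disj := by
    rintro ⟨_, u, hu, rfl⟩ ⟨_, v, hv, rfl⟩ hne
    refine Set.disjoint_left.mpr fun w hw hw' => hne (Subtype.ext ?_)
    exact (cell_eq hw).symm.trans (cell_eq hw')
  adj := fun _ _ => Iff.rfl
  single := by
    rintro ⟨_, v, hv, rfl⟩ hnot
    have hvC : v ∉ C := fun h => hnot (cell_subset h)
    exact ⟨v, cell_of_notMem hvC⟩

theorem CellType.subset (hCU : C ⊆ U) (S : CellType G U C) : S.1 ⊆ U := by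
  obtain ⟨_, v, hv, rfl⟩ := S
  by_cases h : v ∈ C
  · exact (cell_subset h).trans hCU
  · exact (cell_of_notMem h).le.trans (Set.singleton_subset_iff.mpr hv)

theorem cellOf_eq {S : CellType G U C} (hw : v ∈ S.1) (hU : v ∈ U) : cellOf ⟨v, hU⟩ = S := by
  obtain ⟨_, u, hu, rfl⟩ := S
  exact Subtype.ext (cell_eq hw)

theorem conn_cells {D : Set V} (hD : Conn G D) (hDU : D ⊆ U) :
    Conn (cellGraph G U C) {S | (S.1 ∩ D).Nonempty} := by
  obtain ⟨v, hv⟩ := hD.1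
  refine ⟨⟨cellOf ⟨v, hDU hv⟩, v, mem_cell_self, hv⟩, fun T hT hTs => ?_⟩
  have hall : D ⊆ {w | ∃ h : w ∈ U, (cellOf ⟨w, h⟩ : CellType G U C) ∈ T} := by
    refine hD.2 _ ?_ ?_
    · obtain ⟨S, ⟨w, hwS, hwD⟩, hST⟩ := hT
      refine ⟨w, hwD, hDU hwD, ?_⟩
      rwa [cellOf_eq hwS]
    · rintro x hx ⟨hxU, hxT⟩ y hy hxy
      refine ⟨hDU hy, ?_⟩
      by_cases heq : (cellOf ⟨x, hxU⟩ : CellType G U C) = cellOf ⟨y, hDU hy⟩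
      · rwa [← heq]
      · exact hTs _ ⟨x, mem_cell_self, hx⟩ hxT _ ⟨y, mem_cell_self, hy⟩
          ⟨heq, x, mem_cell_self, y, mem_cell_self, hxy⟩
  rintro S ⟨w, hwS, hwD⟩
  obtain ⟨hwU, hwT⟩ := hall hwD
  rwa [cellOf_eq hwS] at hwT

theorem cell_degree_le [Finite V] (hCU : C ⊆ U) {S : CellType G U C} (hS : S.1 = {v}) :
    {T | (cellGraph G U C).Adj S T}.ncard ≤ {w | w ∈ U ∧ G.Adj v w}.ncard := by
  classical
  have hex : ∀ T ∈ {T | (cellGraph G U C).Adj S T}, ∃ w, w ∈ T.1 ∧ G.Adj v w := by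
    rintro T ⟨-, a, ha, b, hb, hab⟩
    rw [hS] at ha
    obtain rfl : a = v := ha
    exact ⟨b, hb, hab⟩
  choose f hf hf' using hex
  refine Set.ncard_le_ncard_of_injOn (fun T => if h : T ∈ {T | (cellGraph G U C).Adj S T} then f T h
    else v) ?_ ?_ (Set.toFinite _)
  · intro T hT
    beta_reduce
    rw [dif_pos hT]
    exact ⟨T.subset hCU (hf T hT), hf' T hT⟩
  · intro T hT T' hT' he
    beta_reduce at he
    rw [dif_pos hT, dif_pos hT'] at he
    exact fibration_cell.eq_of_mem (hf T hT) (he ▸ hf T' hT')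

theorem thinOff_cell [Finite V] (hCU : C ⊆ U)
    (h : ∀ v ∈ U, v ∉ C → {w | w ∈ U ∧ G.Adj v w}.ncard ≤ 2) :
    ThinOff (cellGraph G U C) {S | S.1 ⊆ C} where
  indep := by
    intro S hS T hT hST
    obtain ⟨hne, x, hx, y, hy, hxy⟩ := hST
    refine hne ?_
    have h1 := cell_adj (hS hx) (hT hy) hxy
    rw [← cellOf_eq hx (S.subset hCU hx), ← cellOf_eq hy (T.subset hCU hy)]
    exact Subtype.ext (cell_eq h1)
  deg := by
    rintro ⟨_, v, hv, rfl⟩ hnot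
    have hvC : v ∉ C := fun h => hnot (cell_subset h)
    exact (cell_degree_le hCU (cell_of_notMem hvC)).trans (h v hv hvC)

end Cell

/-- The vertex `v` is where the row `A i` and the column `B j` touch. -/
def IsContact {V ι κ : Type} (G : SimpleGraph V) (A : ι → Set V) (B : κ → Set V) (i : ι) (j : κ)
    (v : V) : Prop :=
  (v ∈ A i ∧ Touch G {v} (B j)) ∨ (v ∈ B j ∧ Touch G {v} (A i))

/-- The vertices of the rows and the columns. -/
def cover {V ι κ : Type} (A : ι → Set V) (B : κ → Set V) : Set V := (⋃ i, A i) ∪ ⋃ j, B j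

/-- The contact vertices. -/
def contacts {V ι κ : Type} (G : SimpleGraph V) (A : ι → Set V) (B : κ → Set V) : Set V :=
  {v | ∃ i j, IsContact G A B i j v}

section Contact

variable {V ι κ : Type} {G : SimpleGraph V} {A : ι → Set V} {B : κ → Set V}

theorem IsContact.swap {i : ι} {j : κ} {v : V} (h : IsContact G A B i j v) :
    IsContact G B A j i v := Or.symm h

theorem PathModel.swap (h : PathModel G A B) : PathModel G B A :=
  ⟨h.model.swap, h.pathB, h.pathA, h.ampleA, h.ampleB⟩

theorem BiModel.index_eq (h : BiModel G A B) {i i' : ι} {v : V} (hv : v ∈ A i) (hv' : v ∈ A i') :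
    i = i' := by
  by_contra hne
  exact (h.antiA i i' hne).ne hv hv' rfl

theorem IsContact.eq_of_adj (h : PathModel G A B) {i i' : ι} {j j' : κ} {v w : V}
    (hv : IsContact G A B i j v) (hw : IsContact G A B i' j' w) (hvw : G.Adj v w) :
    i = i' ∧ j = j' := by
  have hi : ∀ {i i' : ι} {v w : V}, v ∈ A i → w ∈ A i' → G.Adj v w → i = i' := by
    intro i i' v w h1 h2 h3
    by_contra hne
    exact (h.model.antiA i i' hne).2 _ h1 _ h2 h3
  have hj : ∀ {j j' : κ} {v w : V}, v ∈ B j → w ∈ B j' → G.Adj v w → j = j' := by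
    intro i i' v w h1 h2 h3
    by_contra hne
    exact (h.model.antiB i i' hne).2 _ h1 _ h2 h3
  rcases hv with ⟨h1, h2⟩ | ⟨h1, h2⟩ <;> rcases hw with ⟨h3, h4⟩ | ⟨h3, h4⟩
  · obtain rfl := hi h1 h3 hvw
    exact ⟨rfl, h.ampleA.eq_of_touch_pair h1 h3 hvw h2 h4⟩
  · exact ⟨h.ampleB.eq_of_touch h3 ⟨w, rfl, v, h1, hvw.symm⟩ h4,
      h.ampleA.eq_of_touch h1 h2 ⟨v, rfl, w, h3, hvw⟩⟩
  · exact ⟨h.ampleB.eq_of_touch h1 h2 ⟨v, rfl, w, h3, hvw⟩,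
      h.ampleA.eq_of_touch h3 ⟨w, rfl, v, h1, hvw.symm⟩ h4⟩
  · obtain rfl := hj h1 h3 hvw
    exact ⟨h.ampleB.eq_of_touch_pair h1 h3 hvw h2 h4, rfl⟩

theorem contacts_subset_cover : contacts G A B ⊆ cover A B := by
  rintro v ⟨i, j, ⟨h, -⟩ | ⟨h, -⟩⟩
  · exact Or.inl (Set.mem_iUnion.mpr ⟨i, h⟩)
  · exact Or.inr (Set.mem_iUnion.mpr ⟨j, h⟩)

theorem cover_swap : cover B A = cover A B := Set.union_comm _ _

theorem contacts_swap : contacts G B A = contacts G A B := by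
  ext v
  exact ⟨fun ⟨i, j, h⟩ => ⟨j, i, h.swap⟩, fun ⟨i, j, h⟩ => ⟨j, i, h.swap⟩⟩

theorem IsContact.cell (h : PathModel G A B) {i : ι} {j : κ} {v : V}
    (hv : IsContact G A B i j v) : ∀ u ∈ cell G (contacts G A B) v, IsContact G A B i j u := by
  have hC : v ∈ contacts G A B := ⟨i, j, hv⟩
  refine conn_cell.2 {u | IsContact G A B i j u} ⟨v, mem_cell_self, hv⟩ fun x _ hxT y hy hxy => ?_
  obtain ⟨i', j', h'⟩ := cell_subset hC hy
  obtain ⟨rfl, rfl⟩ := IsContact.eq_of_adj h hxT h' hxy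
  exact h'

theorem PathModel.row_eq (h : PathModel G A B)
    (S : CellType G (cover A B) (contacts G A B)) {i i' : ι} (hi : (S.1 ∩ A i).Nonempty)
    (hi' : (S.1 ∩ A i').Nonempty) : i = i' := by
  obtain ⟨u, huS, hu⟩ := hi
  obtain ⟨w, hwS, hw⟩ := hi'
  have hcov : u ∈ cover A B := Or.inl (Set.mem_iUnion.mpr ⟨i, hu⟩)
  have hw' : w ∈ cell G (contacts G A B) u := by
    rw [← cellOf_eq huS hcov] at hwS
    exact hwS
  by_cases huC : u ∈ contacts G A B
  · obtain ⟨i₀, j, hc⟩ := huC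
    have key : ∀ {i u}, u ∈ A i → IsContact G A B i₀ j u → i₀ = i := by
      rintro i u hu (h1 | h1)
      · exact h.model.index_eq h1.1 hu
      · exact (Set.disjoint_left.mp (h.model.disj i j) hu h1.1).elim
    exact (key hu hc).symm.trans (key hw (IsContact.cell h hc w hw'))
  · rw [cell_of_notMem huC] at hw'
    obtain rfl : w = u := hw'
    exact h.model.index_eq hu hw

theorem PathModel.col_eq (h : PathModel G A B)
    (S : CellType G (cover A B) (contacts G A B)) {j j' : κ} (hj : (S.1 ∩ B j).Nonempty)
    (hj' : (S.1 ∩ B j').Nonempty) : j = j' := by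
  have hS : ∃ v ∈ cover B A, S.1 = _root_.cell G (contacts G B A) v := by
    obtain ⟨v, hv, hS⟩ := S.2
    refine ⟨v, by rw [cover_swap]; exact hv, hS.trans ?_⟩
    exact congrArg (fun C => _root_.cell G C v) contacts_swap
  exact h.swap.row_eq ⟨S.1, hS⟩ hj hj'

theorem IndPath.ncard_adj_le {n : ℕ} {p : ℕ → V} (hp : IndPath G n p) {i : ℕ} (hi : i ≤ n) :
    {w | w ∈ seg p 0 n ∧ G.Adj (p i) w}.ncard ≤ 2 := by
  have hsub : {w | w ∈ seg p 0 n ∧ G.Adj (p i) w} ⊆ {p (i - 1), p (i + 1)} := by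
    rintro _ ⟨⟨k, hk, rfl⟩, hadj⟩
    rcases (hp.adj_iff hi hk.2).mp hadj with h | h
    · exact Or.inr (by rw [← h]; rfl)
    · exact Or.inl (by rw [← h]; rfl)
  exact (Set.ncard_le_ncard hsub (by simp)).trans 
    ((Set.ncard_insert_le _ _).trans (by rw [Set.ncard_singleton]))

theorem PathModel.cover_adj (h : PathModel G A B) {v w : V} {i : ι} (hv : v ∈ A i)
    (hvC : v ∉ contacts G A B) (hw : w ∈ cover A B) (hvw : G.Adj v w) : w ∈ A i := by
  rcases hw with hw | hw
  · obtain ⟨i', hi'⟩ := Set.mem_iUnion.mp hw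
    by_cases hii : i = i'
    · exact hii ▸ hi'
    · exact ((h.model.antiA i i' hii).2 v hv w hi' hvw).elim
  · obtain ⟨j, hj⟩ := Set.mem_iUnion.mp hw
    exact (hvC ⟨i, j, Or.inl ⟨hv, v, rfl, w, hj, hvw⟩⟩).elim

theorem PathModel.ncard_adj_le [Finite V] (h : PathModel G A B) {v : V} (hv : v ∈ cover A B)
    (hvC : v ∉ contacts G A B) : {w | w ∈ cover A B ∧ G.Adj v w}.ncard ≤ 2 := by
  have key : ∀ {ι κ : Type} {A : ι → Set V} {B : κ → Set V}, PathModel G A B →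
      ∀ {i}, v ∈ A i → v ∉ contacts G A B → {w | w ∈ cover A B ∧ G.Adj v w}.ncard ≤ 2 := by
    intro ι κ A B h i hv hvC
    obtain ⟨n, p, hp, hA⟩ := isPathSet_iff.mp (h.pathA i)
    have hv' := hv
    rw [hA] at hv'
    obtain ⟨k, hk, rfl⟩ := hv'
    refine (Set.ncard_le_ncard ?_ (Set.toFinite _)).trans (hp.ncard_adj_le hk.2)
    rintro w ⟨hw, hadj⟩
    exact ⟨hA ▸ h.cover_adj hv hvC hw hadj, hadj⟩
  rcases hv with hv | hv
  · obtain ⟨i, hi⟩ := Set.mem_iUnion.mp hv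
    exact key h hi hvC
  · obtain ⟨j, hj⟩ := Set.mem_iUnion.mp hv
    have := key h.swap hj (by rwa [contacts_swap])
    rwa [cover_swap] at this

theorem exists_avoiding {k : ℕ} {α : Type} [Finite α] {S : Set α} (hS : S.ncard < k)
    (r : Fin k → α → Prop) (hr : ∀ a i i', r i a → r i' a → i = i') :
    ∃ i, ∀ a ∈ S, ¬ r i a := by
  classical
  by_contra! hno
  choose f hfS hf using hno
  have hinj : Function.Injective f := fun i i' h => hr (f i) i i' (hf i) (h ▸ hf i')
  have := Set.ncard_le_ncard (s := Set.range f) (t := S) (by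
    rintro _ ⟨i, rfl⟩
    exact hfS i) (Set.toFinite _)
  rw [← Set.image_univ, Set.ncard_image_of_injective _ hinj, Set.ncard_univ, Nat.card_fin] at this
  omega

/-- An anchored model yields a subdivided complete graph or a slab. -/
theorem exists_subK_or_slab (m h R : ℕ) (hh : 0 < h) : ∃ k N : ℕ, 0 < k ∧ ∀ {V : Type} [Finite V]
    {G : SimpleGraph V} {T : Fin m → Set V} {A : Fin k → Set V} {B : Fin m → Fin N → Set V}
    {s : Fin m → Fin N → V}, Anchored G T A B s → SubK G m ∨
      ∃ (W : Type) (_ : Finite W) (H : SimpleGraph W) (K : Set W) (F : W → Set V)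
        (len : Fin h → ℕ) (q : Fin h → ℕ → W) (ρ : Fin R → Set W),
        ThinOff H K ∧ Fibration G H K F ∧ Slab H K len q ρ := by
  classical
  obtain ⟨N, hN⟩ := exists_links_or_slab h R hh (Fintype.card {e : Fin m × Fin m // e.1 < e.2})
  let E := Fintype.equivFin {e : Fin m × Fin m // e.1 < e.2}
  refine ⟨N + 1, N, by omega, fun {V} _ {G} {T} {A} {B} {s} hA => ?_⟩
  set B' : Fin m × Fin N → Set V := fun cj => B cj.1 cj.2 with hB'
  have hmod := hA.model
  set U := cover A B' with hU
  set C := contacts G A B' with hC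
  have hCU : C ⊆ U := contacts_subset_cover
  have hthin := thinOff_cell (G := G) hCU fun v hv hvC => hmod.ncard_adj_le hv hvC
  have hfib := fibration_cell (G := G) (U := U) (C := C)
  have hAU : ∀ i, A i ⊆ U := fun i v hv => Or.inl (Set.mem_iUnion.mpr ⟨i, hv⟩)
  have hBU : ∀ c j, B c j ⊆ U := fun c j v hv => Or.inr (Set.mem_iUnion.mpr ⟨(c, j), hv⟩)
  have hsU : ∀ c j, s c j ∈ U := fun c j => hBU c j (hA.s_mem c j)
  have hsC : ∀ c j, s c j ∉ C := by
    rintro c j ⟨i, cj, h1 | h1⟩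
    · exact Set.disjoint_left.mp (hmod.model.disj i (c, j)) h1.1 (hA.s_mem c j)
    · exact hA.s_not_touch c j i h1.2
  let X : Fin m → Set (CellType G U C) := fun c => {S | ∃ j, S.1 = {s c j}}
  have hcell : ∀ c j, (cellOf ⟨s c j, hsU c j⟩ : CellType G U C).1 = {s c j} := fun c j =>
    cell_of_notMem (hsC c j)
  have hsinj : ∀ {c c' j j'}, s c j = s c' j' → c = c' := by
    intro c c' j j' he
    have := hmod.model.swap.index_eq (i := (c, j)) (i' := (c', j')) (hA.s_mem c j)
      (he ▸ hA.s_mem c' j')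
    exact congrArg Prod.fst this
  have hterm : ∀ c, Terminal (cellGraph G U C) {S | S.1 ⊆ C} (X c) := by
    rintro c S ⟨j, hS⟩
    refine ⟨fun h => hsC c j (h (hS ▸ rfl)), (cell_degree_le hCU hS).trans ?_⟩
    rw [Set.ncard_le_one (Set.toFinite _)]
    have key : ∀ w, w ∈ U → G.Adj (s c j) w → w ∈ B c j := fun w hw hadj =>
      hmod.swap.cover_adj (i := (c, j)) (hA.s_mem c j) (by rw [contacts_swap]; exact hsC c j)
        (by rw [cover_swap]; exact hw) hadj
    intro u hu u' hu'
    exact hA.s_end c j u (key u hu.1 hu.2) u' (key u' hu'.1 hu'.2) hu.2 hu'.2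
  have hlink : ∀ c c', c ≠ c' → Linked (cellGraph G U C) Set.univ (X c) (X c') N := by
    intro c c' hcc
    refine linked_of_unseparated _ _ _ _ _ fun S hS => ?_
    obtain ⟨j, hj⟩ := exists_avoiding hS (fun j S => (S.1 ∩ B c j).Nonempty)
      fun S j j' h1 h2 => congrArg Prod.snd (hmod.col_eq S (j := (c, j)) (j' := (c, j')) h1 h2)
    obtain ⟨j', hj'⟩ := exists_avoiding hS (fun j S => (S.1 ∩ B c' j).Nonempty)
      fun S j j' h1 h2 => congrArg Prod.snd (hmod.col_eq S (j := (c', j)) (j' := (c', j')) h1 h2)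
    obtain ⟨i, hi⟩ := exists_avoiding (Nat.lt_succ_of_lt hS) (fun i S => (S.1 ∩ A i).Nonempty)
      fun S i i' h1 h2 => hmod.row_eq S h1 h2
    have hconn : Conn G (B c j ∪ A i ∪ B c' j') :=
      ((hmod.model.connB (c, j)).union (hmod.model.connA i)
        (Or.inr (hmod.model.touch i (c, j)).symm)).union (hmod.model.connB (c', j'))
        (Or.inr ((hmod.model.touch i (c', j')).mono Set.subset_union_right le_rfl))
    refine ⟨_, conn_cells hconn (Set.union_subset (Set.union_subset (hBU _ _) (hAU _)) (hBU _ _)),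
      ?_, ⟨cellOf ⟨s c j, hsU c j⟩, ?_, j, hcell c j⟩,
      ⟨cellOf ⟨s c' j', hsU c' j'⟩, ?_, j', hcell c' j'⟩⟩
    · rintro L ⟨v, hvL, (hv | hv) | hv⟩
      · exact ⟨trivial, fun hLS => hj L hLS ⟨v, hvL, hv⟩⟩
      · exact ⟨trivial, fun hLS => hi L hLS ⟨v, hvL, hv⟩⟩
      · exact ⟨trivial, fun hLS => hj' L hLS ⟨v, hvL, hv⟩⟩
    · exact ⟨s c j, mem_cell_self, Or.inl (Or.inl (hA.s_mem c j))⟩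
    · exact ⟨s c' j', mem_cell_self, Or.inr (hA.s_mem c' j')⟩
  rcases hN hthin Set.univ (fun e => X (E.symm e).1.1) (fun e => X (E.symm e).1.2)
    (fun e => ⟨hterm _, hterm _, by
      rw [Set.disjoint_left]
      rintro S ⟨j, hS⟩ ⟨j', hS'⟩
      rw [hS] at hS'
      exact (E.symm e).2.ne (hsinj (Set.singleton_injective hS'))⟩)
    (fun e => hlink _ _ (E.symm e).2.ne) with ⟨P, hP, hPd⟩ | ⟨len, q, ρ, hs⟩
  swap
  · exact Or.inr ⟨_, inferInstance, _, _, _, len, q, ρ, hthin, hfib, hs⟩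
  left
  let D : Fin m → Fin m → Set V := fun c c' => if hc : c < c' then
    lift Subtype.val (P (E ⟨(c, c'), hc⟩)) else ∅
  have hD : ∀ c c' (hc : c < c'), D c c' = lift Subtype.val (P (E ⟨(c, c'), hc⟩)) :=
    fun c c' hc => dif_pos hc
  have hDU : ∀ S : Set (CellType G U C), lift Subtype.val S ⊆ U := by
    intro S v hv
    obtain ⟨w, -, hw⟩ := mem_lift.mp hv
    exact CellType.subset hCU w hw
  have hTU : ∀ c, Disjoint (T c) U := by
    intro c
    rw [Set.disjoint_left]
    rintro v hv (hv' | hv')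
    · obtain ⟨i, hi⟩ := Set.mem_iUnion.mp hv'
      exact (hA.antiTA c i).ne hv hi rfl
    · obtain ⟨⟨c', j⟩, hj⟩ := Set.mem_iUnion.mp hv'
      exact Set.disjoint_left.mp (hA.disjTB c c' j) hv hj
  refine ⟨T, D, hA.connT, hA.antiT, fun c c' hc => ?_, fun c c' d d' hc hd hne => ?_⟩
  · rw [hD c c' hc]
    obtain ⟨h1, -, -, h3, h4, h5⟩ := hP (E ⟨(c, c'), hc⟩)
    simp only [Equiv.symm_apply_apply] at h3 h4 h5
    have htouch : ∀ d, (P (E ⟨(c, c'), hc⟩) ∩ X d).Nonempty →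
        Touch G (T d) (lift Subtype.val (P (E ⟨(c, c'), hc⟩))) := by
      rintro d ⟨S, hS, j, hSj⟩
      refine (hA.touchT d j).symm.mono le_rfl ?_
      rw [← hSj]
      exact subset_lift (F := Subtype.val) hS
    refine ⟨hfib.conn_lift h1, (hTU c).mono_right (hDU _), (hTU c').mono_right (hDU _),
      htouch c h3, htouch c' h4, fun u huc huc' => ⟨(hTU u).mono_right (hDU _), fun x hx y hy hxy => ?_⟩⟩
    have hyU := hDU _ hy
    rcases hyU with hy' | hy'
    · obtain ⟨i, hi⟩ := Set.mem_iUnion.mp hy'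
      exact (hA.antiTA u i).2 x hx y hi hxy
    · obtain ⟨⟨d, j⟩, hj⟩ := Set.mem_iUnion.mp hy'
      obtain ⟨rfl, rfl⟩ := hA.eq_of_touch u d j y hj ⟨y, rfl, x, hx, hxy.symm⟩
      obtain ⟨S, hS, hyS⟩ := mem_lift.mp hy
      obtain rfl := cellOf_eq hyS (hsU d j)
      rcases h5 _ hS (hterm d _ ⟨j, hcell d j⟩).2 with ⟨j', hj'⟩ | ⟨j', hj'⟩ <;>
        rw [hcell] at hj'
      · exact huc (hsinj (Set.singleton_injective hj'))
      · exact huc' (hsinj (Set.singleton_injective hj'))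
  · rw [hD c c' hc, hD d d' hd]
    refine hfib.anticomplete_lift ((hP _).2.1.anticomplete (hP _).2.1 hthin (hPd _ _ fun he => hne ?_))
    exact congrArg Subtype.val (E.injective he)

end Contact

/-- Pairwise disjoint closed induced paths. -/
structure Columns {W ι : Type} (H : SimpleGraph W) (K : Set W) (len : ι → ℕ) (q : ι → ℕ → W)
    (J : Set ι) : Prop where
  path : ∀ c ∈ J, IndPath H (len c) (q c)
  closed : ∀ c ∈ J, ClosedOff H K (seg (q c) 0 (len c))
  disj : ∀ c ∈ J, ∀ c' ∈ J, c ≠ c' → Disjoint (seg (q c) 0 (len c)) (seg (q c') 0 (len c'))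

/-- A closed set `{q c a, u} ∪ E` which links the column `c` with the column `c'` and avoids the
other columns in `J`. -/
structure Connector {W ι : Type} (H : SimpleGraph W) (K : Set W) (len : ι → ℕ) (q : ι → ℕ → W)
    (J : Set ι) (c c' : ι) (a b : ℕ) (u : W) (E : Set W) : Prop where
  a_le : a ≤ len c
  b_le : b ≤ len c'
  a_mem : q c a ∈ K
  b_mem : q c' b ∈ K
  u_notMem : u ∉ K
  adj : H.Adj (q c a) u
  conn : Conn H E
  b_memE : q c' b ∈ E
  touch : ∃ x ∈ E, H.Adj u x
  u_notMemE : u ∉ E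
  a_notMemE : q c a ∉ E
  not_adj : ∀ x ∈ E, ¬ H.Adj (q c a) x
  closed : ClosedOff H K (insert (q c a) (insert u E))
  off : ∀ k ∈ J, k ≠ c → k ≠ c' → Disjoint (insert (q c a) (insert u E)) (seg (q k) 0 (len k))
  fst_col : ∀ x ∈ insert (q c a) (insert u E), x ∈ seg (q c) 0 (len c) → x = q c a
  snd_col : ∀ x ∈ insert (q c a) (insert u E), x ∈ seg (q c') 0 (len c') → x = q c' b

section Connector

variable {W ι : Type} {H : SimpleGraph W} {K : Set W} {len : ι → ℕ} {q : ι → ℕ → W} {J : Set ι}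
  {c c' : ι} {a b : ℕ} {u : W} {E : Set W}

theorem ClosedOff.cross {S T : Set W} (hS : ClosedOff H K S) (hT : ClosedOff H K T)
    (hH : ThinOff H K) {x y : W} (hx : x ∈ S) (hxT : x ∉ T) (hy : y ∈ T) (hxy : H.Adj x y) :
    y ∈ S ∧ y ∈ K := by
  have hyK : y ∈ K := by
    by_contra hyK
    exact hxT (hT y hy hyK x hxy.symm)
  exact ⟨hS x hx (fun h => hH.indep x h y hyK hxy) y hxy, hyK⟩

theorem Columns.anticomplete_seg (hQ : Columns H K len q J) (hH : ThinOff H K) {k k' : ι}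
    (hk : k ∈ J) (hk' : k' ∈ J) {i j i' j' : ℕ} (hj : j ≤ len k) (hj' : j' ≤ len k')
    (h : k = k' → j + 1 < i' ∨ j' + 1 < i) : Anticomplete H (seg (q k) i j) (seg (q k') i' j') := by
  by_cases hkk : k = k'
  · subst hkk
    rcases h rfl with h | h
    · exact (hQ.path k hk).anticomplete_seg h hj'
    · exact ((hQ.path k hk).anticomplete_seg h hj).symm
  · exact ((hQ.closed k hk).anticomplete (hQ.closed k' hk') hH (hQ.disj k hk k' hk' hkk)).mono
      (seg_mono (Nat.zero_le _) hj) (seg_mono (Nat.zero_le _) hj')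

theorem Connector.u_off (h : Connector H K len q J c c' a b u E) {k : ι} (hk : k ∈ J) :
    u ∉ seg (q k) 0 (len k) := by
  have hu : u ∈ insert (q c a) (insert u E) := Or.inr (Or.inl rfl)
  intro huk
  by_cases h1 : k = c
  · subst h1
    exact h.u_notMem (h.fst_col u hu huk ▸ h.a_mem)
  by_cases h2 : k = c'
  · subst h2
    exact h.u_notMem (h.snd_col u hu huk ▸ h.b_mem)
  exact Set.disjoint_left.mp (h.off k hk h1 h2) hu huk

theorem Connector.u_seg (h : Connector H K len q J c c' a b u E) (hQ : Columns H K len q J)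
    (hH : ThinOff H K) {k : ι} (hk : k ∈ J) {i j : ℕ} (hj : j ≤ len k)
    (h1 : k = c → a < i ∨ j < a) (h2 : k = c' → b < i ∨ j < b) :
    Anticomplete H {u} (seg (q k) i j) := by
  have hu : u ∈ insert (q c a) (insert u E) := Or.inr (Or.inl rfl)
  have hsub : seg (q k) i j ⊆ seg (q k) 0 (len k) := seg_mono (Nat.zero_le _) hj
  refine anticomplete_of fun x hx y hy => ?_
  obtain rfl : x = u := hx
  refine ⟨fun he => h.u_off hk (he ▸ hsub hy), fun hxy => ?_⟩
  obtain ⟨hyS, -⟩ := h.closed.cross (hQ.closed k hk) hH hu (h.u_off hk) (hsub hy) hxy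
  by_cases hc : k = c
  · subst hc
    obtain ⟨l, hl, rfl⟩ := hy
    have := (hQ.path k hk).inj (hl.2.trans hj) h.a_le (h.fst_col _ hyS (hsub ⟨l, hl, rfl⟩))
    have := h1 rfl
    have := hl.1
    have := hl.2
    omega
  by_cases hc' : k = c'
  · subst hc'
    obtain ⟨l, hl, rfl⟩ := hy
    have := (hQ.path k hk).inj (hl.2.trans hj) h.b_le (h.snd_col _ hyS (hsub ⟨l, hl, rfl⟩))
    have := h2 rfl
    have := hl.1
    have := hl.2
    omega
  exact Set.disjoint_left.mp (h.off k hk hc hc') hyS (hsub hy)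

theorem Connector.E_seg (h : Connector H K len q J c c' a b u E) (hQ : Columns H K len q J)
    (hH : ThinOff H K) {k : ι} (hk : k ∈ J) {i j : ℕ} (hj : j ≤ len k)
    (h2 : k = c' → b + 1 < i ∨ j + 1 < b) : Anticomplete H E (seg (q k) i j) := by
  have hE : E ⊆ insert (q c a) (insert u E) := fun x hx => Or.inr (Or.inr hx)
  have hsub : seg (q k) i j ⊆ seg (q k) 0 (len k) := seg_mono (Nat.zero_le _) hj
  by_cases hc' : k = c'
  · subst hc'
    have hb : ∀ l, i ≤ l → l ≤ j → b ≠ l ∧ ¬ H.Adj (q k b) (q k l) := by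
      intro l hl hl'
      have := h2 rfl
      refine ⟨by omega, fun hadj => ?_⟩
      rw [(hQ.path k hk).adj_iff h.b_le (hl'.trans hj)] at hadj
      omega
    refine anticomplete_of fun x hx y hy => ?_
    obtain ⟨l, hl, rfl⟩ := hy
    have hl' := hb l hl.1 hl.2
    refine ⟨?_, fun hxy => ?_⟩
    · rintro rfl
      exact hl'.1 ((hQ.path k hk).inj h.b_le (hl.2.trans hj)
        (h.snd_col _ (hE hx) (hsub ⟨l, hl, rfl⟩)).symm)
    · by_cases hxk : x ∈ seg (q k) 0 (len k)
      · exact hl'.2 (h.snd_col _ (hE hx) hxk ▸ hxy)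
      · obtain ⟨hyS, -⟩ := h.closed.cross (hQ.closed k hk) hH (hE hx) hxk (hsub ⟨l, hl, rfl⟩) hxy
        exact hl'.1 ((hQ.path k hk).inj h.b_le (hl.2.trans hj)
          (h.snd_col _ hyS (hsub ⟨l, hl, rfl⟩)).symm)
  · by_cases hc : k = c
    · subst hc
      have hEk : ∀ x ∈ E, x ∉ seg (q k) 0 (len k) := fun x hx hxk =>
        h.a_notMemE (h.fst_col x (hE hx) hxk ▸ hx)
      refine anticomplete_of fun x hx y hy => ⟨?_, fun hxy => ?_⟩
      · rintro rfl
        exact hEk x hx (hsub hy)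
      · obtain ⟨hyS, -⟩ := h.closed.cross (hQ.closed k hk) hH (hE hx) (hEk x hx) (hsub hy) hxy
        rw [h.fst_col y hyS (hsub hy)] at hxy
        exact h.not_adj x hx hxy.symm
    · exact (h.closed.anticomplete (hQ.closed k hk) hH (h.off k hk hc hc')).mono hE hsub

end Connector

/-- Columns and connectors arranged along the wall. -/
structure Frame {W : Type} (H : SimpleGraph W) (K : Set W) (r : ℕ) (len : ℕ → ℕ) (q : ℕ → ℕ → W)
    (a b : Fin r × Fin (2 * r) → ℕ) (u : Fin r × Fin (2 * r) → W)
    (E : Fin r × Fin (2 * r) → Set W) : Prop where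
  cols : Columns H K len q (Set.Iic (2 * r))
  con : ∀ v, Connector H K len q (Set.Iic (2 * r)) v.2.val (v.2.val + 1) (a v) (b v) (u v) (E v)
  disj : ∀ v w, v ≠ w → Disjoint (insert (q v.2.val (a v)) (insert (u v) (E v)))
    (insert (q w.2.val (a w)) (insert (u w) (E w)))
  pos : ∀ v, 1 ≤ a v
  lt : ∀ v, a v + 1 ≤ len v.2.val
  even : ∀ v w, v.1.val = w.1.val → v.2.val + 1 = w.2.val → (w.1.val + w.2.val) % 2 = 0 →
    b v + 4 ≤ a w
  odd : ∀ v w, v.1.val = w.1.val → v.2.val + 1 = w.2.val → (w.1.val + w.2.val) % 2 = 1 →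
    a w + 4 ≤ b v
  aa : ∀ v w, v.2.val = w.2.val → v.1.val < w.1.val → a v + 4 ≤ a w
  bb : ∀ v w, v.2.val = w.2.val → v.1.val < w.1.val → b v + 4 ≤ b w
  ba : ∀ v w, v.2.val + 1 = w.2.val → v.1.val < w.1.val → b v + 4 ≤ a w
  ab : ∀ v w, v.2.val = w.2.val + 1 → v.1.val < w.1.val → a v + 4 ≤ b w

/-- The edges of the wall, directed to the right and downwards. -/
def Arc {r : ℕ} (v w : Fin r × Fin (2 * r)) : Prop :=
  (v.1.val = w.1.val ∧ v.2.val + 1 = w.2.val) ∨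
    (v.2.val = w.2.val ∧ v.1.val + 1 = w.1.val ∧ (v.1.val + v.2.val) % 2 = 0)

/-- The region of a vertex of the wall. -/
def frameD {W : Type} {r : ℕ} (q : ℕ → ℕ → W) (a : Fin r × Fin (2 * r) → ℕ)
    (u : Fin r × Fin (2 * r) → W) (v : Fin r × Fin (2 * r)) : Set W :=
  seg (q v.2.val) (a v - 1) (a v + 1) ∪ {u v}

/-- The three ports of the region of a vertex of the wall. -/
def frameY {W : Type} {r : ℕ} (q : ℕ → ℕ → W) (a : Fin r × Fin (2 * r) → ℕ)
    (u : Fin r × Fin (2 * r) → W) (v : Fin r × Fin (2 * r)) : Fin 3 → W :=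
  ![q v.2.val (a v - 1), q v.2.val (a v + 1), u v]

open Classical in
/-- The region of an arc of the wall. -/
noncomputable def frameB {W : Type} {r : ℕ} (q : ℕ → ℕ → W) (a b : Fin r × Fin (2 * r) → ℕ)
    (E : Fin r × Fin (2 * r) → Set W) (v w : Fin r × Fin (2 * r)) : Set W :=
  if v.1.val = w.1.val then E v ∪ seg (q w.2.val) (min (b v) (a w + 2)) (max (b v) (a w - 2))
  else seg (q w.2.val) (a v + 2) (a w - 2)

open Classical in
/-- The region of an edge of the wall. -/
noncomputable def frameC {W : Type} {r : ℕ} (q : ℕ → ℕ → W) (a b : Fin r × Fin (2 * r) → ℕ)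
    (E : Fin r × Fin (2 * r) → Set W) (v w : Fin r × Fin (2 * r)) : Set W :=
  if Arc v w then frameB q a b E v w else frameB q a b E w v

section Frame

variable {W : Type} {H : SimpleGraph W} {K : Set W} {r : ℕ} {len : ℕ → ℕ} {q : ℕ → ℕ → W}
  {a b : Fin r × Fin (2 * r) → ℕ} {u : Fin r × Fin (2 * r) → W}
  {E : Fin r × Fin (2 * r) → Set W}

theorem Arc.ne {v w : Fin r × Fin (2 * r)} (h : Arc v w) : v ≠ w := by
  rintro rfl
  unfold Arc at h
  omega

theorem Arc.not_arc {v w : Fin r × Fin (2 * r)} (h : Arc v w) : ¬ Arc w v := by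
  unfold Arc at h ⊢
  omega

theorem wall_adj_iff_arc {v w : Fin r × Fin (2 * r)} : (Wall r).Adj v w ↔ Arc v w ∨ Arc w v := by
  rw [wall_adj_iff]
  unfold Arc
  omega

theorem Frame.col_mem (v : Fin r × Fin (2 * r)) : v.2.val ∈ Set.Iic (2 * r) := v.2.2.le

theorem wall_cases (v w : Fin r × Fin (2 * r)) (h : v ≠ w) (h2 : v.2.val = w.2.val) :
    v.1.val < w.1.val ∨ w.1.val < v.1.val := by
  by_contra! h'
  exact h (Prod.ext (Fin.ext (by omega)) (Fin.ext h2))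

theorem Frame.u_u (h : Frame H K r len q a b u E) (hH : ThinOff H K) {v w : Fin r × Fin (2 * r)}
    (hvw : v ≠ w) : Anticomplete H {u v} {u w} :=
  ((h.con v).closed.anticomplete (h.con w).closed hH (h.disj v w hvw)).mono
    (by simp) (by simp)

theorem Frame.u_E (h : Frame H K r len q a b u E) (hH : ThinOff H K) {v w : Fin r × Fin (2 * r)}
    (hvw : v ≠ w) : Anticomplete H {u v} (E w) :=
  ((h.con v).closed.anticomplete (h.con w).closed hH (h.disj v w hvw)).mono
    (by simp) (fun _ hx => Or.inr (Or.inr hx))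

theorem Frame.E_E (h : Frame H K r len q a b u E) (hH : ThinOff H K) {v w : Fin r × Fin (2 * r)}
    (hvw : v ≠ w) : Anticomplete H (E v) (E w) :=
  ((h.con v).closed.anticomplete (h.con w).closed hH (h.disj v w hvw)).mono
    (fun _ hx => Or.inr (Or.inr hx)) (fun _ hx => Or.inr (Or.inr hx))

theorem Frame.a_far (h : Frame H K r len q a b u E) {v w : Fin r × Fin (2 * r)} (hvw : v ≠ w)
    (h2 : v.2.val = w.2.val) : a v + 4 ≤ a w ∨ a w + 4 ≤ a v :=
  (wall_cases v w hvw h2).imp (h.aa v w h2) (h.aa w v h2.symm)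

theorem Frame.ab_far (h : Frame H K r len q a b u E) {v w : Fin r × Fin (2 * r)}
    (h2 : v.2.val + 1 = w.2.val) : b v + 4 ≤ a w ∨ a w + 4 ≤ b v := by
  rcases lt_trichotomy v.1.val w.1.val with h1 | h1 | h1
  · exact Or.inl (h.ba v w h2 h1)
  · rcases Nat.mod_two_eq_zero_or_one (w.1.val + w.2.val) with h3 | h3
    · exact Or.inl (h.even v w h1 h2 h3)
    · exact Or.inr (h.odd v w h1 h2 h3)
  · exact Or.inr (h.ab w v h2.symm h1)

theorem Frame.u_seg (h : Frame H K r len q a b u E) (hH : ThinOff H K) (v : Fin r × Fin (2 * r))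
    {k : ℕ} (hk : k ≤ 2 * r) {i j : ℕ} (hj : j ≤ len k)
    (h1 : k = v.2.val → a v < i ∨ j < a v) (h2 : k = v.2.val + 1 → b v < i ∨ j < b v) :
    Anticomplete H {u v} (seg (q k) i j) :=
  (h.con v).u_seg h.cols hH hk hj h1 h2

theorem Frame.E_seg (h : Frame H K r len q a b u E) (hH : ThinOff H K) (v : Fin r × Fin (2 * r))
    {k : ℕ} (hk : k ≤ 2 * r) {i j : ℕ} (hj : j ≤ len k)
    (h2 : k = v.2.val + 1 → b v + 1 < i ∨ j + 1 < b v) : Anticomplete H (E v) (seg (q k) i j) :=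
  (h.con v).E_seg h.cols hH hk hj h2

theorem Frame.D_anti (h : Frame H K r len q a b u E) (hH : ThinOff H K)
    {v w : Fin r × Fin (2 * r)} (hvw : v ≠ w) :
    Anticomplete H (frameD q a u v) (frameD q a u w) := by
  have key : ∀ v w : Fin r × Fin (2 * r), v ≠ w →
      Anticomplete H {u v} (seg (q w.2.val) (a w - 1) (a w + 1)) := by
    intro v w hvw
    refine h.u_seg hH v w.2.2.le (h.lt w) (fun h2 => ?_) (fun h2 => ?_)
    · have := h.a_far hvw h2.symm
      omega
    · have := h.ab_far h2.symm
      omega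
  refine Anticomplete.union_left (Anticomplete.union_right ?_ (key w v hvw.symm).symm)
    (Anticomplete.union_right (key v w hvw) (h.u_u hH hvw))
  refine h.cols.anticomplete_seg hH (Frame.col_mem v) (Frame.col_mem w) (h.lt v) (h.lt w)
    fun h2 => ?_
  have := h.a_far hvw h2
  omega

end Frame

section Frame

variable {W : Type} {H : SimpleGraph W} {K : Set W} {r : ℕ} {len : ℕ → ℕ} {q : ℕ → ℕ → W}
  {a b : Fin r × Fin (2 * r) → ℕ} {u : Fin r × Fin (2 * r) → W}
  {E : Fin r × Fin (2 * r) → Set W}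

theorem frameB_of_eq {v w : Fin r × Fin (2 * r)} (h : v.1.val = w.1.val) :
    frameB q a b E v w = E v ∪ seg (q w.2.val) (min (b v) (a w + 2)) (max (b v) (a w - 2)) :=
  if_pos h

theorem frameB_of_ne {v w : Fin r × Fin (2 * r)} (h : ¬ v.1.val = w.1.val) :
    frameB q a b E v w = seg (q w.2.val) (a v + 2) (a w - 2) :=
  if_neg h

theorem IndPath.only_succ {n : ℕ} {p : ℕ → W} (hp : IndPath H n p) {a i j : ℕ} (ha : a + 1 ≤ n)
    (hj : j ≤ n) (h : a + 2 ≤ i) {x z : W} (hx : x ∈ seg p (a - 1) (a + 1)) (hz : z ∈ seg p i j) :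
    x ≠ z ∧ (H.Adj x z → x = p (a + 1)) := by
  obtain ⟨k, hk, rfl⟩ := hx
  obtain ⟨l, hl, rfl⟩ := hz
  obtain ⟨hk1, hk2⟩ := hk
  obtain ⟨hl1, hl2⟩ := hl
  refine ⟨fun he => ?_, fun hadj => ?_⟩
  · have := hp.inj (by omega) (by omega) he
    omega
  · rw [hp.adj_iff (by omega) (by omega)] at hadj
    rw [show k = a + 1 by omega]

theorem IndPath.only_pred {n : ℕ} {p : ℕ → W} (hp : IndPath H n p) {a i j : ℕ} (ha : a + 1 ≤ n)
    (h : j + 2 ≤ a) {x z : W} (hx : x ∈ seg p (a - 1) (a + 1)) (hz : z ∈ seg p i j) :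
    x ≠ z ∧ (H.Adj x z → x = p (a - 1)) := by
  obtain ⟨k, hk, rfl⟩ := hx
  obtain ⟨l, hl, rfl⟩ := hz
  obtain ⟨hk1, hk2⟩ := hk
  obtain ⟨hl1, hl2⟩ := hl
  refine ⟨fun he => ?_, fun hadj => ?_⟩
  · have := hp.inj (by omega) (by omega) he
    omega
  · rw [hp.adj_iff (by omega) (by omega)] at hadj
    rw [show k = a - 1 by omega]

theorem Frame.b_le (h : Frame H K r len q a b u E) {v : Fin r × Fin (2 * r)} {k : ℕ}
    (hk : v.2.val + 1 = k) : b v ≤ len k :=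
  hk ▸ (h.con v).b_le

theorem Frame.D_B_anti (h : Frame H K r len q a b u E) (hH : ThinOff H K)
    {v w x : Fin r × Fin (2 * r)} (hvw : Arc v w) (hxv : x ≠ v) (hxw : x ≠ w) :
    Anticomplete H (frameD q a u x) (frameB q a b E v w) := by
  have hlw := h.lt w
  by_cases h1 : v.1.val = w.1.val
  · have h2 : v.2.val + 1 = w.2.val := by unfold Arc at hvw; omega
    have hbl := h.b_le h2
    rw [frameB_of_eq h1]
    refine Anticomplete.union_left (Anticomplete.union_right ?_ ?_)
      (Anticomplete.union_right (h.u_E hH hxv) ?_)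
    · refine (h.E_seg hH v x.2.2.le (h.lt x) fun h3 => ?_).symm
      have := h.ab_far h3.symm
      omega
    · refine h.cols.anticomplete_seg hH (Frame.col_mem x) (Frame.col_mem w) (h.lt x) (by omega)
        fun h3 => ?_
      rcases wall_cases x w hxw h3 with h4 | h4
      · have := h.aa x w h3 h4
        have := h.ab x v (by omega) (by omega)
        omega
      · have := h.aa w x h3.symm h4
        have := h.ba v x (by omega) (by omega)
        omega
    · refine h.u_seg hH x w.2.2.le (by omega) (fun h3 => ?_) (fun h3 => ?_)
      · rcases wall_cases x w hxw h3.symm with h4 | h4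
        · have := h.aa x w h3.symm h4
          have := h.ab x v (by omega) (by omega)
          omega
        · have := h.aa w x h3 h4
          have := h.ba v x (by omega) (by omega)
          omega
      · rcases wall_cases x v hxv (by omega) with h4 | h4
        · have := h.bb x v (by omega) h4
          have := h.ba x w (by omega) (by omega)
          omega
        · have := h.bb v x (by omega) h4
          have := h.ab w x (by omega) (by omega)
          omega
  · obtain ⟨h2, h3, h4⟩ : v.2.val = w.2.val ∧ v.1.val + 1 = w.1.val ∧
        (v.1.val + v.2.val) % 2 = 0 := by unfold Arc at hvw; omega
    rw [frameB_of_ne h1]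
    have hvw' := h.aa v w h2 (by omega)
    have hfar : x.2.val = w.2.val → a x + 4 ≤ a v ∨ a w + 4 ≤ a x := by
      intro h5
      rcases wall_cases x w hxw h5 with h6 | h6
      · rcases wall_cases x v hxv (by omega) with h7 | h7
        · exact Or.inl (h.aa x v (by omega) h7)
        · omega
      · exact Or.inr (h.aa w x h5.symm h6)
    refine Anticomplete.union_left ?_ ?_
    · refine h.cols.anticomplete_seg hH (Frame.col_mem x) (Frame.col_mem w) (h.lt x) (by omega)
        fun h5 => ?_
      have := hfar h5
      omega
    · refine h.u_seg hH x w.2.2.le (by omega) (fun h5 => ?_) (fun h5 => ?_)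
      · have := hfar h5.symm
        omega
      · rcases lt_trichotomy x.1.val v.1.val with h6 | h6 | h6
        · have := h.ba x v (by omega) h6
          omega
        · have := h.even x v h6 (by omega) (by omega)
          omega
        · by_cases h7 : x.1.val = w.1.val
          · have := h.odd x w h7 (by omega) (by omega)
            omega
          · have := h.ab w x (by omega) (by omega)
            omega

theorem Frame.D_B_fst (h : Frame H K r len q a b u E) (hH : ThinOff H K)
    {v w : Fin r × Fin (2 * r)} (hvw : Arc v w) {x z : W} (hx : x ∈ frameD q a u v)
    (hz : z ∈ frameB q a b E v w) :
    x ≠ z ∧ (H.Adj x z → x = frameY q a u v (port v w)) := by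
  have of_anti : ∀ {X Y : Set W}, Anticomplete H X Y → x ∈ X → z ∈ Y →
      x ≠ z ∧ (H.Adj x z → x = frameY q a u v (port v w)) := fun hXY hx hz =>
    ⟨hXY.ne hx hz, fun hxz => (hXY.2 x hx z hz hxz).elim⟩
  have hlw := h.lt w
  have hlv := h.lt v
  by_cases h1 : v.1.val = w.1.val
  · have h2 : v.2.val + 1 = w.2.val := by unfold Arc at hvw; omega
    have hbl := h.b_le h2
    have hp : port v w = 2 := if_pos ⟨Fin.ext h1, h2⟩
    rw [frameB_of_eq h1] at hz
    rcases hx with hx | hx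
    · rcases hz with hz | hz
      · exact of_anti (h.E_seg hH v v.2.2.le hlv fun h3 => by omega).symm hx hz
      · exact of_anti (h.cols.anticomplete_seg hH (Frame.col_mem v) (Frame.col_mem w) hlv
          (by omega) fun h3 => by omega) hx hz
    · obtain rfl : x = u v := hx
      refine ⟨?_, fun _ => by rw [hp]; rfl⟩
      rintro rfl
      rcases hz with hz | hz
      · exact (h.con v).u_notMemE hz
      · exact (h.con v).u_off (Frame.col_mem w) (seg_mono (Nat.zero_le _) (by omega) hz)
  · obtain ⟨h2, h3, h4⟩ : v.2.val = w.2.val ∧ v.1.val + 1 = w.1.val ∧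
        (v.1.val + v.2.val) % 2 = 0 := by unfold Arc at hvw; omega
    have hp : port v w = 1 := by
      unfold port
      rw [if_neg (fun h => h1 (congrArg Fin.val h.1)), if_pos h4,
        if_neg (fun h => h1 (congrArg Fin.val h))]
    rw [frameB_of_ne h1] at hz
    rcases hx with hx | hx
    · rw [hp]
      rw [← h2] at hz
      rw [← h2] at hlw
      exact (h.cols.path _ (Frame.col_mem v)).only_succ hlv (by omega) le_rfl hx hz
    · refine of_anti (h.u_seg hH v w.2.2.le (by omega) (fun _ => Or.inl (by omega))
        (fun h5 => by omega)) hx hz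

theorem Frame.D_B_snd (h : Frame H K r len q a b u E) (hH : ThinOff H K)
    {v w : Fin r × Fin (2 * r)} (hvw : Arc v w) {x z : W} (hx : x ∈ frameD q a u w)
    (hz : z ∈ frameB q a b E v w) :
    x ≠ z ∧ (H.Adj x z → x = frameY q a u w (port w v)) := by
  have of_anti : ∀ {X Y : Set W}, Anticomplete H X Y → x ∈ X → z ∈ Y →
      x ≠ z ∧ (H.Adj x z → x = frameY q a u w (port w v)) := fun hXY hx hz =>
    ⟨hXY.ne hx hz, fun hxz => (hXY.2 x hx z hz hxz).elim⟩
  have hlw := h.lt w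
  have hw := h.cols.path _ (Frame.col_mem w)
  by_cases h1 : v.1.val = w.1.val
  · have h2 : v.2.val + 1 = w.2.val := by unfold Arc at hvw; omega
    have hbl := h.b_le h2
    have hnp : ¬ (w.1 = v.1 ∧ w.2.val + 1 = v.2.val) := fun h => by omega
    have hwv : w.1 = v.1 := Fin.ext h1.symm
    rw [frameB_of_eq h1] at hz
    have hfar := h.ab_far h2
    rcases hz with hz | hz
    · rcases hx with hx | hx
      · refine of_anti (h.E_seg hH v w.2.2.le hlw fun h3 => ?_).symm hx hz
        omega
      · exact of_anti (h.u_E hH hvw.ne.symm) hx hz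
    · rcases hx with hx | hx
      · rcases Nat.mod_two_eq_zero_or_one (w.1.val + w.2.val) with h3 | h3
        · have hp : port w v = 0 := by
            unfold port
            rw [if_neg hnp, if_pos h3, if_pos hwv]
          have := h.even v w h1 h2 h3
          rw [hp]
          exact hw.only_pred hlw (by omega) hx hz
        · have hp : port w v = 1 := by
            unfold port
            rw [if_neg hnp, if_neg (by omega), if_pos hwv]
          have := h.odd v w h1 h2 h3
          rw [hp]
          exact hw.only_succ hlw (by omega) (by omega) hx hz
      · refine of_anti (h.u_seg hH w w.2.2.le (by omega) (fun _ => by omega)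
          (fun h5 => by omega)) hx hz
  · obtain ⟨h2, h3, h4⟩ : v.2.val = w.2.val ∧ v.1.val + 1 = w.1.val ∧
        (v.1.val + v.2.val) % 2 = 0 := by unfold Arc at hvw; omega
    have hvw' := h.aa v w h2 (by omega)
    have hp : port w v = 0 := by
      unfold port
      rw [if_neg (fun h => h1 (congrArg Fin.val h.1).symm), if_neg (by omega),
        if_neg (fun h => h1 (congrArg Fin.val h).symm)]
    rw [frameB_of_ne h1] at hz
    rcases hx with hx | hx
    · rw [hp]
      exact hw.only_pred hlw (by omega) hx hz
    · refine of_anti (h.u_seg hH w w.2.2.le (by omega) (fun _ => Or.inr (by omega))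
        (fun h5 => by omega)) hx hz

theorem Frame.B_B_hor_ver (h : Frame H K r len q a b u E) (hH : ThinOff H K)
    {v w v' w' : Fin r × Fin (2 * r)} (hvw : Arc v w) (hvw' : Arc v' w')
    (h1 : v.1.val = w.1.val) (h1' : ¬ v'.1.val = w'.1.val) :
    Anticomplete H (frameB q a b E v w) (frameB q a b E v' w') := by
  have h2 : v.2.val + 1 = w.2.val := by unfold Arc at hvw; omega
  obtain ⟨h2', h3', h4'⟩ : v'.2.val = w'.2.val ∧ v'.1.val + 1 = w'.1.val ∧
        (v'.1.val + v'.2.val) % 2 = 0 := by unfold Arc at hvw'; omega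
  have hlw := h.lt w
  have hlw' := h.lt w'
  have hbl := h.b_le h2
  have hav := h.aa v' w' h2' (by omega)
  rw [frameB_of_eq h1, frameB_of_ne h1']
  have hcase : w'.2.val = w.2.val →
      (b v + 4 ≤ a v' ∧ a w ≤ a v') ∨ (a w' + 4 ≤ b v ∧ a w' ≤ a w) := by
    intro h5
    rcases lt_trichotomy w.1.val v'.1.val with h6 | h6 | h6
    · exact Or.inl ⟨h.ba v v' (by omega) (by omega),
        (Nat.le_add_right _ _).trans (h.aa w v' (by omega) h6)⟩
    · obtain rfl : w = v' := Prod.ext (Fin.ext h6) (Fin.ext (by omega))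
      exact Or.inl ⟨h.even v w h1 h2 h4', le_rfl⟩
    · by_cases h7 : w.1.val = w'.1.val
      · obtain rfl : w = w' := Prod.ext (Fin.ext h7) (Fin.ext (by omega))
        exact Or.inr ⟨h.odd v w h1 h2 (by omega), le_rfl⟩
      · exact Or.inr ⟨h.ab w' v (by omega) (by omega),
          (Nat.le_add_right _ _).trans (h.aa w' w h5 (by omega))⟩
  refine Anticomplete.union_left ?_ ?_
  · refine h.E_seg hH v w'.2.2.le (by omega) fun h5 => ?_
    have := hcase (by omega)
    omega
  · refine h.cols.anticomplete_seg hH (Frame.col_mem w) (Frame.col_mem w') (by omega) (by omega)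
      fun h5 => ?_
    have := hcase h5.symm
    omega

theorem Frame.B_B_hor_hor (h : Frame H K r len q a b u E) (hH : ThinOff H K)
    {v w v' w' : Fin r × Fin (2 * r)} (hvw : Arc v w) (hvw' : Arc v' w')
    (h1 : v.1.val = w.1.val) (h1' : v'.1.val = w'.1.val) (hne : v ≠ v') :
    Anticomplete H (frameB q a b E v w) (frameB q a b E v' w') := by
  have key : ∀ v w v' w' : Fin r × Fin (2 * r), Arc v w → Arc v' w' → v.1.val = w.1.val →
      v'.1.val = w'.1.val → v ≠ v' → w'.2.val = v.2.val + 1 →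
      (b v + 4 ≤ b v' ∧ b v + 4 ≤ a w') ∨ (b v' + 4 ≤ b v ∧ a w' + 4 ≤ b v) := by
    intro v w v' w' hvw hvw' h1 h1' hne h3
    have h2' : v'.2.val + 1 = w'.2.val := by unfold Arc at hvw'; omega
    rcases wall_cases v v' hne (by omega) with h4 | h4
    · exact Or.inl ⟨h.bb v v' (by omega) h4, h.ba v w' (by omega) (by omega)⟩
    · exact Or.inr ⟨h.bb v' v (by omega) h4, h.ab w' v (by omega) (by omega)⟩
  have h2 : v.2.val + 1 = w.2.val := by unfold Arc at hvw; omega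
  have h2' : v'.2.val + 1 = w'.2.val := by unfold Arc at hvw'; omega
  have hlw := h.lt w
  have hlw' := h.lt w'
  have hbl := h.b_le h2
  have hbl' := h.b_le h2'
  rw [frameB_of_eq h1, frameB_of_eq h1']
  refine Anticomplete.union_left (Anticomplete.union_right (h.E_E hH hne) ?_)
    (Anticomplete.union_right (Anticomplete.symm ?_) ?_)
  · refine h.E_seg hH v w'.2.2.le (by omega) fun h5 => ?_
    have := key v w v' w' hvw hvw' h1 h1' hne h5
    omega
  · refine h.E_seg hH v' w.2.2.le (by omega) fun h5 => ?_
    have := key v' w' v w hvw' hvw h1' h1 hne.symm h5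
    omega
  · refine h.cols.anticomplete_seg hH (Frame.col_mem w) (Frame.col_mem w') (by omega) (by omega)
      fun h5 => ?_
    rcases wall_cases v v' hne (by omega) with h4 | h4
    · have := h.aa w w' h5 (by omega)
      have := h.bb v v' (by omega) h4
      have := h.ba v w' (by omega) (by omega)
      have := h.ab w v' (by omega) (by omega)
      omega
    · have := h.aa w' w h5.symm (by omega)
      have := h.bb v' v (by omega) h4
      have := h.ba v' w (by omega) (by omega)
      have := h.ab w' v (by omega) (by omega)
      omega

theorem Frame.B_B_ver_ver (h : Frame H K r len q a b u E) (hH : ThinOff H K)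
    {v w v' w' : Fin r × Fin (2 * r)} (hvw : Arc v w) (hvw' : Arc v' w')
    (h1 : ¬ v.1.val = w.1.val) (h1' : ¬ v'.1.val = w'.1.val) (hne : v ≠ v') :
    Anticomplete H (frameB q a b E v w) (frameB q a b E v' w') := by
  have h2 : v.2.val = w.2.val ∧ v.1.val + 1 = w.1.val ∧
        (v.1.val + v.2.val) % 2 = 0 := by unfold Arc at hvw; omega
  have h2' : v'.2.val = w'.2.val ∧ v'.1.val + 1 = w'.1.val ∧
        (v'.1.val + v'.2.val) % 2 = 0 := by unfold Arc at hvw'; omega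
  have hlw := h.lt w
  have hlw' := h.lt w'
  have := h.aa v w h2.1 (by omega)
  have := h.aa v' w' h2'.1 (by omega)
  rw [frameB_of_ne h1, frameB_of_ne h1']
  refine h.cols.anticomplete_seg hH (Frame.col_mem w) (Frame.col_mem w') (by omega) (by omega)
    fun h5 => ?_
  rcases wall_cases v v' hne (by omega) with h4 | h4
  · have := h.aa w v' (by omega) (by omega)
    omega
  · have := h.aa w' v (by omega) (by omega)
    omega

theorem Frame.B_B (h : Frame H K r len q a b u E) (hH : ThinOff H K)
    {v w v' w' : Fin r × Fin (2 * r)} (hvw : Arc v w) (hvw' : Arc v' w')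
    (hne : ¬ (v = v' ∧ w = w')) :
    Anticomplete H (frameB q a b E v w) (frameB q a b E v' w') := by
  have hvv : (v.1.val = w.1.val ↔ v'.1.val = w'.1.val) → v ≠ v' := by
    rintro h1 rfl
    refine hne ⟨rfl, Prod.ext (Fin.ext ?_) (Fin.ext ?_)⟩ <;> unfold Arc at hvw hvw' <;> omega
  by_cases h1 : v.1.val = w.1.val <;> by_cases h1' : v'.1.val = w'.1.val
  · exact h.B_B_hor_hor hH hvw hvw' h1 h1' (hvv (by tauto))
  · exact h.B_B_hor_ver hH hvw hvw' h1 h1'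
  · exact (h.B_B_hor_ver hH hvw' hvw h1' h1).symm
  · exact h.B_B_ver_ver hH hvw hvw' h1 h1' (hvv (by tauto))

theorem Frame.B_conn (h : Frame H K r len q a b u E) {v w : Fin r × Fin (2 * r)} (hvw : Arc v w) :
    Conn H (frameB q a b E v w) := by
  have hlw := h.lt w
  have hw := h.cols.path _ (Frame.col_mem w)
  by_cases h1 : v.1.val = w.1.val
  · have h2 : v.2.val + 1 = w.2.val := by unfold Arc at hvw; omega
    have hbl := h.b_le h2
    rw [frameB_of_eq h1]
    refine (h.con v).conn.union (hw.conn_seg (by omega) (by omega))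
      (Or.inl ⟨q w.2.val (b v), h2 ▸ (h.con v).b_memE, seg_mem (by omega) (by omega)⟩)
  · have h2 : v.2.val = w.2.val ∧ v.1.val + 1 = w.1.val ∧
        (v.1.val + v.2.val) % 2 = 0 := by unfold Arc at hvw; omega
    have := h.aa v w h2.1 (by omega)
    rw [frameB_of_ne h1]
    exact hw.conn_seg (by omega) (by omega)

theorem Frame.touch_fst (h : Frame H K r len q a b u E) {v w : Fin r × Fin (2 * r)}
    (hvw : Arc v w) : ∃ x ∈ frameB q a b E v w, H.Adj (frameY q a u v (port v w)) x := by
  have hlw := h.lt w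
  by_cases h1 : v.1.val = w.1.val
  · have h2 : v.2.val + 1 = w.2.val := by unfold Arc at hvw; omega
    have hp : port v w = 2 := if_pos ⟨Fin.ext h1, h2⟩
    rw [frameB_of_eq h1, hp]
    obtain ⟨x, hx, hux⟩ := (h.con v).touch
    exact ⟨x, Or.inl hx, hux⟩
  · obtain ⟨h2, h3, h4⟩ : v.2.val = w.2.val ∧ v.1.val + 1 = w.1.val ∧
        (v.1.val + v.2.val) % 2 = 0 := by unfold Arc at hvw; omega
    have hp : port v w = 1 := by
      unfold port
      rw [if_neg (fun h => h1 (congrArg Fin.val h.1)), if_pos h4,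
        if_neg (fun h => h1 (congrArg Fin.val h))]
    have := h.aa v w h2 (by omega)
    rw [frameB_of_ne h1, hp]
    refine ⟨q w.2.val (a v + 2), seg_mem le_rfl (by omega), ?_⟩
    rw [← h2]
    rw [← h2] at hlw
    exact (h.cols.path _ (Frame.col_mem v)).adj_succ (by omega)

theorem Frame.touch_snd (h : Frame H K r len q a b u E) {v w : Fin r × Fin (2 * r)}
    (hvw : Arc v w) : ∃ x ∈ frameB q a b E v w, H.Adj (frameY q a u w (port w v)) x := by
  have hlw := h.lt w
  have hpw := h.pos w
  have hw := h.cols.path _ (Frame.col_mem w)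
  have hpred : ∀ {X : Set W}, 2 ≤ a w → q w.2.val (a w - 2) ∈ X →
      ∃ x ∈ X, H.Adj (q w.2.val (a w - 1)) x := fun h2 hX =>
    ⟨_, hX, (hw.adj_iff (by omega) (by omega)).mpr (Or.inr (by omega))⟩
  by_cases h1 : v.1.val = w.1.val
  · have h2 : v.2.val + 1 = w.2.val := by unfold Arc at hvw; omega
    have hbl := h.b_le h2
    have hnp : ¬ (w.1 = v.1 ∧ w.2.val + 1 = v.2.val) := fun h => by omega
    have hwv : w.1 = v.1 := Fin.ext h1.symm
    rw [frameB_of_eq h1]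
    rcases Nat.mod_two_eq_zero_or_one (w.1.val + w.2.val) with h3 | h3
    · have hp : port w v = 0 := by
        unfold port
        rw [if_neg hnp, if_pos h3, if_pos hwv]
      have := h.even v w h1 h2 h3
      rw [hp]
      exact hpred (by omega) (Or.inr (seg_mem (by omega) (by omega)))
    · have hp : port w v = 1 := by
        unfold port
        rw [if_neg hnp, if_neg (by omega), if_pos hwv]
      have := h.odd v w h1 h2 h3
      rw [hp]
      exact ⟨q w.2.val (a w + 2), Or.inr (seg_mem (by omega) (by omega)), hw.adj_succ (by omega)⟩
  · obtain ⟨h2, h3, h4⟩ : v.2.val = w.2.val ∧ v.1.val + 1 = w.1.val ∧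
        (v.1.val + v.2.val) % 2 = 0 := by unfold Arc at hvw; omega
    have := h.aa v w h2 (by omega)
    have hp : port w v = 0 := by
      unfold port
      rw [if_neg (fun h => h1 (congrArg Fin.val h.1).symm), if_neg (by omega),
        if_neg (fun h => h1 (congrArg Fin.val h).symm)]
    rw [frameB_of_ne h1, hp]
    exact hpred (by omega) (seg_mem (by omega) (by omega))

theorem Frame.assembly (h : Frame H K r len q a b u E) (hH : ThinOff H K) :
    Assembly H (Wall r) (frameD q a u) (fun v w => frameY q a u v (port v w))
      (frameC q a b E) := by
  have hC : ∀ {v w : Fin r × Fin (2 * r)}, Arc v w → frameC q a b E v w = frameB q a b E v w :=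
    fun hvw => if_pos hvw
  have hC' : ∀ {v w : Fin r × Fin (2 * r)}, Arc v w → frameC q a b E w v = frameB q a b E v w :=
    fun hvw => if_neg hvw.not_arc
  have hDB : ∀ {v w : Fin r × Fin (2 * r)}, Arc v w → ∀ x,
      Disjoint (frameD q a u x) (frameB q a b E v w) := by
    intro v w hvw x
    by_cases hxv : x = v
    · subst hxv
      exact Set.disjoint_left.mpr fun z hz hz' => (h.D_B_fst hH hvw hz hz').1 rfl
    by_cases hxw : x = w
    · subst hxw
      exact Set.disjoint_left.mpr fun z hz hz' => (h.D_B_snd hH hvw hz hz').1 rfl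
    exact (h.D_B_anti hH hvw hxv hxw).1
  have hBB : ∀ {v w v' w' : Fin r × Fin (2 * r)}, Arc v w → Arc v' w' → s(v, w) ≠ s(v', w') →
      Anticomplete H (frameB q a b E v w) (frameB q a b E v' w') := fun hvw hvw' hne =>
    h.B_B hH hvw hvw' (by rintro ⟨rfl, rfl⟩; exact hne rfl)
  constructor
  · exact fun v w hvw => h.D_anti hH hvw
  · intro v w hvw
    rcases wall_adj_iff_arc.mp hvw with hvw | hvw
    · rw [hC hvw, hC' hvw]
    · rw [hC hvw, hC' hvw]
  · intro v w hvw
    rcases wall_adj_iff_arc.mp hvw with hvw | hvw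
    · rw [hC hvw]
      exact h.B_conn hvw
    · rw [hC' hvw]
      exact h.B_conn hvw
  · intro v w hvw x
    rcases wall_adj_iff_arc.mp hvw with hvw | hvw
    · rw [hC hvw]
      exact hDB hvw x
    · rw [hC' hvw]
      exact hDB hvw x
  · intro v w hvw x hxv hxw
    rcases wall_adj_iff_arc.mp hvw with hvw | hvw
    · rw [hC hvw]
      exact h.D_B_anti hH hvw hxv hxw
    · rw [hC' hvw]
      exact h.D_B_anti hH hvw hxw hxv
  · intro v w hvw
    rcases wall_adj_iff_arc.mp hvw with hvw | hvw
    · rw [hC hvw]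
      exact h.touch_fst hvw
    · rw [hC' hvw]
      exact h.touch_snd hvw
  · intro v w hvw x hx z hz hxz
    rcases wall_adj_iff_arc.mp hvw with hvw | hvw
    · rw [hC hvw] at hz
      exact (h.D_B_fst hH hvw hx hz).2 hxz
    · rw [hC' hvw] at hz
      exact (h.D_B_snd hH hvw hx hz).2 hxz
  · intro v w v' w' hvw hvw' hne
    rcases wall_adj_iff_arc.mp hvw with hvw | hvw <;>
      rcases wall_adj_iff_arc.mp hvw' with hvw' | hvw'
    · rw [hC hvw, hC hvw']
      exact hBB hvw hvw' hne
    · rw [hC hvw, hC' hvw']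
      exact hBB hvw hvw' (by rwa [Sym2.eq_swap (a := w')])
    · rw [hC' hvw, hC hvw']
      exact hBB hvw hvw' (by rwa [Sym2.eq_swap (a := w)])
    · rw [hC' hvw, hC' hvw']
      exact hBB hvw hvw' (by rwa [Sym2.eq_swap (a := w'), Sym2.eq_swap (a := w)])

end Frame

section Lift

variable {V W U : Type} {G : SimpleGraph V} {H : SimpleGraph W} {K : Set W} {F : W → Set V}
  {pt : W → V}

theorem Fibration.eq_pt (hF : Fibration G H K F) (hpt : ∀ w, pt w ∈ F w) {w : W} (hw : w ∉ K)
    {v : V} (hv : v ∈ F w) : v = pt w := by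
  obtain ⟨z, hz⟩ := hF.single w hw
  have h1 : v ∈ ({z} : Set V) := hz ▸ hv
  have h2 : pt w ∈ ({z} : Set V) := hz ▸ hpt w
  exact h1.trans h2.symm

theorem Assembly.lift {Ω : SimpleGraph U} {D : U → Set W} {y : U → U → W} {C : U → U → Set W}
    (h : Assembly H Ω D y C) (hF : Fibration G H K F) (hpt : ∀ w, pt w ∈ F w)
    (hy : ∀ v w, Ω.Adj v w → y v w ∉ K) :
    Assembly G Ω (fun v => _root_.lift F (D v)) (fun v w => pt (y v w))
      (fun v w => _root_.lift F (C v w)) where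
  D_anti v w hvw := hF.anticomplete_lift (h.D_anti v w hvw)
  C_symm v w hvw := congrArg (_root_.lift F) (h.C_symm v w hvw)
  C_conn v w hvw := hF.conn_lift (h.C_conn v w hvw)
  C_disj v w hvw u := hF.disjoint_lift (h.C_disj v w hvw u)
  C_anti v w hvw u hv hw := hF.anticomplete_lift (h.C_anti v w hvw u hv hw)
  C_touch v w hvw := by
    obtain ⟨x, hx, hadj⟩ := h.C_touch v w hvw
    obtain ⟨-, s, hs, t, ht, hst⟩ := (hF.adj _ _).mp hadj
    rw [hF.eq_pt hpt (hy v w hvw) hs] at hst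
    exact ⟨t, subset_lift hx ht, hst⟩
  C_only v w hvw s hs t ht hst := by
    obtain ⟨s', hs', hss⟩ := mem_lift.mp hs
    obtain ⟨t', ht', htt⟩ := mem_lift.mp ht
    have hne : s' ≠ t' := fun he =>
      Set.disjoint_left.mp (h.C_disj v w hvw v) hs' (he ▸ ht')
    have he := h.C_only v w hvw s' hs' t' ht' ((hF.adj _ _).mpr ⟨hne, s, hss, t, htt, hst⟩)
    subst he
    exact hF.eq_pt hpt (hy v w hvw) hss
  C_C v w v' w' hvw hvw' hne := hF.anticomplete_lift (h.C_C v w v' w' hvw hvw' hne)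

variable {r : ℕ} {len : ℕ → ℕ} {q : ℕ → ℕ → W} {a b : Fin r × Fin (2 * r) → ℕ}
  {u : Fin r × Fin (2 * r) → W} {E : Fin r × Fin (2 * r) → Set W}

theorem Frame.frameY_notMem (h : Frame H K r len q a b u E) (hH : ThinOff H K)
    (v : Fin r × Fin (2 * r)) (i : Fin 3) : frameY q a u v i ∉ K := by
  have hv := h.cols.path _ (Frame.col_mem v)
  have h1 := h.pos v
  have h2 := h.lt v
  fin_cases i
  · exact fun hK => hH.indep _ (h.con v).a_mem _ hK
      ((hv.adj_iff (by omega) (by omega)).mpr (Or.inr (by omega)))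
  · exact fun hK => hH.indep _ (h.con v).a_mem _ hK (hv.adj_succ (by omega))
  · exact (h.con v).u_notMem

theorem Frame.frameY_mem (v : Fin r × Fin (2 * r)) (i : Fin 3) :
    frameY q a u v i ∈ frameD q a u v := by
  fin_cases i
  · exact Or.inl (seg_mem le_rfl (by omega))
  · exact Or.inl (seg_mem (by omega) le_rfl)
  · exact Or.inr rfl

theorem Frame.frameY_injective (h : Frame H K r len q a b u E) (v : Fin r × Fin (2 * r)) :
    Function.Injective (frameY q a u v) := by
  have hv := h.cols.path _ (Frame.col_mem v)
  have h1 := h.pos v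
  have h2 := h.lt v
  have h01 : q v.2.val (a v - 1) ≠ q v.2.val (a v + 1) := fun he => by
    have := hv.inj (by omega) (by omega) he
    omega
  have hu : ∀ i ≤ len v.2.val, q v.2.val i ≠ u v := fun i hi he =>
    (h.con v).u_off (Frame.col_mem v) (he ▸ seg_mem (Nat.zero_le _) hi)
  have h02 := hu (a v - 1) (by omega)
  have h12 := hu (a v + 1) h2
  intro i j hij
  fin_cases i <;> fin_cases j <;> first
    | rfl
    | exact (h01 hij).elim
    | exact (h01 hij.symm).elim
    | exact (h02 hij).elim
    | exact (h02 hij.symm).elim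
    | exact (h12 hij).elim
    | exact (h12 hij.symm).elim

theorem Frame.conn_frameD (h : Frame H K r len q a b u E) (v : Fin r × Fin (2 * r)) :
    Conn H (frameD q a u v) := by
  have h2 := h.lt v
  exact ((h.cols.path _ (Frame.col_mem v)).conn_seg (by omega) h2).union (conn_singleton _)
    (Or.inr ⟨_, seg_mem (by omega) (by omega), _, rfl, (h.con v).adj⟩)

theorem Frame.good (h : Frame H K r len q a b u E) (hH : ThinOff H K) (hF : Fibration G H K F)
    (hpt : ∀ w, pt w ∈ F w)
    (hT : (∀ v, TypeC G (lift F (frameD q a u v)) (fun i => pt (frameY q a u v i))) ∨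
      ∀ v, ¬ TypeC G (lift F (frameD q a u v)) (fun i => pt (frameY q a u v i))) : Good G r := by
  refine good_of_assembly (D := fun v => lift F (frameD q a u v))
    (y := fun v i => pt (frameY q a u v i)) (C := fun v w => lift F (frameC q a b E v w))
    ((h.assembly hH).lift hF hpt fun v w _ => h.frameY_notMem hH v _) ?_
  refine hT.imp id fun hT v => ?_
  refine (typeC_or_typeT (hF.conn_lift (h.conn_frameD v)) _ (fun i j hij => ?_) fun i =>
    subset_lift (Frame.frameY_mem v i) (hpt _)).resolve_left (hT v)
  exact h.frameY_injective v (hF.eq_of_mem (hpt _) (by rw [show pt _ = pt _ from hij]; exact hpt _))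

end Lift

theorem exists_orderEmb_of_split {n m : ℕ} {S : Set (Fin n)} (h : 2 * m ≤ S.ncard)
    (P : Fin n → Prop) :
    ∃ e : Fin m ↪o Fin n, (∀ i, e i ∈ S) ∧ ∃ β : Prop, ∀ i, P (e i) ↔ β := by
  have hle : S.ncard ≤ {i | i ∈ S ∧ P i}.ncard + {i | i ∈ S ∧ ¬ P i}.ncard := by
    refine (Set.ncard_le_ncard (fun i hi => ?_) (Set.toFinite _)).trans (Set.ncard_union_le _ _)
    by_cases hP : P i
    · exact Or.inl ⟨hi, hP⟩
    · exact Or.inr ⟨hi, hP⟩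
  rcases le_or_gt m {i | i ∈ S ∧ P i}.ncard with hm | hm
  · obtain ⟨e, he⟩ := exists_orderEmb_of_ncard hm
    exact ⟨e, fun i => (he i).1, True, fun i => iff_of_true (he i).2 trivial⟩
  · obtain ⟨e, he⟩ := exists_orderEmb_of_ncard (show m ≤ {i | i ∈ S ∧ ¬ P i}.ncard by omega)
    exact ⟨e, fun i => (he i).1, False, fun i => iff_of_false (he i).2 id⟩

/-- The vertices at distance at most `n` from `v`. -/
def ballSet {V : Type} (G : SimpleGraph V) (v : V) : ℕ → Set V
  | 0 => {v}
  | n + 1 => ballSet G v n ∪ ⋃ u ∈ ballSet G v n, {w | G.Adj u w}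

theorem ncard_ballSet_le {V : Type} [Finite V] (G : SimpleGraph V) (v : V) {d : ℕ}
    (hd : ∀ u, {w | G.Adj u w}.ncard ≤ d) (n : ℕ) : (ballSet G v n).ncard ≤ (d + 1) ^ n := by
  induction n with
  | zero => simp [ballSet]
  | succ n ih =>
    have hsum : (⋃ u ∈ ballSet G v n, {w | G.Adj u w}).ncard ≤ (ballSet G v n).ncard * d := by
      classical
      have hfin := Set.toFinite (ballSet G v n)
      have := Finset.set_ncard_biUnion_le hfin.toFinset fun u => {w | G.Adj u w}
      simp only [Set.Finite.mem_toFinset] at this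
      refine this.trans ((Finset.sum_le_card_nsmul _ _ d fun u _ => hd u).trans_eq ?_)
      rw [smul_eq_mul, Set.ncard_eq_toFinset_card _ hfin]
    calc (ballSet G v (n + 1)).ncard ≤ (ballSet G v n).ncard + (ballSet G v n).ncard * d :=
          (Set.ncard_union_le _ _).trans (Nat.add_le_add_left hsum _)
      _ = (ballSet G v n).ncard * (d + 1) := by ring
      _ ≤ (d + 1) ^ n * (d + 1) := Nat.mul_le_mul_right _ ih
      _ = (d + 1) ^ (n + 1) := (pow_succ _ _).symm

theorem IndPath.mem_ballSet {V : Type} {G : SimpleGraph V} {n : ℕ} {p : ℕ → V}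
    (hp : IndPath G n p) {i : ℕ} (hi : i ≤ n) : p i ∈ ballSet G (p 0) i := by
  induction i with
  | zero => rfl
  | succ i ih =>
    exact Or.inr (Set.mem_biUnion (ih (by omega)) (hp.adj_succ hi))

theorem ballSet_mono {V : Type} (G : SimpleGraph V) (v : V) {m n : ℕ} (h : m ≤ n) :
    ballSet G v m ⊆ ballSet G v n := by
  induction n, h using Nat.le_induction with
  | base => exact subset_rfl
  | succ n _ ih => exact ih.trans Set.subset_union_left

/-- A sequence of vertices in which consecutive ones are linked by paths avoiding the others. -/
structure PathChain {ι : Type} (Γ : SimpleGraph ι) (Ty : ι → ι → Prop) (m : ℕ) (γ : ℕ → ι)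
    (β : Prop) : Prop where
  inj : ∀ k ≤ m, ∀ k' ≤ m, γ k = γ k' → k = k'
  link : ∀ k < m, ∃ (n : ℕ) (x : ℕ → ι), 0 < n ∧ (∀ i ≤ n, ∀ j ≤ n, x i = x j → i = j) ∧
    (∀ i < n, Γ.Adj (x i) (x (i + 1))) ∧ x 0 = γ k ∧ x n = γ (k + 1) ∧
    (Ty (x 0) (x 1) ↔ β) ∧ ∀ i, 0 < i → i < n → ∀ k' ≤ m, x i ≠ γ k'

theorem exists_pathChain (m : ℕ) : ∃ h, 0 < h ∧ ∀ (Γ : SimpleGraph (Fin h)), Conn Γ Set.univ →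
    ∀ Ty : Fin h → Fin h → Prop, ∃ γ β, PathChain Γ Ty m γ β := by
  obtain ⟨h, hh⟩ : ∃ h, h = (2 * (m + 1) + 1) ^ (2 * (m + 1)) + 1 := ⟨_, rfl⟩
  refine ⟨h, by omega, fun Γ hΓ Ty => ?_⟩
  have hmin : ∀ k, min k m < m + 1 := fun k => by omega
  by_cases hdeg : ∃ z, 2 * (m + 1) ≤ {w | Γ.Adj z w}.ncard
  · obtain ⟨z, hz⟩ := hdeg
    obtain ⟨e, heS, β, hβ⟩ := exists_orderEmb_of_split hz fun c => Ty c z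
    have heq : ∀ k ≤ m, ∀ k' ≤ m, e ⟨min k m, hmin k⟩ = e ⟨min k' m, hmin k'⟩ → k = k' := by
      intro k hk k' hk' he
      have := congrArg Fin.val (e.injective he)
      simp only at this
      omega
    refine ⟨fun k => e ⟨min k m, hmin k⟩, β, heq, fun k hk => ?_⟩
    have hne := fun k => (heS ⟨min k m, hmin k⟩).ne
    refine ⟨2, fun i => if i = 0 then e ⟨min k m, hmin k⟩ else if i = 1 then z else
      e ⟨min (k + 1) m, hmin (k + 1)⟩, by omega, ?_, ?_, rfl, rfl, hβ _, ?_⟩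
    · have h1 := hne k
      have h2 := hne (k + 1)
      have h3 : e ⟨min k m, hmin k⟩ ≠ e ⟨min (k + 1) m, hmin (k + 1)⟩ := fun he => by
        have := heq k (by omega) (k + 1) (by omega) he
        omega
      intro i hi j hj hij
      interval_cases i <;> interval_cases j <;> first
        | rfl
        | exact (h1 hij).elim
        | exact (h1 hij.symm).elim
        | exact (h2 hij).elim
        | exact (h2 hij.symm).elim
        | exact (h3 hij).elim
        | exact (h3 hij.symm).elim
    · intro i hi
      interval_cases i
      · exact (heS ⟨min k m, hmin k⟩).symm
      · exact heS ⟨min (k + 1) m, hmin (k + 1)⟩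
    · intro i hi hi' k' _
      obtain rfl : i = 1 := by omega
      exact hne k'
  · push Not at hdeg
    set v : Fin h := ⟨0, by omega⟩
    have hcard := ncard_ballSet_le Γ v (fun u => (hdeg u).le) (2 * (m + 1))
    obtain ⟨w, hw⟩ : ∃ w, w ∉ ballSet Γ v (2 * (m + 1)) := by
      by_contra! hall
      rw [Set.eq_univ_of_forall hall, Set.ncard_univ, Nat.card_eq_fintype_card,
        Fintype.card_fin] at hcard
      omega
    obtain ⟨n, p, hp, -, hp0, hpn, -, -⟩ := hΓ.exists_indPath (X := {v}) (Y := {w})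
      ⟨v, trivial, rfl⟩ ⟨w, trivial, rfl⟩
    have hn : 2 * (m + 1) < n := by
      by_contra! hn
      refine hw (ballSet_mono Γ v hn ?_)
      have := hp.mem_ballSet le_rfl
      rwa [show p 0 = v from hp0, show p n = w from hpn] at this
    obtain ⟨e, -, β, hβ⟩ := exists_orderEmb_of_split (n := 2 * (m + 1)) (m := m + 1)
      (S := Set.univ) (by rw [Set.ncard_univ, Nat.card_eq_fintype_card, Fintype.card_fin])
      fun i => Ty (p i.val) (p (i.val + 1))
    have hlt : ∀ k k' : Fin (m + 1), k < k' → (e k).val < (e k').val := fun k k' hk =>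
      e.strictMono hk
    have he : ∀ k, (e k).val < 2 * (m + 1) := fun k => (e k).2
    refine ⟨fun k => p (e ⟨min k m, hmin k⟩).val, β, fun k hk k' hk' hkk => ?_, fun k hk => ?_⟩
    · have h1 := hp.inj (by have := he ⟨min k m, hmin k⟩; omega)
        (by have := he ⟨min k' m, hmin k'⟩; omega) hkk
      have := congrArg Fin.val (e.injective (Fin.ext h1))
      simp only at this
      omega
    · have h1 := hlt ⟨min k m, hmin k⟩ ⟨min (k + 1) m, hmin (k + 1)⟩
        (by rw [Fin.lt_def]; simp only; omega)
      have h2 := he ⟨min (k + 1) m, hmin (k + 1)⟩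
      refine ⟨(e ⟨min (k + 1) m, hmin (k + 1)⟩).val - (e ⟨min k m, hmin k⟩).val,
        fun i => p ((e ⟨min k m, hmin k⟩).val + i), by omega, fun i hi j hj hij => ?_,
        fun i hi => ?_, rfl, ?_, hβ _, fun i hi hi' k' hk' hkk => ?_⟩
      · have := hp.inj (by omega) (by omega) hij
        omega
      · exact hp.adj_succ (by omega)
      · beta_reduce
        congr 1
        omega
      · have h3 := hp.inj (by omega) (by have := he ⟨min k' m, hmin k'⟩; omega) hkk
        rcases lt_or_ge k k' with h4 | h4
        · have : (e ⟨min (k + 1) m, hmin (k + 1)⟩).val ≤ (e ⟨min k' m, hmin k'⟩).val :=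
            e.monotone (by rw [Fin.le_def]; simp only; omega)
          omega
        · have : (e ⟨min k' m, hmin k'⟩).val ≤ (e ⟨min k m, hmin k⟩).val :=
            e.monotone (by rw [Fin.le_def]; simp only; omega)
          omega

section Grid

variable {W ι : Type} {H : SimpleGraph W} {K : Set W} {len : ι → ℕ} {q : ι → ℕ → W}
  {Θ : ι → ℕ → W → Prop}

/-- An induced path in `S` between two columns whose interior avoids all columns. -/
def Jump (H : SimpleGraph W) (len : ι → ℕ) (q : ι → ℕ → W) (Θ : ι → ℕ → W → Prop) (S : Set W)
    (c c' : ι) (β : Prop) : Prop :=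
  ∃ (n a b : ℕ) (p : ℕ → W), 2 ≤ n ∧ IndPath H n p ∧ a ≤ len c ∧ b ≤ len c' ∧ p 0 = q c a ∧
    p n = q c' b ∧ (∀ i ≤ n, p i ∈ S) ∧
    (∀ i, 0 < i → i < n → ∀ k, p i ∉ seg (q k) 0 (len k)) ∧ (Θ c a (p 1) ↔ β)

theorem Jump.reverse {S : Set W} {c c' : ι} {β : Prop} (h : Jump H len q Θ S c c' β) :
    ∃ β', Jump H len q Θ S c' c β' := by
  obtain ⟨n, a, b, p, hn, hp, ha, hb, h0, h1, hS, hoff, -⟩ := h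
  refine ⟨Θ c' b (p (n - 1)), n, b, a, fun i => p (n - i), hn, hp.reverse, hb, ha, h1, ?_,
    fun i _ => hS _ (by omega), fun i _ _ => hoff _ (by omega) (by omega), Iff.rfl⟩
  beta_reduce
  rwa [Nat.sub_self]

theorem Columns.exists_jump (hQ : Columns H K len q Set.univ) (hH : ThinOff H K) {S : Set W}
    (hS : Conn H S) (hm : ∀ c, ∃ i ≤ len c, q c i ∈ S) {T : Set ι} {z z' : ι} (hz : z ∈ T)
    (hz' : z' ∉ T) : ∃ c ∈ T, ∃ c' ∉ T, ∃ β, Jump H len q Θ S c c' β := by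
  have hmeet : ∀ (T' : Set ι), ∀ k ∈ T', (S ∩ ⋃ c ∈ T', seg (q c) 0 (len c)).Nonempty := by
    intro T' k hk
    obtain ⟨i, hi, hiS⟩ := hm k
    exact ⟨_, hiS, Set.mem_biUnion hk (seg_mem (Nat.zero_le _) hi)⟩
  obtain ⟨n, p, hp, hpS, h0, h1, hX, hY⟩ := hS.exists_indPath (hmeet T z hz) (hmeet Tᶜ z' hz')
  obtain ⟨c, hc, ha⟩ := Set.mem_iUnion₂.mp h0
  obtain ⟨c', hc', hb⟩ := Set.mem_iUnion₂.mp h1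
  have hcc : c ≠ c' := fun h => hc' (h ▸ hc)
  have hant := (hQ.closed c trivial).anticomplete (hQ.closed c' trivial) hH
    (hQ.disj c trivial c' trivial hcc)
  have hn : 2 ≤ n := by
    by_contra! hn
    interval_cases n
    · exact hant.ne ha hb rfl
    · exact hant.2 _ ha _ hb (hp.adj_succ one_pos)
  obtain ⟨a, ha, ha'⟩ := ha
  obtain ⟨b, hb, hb'⟩ := hb
  refine ⟨c, hc, c', hc', _, n, a, b, p, hn, hp, ha.2, hb.2, ha'.symm, hb'.symm, hpS,
    fun i hi hi' k hik => ?_, Iff.rfl⟩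
  by_cases hk : k ∈ T
  · exact hi.ne' (hX i hi'.le (Set.mem_biUnion hk hik))
  · exact hi'.ne (hY i hi'.le (Set.mem_biUnion (show k ∈ Tᶜ from hk) hik))

/-- Columns crossed by rows in a common order. -/
structure Grid (H : SimpleGraph W) (K : Set W) (len : ι → ℕ) (q : ι → ℕ → W) (R : ℕ)
    (ρ : ℕ → Set W) (vis : ι → ℕ → ℕ) : Prop where
  cols : Columns H K len q Set.univ
  vis_le : ∀ k, ∀ t < R, vis k t ≤ len k
  vis_lt : ∀ k t t', t < t' → t' < R → vis k t < vis k t'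
  rows : ∀ k s t s' i, s < t → t < s' → s' < R → i ≤ len k → q k i ∈ ρ t →
    vis k s < i ∧ i < vis k s'
  disj : ∀ t t', t < t' → t' < R → Disjoint (ρ t) (ρ t')

/-- The part of a grid strictly between two rows. -/
def gridBand (len : ι → ℕ) (q : ι → ℕ → W) (ρ : ℕ → Set W) (vis : ι → ℕ → ℕ) (s s' : ℕ) : Set W :=
  {x | (∃ t, s < t ∧ t < s' ∧ x ∈ ρ t) ∧ ∀ k, x ∉ seg (q k) 0 (len k)} ∪
    {x | ∃ k i, vis k s < i ∧ i < vis k s' ∧ x = q k i}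

/-- The existence of a connector in a band of a grid. -/
def BandLink (H : SimpleGraph W) (K : Set W) (len : ι → ℕ) (q : ι → ℕ → W)
    (Θ : ι → ℕ → W → Prop) (ρ : ℕ → Set W) (vis : ι → ℕ → ℕ) (J : Set ι) (s s' : ℕ) (c c' : ι)
    (β : Prop) : Prop :=
  ∃ a b u E, Connector H K len q J c c' a b u E ∧
    insert (q c a) (insert u E) ⊆ gridBand len q ρ vis s s' ∧
    (vis c s < a ∧ a < vis c s') ∧ (vis c' s < b ∧ b < vis c' s') ∧ (Θ c a u ↔ β)

variable {R : ℕ} {ρ : ℕ → Set W} {vis : ι → ℕ → ℕ}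

theorem Grid.vis_mono (h : Grid H K len q R ρ vis) {k : ι} {t t' : ℕ} (ht : t ≤ t')
    (ht' : t' < R) : vis k t ≤ vis k t' := by
  rcases ht.eq_or_lt with rfl | hlt
  · exact le_rfl
  · exact (h.vis_lt k t t' hlt ht').le

theorem Grid.vis_add (h : Grid H K len q R ρ vis) (k : ι) (t n : ℕ) (ht : t + n < R) :
    vis k t + n ≤ vis k (t + n) := by
  induction n with
  | zero => exact le_rfl
  | succ n ih =>
    have := ih (by omega)
    have := h.vis_lt k (t + n) (t + (n + 1)) (by omega) ht
    omega

theorem Grid.band_mono (h : Grid H K len q R ρ vis) {s s' t' : ℕ} (hs : s' ≤ t')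
    (ht' : t' < R) : gridBand len q ρ vis s s' ⊆ gridBand len q ρ vis s t' := by
  rintro x (⟨⟨t, h1, h2, h3⟩, h4⟩ | ⟨k, i, h1, h2, h3⟩)
  · exact Or.inl ⟨⟨t, h1, by omega, h3⟩, h4⟩
  · exact Or.inr ⟨k, i, h1, h2.trans_le (h.vis_mono hs ht'), h3⟩

theorem Grid.band_anti (h : Grid H K len q R ρ vis) {s s' t : ℕ} (hs : s ≤ t) (ht : t < R) :
    gridBand len q ρ vis t s' ⊆ gridBand len q ρ vis s s' := by
  rintro x (⟨⟨t, h1, h2, h3⟩, h4⟩ | ⟨k, i, h1, h2, h3⟩)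
  · exact Or.inl ⟨⟨t, by omega, h2, h3⟩, h4⟩
  · exact Or.inr ⟨k, i, (h.vis_mono hs ht).trans_lt h1, h2, h3⟩

theorem Grid.band_disjoint (h : Grid H K len q R ρ vis) {s s' t t' : ℕ} (hst : s' ≤ t)
    (ht : t < R) (ht' : t' < R) :
    Disjoint (gridBand len q ρ vis s s') (gridBand len q ρ vis t t') := by
  have hle : ∀ k i t, i < vis k t → t < R → i ≤ len k := fun k i t hi ht =>
    hi.le.trans (h.vis_le k t ht)
  refine Set.disjoint_left.mpr ?_
  rintro x (⟨⟨t₁, h1, h2, h3⟩, h4⟩ | ⟨k, i, h1, h2, rfl⟩)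
    (⟨⟨t₂, h1', h2', h3'⟩, h4'⟩ | ⟨k', i', h1', h2', h3'⟩)
  · exact Set.disjoint_left.mp (h.disj t₁ t₂ (by omega) (by omega)) h3 h3'
  · exact h4 k' (h3' ▸ seg_mem (Nat.zero_le _) (hle _ _ _ h2' ht'))
  · exact h4' k (seg_mem (Nat.zero_le _) (hle _ _ _ h2 (by omega)))
  · have hi := hle _ _ _ h2 (by omega)
    have hi' := hle _ _ _ h2' ht'
    by_cases hk : k = k'
    · subst hk
      have := (h.cols.path k trivial).inj hi hi' h3'
      have := h.vis_mono (k := k) hst ht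
      omega
    · refine Set.disjoint_left.mp (h.cols.disj k trivial k' trivial hk)
        (seg_mem (Nat.zero_le _) hi) ?_
      rw [h3']
      exact seg_mem (Nat.zero_le _) hi'

theorem BandLink.mono {J J' : Set ι} {s s' t' : ℕ} {c c' : ι} {β : Prop}
    (h : BandLink H K len q Θ ρ vis J s s' c c' β) (hG : Grid H K len q R ρ vis) (hJ : J' ⊆ J)
    (hs : s' ≤ t') (ht' : t' < R) : BandLink H K len q Θ ρ vis J' s t' c c' β := by
  obtain ⟨a, b, u, E, hE, hsub, ha, hb, hβ⟩ := h
  have := hG.vis_mono (k := c) hs ht'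
  have := hG.vis_mono (k := c') hs ht'
  exact ⟨a, b, u, E, { hE with off := fun k hk => hE.off k (hJ hk) },
    hsub.trans (hG.band_mono hs ht'), by omega, by omega, hβ⟩

theorem seg_eq_insert_insert {p : ℕ → W} {n : ℕ} (hn : 2 ≤ n) :
    seg p 0 n = insert (p 0) (insert (p 1) (seg p 2 n)) := by
  ext x
  simp only [mem_seg, Set.mem_insert_iff]
  constructor
  · rintro ⟨i, -, hi, rfl⟩
    rcases i with _ | _ | i
    · exact Or.inl rfl
    · exact Or.inr (Or.inl rfl)
    · exact Or.inr (Or.inr ⟨_, by omega, hi, rfl⟩)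
  · rintro (rfl | rfl | ⟨i, -, hi, rfl⟩)
    · exact ⟨0, le_rfl, by omega, rfl⟩
    · exact ⟨1, by omega, by omega, rfl⟩
    · exact ⟨i, by omega, hi, rfl⟩

theorem Jump.bandLink [Finite W] {s : ℕ} {c c' : ι} {β : Prop}
    (h : Jump H len q Θ (ρ (s + 1)) c c' β) (hcc : c ≠ c') (hH : ThinOff H K)
    (hG : Grid H K len q R ρ vis) (hs : s + 2 < R) :
    BandLink H K len q Θ ρ vis Set.univ s (s + 2) c c' β := by
  obtain ⟨n, a, b, p, hn, hp, ha, hb, h0, h1, hS, hoff, hβ⟩ := h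
  have hac : q c a ∈ seg (q c) 0 (len c) := seg_mem (Nat.zero_le _) ha
  have hbc : q c' b ∈ seg (q c') 0 (len c') := seg_mem (Nat.zero_le _) hb
  have hadj : H.Adj (q c a) (p 1) := h0 ▸ hp.adj_succ (by omega)
  have haK : q c a ∈ K := by
    by_contra haK
    exact hoff 1 (by omega) (by omega) c (hG.cols.closed c trivial _ hac haK _ hadj)
  have hbK : q c' b ∈ K := by
    by_contra hbK
    refine hoff (n - 1) (by omega) (by omega) c' (hG.cols.closed c' trivial _ hbc hbK _ ?_)
    rw [← h1, hp.adj_iff le_rfl (by omega)]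
    omega
  have hseg : seg p 0 n = insert (q c a) (insert (p 1) (seg p 2 n)) :=
    h0 ▸ seg_eq_insert_insert hn
  have hcol : ∀ x ∈ seg p 0 n, ∀ k, x ∈ seg (q k) 0 (len k) →
      (x = q c a ∧ k = c) ∨ (x = q c' b ∧ k = c') := by
    rintro _ ⟨i, ⟨-, hi⟩, rfl⟩ k hk
    rcases Nat.eq_zero_or_pos i with rfl | hi0
    · refine Or.inl ⟨h0, ?_⟩
      by_contra hkc
      exact Set.disjoint_left.mp (hG.cols.disj k trivial c trivial hkc) hk (h0 ▸ hac)
    rcases hi.eq_or_lt with rfl | hin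
    · refine Or.inr ⟨h1, ?_⟩
      by_contra hkc
      exact Set.disjoint_left.mp (hG.cols.disj k trivial c' trivial hkc) hk (h1 ▸ hbc)
    · exact (hoff i hi0 hin k hk).elim
  have hra := hG.rows c s (s + 1) (s + 2) a (by omega) (by omega) hs ha (h0 ▸ hS 0 (by omega))
  have hrb := hG.rows c' s (s + 1) (s + 2) b (by omega) (by omega) hs hb (h1 ▸ hS n le_rfl)
  refine ⟨a, b, p 1, seg p 2 n, ⟨ha, hb, haK, hbK, fun h => hH.indep _ haK _ h hadj, hadj,
    hp.conn_seg hn le_rfl, h1 ▸ seg_mem hn le_rfl,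
    ⟨p 2, seg_mem le_rfl hn, hp.adj_succ (by omega)⟩, ?_, ?_, ?_, hseg ▸ hp.closedOff (by omega) hH
      (Or.inl (h0 ▸ haK)) (Or.inl (h1 ▸ hbK)), ?_, ?_, ?_⟩, ?_, hra, hrb, hβ⟩
  · rw [hp.mem_seg_iff (by omega) le_rfl]
    omega
  · rw [← h0, hp.mem_seg_iff (by omega) le_rfl]
    omega
  · rintro _ ⟨i, hi, rfl⟩
    rw [← h0, hp.adj_iff (by omega) hi.2]
    have := hi.1
    omega
  · rw [← hseg]
    refine fun k _ hk hk' => Set.disjoint_left.mpr fun x hx hxk => ?_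
    rcases hcol x hx k hxk with h | h
    · exact hk h.2
    · exact hk' h.2
  · rw [← hseg]
    intro x hx hxk
    rcases hcol x hx c hxk with h | h
    · exact h.1
    · exact (hcc h.2).elim
  · rw [← hseg]
    intro x hx hxk
    rcases hcol x hx c' hxk with h | h
    · exact (hcc h.2.symm).elim
    · exact h.1
  · rw [← hseg]
    intro x hx
    by_cases hxk : ∃ k, x ∈ seg (q k) 0 (len k)
    · obtain ⟨k, hk⟩ := hxk
      rcases hcol x hx k hk with h | h
      · exact Or.inr ⟨c, a, hra.1, hra.2, h.1⟩
      · exact Or.inr ⟨c', b, hrb.1, hrb.2, h.1⟩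
    · obtain ⟨i, hi, rfl⟩ := hx
      exact Or.inl ⟨⟨s + 1, by omega, by omega, hS i hi.2⟩, fun k hk => hxk ⟨k, hk⟩⟩

theorem BandLink.trans {J : Set ι} {s t t' : ℕ} {c c' c'' : ι} {β β' : Prop}
    (h₁ : BandLink H K len q Θ ρ vis Set.univ s t c c' β)
    (h₂ : BandLink H K len q Θ ρ vis J t t' c' c'' β') (hH : ThinOff H K)
    (hG : Grid H K len q R ρ vis) (hst : s ≤ t) (htt : t ≤ t') (ht' : t' < R) (hc : c ∈ J) (h12 : c ≠ c')
    (h13 : c ≠ c'') (h23 : c' ≠ c'') :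
    BandLink H K len q Θ ρ vis {k | k ∈ J ∧ k ≠ c'} s t' c c'' β := by
  obtain ⟨a, b, u, E, hE, hsub, ha, hb, hβ⟩ := h₁
  obtain ⟨a', b', u', E', hE', hsub', ha', hb', -⟩ := h₂
  have hd := (hG.band_disjoint (s := s) (s' := t) (t' := t') le_rfl (by omega) ht').mono hsub hsub'
  have hlt : b < a' := hb.2.trans ha'.1
  have hcol : seg (q c') b a' ⊆ seg (q c') 0 (len c') := seg_mono (Nat.zero_le _) hE'.a_le
  have hcd : ∀ k, k ≠ c' → Disjoint (seg (q c') b a') (seg (q k) 0 (len k)) := fun k hk =>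
    (hG.cols.disj c' trivial k trivial hk.symm).mono_left hcol
  have huS : u ∈ insert (q c a) (insert u E) := Or.inr (Or.inl rfl)
  have haS : q c a ∈ insert (q c a) (insert u E) := Or.inl rfl
  have hES : insert u' E' ⊆ insert (q c' a') (insert u' E') := Set.subset_insert _ _
  have hac : q c a ∈ seg (q c) 0 (len c) := seg_mem (Nat.zero_le _) hE.a_le
  have hS : insert (q c a) (insert u (E ∪ seg (q c') b a' ∪ insert u' E')) =
      insert (q c a) (insert u E) ∪ seg (q c') b a' ∪ insert (q c' a') (insert u' E') := by
    have : q c' a' ∈ seg (q c') b a' := seg_mem hlt.le le_rfl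
    ext x
    simp only [Set.mem_insert_iff, Set.mem_union]
    constructor
    · tauto
    · rintro ((h | h) | rfl | h)
      all_goals tauto
  have hvc := hG.vis_mono (k := c) htt ht'
  have hvc' := hG.vis_mono (k := c') htt ht'
  have hvc0 := hG.vis_mono (k := c') hst (by omega)
  have hvc'' := hG.vis_mono (k := c'') hst (by omega)
  obtain ⟨y, hy, huy⟩ := hE'.touch
  have hanE : q c a ∉ E ∪ seg (q c') b a' ∪ insert u' E' := by
    rintro ((h | h) | h)
    · exact hE.a_notMemE h
    · exact Set.disjoint_left.mp (hcd c h12) h hac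
    · exact Set.disjoint_left.mp hd haS (hES h)
  have hclosed : ClosedOff H K (insert (q c a) (insert u (E ∪ seg (q c') b a' ∪ insert u' E'))) := by
    rw [hS]
    rintro x ((hx | ⟨i, hi, rfl⟩) | hx) hxK v hxv
    · exact Or.inl (Or.inl (hE.closed x hx hxK v hxv))
    · refine Or.inl (Or.inr ?_)
      obtain ⟨j, hj, rfl⟩ := hG.cols.closed c' trivial _ (hcol ⟨i, hi, rfl⟩) hxK v hxv
      rw [(hG.cols.path c' trivial).adj_iff (hi.2.trans hE'.a_le) hj.2] at hxv
      have h1 : i ≠ b := fun h => hxK (h ▸ hE.b_mem)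
      have h2 : i ≠ a' := fun h => hxK (h ▸ hE'.a_mem)
      have := hi.1
      have := hi.2
      exact seg_mem (by omega) (by omega)
    · exact Or.inr (hE'.closed x hx hxK v hxv)
  refine ⟨a, b', u, E ∪ seg (q c') b a' ∪ insert u' E', ⟨hE.a_le, hE'.b_le, hE.a_mem, hE'.b_mem,
    hE.u_notMem, hE.adj, ?_, Or.inr (Or.inr hE'.b_memE), ?_, ?_, hanE, ?_, hclosed, ?_, ?_, ?_⟩,
    ?_, by omega, by omega, hβ⟩
  · exact (hE.conn.union ((hG.cols.path c' trivial).conn_seg hlt.le hE'.a_le)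
      (Or.inl ⟨_, hE.b_memE, seg_mem le_rfl hlt.le⟩)).union (hE'.conn.insert hy huy)
      (Or.inr ⟨_, Or.inr (seg_mem hlt.le le_rfl), _, Or.inl rfl, hE'.adj⟩)
  · obtain ⟨x, hx, hux⟩ := hE.touch
    exact ⟨x, Or.inl (Or.inl hx), hux⟩
  · rintro ((h | h) | h)
    · exact hE.u_notMemE h
    · exact hE.u_off trivial (hcol h)
    · exact Set.disjoint_left.mp hd huS (hES h)
  · rintro x ((h | h) | h) hax
    · exact hE.not_adj x h hax
    · by_cases hxK : x ∈ K
      · exact hH.indep _ hE.a_mem _ hxK hax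
      · exact Set.disjoint_left.mp (hG.cols.disj c trivial c' trivial h12) hac
          (hG.cols.closed c' trivial x (hcol h) hxK _ hax.symm)
    · by_cases hxK : x ∈ K
      · exact hH.indep _ hE.a_mem _ hxK hax
      · exact Set.disjoint_left.mp hd haS (hE'.closed x (hES h) hxK _ hax.symm)
  · rw [hS]
    rintro k ⟨hk, hkc'⟩ hkc hkc''
    exact ((hE.off k trivial hkc hkc').union_left (hcd k hkc')).union_left (hE'.off k hk hkc' hkc'')
  · rw [hS]
    rintro x ((hx | hx) | hx) hxk
    · exact hE.fst_col x hx hxk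
    · exact (Set.disjoint_left.mp (hcd c h12) hx hxk).elim
    · exact (Set.disjoint_left.mp (hE'.off c hc h12 h13) hx hxk).elim
  · rw [hS]
    rintro x ((hx | hx) | hx) hxk
    · exact (Set.disjoint_left.mp (hE.off c'' trivial h13.symm h23.symm) hx hxk).elim
    · exact (Set.disjoint_left.mp (hcd c'' h23.symm) hx hxk).elim
    · exact hE'.snd_col x hx hxk
  · rw [hS]
    rintro x ((hx | ⟨i, hi, rfl⟩) | hx)
    · exact hG.band_mono htt ht' (hsub hx)
    · have := hi.1
      have := hi.2
      exact Or.inr ⟨c', i, by omega, by omega, rfl⟩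
    · exact hG.band_anti hst (by omega) (hsub' hx)

theorem Grid.exists_bandLink (hG : Grid H K len q R ρ vis) (hH : ThinOff H K)
    (Ty : ι → ι → Prop) {n : ℕ} (hn : 0 < n) {x : ℕ → ι} (hx : ∀ i ≤ n, ∀ j ≤ n, x i = x j → i = j) {s : ℕ}
    (hl : ∀ i < n, ∀ s, s + 2 < R →
      BandLink H K len q Θ ρ vis Set.univ s (s + 2) (x i) (x (i + 1)) (Ty (x i) (x (i + 1))))
    (hs : s + 2 * n < R) :
    BandLink H K len q Θ ρ vis {k | ∀ i, 0 < i → i < n → k ≠ x i} s (s + 2 * n) (x 0) (x n)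
      (Ty (x 0) (x 1)) := by
  induction n, hn using Nat.le_induction generalizing x s with
  | base => exact (hl 0 one_pos s hs).mono hG (Set.subset_univ _) le_rfl hs
  | succ n hn ih =>
    have hn' : 0 < n := hn
    have h₂ := ih (x := fun i => x (i + 1)) (s := s + 2)
      (fun i hi j hj hij => by
        have := hx (i + 1) (by omega) (j + 1) (by omega) hij
        omega) (fun i hi => hl (i + 1) (by omega)) (by omega)
    have hne : ∀ i j, i ≤ n + 1 → j ≤ n + 1 → i ≠ j → x i ≠ x j := fun i j hi hj hij h =>
      hij (hx i hi j hj h)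
    refine ((hl 0 (by omega) s (by omega)).trans h₂ hH hG (by omega) (by omega) (by omega)
      (fun i _ _ => hne _ _ (by omega) (by omega) (by omega)) (hne _ _ (by omega) (by omega) (by omega))
      (hne _ _ (by omega) le_rfl (by omega)) (hne _ _ (by omega) le_rfl (by omega))).mono hG
      (fun k hk => ⟨fun i hi hi' => hk (i + 1) (by omega) (by omega), hk 1 one_pos (by omega)⟩)
      (by omega) hs

end Grid

theorem Slab.exists_grid {W : Type} {H : SimpleGraph W} {K : Set W} {h R m : ℕ} {len : Fin h → ℕ}
    {q : Fin h → ℕ → W} {ρ : Fin R → Set W} (hs : Slab H K len q ρ) {e : ℕ → Fin R}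
    (he : ∀ t t', t < t' → t' < m → e t < e t') :
    ∃ vis, Grid H K len q m (fun t => ρ (e t)) vis := by
  choose vis hvis hvisρ using hs.meets
  refine ⟨fun k t => vis (e t) k, ⟨fun c _ => hs.path c, fun c _ => hs.closedCol c, ?_⟩,
    fun k t _ => hvis _ _, fun k t t' ht ht' =>
      hs.aligned _ _ (he t t' ht ht') k _ (hvis _ _) _ (hvis _ _) (hvisρ _ _) (hvisρ _ _),
    fun k s t s' i hst hts hs' hi hit =>
      ⟨hs.aligned _ _ (he s t hst (hts.trans hs')) k _ (hvis _ _) _ hi (hvisρ _ _) hit,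
        hs.aligned _ _ (he t s' hts hs') k _ hi _ (hvis _ _) hit (hvisρ _ _)⟩,
    fun t t' ht ht' => hs.disj _ _ (he t t' ht ht').ne⟩
  intro c _ c' _ hcc
  refine Set.disjoint_left.mpr ?_
  rintro _ ⟨i, hi, rfl⟩ ⟨i', hi', hii⟩
  exact hs.ne c c' hcc i hi.2 i' hi'.2 hii.symm

/-- The position of a vertex of the wall in a linear order compatible with its frame. -/
def frameRank {r : ℕ} (v : Fin r × Fin (2 * r)) : ℕ :=
  (2 * v.1.val + if (v.1.val + v.2.val) % 2 = 0 then 1 else 0) * (2 * r) + v.2.val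

theorem frameRank_lt {r : ℕ} (v : Fin r × Fin (2 * r)) : frameRank v < 2 * r * (2 * r) := by
  have h1 : 2 * v.1.val + (if (v.1.val + v.2.val) % 2 = 0 then 1 else 0) + 1 ≤ 2 * r := by
    have := v.1.2
    split_ifs <;> omega
  have h2 := Nat.mul_le_mul_right (2 * r) h1
  have := v.2.2
  rw [add_mul, one_mul] at h2
  unfold frameRank
  omega

theorem frameRank_lt_of_row {r : ℕ} {v w : Fin r × Fin (2 * r)}
    (h : 2 * v.1.val + (if (v.1.val + v.2.val) % 2 = 0 then 1 else 0) <
      2 * w.1.val + if (w.1.val + w.2.val) % 2 = 0 then 1 else 0) : frameRank v < frameRank w := by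
  have h2 := Nat.mul_le_mul_right (2 * r) (Nat.succ_le_of_lt h)
  have := v.2.2
  rw [Nat.succ_eq_add_one, add_mul, one_mul] at h2
  unfold frameRank
  omega

theorem frameRank_lt_of_fst_lt {r : ℕ} {v w : Fin r × Fin (2 * r)} (h : v.1.val < w.1.val) :
    frameRank v < frameRank w :=
  frameRank_lt_of_row (by split_ifs <;> omega)

theorem frameRank_injective {r : ℕ} : Function.Injective (frameRank (r := r)) := by
  intro v w hvw
  have h1 : v.1 = w.1 := by
    rcases lt_trichotomy v.1.val w.1.val with h | h | h
    · exact absurd hvw (frameRank_lt_of_fst_lt h).ne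
    · exact Fin.ext h
    · exact absurd hvw (frameRank_lt_of_fst_lt h).ne'
  refine Prod.ext h1 (Fin.ext ?_)
  by_cases hp : (v.1.val + v.2.val) % 2 = 0 ↔ (w.1.val + w.2.val) % 2 = 0
  · unfold frameRank at hvw
    rw [if_congr hp rfl rfl, h1] at hvw
    exact Nat.add_left_cancel hvw
  · have : frameRank v ≠ frameRank w := by
      rcases lt_or_gt_of_ne (show 2 * v.1.val + (if (v.1.val + v.2.val) % 2 = 0 then 1 else 0) ≠
        2 * w.1.val + if (w.1.val + w.2.val) % 2 = 0 then 1 else 0 by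
          have := congrArg Fin.val h1
          split_ifs <;> omega) with h | h
      · exact (frameRank_lt_of_row h).ne
      · exact (frameRank_lt_of_row h).ne'
    exact absurd hvw this

theorem Grid.exists_frame {W ι : Type} {H : SimpleGraph W} {K : Set W} {len : ι → ℕ}
    {q : ι → ℕ → W} {Θ : ι → ℕ → W → Prop} {R : ℕ} {ρ : ℕ → Set W} {vis : ι → ℕ → ℕ}
    (hG : Grid H K len q R ρ vis) {r d : ℕ} (hR : 2 * r * (2 * r) * (d + 4) < R) {γ : ℕ → ι}
    (hγ : ∀ k ≤ 2 * r, ∀ k' ≤ 2 * r, γ k = γ k' → k = k') {β : Prop}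
    (hl : ∀ k < 2 * r, ∀ s, s + d < R → ∃ J, (∀ k' ≤ 2 * r, γ k' ∈ J) ∧
      BandLink H K len q Θ ρ vis J s (s + d) (γ k) (γ (k + 1)) β) :
    ∃ (a b : Fin r × Fin (2 * r) → ℕ) (u : Fin r × Fin (2 * r) → W)
      (E : Fin r × Fin (2 * r) → Set W),
      Frame H K r (fun k => len (γ k)) (fun k => q (γ k)) a b u E ∧
        ∀ v, (Θ (γ v.2.val) (a v) (u v) ↔ β) := by
  obtain ⟨base, hbase⟩ : ∃ base : Fin r × Fin (2 * r) → ℕ, ∀ v, base v = frameRank v * (d + 4) :=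
    ⟨_, fun _ => rfl⟩
  have hbR : ∀ v, base v + d + 4 < R := fun v => by
    have h := Nat.mul_le_mul_right (d + 4) (Nat.succ_le_of_lt (frameRank_lt v))
    rw [Nat.succ_eq_add_one, add_mul, one_mul, ← hbase] at h
    omega
  have hblt : ∀ v w, frameRank v < frameRank w → base v + d + 4 ≤ base w := fun v w h => by
    have h := Nat.mul_le_mul_right (d + 4) (Nat.succ_le_of_lt h)
    rw [Nat.succ_eq_add_one, add_mul, one_mul, ← hbase, ← hbase] at h
    omega
  have hex : ∀ v : Fin r × Fin (2 * r), BandLink H K len q Θ ρ vis (γ '' Set.Iic (2 * r)) (base v)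
      (base v + d) (γ v.2.val) (γ (v.2.val + 1)) β := fun v => by
    obtain ⟨J, hJ, h⟩ := hl v.2.val v.2.2 (base v) (by have := hbR v; omega)
    refine h.mono hG ?_ le_rfl (by have := hbR v; omega)
    rintro _ ⟨k, hk, rfl⟩
    exact hJ k hk
  choose a b u E hE hsub ha hb hβ using hex
  have hgap : ∀ v w, frameRank v < frameRank w → ∀ k x y, x < vis k (base v + d) →
      vis k (base w) < y → x + 4 ≤ y := fun v w h k x y hx hy => by
    have h1 := hblt v w h
    have h2 := hbR w
    have h3 := hG.vis_add k (base v + d) 4 (by omega)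
    have h4 := hG.vis_mono (k := k) h1 (by omega)
    omega
  have hdisj : ∀ v w, frameRank v < frameRank w →
      Disjoint (insert (q (γ v.2.val) (a v)) (insert (u v) (E v)))
        (insert (q (γ w.2.val) (a w)) (insert (u w) (E w))) := fun v w h => by
    have h1 := hblt v w h
    have h2 := hbR w
    exact (hG.band_disjoint (by omega) (by omega) (by omega)).mono (hsub v) (hsub w)
  have hsucc : ∀ {v w : Fin r × Fin (2 * r)}, v.2.val + 1 = w.2.val →
      ∀ k, vis (γ (v.2.val + 1)) k = vis (γ w.2.val) k := fun h k => by rw [h]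
  refine ⟨a, b, u, E, ⟨⟨fun k _ => hG.cols.path _ trivial, fun k _ => hG.cols.closed _ trivial,
    fun k hk k' hk' hkk => hG.cols.disj _ trivial _ trivial fun h => hkk (hγ k hk k' hk' h)⟩,
    fun v => ⟨(hE v).a_le, (hE v).b_le, (hE v).a_mem, (hE v).b_mem, (hE v).u_notMem, (hE v).adj,
      (hE v).conn, (hE v).b_memE, (hE v).touch, (hE v).u_notMemE, (hE v).a_notMemE, (hE v).not_adj,
      (hE v).closed, fun k hk h1 h2 => (hE v).off _ ⟨k, hk, rfl⟩
        (fun h => h1 (hγ k hk _ v.2.2.le h)) fun h => h2 (hγ k hk _ v.2.2 h),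
      (hE v).fst_col, (hE v).snd_col⟩, fun v w hvw => ?_, fun v => by have := (ha v).1; omega,
      fun v => ?_, ?_, ?_, ?_, ?_, ?_, ?_⟩, hβ⟩
  · rcases lt_or_gt_of_ne (frameRank_injective.ne hvw) with h | h
    · exact hdisj v w h
    · exact (hdisj w v h).symm
  · have := (ha v).2
    have := hG.vis_le (γ v.2.val) (base v + d) (by have := hbR v; omega)
    show a v + 1 ≤ len (γ v.2.val)
    omega
  · intro v w h1 h2 h3
    exact hgap v w (frameRank_lt_of_row (by split_ifs <;> omega)) _ _ _ (hb v).2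
      (hsucc h2 _ ▸ (ha w).1)
  · intro v w h1 h2 h3
    exact hgap w v (frameRank_lt_of_row (by split_ifs <;> omega)) _ _ _ (hsucc h2 _ ▸ (ha w).2)
      (hb v).1
  · intro v w h1 h2
    have h3 : v.2 = w.2 := Fin.ext h1
    exact hgap v w (frameRank_lt_of_fst_lt h2) _ _ _ (ha v).2 (h3 ▸ (ha w).1)
  · intro v w h1 h2
    have h3 : v.2 = w.2 := Fin.ext h1
    exact hgap v w (frameRank_lt_of_fst_lt h2) _ _ _ (hb v).2 (h3 ▸ (hb w).1)
  · intro v w h1 h2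
    exact hgap v w (frameRank_lt_of_fst_lt h2) _ _ _ (hb v).2 (hsucc h1 _ ▸ (ha w).1)
  · intro v w h1 h2
    exact hgap v w (frameRank_lt_of_fst_lt h2) _ _ _ (ha v).2 (hsucc h1.symm _ ▸ (hb w).1)

theorem exists_good_of_slab (r : ℕ) : ∃ h R, 0 < h ∧ ∀ {V W : Type} [Finite W] {G : SimpleGraph V}
    {H : SimpleGraph W} {K : Set W} {F : W → Set V} {len : Fin h → ℕ} {q : Fin h → ℕ → W}
    {ρ : Fin R → Set W}, ThinOff H K → Fibration G H K F → Slab H K len q ρ → Good G r := by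
  obtain ⟨h, hh, hchain⟩ := exists_pathChain (2 * r)
  obtain ⟨m, hm⟩ : ∃ m, m = 2 * r * (2 * r) * (2 * h + 4) + 1 := ⟨_, rfl⟩
  obtain ⟨R, hR⟩ := fin_pigeonhole (Set (Fin h × Fin h × Bool)) m
  refine ⟨h, R, hh, fun {V W} _ {G H K F len q ρ} hH hF hs => ?_⟩
  choose pt hpt using fun w => (hF.conn w).nonempty
  obtain ⟨Θ, hΘ⟩ : ∃ Θ : Fin h → ℕ → W → Prop, ∀ c a u, Θ c a u ↔
      TypeC G (lift F (seg (q c) (a - 1) (a + 1) ∪ {u}))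
        (fun i => pt (![q c (a - 1), q c (a + 1), u] i)) := ⟨_, fun _ _ _ => Iff.rfl⟩
  obtain ⟨e', C, he'⟩ := hR R le_rfl
    fun t => {z | Jump H len q Θ (ρ t) z.1 z.2.1 (z.2.2 = true)}
  have hmin : ∀ t, min t (m - 1) < m := fun t => by omega
  obtain ⟨e, he, heC⟩ : ∃ e : ℕ → Fin R, (∀ t t', t < t' → t' < m → e t < e t') ∧
      ∀ t c c' B, (c, c', B) ∈ C ↔ Jump H len q Θ (ρ (e t)) c c' (B = true) := by
    refine ⟨fun t => e' ⟨min t (m - 1), hmin t⟩, fun t t' h1 h2 => e'.strictMono ?_,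
      fun t c c' B => ?_⟩
    · rw [Fin.lt_def]
      simp only
      omega
    · rw [← he' ⟨min t (m - 1), hmin t⟩]
      rfl
  obtain ⟨vis, hG⟩ := hs.exists_grid he
  have hcolor : ∀ t c c' β, Jump H len q Θ (ρ (e t)) c c' β → ∃ B, (c, c', B) ∈ C := by
    classical
    intro t c c' β hJ
    refine ⟨decide β, (heC t _ _ _).mpr ?_⟩
    rwa [show (decide β = true) = β from propext decide_eq_true_iff]
  let Γ : SimpleGraph (Fin h) :=
    { Adj := fun c c' => c ≠ c' ∧ ∃ B, (c, c', B) ∈ C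
      symm := ⟨fun c c' ⟨hne, B, hB⟩ => by
        obtain ⟨β, hJ⟩ := ((heC 0 _ _ _).mp hB).reverse
        exact ⟨hne.symm, hcolor 0 _ _ _ hJ⟩⟩
      loopless := ⟨fun c hc => hc.1 rfl⟩ }
  have hΓ : Conn Γ Set.univ := by
    refine ⟨⟨⟨0, hh⟩, trivial⟩, fun T ⟨z, _, hz⟩ hT z' _ => ?_⟩
    by_contra hz'
    obtain ⟨c, hc, c', hc', β, hJ⟩ := hG.cols.exists_jump hH (hs.conn (e 0)) (hs.meets (e 0)) hz hz'
    exact hc' (hT c trivial hc c' trivial ⟨fun h => hc' (h ▸ hc), hcolor 0 _ _ _ hJ⟩)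
  have hlink : ∀ c c', Γ.Adj c c' → ∀ s, s + 2 < m →
      BandLink H K len q Θ (fun t => ρ (e t)) vis Set.univ s (s + 2) c c' ((c, c', true) ∈ C) := by
    intro c c' hcc s hsm
    refine Jump.bandLink ?_ hcc.1 hH hG hsm
    by_cases hC : (c, c', true) ∈ C
    · rw [show ((c, c', true) ∈ C) = (true = true) from propext ⟨fun _ => rfl, fun _ => hC⟩]
      exact (heC _ _ _ _).mp hC
    · obtain ⟨-, B, hB⟩ := hcc
      cases B with
      | true => exact (hC hB).elim
      | false =>
        rw [show ((c, c', true) ∈ C) = (false = true) from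
          propext ⟨fun h => (hC h).elim, fun h => by cases h⟩]
        exact (heC _ _ _ _).mp hB
  obtain ⟨γ, β, hγ⟩ := hchain Γ hΓ fun c c' => (c, c', true) ∈ C
  obtain ⟨a, b, u, E, hFr, hβ⟩ := hG.exists_frame (Θ := Θ) (r := r) (d := 2 * h) (by omega) hγ.inj
    (β := β) fun k hk s hsm => by
      obtain ⟨n, x, hn, hx, hadj, h0, h1, hTy, hoff⟩ := hγ.link k hk
      have hnh : n ≤ h := by
        have := Fintype.card_le_of_injective (fun i : Fin (n + 1) => x i.val) fun i j hij =>
          Fin.ext (hx i.val (by omega) j.val (by omega) hij)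
        simp only [Fintype.card_fin] at this
        omega
      have hB := (hG.exists_bandLink hH (fun c c' => (c, c', true) ∈ C) hn hx (s := s)
        (fun i hi s hs => hlink _ _ (hadj i hi) s hs) (by omega)).mono hG subset_rfl
        (show s + 2 * n ≤ s + 2 * h by omega) hsm
      beta_reduce at hB
      rw [h0, h1, ← h0, show ((x 0, x 1, true) ∈ C) = β from propext hTy, h0] at hB
      refine ⟨_, ?_, hB⟩
      intro k' hk' i hi hi' he
      exact hoff i hi hi' k' hk' he.symm
  refine hFr.good hH hF hpt ?_
  by_cases hb : β
  · exact Or.inl fun v => (hΘ _ _ _).mp ((hβ v).mpr hb)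
  · exact Or.inr fun v hv => hb ((hβ v).mp ((hΘ _ _ _).mpr hv))

theorem exists_con_of_minor (r s l : ℕ) : ∃ f g : ℕ, 0 < f ∧ 0 < g ∧ ∀ {V : Type} [Finite V]
    (G : SimpleGraph V), HasInducedMinor G (completeBipartiteGraph (Fin f) (Fin g)) →
    Good G r ∨ HasCon G s l := by
  obtain ⟨n, hn⟩ := exists_good_of_subK r
  obtain ⟨h, R, hh, hslab⟩ := exists_good_of_slab r
  obtain ⟨k, N, hk, hanch⟩ := exists_subK_or_slab n h R hh
  obtain ⟨q, hq⟩ := exists_anchored s l n k N hk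
  obtain ⟨P, Q, hPQ⟩ := exists_pathModel n s l (k + 1) q
  obtain ⟨f, g, hf, hg, hfg⟩ := exists_linear_model n P Q
  refine ⟨f, g, hf, hg, fun {V} _ G hG => ?_⟩
  rcases hfg G hG with hK | ⟨A, B, hAB, hA, hB⟩
  · exact Or.inl (hn G hK)
  rcases hPQ hAB hA hB with hK | hC | ⟨A', B', hAB'⟩
  · exact Or.inl (hn G hK)
  · exact Or.inr hC
  rcases hq hAB' with hC | ⟨T, A₂, B₂, x, hanchored⟩
  · exact Or.inr hC
  rcases hanch hanchored with hK | ⟨W, _, H, K, F, len, q, ρ, hH, hF, hs⟩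
  · exact Or.inl (hn G hK)
  · exact Or.inl (hslab hH hF hs)

theorem HasCon.exists_outcome (d l l' r s s' : ℕ) (hr : 0 < r) : ∃ S L : ℕ, ∀ {V : Type} [Finite V]
    {G : SimpleGraph V}, HasCon G S L →
    Good G r ∨ HasInterrupted G d s l ∨ HasZigzagged G d s' l' (2 * r ^ 2) := by
  obtain ⟨n, hn⟩ := exists_good_of_subK r
  obtain ⟨S₁, L₁, h₁⟩ := exists_interrupted_or_zigzagged d r s l s' l' hr
  obtain ⟨S, L, h⟩ := exists_ample_con d n r S₁ L₁
  refine ⟨S, L, fun {V _ G} ⟨x, B, hx⟩ => ?_⟩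
  rcases h S L le_rfl le_rfl hx with hK | hG | ⟨f, g, hfg⟩
  · exact Or.inl (hn G hK)
  · exact Or.inl hG
  · exact h₁ (hx.shrink f.injective g.injective (fun _ => subset_rfl) (fun j => hx.1.connB (g j))
      fun i j => hx.1.touch (f i) (g j)) hfg

/-- Theorem 2.3: for all positive `d, l, l', r, s, s'` there are `f, g`
such that every graph `G` with an induced minor isomorphic to `K_{f,g}` contains, as an
induced subgraph, `K_{r,r}`, a subdivision of the `r`-by-`r` wall, or the line graph of
such a subdivision; or `G` contains a `d`-ample interrupted `(s,l)`-constellation; or a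
`d`-ample `2r²`-zigzagged `(s',l')`-constellation. -/
theorem stmt2 (d l l' r s s' : ℕ)
    (hd : 0 < d) (hl : 0 < l) (hl' : 0 < l') (hr : 0 < r) (hs : 0 < s) (hs' : 0 < s') :
    ∃ f g : ℕ, 0 < f ∧ 0 < g ∧
      ∀ (V : Type) [Fintype V] (G : SimpleGraph V),
        HasInducedMinor G (completeBipartiteGraph (Fin f) (Fin g)) →
          (HasInducedSubgraphIso G (completeBipartiteGraph (Fin r) (Fin r)) ∨
            (∃ X : Set V, IsSubdivisionWith (G.induce X) (Wall r) (fun n => 1 ≤ n)) ∨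
            (∃ (m : ℕ) (S' : SimpleGraph (Fin m)),
              IsSubdivisionWith S' (Wall r) (fun n => 1 ≤ n) ∧
              HasInducedSubgraphIso G (LineGraph S'))) ∨
          (∃ W' S' : Set V, IsConstellationOn G W' S' ∧ DAmple G W' S' d ∧
              Interrupted G W' S' ∧
              S'.ncard = s ∧ (CompsOn G (W' \ S')).ncard = l) ∨
          (∃ W' S' : Set V, IsConstellationOn G W' S' ∧ DAmple G W' S' d ∧
              Zigzagged G W' S' (2 * r ^ 2) ∧
              S'.ncard = s' ∧ (CompsOn G (W' \ S')).ncard = l') := by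
  obtain ⟨S, L, h⟩ := HasCon.exists_outcome d l l' r s s' hr
  obtain ⟨f, g, hf, hg, hfg⟩ := exists_con_of_minor r S L
  refine ⟨f, g, hf, hg, fun V _ G hG => ?_⟩
  rcases hfg G hG with hgood | hcon
  · exact Or.inl hgood
  · exact h hcon
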